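/- Assume [H1] and [H2]. Then the nonlocal Fokker–Planck initial value problem ∂_t ψ = div(∇V ψ + β⁻¹∇ψ) − ∂_{x₁}(φ_ψ ψ) on (0,∞)×𝕋ⁿ with ψ(0)=ψ₀ has a unique maximal L^p-solution ψ with maximal interval of existence (0, T_max), T_max = T_max(ψ₀) > 0. Moreover: (i) for every ε ∈ [0, 1−σ/2) and every τ ∈ [0, σ), ψ ∈ C((0,T_max), W^{2,p}(𝕋ⁿ)) ∩ C^μ_loc([0,T_max), W^{τ,p}(𝕋ⁿ)) with μ := min(1 − σ/2 − ε, (σ−τ)/2); and (ii) dψ/dt ∈ C^{ν−ε}_loc((0,T_max), L^p(𝕋ⁿ)) for every ε ∈ (0,ν), where ν := min(1 − σ/2, σ/2 − 1/2 − n/(2p)). -/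

import Mathlib

open MeasureTheory ENNReal Set Filter

noncomputable section

/-- Ambient space `ℝ × ℝ^m`: the universal cover of the torus `𝕋^{m+1}` (so `n = m + 1`). -/
abbrev Spc (m : ℕ) : Type := ℝ × (Fin m → ℝ)

/-- Unit cube in the last `m` coordinates: a fundamental domain for `𝕋^m`. -/
def cube1 (m : ℕ) : Set (Fin m → ℝ) := Set.pi Set.univ fun _ => Set.Ico (0 : ℝ) 1

/-- A fundamental domain for the torus `𝕋^{m+1}`. -/
def cube (m : ℕ) : Set (Spc m) := Set.Ico (0 : ℝ) 1 ×ˢ cube1 m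

/-- The measure of the torus: Lebesgue measure restricted to a fundamental domain. -/
def μT (m : ℕ) : Measure (Spc m) := volume.restrict (cube m)

/-- `ℤ^{m+1}`-periodicity: `f` is a function on the torus `𝕋^{m+1}`. -/
def IsPeriodic {m : ℕ} (f : Spc m → ℝ) : Prop :=
  ∀ (x : Spc m) (k : ℤ) (j : Fin m → ℤ), f (x.1 + k, fun i => x.2 i + j i) = f x

/-- The first coordinate direction. -/
def e1 (m : ℕ) : Spc m := (1, 0)

/-- The remaining coordinate directions. -/
def eC (m : ℕ) (i : Fin m) : Spc m := (0, Pi.single i 1)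

/-- Partial derivative in the direction `v`. -/
def pd {m : ℕ} (v : Spc m) (f : Spc m → ℝ) (x : Spc m) : ℝ := fderiv ℝ f x v

/-- `∇f ⋅ ∇g`. -/
def gradDot {m : ℕ} (f g : Spc m → ℝ) (x : Spc m) : ℝ :=
  pd (e1 m) f x * pd (e1 m) g x + ∑ i, pd (eC m i) f x * pd (eC m i) g x

/-- The Laplacian. -/
def lap {m : ℕ} (f : Spc m → ℝ) (x : Spc m) : ℝ :=
  pd (e1 m) (pd (e1 m) f) x + ∑ i, pd (eC m i) (pd (eC m i) f) x

/-- The marginal `ψ̄(x₁) = ∫_{𝕋^m} ψ(x₁, ⋅)`. -/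
def marg {m : ℕ} (ψ : Spc m → ℝ) (x1 : ℝ) : ℝ := ∫ y in cube1 m, ψ (x1, y)

/-- The nonlocal coefficient `φ_ψ = (∫ ∂_{x₁}V ψ dx₂…dxₙ) / ψ̄`. -/
def phiF {m : ℕ} (V ψ : Spc m → ℝ) (x1 : ℝ) : ℝ :=
  (∫ y in cube1 m, pd (e1 m) V (x1, y) * ψ (x1, y)) / marg ψ x1

/-- `F(ψ) = ∇V⋅∇ψ + ΔV ψ − ∂_{x₁}(φ_ψ ψ)`. -/
def Fop {m : ℕ} (V ψ : Spc m → ℝ) (x : Spc m) : ℝ :=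
  gradDot V ψ x + lap V x * ψ x - pd (e1 m) (fun z => phiF V ψ z.1 * ψ z) x

/-- `L^p`-norm on the torus. -/
def LpN {m : ℕ} (p : ℝ) (f : Spc m → ℝ) : ℝ≥0∞ := eLpNorm f (ENNReal.ofReal p) (μT m)

/-- Gagliardo (Sobolev–Slobodeckij) seminorm of fractional order `s`. -/
def gagl {m : ℕ} {F : Type*} [NormedAddCommGroup F] (s p : ℝ) (f : Spc m → F) : ℝ≥0∞ :=
  (∫⁻ x in cube m, ∫⁻ y in cube m,
      ENNReal.ofReal (‖f x - f y‖ ^ p / ‖x - y‖ ^ ((m : ℝ) + 1 + s * p))) ^ (1 / p)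

/-- The differential of `f`. -/
def grd {m : ℕ} (f : Spc m → ℝ) (x : Spc m) : Spc m →L[ℝ] ℝ := fderiv ℝ f x

/-- The `W^{σ,p}`-norm on the torus, for `0 ≤ σ ≤ 2`. -/
def WNorm {m : ℕ} (σ p : ℝ) (f : Spc m → ℝ) : ℝ≥0∞ :=
  if σ ≤ 0 then LpN p f
  else if σ < 1 then LpN p f + gagl σ p f
  else if σ < 2 then
    LpN p f + eLpNorm (fun x => ‖grd f x‖) (ENNReal.ofReal p) (μT m)
      + (if σ = 1 then 0 else gagl (σ - 1) p (grd f))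
  else
    LpN p f + eLpNorm (fun x => ‖grd f x‖) (ENNReal.ofReal p) (μT m)
      + eLpNorm (fun x => ‖iteratedFDeriv ℝ 2 f x‖) (ENNReal.ofReal p) (μT m)

/-- Membership in `W^{σ,p}(𝕋^{m+1})`, for `0 ≤ σ ≤ 2`. -/
def MemW {m : ℕ} (σ p : ℝ) (f : Spc m → ℝ) : Prop :=
  IsPeriodic f ∧ Measurable f ∧ (1 ≤ σ → Differentiable ℝ f) ∧
    (2 ≤ σ → Differentiable ℝ (grd f)) ∧ WNorm σ p f < ⊤

/-- Membership in `𝒟^{σ,p}(𝕋^{m+1}) = {ψ ∈ W^{σ,p} | ψ̄ > 0}`. -/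
def MemD {m : ℕ} (σ p : ℝ) (f : Spc m → ℝ) : Prop :=
  MemW σ p f ∧ ∀ x1 : ℝ, 0 < marg f x1

/-- Hypothesis `[H₁]`: `ψ₀ ∈ 𝒟^{σ,p}`, `ψ₀ ≥ 0`, `∫ ψ₀ = 1`. -/
def Hyp1 {m : ℕ} (σ p : ℝ) (ψ0 : Spc m → ℝ) : Prop :=
  MemD σ p ψ0 ∧ (∀ x, 0 ≤ ψ0 x) ∧ (∫ x in cube m, ψ0 x) = 1

/-- Hypothesis `[H₂]`: `n = m + 1 ≥ 2`, `p > n`, `σ ∈ (1 + n/p, 2)`. -/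
def Hyp2 (m : ℕ) (σ p : ℝ) : Prop :=
  1 ≤ m ∧ (m : ℝ) + 1 < p ∧ 1 + ((m : ℝ) + 1) / p < σ ∧ σ < 2

/-- The real interval `[0, Tmax)`, where `Tmax ∈ (0, ∞]`. -/
def Ico0 (Tmax : ℝ≥0∞) : Set ℝ := {t : ℝ | 0 ≤ t ∧ ENNReal.ofReal t < Tmax}

/-- The real interval `(0, Tmax)`, where `Tmax ∈ (0, ∞]`. -/
def Ioo0 (Tmax : ℝ≥0∞) : Set ℝ := {t : ℝ | 0 < t ∧ ENNReal.ofReal t < Tmax}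

/-- Continuity in `W^{σ,p}`-norm of a curve, on a time set `s`. -/
def ContW {m : ℕ} (σ p : ℝ) (s : Set ℝ) (ψ : ℝ → Spc m → ℝ) : Prop :=
  ∀ t ∈ s, ∀ ε : ℝ, 0 < ε → ∃ δ > 0, ∀ t' ∈ s, |t' - t| < δ →
    WNorm σ p (fun x => ψ t' x - ψ t x) < ENNReal.ofReal ε

/-- Hölder continuity (exponent `α`) in `W^{σ,p}`-norm of a curve, on a time set `s`. -/
def HolderW {m : ℕ} (α σ p : ℝ) (s : Set ℝ) (ψ : ℝ → Spc m → ℝ) : Prop :=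
  ∃ C : ℝ, ∀ t ∈ s, ∀ t' ∈ s,
    WNorm σ p (fun x => ψ t' x - ψ t x) ≤ ENNReal.ofReal (C * |t' - t| ^ α)

/-- `ψ` is an `L^p`-solution on `[0, Tmax)` of the nonlocal Fokker–Planck equation
`∂ₜψ = div(∇V ψ + β⁻¹∇ψ) − ∂_{x₁}(φ_ψ ψ) = β⁻¹Δψ + F(ψ)`, `ψ(0) = ψ₀`. -/
structure IsLpSolution {m : ℕ} (V : Spc m → ℝ) (β σ p : ℝ) (ψ0 : Spc m → ℝ)
    (Tmax : ℝ≥0∞) (ψ : ℝ → Spc m → ℝ) : Prop where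
  init : ∀ x, ψ 0 x = ψ0 x
  contLp : ContW 0 p (Ico0 Tmax) ψ
  regW2 : ∀ t ∈ Ioo0 Tmax, MemW 2 p (ψ t)
  regD : ∀ t ∈ Ioo0 Tmax, MemD σ p (ψ t)
  eqn : ∀ t ∈ Ioo0 Tmax,
    Tendsto (fun h : ℝ => LpN p
        (fun x => (ψ (t + h) x - ψ t x) / h - (β⁻¹ * lap (ψ t) x + Fop V (ψ t) x)))
      (nhdsWithin 0 {h : ℝ | h ≠ 0}) (nhds 0)
  derivCont : ContW 0 p (Ioo0 Tmax)
    (fun t x => β⁻¹ * lap (ψ t) x + Fop V (ψ t) x)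

/-- A maximal `L^p`-solution: an `L^p`-solution admitting no proper extension. -/
def IsMaximalLpSolution {m : ℕ} (V : Spc m → ℝ) (β σ p : ℝ) (ψ0 : Spc m → ℝ)
    (Tmax : ℝ≥0∞) (ψ : ℝ → Spc m → ℝ) : Prop :=
  IsLpSolution V β σ p ψ0 Tmax ψ ∧ 0 < Tmax ∧
    ∀ (Tmax' : ℝ≥0∞) (ψ' : ℝ → Spc m → ℝ), IsLpSolution V β σ p ψ0 Tmax' ψ' →
      (∀ t ∈ Ico0 Tmax, ψ' t = ψ t) → Tmax' ≤ Tmax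

/-- The Euclidean quadratic form on `Spc m`. -/
def qd {m : ℕ} (z : Spc m) : ℝ := z.1 ^ 2 + ∑ i, z.2 i ^ 2

/-- The heat semigroup `e^{β⁻¹ t Δ}` on the torus, realized by convolution with the Gaussian
heat kernel on the universal cover (and the identity for `t ≤ 0`). -/
def heatSG {m : ℕ} (β t : ℝ) (f : Spc m → ℝ) (x : Spc m) : ℝ :=
  if t ≤ 0 then f x
  else ∫ y : Spc m, (4 * Real.pi * (t / β)) ^ (-((m : ℝ) + 1) / 2) *
      Real.exp (-qd (x - y) / (4 * (t / β))) * f y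

/-- `ψ` is a mild solution of the nonlocal Fokker–Planck equation on `[0, Tmax)`:
`ψ ∈ C([0,Tmax), 𝒟^{σ,p})` and `ψ(t) = e^{β⁻¹tΔ}ψ₀ + ∫₀ᵗ e^{β⁻¹(t−s)Δ} F(ψ(s)) ds`. -/
def IsMildSolution {m : ℕ} (V : Spc m → ℝ) (β σ p : ℝ) (ψ0 : Spc m → ℝ)
    (Tmax : ℝ≥0∞) (ψ : ℝ → Spc m → ℝ) : Prop :=
  (∀ x, ψ 0 x = ψ0 x) ∧ (∀ t ∈ Ico0 Tmax, MemD σ p (ψ t)) ∧ ContW σ p (Ico0 Tmax) ψ ∧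
    ∀ t ∈ Ico0 Tmax, ∀ᵐ x ∂(volume : Measure (Spc m)),
      ψ t x = heatSG β t ψ0 x + ∫ s in Set.Ioc (0 : ℝ) t, heatSG β (t - s) (Fop V (ψ s)) x

/-- A maximal mild solution. -/
def IsMaximalMildSolution {m : ℕ} (V : Spc m → ℝ) (β σ p : ℝ) (ψ0 : Spc m → ℝ)
    (Tmax : ℝ≥0∞) (ψ : ℝ → Spc m → ℝ) : Prop :=
  IsMildSolution V β σ p ψ0 Tmax ψ ∧ 0 < Tmax ∧
    ∀ (Tmax' : ℝ≥0∞) (ψ' : ℝ → Spc m → ℝ), IsMildSolution V β σ p ψ0 Tmax' ψ' →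
      (∀ t ∈ Ico0 Tmax, ψ' t = ψ t) → Tmax' ≤ Tmax

/-- `L^p`-norm on the one-dimensional torus `𝕋`. -/
def LpN1 (p : ℝ) (g : ℝ → ℝ) : ℝ≥0∞ :=
  eLpNorm g (ENNReal.ofReal p) (volume.restrict (Set.Ico (0 : ℝ) 1))

/-- Membership in `L^p₀(𝕋^{m+1})`: periodic, `L^p` and of mean zero. -/
def MemL0 {m : ℕ} (p : ℝ) (f : Spc m → ℝ) : Prop :=
  IsPeriodic f ∧ Measurable f ∧ LpN p f < ⊤ ∧ (∫ x in cube m, f x) = 0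

set_option linter.all false
set_option maxSynthPendingDepth 3

/-! ## Part A: Gaussian kernel -/

/-- rapid decay -/
def RD {m : ℕ} {F : Type*} [NormedAddCommGroup F] (K : Spc m → F) : Prop :=
  Continuous K ∧ ∀ N : ℕ, ∃ C : ℝ, ∀ z, (1 + ‖z‖) ^ N * ‖K z‖ ≤ C

/-- the Euclidean bilinear form -/
def LL (m : ℕ) : Spc m →L[ℝ] Spc m →L[ℝ] ℝ :=
  (ContinuousLinearMap.fst ℝ ℝ (Fin m → ℝ)).smulRight (ContinuousLinearMap.fst ℝ ℝ (Fin m → ℝ)) +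
  ∑ i, ((ContinuousLinearMap.proj (R := ℝ) i).comp
    (ContinuousLinearMap.snd ℝ ℝ (Fin m → ℝ))).smulRight
      ((ContinuousLinearMap.proj (R := ℝ) i).comp (ContinuousLinearMap.snd ℝ ℝ (Fin m → ℝ)))

section kern
variable {m : ℕ} {F : Type*} [NormedAddCommGroup F] [NormedSpace ℝ F]
variable {F' : Type*} [NormedAddCommGroup F'] [NormedSpace ℝ F']

lemma LL_apply (z v : Spc m) : LL m z v = z.1 * v.1 + ∑ i, z.2 i * v.2 i := by
  simp [LL]

lemma qd_eq (z : Spc m) : qd z = LL m z z := by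
  rw [LL_apply]; simp [qd, sq]

lemma LL_symm (z v : Spc m) : LL m z v = LL m v z := by
  simp [LL_apply, mul_comm]

lemma norm_sq_le_qd (z : Spc m) : ‖z‖ ^ 2 ≤ qd z := by
  have h0 : ∀ i, (z.2 i) ^ 2 ≤ ∑ i, z.2 i ^ 2 := fun i =>
    Finset.single_le_sum (f := fun i => z.2 i ^ 2) (fun i _ => sq_nonneg _) (Finset.mem_univ i)
  have hs : 0 ≤ ∑ i, z.2 i ^ 2 := Finset.sum_nonneg fun i _ => sq_nonneg _
  have hq : 0 ≤ qd z := by unfold qd; positivity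
  have : ‖z‖ ≤ √(qd z) := by
    rw [Prod.norm_def]
    refine max_le ?_ ((pi_norm_le_iff_of_nonneg (Real.sqrt_nonneg _)).2 fun i => ?_)
    · refine Real.le_sqrt_of_sq_le ?_
      rw [Real.norm_eq_abs, sq_abs]; unfold qd; linarith
    · refine Real.le_sqrt_of_sq_le ?_
      rw [Real.norm_eq_abs, sq_abs]; unfold qd; nlinarith [h0 i, sq_nonneg z.1]
  calc ‖z‖ ^ 2 ≤ √(qd z) ^ 2 := by gcongr
    _ = qd z := Real.sq_sqrt hq

lemma continuous_qd : Continuous (qd (m := m)) := by unfold qd; fun_prop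

lemma RD_exp : RD fun z : Spc m => Real.exp (-qd z / 2) := by
  refine ⟨by have := continuous_qd (m := m); fun_prop, fun N => ?_⟩
  refine ⟨(N.factorial : ℝ) * Real.exp (3 / 2), fun z => ?_⟩
  have h1 : (1 + ‖z‖) ^ N ≤ N.factorial * Real.exp (1 + ‖z‖) := by
    have := Real.pow_div_factorial_le_exp (1 + ‖z‖) (by positivity) N
    rw [div_le_iff₀ (by positivity)] at this; linarith
  rw [Real.norm_eq_abs, abs_of_pos (Real.exp_pos _)]
  calc (1 + ‖z‖) ^ N * Real.exp (-qd z / 2)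
      ≤ (N.factorial * Real.exp (1 + ‖z‖)) * Real.exp (-qd z / 2) := by gcongr
    _ = N.factorial * Real.exp (1 + ‖z‖ + -qd z / 2) := by rw [mul_assoc, ← Real.exp_add]
    _ ≤ _ := by
      gcongr
      nlinarith [norm_sq_le_qd z, sq_nonneg (‖z‖ - 1)]

lemma RD.mul_poly {K : Spc m → F} (hK : RD K) {G : Spc m → F'} (hG : Continuous G) (C : ℝ) (j : ℕ)
    (hb : ∀ z, ‖G z‖ ≤ C * (1 + ‖z‖) ^ j * ‖K z‖) : RD G := by
  refine ⟨hG, fun N => ?_⟩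
  obtain ⟨C1, h1⟩ := hK.2 (N + j)
  refine ⟨|C| * C1, fun z => ?_⟩
  calc (1 + ‖z‖) ^ N * ‖G z‖ ≤ (1 + ‖z‖) ^ N * (|C| * (1 + ‖z‖) ^ j * ‖K z‖) := by
        gcongr
        refine (hb z).trans ?_
        gcongr; exact le_abs_self C
    _ = |C| * ((1 + ‖z‖) ^ (N + j) * ‖K z‖) := by ring
    _ ≤ _ := by gcongr; exact h1 z

instance haarSpc (m : ℕ) : (volume : Measure (Spc m)).IsAddHaarMeasure :=
  MeasureTheory.Measure.prod.instIsAddHaarMeasure volume volume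

lemma integrable_pow_neg (m : ℕ) : Integrable fun z : Spc m => ((1 + ‖z‖) ^ (m + 2))⁻¹ := by
  have := integrable_one_add_norm (E := Spc m) (μ := volume) (r := (m : ℝ) + 2)
    (by simp; linarith)
  refine this.congr (Eventually.of_forall fun z => ?_)
  simp only
  rw [Real.rpow_neg (by positivity)]
  congr 1
  exact_mod_cast Real.rpow_natCast (1 + ‖z‖) (m + 2)

lemma RD.bound {K : Spc m → F} (hK : RD K) :
    ∃ C, 0 ≤ C ∧ ∀ z, ‖K z‖ ≤ C * ((1 + ‖z‖) ^ (m + 2))⁻¹ := by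
  obtain ⟨C, h⟩ := hK.2 (m + 2)
  refine ⟨C, le_trans (by positivity) (h 0), fun z => ?_⟩
  rw [← div_eq_mul_inv, le_div_iff₀ (by positivity)]
  linarith [h z]

lemma RD.integrable {K : Spc m → F} (hK : RD K) : Integrable K := by
  obtain ⟨C, -, h⟩ := hK.bound
  exact ((integrable_pow_neg m).const_mul C).mono' hK.1.aestronglyMeasurable
    (Eventually.of_forall h)

lemma RD.norm {K : Spc m → F} (hK : RD K) : RD fun z => ‖K z‖ :=
  hK.mul_poly hK.1.norm 1 0 (by simp)

/-- real moments -/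
lemma RD.moment {K : Spc m → F} (hK : RD K) (a : ℝ) (ha : 0 ≤ a) :
    Integrable fun z => ‖z‖ ^ a * ‖K z‖ := by
  refine (hK.mul_poly (G := fun z => ‖z‖ ^ a * ‖K z‖)
    (by have := hK.1; exact (continuous_norm.rpow_const fun _ => Or.inr ha).mul this.norm)
    1 ⌈a⌉₊ fun z => ?_).integrable
  rw [norm_mul, norm_norm, one_mul, Real.norm_of_nonneg (by positivity)]
  gcongr
  calc ‖z‖ ^ a ≤ (1 + ‖z‖) ^ a := by gcongr; linarith
    _ ≤ (1 + ‖z‖) ^ (⌈a⌉₊ : ℝ) := Real.rpow_le_rpow_of_exponent_le (by linarith [norm_nonneg z])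
        (Nat.le_ceil a)
    _ = _ := Real.rpow_natCast _ _

/-- normalising constant -/
def kc (m : ℕ) : ℝ := (∫ z : Spc m, Real.exp (-qd z / 2))⁻¹

/-- Gaussian -/
def kk (z : Spc m) : ℝ := kc m * Real.exp (-qd z / 2)

/-- its derivative -/
def dk (z : Spc m) : Spc m →L[ℝ] ℝ := -(kk z • LL m z)

/-- its second derivative -/
def ddk (z : Spc m) : Spc m →L[ℝ] Spc m →L[ℝ] ℝ := -(kk z • LL m + (dk z).smulRight (LL m z))

lemma kc_pos : 0 < kc m := by
  refine inv_pos.2 ?_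
  exact integral_exp_pos (RD_exp (m := m)).integrable

lemma kk_pos (z : Spc m) : 0 < kk z := mul_pos kc_pos (Real.exp_pos _)

lemma RD_kk : RD (kk (m := m)) := by
  refine RD_exp.mul_poly (by unfold kk; have := continuous_qd (m := m); fun_prop) (kc m) 0
    fun z => ?_
  rw [kk, norm_mul, Real.norm_of_nonneg kc_pos.le]; simp

lemma RD_dk : RD (dk (m := m)) := by
  refine RD_kk.mul_poly (by have := RD_kk (m := m).1; unfold dk; fun_prop) ‖LL m‖ 1 fun z => ?_
  rw [dk, norm_neg, norm_smul, pow_one, mul_comm]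
  gcongr
  exact ((LL m).le_opNorm z).trans (by gcongr; linarith)

lemma RD_ddk : RD (ddk (m := m)) := by
  refine RD_kk.mul_poly (j := 2) (C := ‖LL m‖ + ‖LL m‖ * ‖LL m‖) ?_ fun z => ?_
  · have := RD_kk (m := m).1
    have h2 := RD_dk (m := m).1
    unfold ddk
    have h3 : Continuous fun z : Spc m => (dk z).smulRight (LL m z) := (ContinuousLinearMap.smulRightL ℝ (Spc m) (Spc m →L[ℝ] ℝ)).isBoundedBilinearMap.continuous.comp
      (h2.prodMk (LL m).continuous)
    have h4 : Continuous fun z : Spc m => kk z • LL m := by fun_prop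
    exact (h4.add h3).neg
  · have hz : ‖LL m z‖ ≤ ‖LL m‖ * (1 + ‖z‖) := ((LL m).le_opNorm z).trans (by gcongr; linarith)
    have e : ‖ddk z‖ = ‖kk z • LL m + (dk z).smulRight (LL m z)‖ := by
      rw [ddk]; exact norm_neg (kk z • LL m + (dk z).smulRight (LL m z))
    rw [e]
    refine (norm_add_le (kk z • LL m) ((dk z).smulRight (LL m z))).trans ?_
    rw [norm_smul, ContinuousLinearMap.norm_smulRight_apply, dk, norm_neg, norm_smul]
    have h1 : (1 : ℝ) ≤ (1 + ‖z‖) ^ 2 := one_le_pow₀ (by linarith [norm_nonneg z])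
    calc ‖kk z‖ * ‖LL m‖ + ‖kk z‖ * ‖LL m z‖ * ‖LL m z‖
        ≤ ‖kk z‖ * (‖LL m‖ * (1 + ‖z‖) ^ 2) + ‖kk z‖ * (‖LL m‖ * (1 + ‖z‖)) * (‖LL m‖ * (1 + ‖z‖)) := by
          gcongr
          exact le_mul_of_one_le_right (norm_nonneg _) h1
      _ = _ := by ring

lemma integral_kk : ∫ z : Spc m, kk z = 1 := by
  simp only [kk]
  rw [integral_const_mul, kc, inv_mul_cancel₀]
  exact (integral_exp_pos (RD_exp (m := m)).integrable).ne'

lemma hasFDerivAt_qd (z : Spc m) : HasFDerivAt (qd (m := m)) ((2 : ℝ) • LL m z) z := by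
  have h := (LL m).isBoundedBilinearMap.hasFDerivAt (z, z)
  have h2 : HasFDerivAt (fun z : Spc m => (z, z)) ((ContinuousLinearMap.id ℝ (Spc m)).prod
    (ContinuousLinearMap.id ℝ (Spc m))) z := (hasFDerivAt_id z).prodMk (hasFDerivAt_id z)
  have h3 := HasFDerivAt.comp (f := fun z : Spc m => (z, z))
    (g := fun p : Spc m × Spc m => LL m p.1 p.2) z h h2
  have e : (qd (m := m)) = (fun p : Spc m × Spc m => LL m p.1 p.2) ∘ fun z => (z, z) := by
    funext z; simp [qd_eq]
  rw [e]
  refine h3.congr_fderiv ?_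
  ext v <;> simp [IsBoundedBilinearMap.deriv, LL_symm, two_mul] <;> rw [LL_symm]

lemma hasFDerivAt_kk (z : Spc m) : HasFDerivAt (kk (m := m)) (dk z) z := by
  have h := (((hasFDerivAt_qd z).neg.mul_const (1 / 2 : ℝ)).exp).const_mul (kc m)
  have e : (kk (m := m)) = fun z => kc m * Real.exp (-qd z * (1 / 2)) := by
    funext z; simp [kk, div_eq_mul_inv]
  rw [e]
  refine h.congr_fderiv ?_
  ext v <;> simp [dk, kk, div_eq_mul_inv] <;> ring

lemma hasFDerivAt_dk (z : Spc m) : HasFDerivAt (dk (m := m)) (ddk z) z := by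
  have h := ((hasFDerivAt_kk z).smul (LL m).hasFDerivAt).neg
  exact h

/-- kernel operators -/
def SK (K : Spc m → F) (b : ℝ) (f : Spc m → ℝ) (x : Spc m) : F := ∫ z, f (x + b • z) • K z

/-- Gaussian averages -/
def TT (b : ℝ) (f : Spc m → F) (x : Spc m) : F := ∫ z, kk z • f (x + b • z)

lemma TT_eq_SK (b : ℝ) (f : Spc m → ℝ) : TT b f = SK kk b f := by
  funext x; simp [TT, SK, mul_comm]

lemma SK_integrable {K : Spc m → F} (hK : RD K) {f : Spc m → ℝ} (hf : Continuous f) {M : ℝ}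
    (hM : ∀ x, |f x| ≤ M) (b : ℝ) (x : Spc m) : Integrable fun z => f (x + b • z) • K z :=
  hK.integrable.bdd_smul M (by fun_prop) (Eventually.of_forall fun z => by simpa using hM _)

lemma SK_bound {K : Spc m → F} (hK : RD K) {f : Spc m → ℝ} {M : ℝ}
    (hM : ∀ x, |f x| ≤ M) (b : ℝ) (x : Spc m) : ‖SK K b f x‖ ≤ M * ∫ z, ‖K z‖ := by
  rw [← integral_const_mul]
  refine norm_integral_le_of_norm_le (hK.norm.integrable.const_mul M)
    (Eventually.of_forall fun z => ?_)
  rw [norm_smul]; gcongr; exact hM _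

lemma TT_integrable {f : Spc m → F} (hf : Continuous f) {M : ℝ}
    (hM : ∀ x, ‖f x‖ ≤ M) (b : ℝ) (x : Spc m) : Integrable fun z => kk z • f (x + b • z) :=
  RD_kk.integrable.smul_bdd M (by fun_prop) (Eventually.of_forall fun z => by simpa using hM _)

lemma TT_bound {f : Spc m → F} {M : ℝ}
    (hM : ∀ x, ‖f x‖ ≤ M) (b : ℝ) (x : Spc m) : ‖TT b f x‖ ≤ M := by
  have : M = ∫ z : Spc m, kk z * M := by rw [integral_mul_const, integral_kk, one_mul]
  rw [this]
  refine norm_integral_le_of_norm_le (RD_kk.integrable.mul_const M)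
    (Eventually.of_forall fun z => ?_)
  rw [norm_smul, Real.norm_of_nonneg (kk_pos z).le]
  have := kk_pos z
  gcongr; exact hM _

lemma one_add_norm_shift (z w : Spc m) (hw : ‖w‖ ≤ 1) : 1 + ‖z‖ ≤ 2 * (1 + ‖z + w‖) := by
  have : ‖z‖ ≤ ‖z + w‖ + ‖w‖ := by
    calc ‖z‖ = ‖(z + w) - w‖ := by simp
      _ ≤ _ := norm_sub_le _ _
  linarith [norm_nonneg (z + w)]

lemma SK_hasFDerivAt [CompleteSpace F] {K : Spc m → F} {K' : Spc m → Spc m →L[ℝ] F} (hK : RD K)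
    (hK' : RD K') (hd : ∀ z, HasFDerivAt K (K' z) z) {f : Spc m → ℝ} (hf : Continuous f) {M : ℝ}
    (hM : ∀ x, |f x| ≤ M) {b : ℝ} (hb : 0 < b) (x : Spc m) :
    HasFDerivAt (SK K b f) (-b⁻¹ • SK K' b f x) x := by
  have tr : ∀ {G : Type _} [NormedAddCommGroup G] [NormedSpace ℝ G] (H : Spc m → G) (x : Spc m),
      SK H b f x = ∫ z, f (b • z) • H (z + (-b⁻¹) • x) := by
    intro G _ _ H x
    rw [SK, ← integral_add_right_eq_self (fun z => f (x + b • z) • H z) ((-b⁻¹) • x)]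
    congr 1; funext z
    congr 2
    rw [smul_add, smul_smul]
    have : b * -b⁻¹ = -1 := by field_simp
    rw [this]; module
  have e1 : SK K b f = fun x => ∫ z, f (b • z) • K (z + (-b⁻¹) • x) := funext fun x => tr K x
  have e2 : -b⁻¹ • SK K' b f x = ∫ z, f (b • z) • (-b⁻¹ • K' (z + (-b⁻¹) • x)) := by
    rw [tr K' x, ← integral_smul]
    congr 1; funext z; rw [smul_comm]
  rw [e1, e2]
  obtain ⟨C, hC0, hC⟩ := hK'.bound
  have hM0 : 0 ≤ M := (abs_nonneg _).trans (hM 0)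
  have hKc := hK.1
  have hK'c := hK'.1
  refine hasFDerivAt_integral_of_dominated_of_fderiv_le (s := Metric.ball x b)
    (F' := fun x z => f (b • z) • (-b⁻¹ • K' (z + (-b⁻¹) • x)))
    (bound := fun z => M * (b⁻¹ * (C * (2 ^ (m + 2) * ((1 + ‖z + (-b⁻¹) • x‖) ^ (m + 2))⁻¹))))
    (Metric.ball_mem_nhds x hb) ?_ ?_ ?_ ?_ ?_ ?_
  · refine Eventually.of_forall fun x => Continuous.aestronglyMeasurable (by fun_prop)
  · refine (hK.integrable.comp_add_right _).bdd_smul M (by fun_prop)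
      (Eventually.of_forall fun z => by simpa using hM _)
  · exact Continuous.aestronglyMeasurable (by fun_prop)
  · refine Eventually.of_forall fun z y hy => ?_
    rw [norm_smul, norm_smul, norm_neg, norm_inv, Real.norm_of_nonneg hb.le]
    gcongr
    · exact hM _
    refine (hC _).trans ?_
    gcongr
    rw [← div_eq_mul_inv, inv_le_comm₀ (by positivity) (by positivity), inv_div,
      div_le_iff₀ (by positivity), mul_comm, ← mul_pow]
    gcongr
    have := one_add_norm_shift (z + (-b⁻¹) • x) ((-b⁻¹) • (y - x)) (by
      rw [norm_smul, norm_neg, norm_inv, Real.norm_of_nonneg hb.le, inv_mul_le_iff₀ hb, mul_one]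
      exact (mem_ball_iff_norm.1 hy).le)
    have e : z + -b⁻¹ • x + -b⁻¹ • (y - x) = z + -b⁻¹ • y := by module
    rwa [e] at this
  · exact ((((((integrable_pow_neg m).comp_add_right _).const_mul _).const_mul _).const_mul _).const_mul _)
  · refine Eventually.of_forall fun z y _ => ?_
    refine HasFDerivAt.const_smul ?_ _
    have h1 : HasFDerivAt (fun y : Spc m => z + (-b⁻¹) • y)
        ((-b⁻¹) • ContinuousLinearMap.id ℝ (Spc m)) y :=
      ((hasFDerivAt_id y).const_smul (-b⁻¹)).const_add z
    refine ((hd _).comp y h1).congr_fderiv ?_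
    ext <;> simp

end kern

section kern2
variable {m : ℕ} {F : Type*} [NormedAddCommGroup F] [NormedSpace ℝ F]
variable {X : Type*} [TopologicalSpace X] [FirstCountableTopology X]

lemma TT_zero [CompleteSpace F] (f : Spc m → F) : TT 0 f = f := by
  funext x
  simp only [TT, zero_smul, add_zero]
  rw [integral_smul_const, integral_kk, one_smul]

lemma TT_cont {f : X → Spc m → F} (hf : Continuous (Function.uncurry f)) {M : ℝ}
    (hM : ∀ q x, ‖f q x‖ ≤ M) {b : X → ℝ} (hb : Continuous b) {x : X → Spc m} (hx : Continuous x) :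
    Continuous fun q => TT (b q) (f q) (x q) := by
  have h1 : ∀ z : Spc m, Continuous fun q => f q (x q + b q • z) := fun z =>
    hf.comp (continuous_id.prodMk (by fun_prop))
  have h2 : ∀ q, Continuous (f q) := fun q => hf.comp (by fun_prop : Continuous fun x => (q, x))
  refine continuous_of_dominated (bound := fun z => kk z * M) (fun q => ?_) (fun q => ?_)
    (RD_kk.integrable.mul_const M) (Eventually.of_forall fun z => (h1 z).const_smul _)
  · have := RD_kk (m := m).1
    have := h2 q
    exact Continuous.aestronglyMeasurable (by fun_prop)
  · refine Eventually.of_forall fun z => ?_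
    rw [norm_smul, Real.norm_of_nonneg (kk_pos z).le]
    have := kk_pos z
    gcongr; exact hM _ _

lemma SK_cont {K : Spc m → F} (hK : RD K) {f : X → Spc m → ℝ}
    (hf : Continuous (Function.uncurry f)) {M : ℝ}
    (hM : ∀ q x, |f q x| ≤ M) {b : X → ℝ} (hb : Continuous b) {x : X → Spc m} (hx : Continuous x) :
    Continuous fun q => SK K (b q) (f q) (x q) := by
  have h1 : ∀ z : Spc m, Continuous fun q => f q (x q + b q • z) := fun z =>
    hf.comp (continuous_id.prodMk (by fun_prop))
  have h2 : ∀ q, Continuous (f q) := fun q => hf.comp (by fun_prop : Continuous fun x => (q, x))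
  refine continuous_of_dominated (bound := fun z => M * ‖K z‖) (fun q => ?_) (fun q => ?_)
    (hK.norm.integrable.const_mul M) (Eventually.of_forall fun z => (h1 z).smul continuous_const)
  · have := hK.1
    have := h2 q
    exact Continuous.aestronglyMeasurable (by fun_prop)
  · refine Eventually.of_forall fun z => ?_
    rw [norm_smul]
    gcongr; exact hM _ _

lemma TT_hasFDerivAt {f : Spc m → ℝ} (hf : Continuous f) {M : ℝ}
    (hM : ∀ x, |f x| ≤ M) {b : ℝ} (hb : 0 < b) (x : Spc m) :
    HasFDerivAt (TT b f) (-b⁻¹ • SK dk b f x) x := by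
  rw [TT_eq_SK]
  exact SK_hasFDerivAt RD_kk RD_dk hasFDerivAt_kk hf hM hb x

lemma SKdk_hasFDerivAt {f : Spc m → ℝ} (hf : Continuous f) {M : ℝ}
    (hM : ∀ x, |f x| ≤ M) {b : ℝ} (hb : 0 < b) (x : Spc m) :
    HasFDerivAt (SK dk b f) (-b⁻¹ • SK ddk b f x) x :=
  SK_hasFDerivAt RD_dk RD_ddk hasFDerivAt_dk hf hM hb x

lemma conv_hasFDerivAt {κ : Spc m → ℝ} (hκ : RD κ) {f : Spc m → F} {f' : Spc m → Spc m →L[ℝ] F}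
    (hf : ∀ x, HasFDerivAt f (f' x) x) (hc : Continuous f') {M M' : ℝ} (hM : ∀ x, ‖f x‖ ≤ M)
    (hM' : ∀ x, ‖f' x‖ ≤ M') (b : ℝ) (x : Spc m) :
    HasFDerivAt (fun x => ∫ z, κ z • f (x + b • z)) (∫ z, κ z • f' (x + b • z)) x := by
  have hfc : Continuous f := continuous_iff_continuousAt.2 fun x => (hf x).continuousAt
  have := hκ.1
  refine hasFDerivAt_integral_of_dominated_of_fderiv_le (s := univ)
    (F' := fun x z => κ z • f' (x + b • z)) (bound := fun z => ‖κ z‖ * M')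
    univ_mem ?_ ?_ ?_ ?_ ?_ ?_
  · exact Eventually.of_forall fun x => Continuous.aestronglyMeasurable (by fun_prop)
  · exact hκ.integrable.smul_bdd M (by fun_prop) (Eventually.of_forall fun z => hM _)
  · exact Continuous.aestronglyMeasurable (by fun_prop)
  · refine Eventually.of_forall fun z y _ => ?_
    rw [norm_smul]; gcongr; exact hM' _
  · exact hκ.norm.integrable.mul_const M'
  · refine Eventually.of_forall fun z y _ => ?_
    have h1 : HasFDerivAt (fun y : Spc m => y + b • z) (ContinuousLinearMap.id ℝ (Spc m)) y :=
      (hasFDerivAt_id y).add_const (b • z)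
    exact HasFDerivAt.const_smul ((hf _).comp y h1) _

lemma TT_comm_hasFDerivAt {f : Spc m → F} {f' : Spc m → Spc m →L[ℝ] F}
    (hf : ∀ x, HasFDerivAt f (f' x) x) (hc : Continuous f') {M M' : ℝ} (hM : ∀ x, ‖f x‖ ≤ M)
    (hM' : ∀ x, ‖f' x‖ ≤ M') (b : ℝ) (x : Spc m) :
    HasFDerivAt (TT b f) (TT b f' x) x := conv_hasFDerivAt RD_kk hf hc hM hM' b x

/-! semigroup law -/

lemma subst_affine {G : Type*} [NormedAddCommGroup G] [NormedSpace ℝ G] (H : Spc m → G) {r : ℝ}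
    (hr : r ≠ 0) (v : Spc m) :
    ∫ w, H w = |r ^ (m + 1)| • ∫ q, H (r • q + v) := by
  have h := Measure.integral_comp_smul (volume : Measure (Spc m)) (fun w => H (w + v)) r
  rw [h, integral_add_right_eq_self, smul_smul]
  have : Module.finrank ℝ (Spc m) = m + 1 := by simp [add_comm]
  rw [this, abs_inv, mul_inv_cancel₀ (by positivity), one_smul]

lemma kk_rot (a b c : ℝ) (hc : c ≠ 0) (h : c ^ 2 = a ^ 2 + b ^ 2) (x q : Spc m) :
    kk ((a / c) • x + (-b / c) • q) * kk ((b / c) • x + (a / c) • q) = kk x * kk q := by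
  simp only [kk]
  have : -qd ((a / c) • x + (-b / c) • q) / 2 + -qd ((b / c) • x + (a / c) • q) / 2 =
      -qd x / 2 + -qd q / 2 := by
    have e1 : ∀ (s t : ℝ), (a / c * s + -b / c * t) ^ 2 + (b / c * s + a / c * t) ^ 2 = s ^ 2 + t ^ 2 := by
      intro s t
      field_simp
      rw [h]; ring
    have e2 : qd ((a / c) • x + (-b / c) • q) + qd ((b / c) • x + (a / c) • q) = qd x + qd q := by
      simp only [qd, Prod.fst_add, Prod.smul_fst, Prod.snd_add, Prod.smul_snd, Pi.add_apply,
        Pi.smul_apply, smul_eq_mul]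
      have := e1 x.1 q.1
      have h2 : ∑ i, (a / c * x.2 i + -b / c * q.2 i) ^ 2 + ∑ i, (b / c * x.2 i + a / c * q.2 i) ^ 2
          = ∑ i, x.2 i ^ 2 + ∑ i, q.2 i ^ 2 := by
        rw [← Finset.sum_add_distrib, ← Finset.sum_add_distrib]
        exact Finset.sum_congr rfl fun i _ => e1 _ _
      linarith
    linarith
  calc _ = kc m * kc m * (Real.exp (-qd ((a / c) • x + (-b / c) • q) / 2) *
        Real.exp (-qd ((b / c) • x + (a / c) • q) / 2)) := by ring
    _ = _ := by rw [← Real.exp_add, this, Real.exp_add]; ring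

lemma TT_TT [CompleteSpace F] {f : Spc m → F} (hf : Continuous f) {M : ℝ} (hM : ∀ x, ‖f x‖ ≤ M)
    {a b c : ℝ} (hb : 0 < b) (hc : 0 < c) (h : c ^ 2 = a ^ 2 + b ^ 2) (x : Spc m) :
    TT a (TT b f) x = TT c f x := by
  have hkc := RD_kk (m := m).1
  set r := c / b with hr
  have hr0 : r ≠ 0 := by positivity
  set s := a / b with hs
  set J : ℝ := |r ^ (m + 1)| with hJ
  have hJ0 : J ≠ 0 := by positivity
  have st1 : ∀ z, TT b f (x + a • z) = J • ∫ q, kk (r • q + (-s) • z) • f (x + c • q) := by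
    intro z
    rw [TT, subst_affine _ hr0 ((-s) • z)]
    congr 2; funext q; congr 2
    have e1 : b * r = c := by rw [hr]; field_simp
    have e2 : b * s = a := by rw [hs]; field_simp
    rw [smul_add, smul_smul, smul_smul, e1, mul_neg, e2]; module
  have hint0 : Integrable (fun q : Spc m × Spc m => kk q.1 * kk (r • q.2 + (-s) • q.1))
      (volume.prod volume) := by
    have hcont : Continuous fun q : Spc m × Spc m => kk q.1 * kk (r • q.2 + (-s) • q.1) := by
      fun_prop
    refine (integrable_prod_iff hcont.aestronglyMeasurable).2 ⟨Eventually.of_forall fun z => ?_, ?_⟩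
    · exact ((RD_kk.integrable.comp_add_right ((-s) • z)).comp_smul hr0).const_mul (kk z)
    · have : (fun z : Spc m => ∫ q, ‖kk z * kk (r • q + (-s) • z)‖) = fun z => kk z * J⁻¹ := by
        funext z
        have h1 := subst_affine (kk (m := m)) hr0 ((-s) • z)
        rw [integral_kk] at h1
        simp_rw [Real.norm_of_nonneg (mul_pos (kk_pos z) (kk_pos _)).le]
        rw [integral_const_mul]
        congr 1
        exact eq_inv_of_mul_eq_one_right h1.symm
      rw [this]
      exact RD_kk.integrable.mul_const _
  have hint : Integrable (Function.uncurry fun z q : Spc m =>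
      (kk z * kk (r • q + (-s) • z)) • f (x + c • q)) (volume.prod volume) :=
    hint0.smul_bdd M (by fun_prop) (Eventually.of_forall fun q => hM _)
  have st2 : ∀ q : Spc m, ∫ z, kk z * kk (r • q + (-s) • z) = J⁻¹ * kk q := by
    intro q
    have hbc : -b / c ≠ 0 := by simp [hb.ne', hc.ne']
    rw [subst_affine _ hbc ((a / c) • q)]
    have e : ∀ w, kk ((-b / c) • w + (a / c) • q) *
        kk (r • q + (-s) • ((-b / c) • w + (a / c) • q)) = kk q * kk w := by
      intro w
      rw [← kk_rot a b c hc.ne' h q w, add_comm]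
      congr 2
      have e3 : r - s * (a / c) = b / c := by
        rw [hr, hs]; field_simp; linarith
      have e4 : s * (b / c) = a / c := by rw [hs]; field_simp
      rw [← e3, ← e4, neg_div]; module
    simp_rw [e]
    rw [integral_const_mul, integral_kk, mul_one, smul_eq_mul]
    congr 1
    rw [hJ, hr, ← abs_inv, ← inv_pow, inv_div, abs_pow, abs_pow, abs_div, abs_div, abs_neg]
  calc TT a (TT b f) x = ∫ z, J • ∫ q, (kk z * kk (r • q + (-s) • z)) • f (x + c • q) := by
        rw [TT]; congr 1; funext z
        rw [st1, smul_comm, ← integral_smul]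
        congr 2; funext q; rw [smul_smul]
    _ = J • ∫ q, ∫ z, (kk z * kk (r • q + (-s) • z)) • f (x + c • q) := by
        rw [integral_smul, integral_integral_swap hint]
    _ = TT c f x := by
        simp_rw [integral_smul_const, st2]
        rw [TT, ← integral_smul]
        congr 1; funext q
        rw [smul_smul, ← mul_assoc, mul_inv_cancel₀ hJ0, one_mul]

/-! approximation -/

lemma TT_sub_le {f : Spc m → F} [CompleteSpace F] (hf : Continuous f) {M : ℝ} (hM : ∀ x, ‖f x‖ ≤ M)
    {A H α b : ℝ} (hα : 0 ≤ α) (hb : 0 ≤ b) (x : Spc m) (hH : ∀ y, ‖f y - f x‖ ≤ A + H * ‖y - x‖ ^ α) :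
    ‖TT b f x - f x‖ ≤ A + H * b ^ α * ∫ z : Spc m, ‖z‖ ^ α * ‖kk z‖ := by
  have e : TT b f x - f x = ∫ z, kk z • (f (x + b • z) - f x) := by
    simp_rw [smul_sub]
    rw [integral_sub (TT_integrable hf hM b x) (RD_kk.integrable.smul_const _), integral_smul_const,
      integral_kk, one_smul, TT]
  have e2 : A + H * b ^ α * ∫ z : Spc m, ‖z‖ ^ α * ‖kk z‖ =
      ∫ z : Spc m, (kk z * A + H * b ^ α * (‖z‖ ^ α * ‖kk z‖)) := by
    rw [integral_add (RD_kk.integrable.mul_const _) ((RD_kk.moment α hα).const_mul _),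
      integral_const_mul, integral_mul_const, integral_kk, one_mul]
  rw [e, e2]
  refine norm_integral_le_of_norm_le
    ((RD_kk.integrable.mul_const _).add ((RD_kk.moment α hα).const_mul _))
    (Eventually.of_forall fun z => ?_)
  have hk := kk_pos z
  rw [norm_smul]
  refine (mul_le_mul_of_nonneg_left (hH (x + b • z)) (norm_nonneg _)).trans (le_of_eq ?_)
  rw [add_sub_cancel_left, norm_smul, Real.mul_rpow (norm_nonneg _) (norm_nonneg _),
    Real.norm_of_nonneg hb, Real.norm_of_nonneg hk.le]; ring

/-- moment constant -/
def mom (m : ℕ) (α : ℝ) : ℝ := ∫ z : Spc m, ‖z‖ ^ α * ‖kk z‖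

lemma mom_nonneg (α : ℝ) : 0 ≤ mom m α := integral_nonneg fun z => by positivity

lemma TT_unif [CompleteSpace F] {f : Spc m → F} (hf : UniformContinuous f) {M : ℝ}
    (hM : ∀ x, ‖f x‖ ≤ M) {ε : ℝ} (hε : 0 < ε) :
    ∃ δ > 0, ∀ b, 0 ≤ b → b < δ → ∀ x, ‖TT b f x - f x‖ ≤ ε := by
  obtain ⟨η, hη, h⟩ := Metric.uniformContinuous_iff.1 hf (ε / 2) (by positivity)
  have hM0 : 0 ≤ M := (norm_nonneg _).trans (hM 0)
  have hm := mom_nonneg (m := m) 1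
  set B := 2 * M / η * mom m 1 with hB
  have hB0 : 0 ≤ B := by positivity
  refine ⟨ε / 2 / (B + 1), by positivity, fun b hb hbδ x => ?_⟩
  refine (TT_sub_le hf.continuous hM (A := ε / 2) (H := 2 * M / η) (α := 1) zero_le_one hb x
    fun y => ?_).trans ?_
  · rw [Real.rpow_one]
    by_cases hy : dist y x < η
    · have := h hy
      rw [dist_eq_norm] at this
      have : 0 ≤ 2 * M / η * ‖y - x‖ := by positivity
      linarith
    · rw [not_lt, dist_eq_norm] at hy
      have h1 : ‖f y - f x‖ ≤ 2 * M := (norm_sub_le _ _).trans (by linarith [hM y, hM x])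
      have h2 : 2 * M ≤ 2 * M / η * ‖y - x‖ := by
        rw [div_mul_eq_mul_div, le_div_iff₀ hη]; gcongr
      linarith
  · change ε / 2 + 2 * M / η * b ^ (1 : ℝ) * mom m 1 ≤ ε
    rw [Real.rpow_one]
    rw [lt_div_iff₀ (by positivity)] at hbδ
    have : 2 * M / η * b * mom m 1 = b * B := by rw [hB]; ring
    rw [this]; nlinarith

/-! the b-derivative -/

/-- trace -/
def tr (A : Spc m →L[ℝ] Spc m →L[ℝ] ℝ) : ℝ := A (e1 m) (e1 m) + ∑ i, A (eC m i) (eC m i)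

lemma spc_decomp (z : Spc m) : z = z.1 • e1 m + ∑ i, z.2 i • eC m i := by
  ext i
  · simp [e1, eC, Prod.fst_sum]
  · simp [e1, eC, Prod.snd_sum, Pi.single_apply]

lemma clm_decomp (A : Spc m →L[ℝ] F) (z : Spc m) : A z = z.1 • A (e1 m) + ∑ i, z.2 i • A (eC m i) := by
  conv_lhs => rw [spc_decomp z]
  simp

lemma LL_e1 (z : Spc m) : LL m z (e1 m) = z.1 := by simp [LL_apply, e1]
lemma LL_eC (z : Spc m) (i : Fin m) : LL m z (eC m i) = z.2 i := by
  simp [LL_apply, eC, Pi.single_apply]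

lemma dk_integral_apply {f : Spc m → ℝ} (hf : Continuous f) {M : ℝ} (hM : ∀ x, |f x| ≤ M) (b : ℝ)
    (x v : Spc m) : SK dk b f x v = ∫ z, dk z v • f (x + b • z) := by
  rw [SK, ContinuousLinearMap.integral_apply (SK_integrable RD_dk hf hM b x)]
  congr 1; funext z; simp [mul_comm]

lemma RD_dk_apply (v : Spc m) : RD fun z : Spc m => dk z v := by
  refine RD_dk.mul_poly (by have := RD_dk (m := m).1; fun_prop) ‖v‖ 0 fun z => ?_
  simpa [mul_comm] using (dk z).le_opNorm v

lemma ddk_comm {f : Spc m → ℝ} {f' : Spc m → Spc m →L[ℝ] ℝ}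
    (hf : ∀ x, HasFDerivAt f (f' x) x) (hc : Continuous f') {M M' : ℝ} (hM : ∀ x, |f x| ≤ M)
    (hM' : ∀ x, ‖f' x‖ ≤ M') {b : ℝ} (hb : 0 < b) (x v w : Spc m) :
    -b⁻¹ * SK ddk b f x v w = ∫ z, dk z w * f' (x + b • z) v := by
  have hfc : Continuous f := continuous_iff_continuousAt.2 fun x => (hf x).continuousAt
  have h1 := (SKdk_hasFDerivAt hfc hM hb x).clm_apply (hasFDerivAt_const w x)
  have h2 := conv_hasFDerivAt (RD_dk_apply w) hf hc hM hM' b x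
  have e : (fun x => SK dk b f x w) = fun x => ∫ z, dk z w • f (x + b • z) :=
    funext fun x => dk_integral_apply hfc hM b x w
  rw [e] at h1
  have h3 := congrArg (fun L : Spc m →L[ℝ] ℝ => L v) (h1.unique h2)
  rw [ContinuousLinearMap.integral_apply] at h3
  · simpa using h3
  · exact (RD_dk_apply w).integrable.smul_bdd M' (by fun_prop) (Eventually.of_forall fun z => hM' _)

lemma TT_hasDerivAt_C1 {f : Spc m → ℝ} {f' : Spc m → Spc m →L[ℝ] ℝ}
    (hf : ∀ x, HasFDerivAt f (f' x) x) (hc : Continuous f') {M M' : ℝ} (hM : ∀ x, |f x| ≤ M)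
    (hM' : ∀ x, ‖f' x‖ ≤ M') {b : ℝ} (hb : 0 < b) (x : Spc m) :
    HasDerivAt (fun b => TT b f x) (b⁻¹ * tr (SK ddk b f x)) b := by
  have hfc : Continuous f := continuous_iff_continuousAt.2 fun x => (hf x).continuousAt
  have hkc := RD_kk (m := m).1
  have key : b⁻¹ * tr (SK ddk b f x) = ∫ z, kk z * f' (x + b • z) z := by
    have hI : ∀ v w : Spc m, Integrable fun z => dk z w * f' (x + b • z) v := fun v w => by
      refine (RD_dk_apply w).integrable.mul_bdd (c := M' * ‖v‖) (by fun_prop)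
        (Eventually.of_forall fun z => ((f' _).le_opNorm v).trans (by gcongr; exact hM' _))
    rw [← neg_neg (b⁻¹ * _), ← neg_mul, tr, mul_add, Finset.mul_sum]
    simp_rw [ddk_comm hf hc hM hM' hb x]
    rw [← integral_finsetSum _ (fun i _ => hI _ _), ← integral_add (hI _ _)
      (integrable_finsetSum _ fun i _ => hI _ _), ← integral_neg]
    congr 1; funext z
    rw [clm_decomp (f' (x + b • z)) z]
    simp only [dk, neg_mul, ContinuousLinearMap.neg_apply, ContinuousLinearMap.smul_apply, LL_e1,
      LL_eC, smul_eq_mul, Finset.sum_neg_distrib, mul_add, Finset.mul_sum, neg_add, neg_neg]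
    congr 1
    · ring
    · exact Finset.sum_congr rfl fun i _ => by ring
  rw [key]
  have hz : Integrable fun z : Spc m => kk z * (M' * ‖z‖) := by
    have := ((RD_kk (m := m)).moment 1 zero_le_one).mul_const M'
    refine this.congr (Eventually.of_forall fun z => ?_)
    simp only [Real.rpow_one]
    rw [Real.norm_of_nonneg (kk_pos z).le]; ring
  refine (hasDerivAt_integral_of_dominated_loc_of_deriv_le (s := univ)
    (F := fun b z => kk z • f (x + b • z))
    (F' := fun b z => kk z * f' (x + b • z) z) (bound := fun z => kk z * (M' * ‖z‖))
    univ_mem ?_ ?_ ?_ ?_ hz ?_).2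
  · exact Eventually.of_forall fun x => Continuous.aestronglyMeasurable (by fun_prop)
  · exact TT_integrable hfc hM b x
  · exact Continuous.aestronglyMeasurable (by fun_prop)
  · refine Eventually.of_forall fun z y _ => ?_
    have := kk_pos z
    rw [norm_mul, Real.norm_of_nonneg this.le]; gcongr
    exact ((f' _).le_opNorm z).trans (by gcongr; exact hM' _)
  · refine Eventually.of_forall fun z y _ => ?_
    refine HasDerivAt.const_mul (kk z) ?_
    have h1 : HasDerivAt (fun y : ℝ => x + y • z) ((1 : ℝ) • z) y :=
      ((hasDerivAt_id y).smul_const z).const_add x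
    rw [one_smul] at h1
    exact (hf _).comp_hasDerivAt y h1

lemma TT_hasDerivAt {f : Spc m → ℝ} (hf : Continuous f) {M : ℝ} (hM : ∀ x, |f x| ≤ M)
    {b : ℝ} (hb : 0 < b) (x : Spc m) :
    HasDerivAt (fun b => TT b f x) (b⁻¹ * tr (SK ddk b f x)) b := by
  set d := b / 2 with hd
  have hd0 : 0 < d := by positivity
  set c := √(b ^ 2 - d ^ 2) with hcdef
  have hc0 : 0 < c := Real.sqrt_pos.2 (by rw [hd]; nlinarith)
  have hcsq : c ^ 2 = b ^ 2 - d ^ 2 := Real.sq_sqrt (by rw [hd]; nlinarith)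
  set f1 := TT d f with hf1
  have hf1d : ∀ x, HasFDerivAt f1 (-d⁻¹ • SK dk d f x) x := fun x => TT_hasFDerivAt hf hM hd0 x
  have hf1c : Continuous fun x => -d⁻¹ • SK dk d f x :=
    (SK_cont (X := Spc m) RD_dk (f := fun _ => f) (by fun_prop) (fun _ => hM) continuous_const
      continuous_id : Continuous fun x => SK dk d f x).const_smul (-d⁻¹)
  have hf1c0 : Continuous f1 := continuous_iff_continuousAt.2 fun x => (hf1d x).continuousAt
  have hf1M : ∀ x, |f1 x| ≤ M := fun x => TT_bound (f := f) hM d x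
  have hD := TT_hasDerivAt_C1 hf1d hf1c hf1M (M' := d⁻¹ * (M * ∫ z : Spc m, ‖dk z‖)) (fun x => by
    rw [norm_smul, norm_neg, norm_inv, Real.norm_of_nonneg hd0.le]
    gcongr; exact SK_bound RD_dk hM d x) hc0 x
  have hs : HasDerivAt (fun b : ℝ => √(b ^ 2 - d ^ 2)) (b / c) b := by
    have h1 : HasDerivAt (fun b : ℝ => b ^ 2 - d ^ 2) (2 * b) b := by
      simpa using ((hasDerivAt_pow 2 b).sub_const (d ^ 2))
    have h2 := h1.sqrt (by rw [← hcsq]; positivity)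
    convert h2 using 1
    rw [← hcdef]; field_simp
  have hcomp := HasDerivAt.comp (h₂ := fun b => TT b f1 x) b (hcdef ▸ hD) hs
  have hTc : ∀ e, TT c f1 e = TT b f e := fun e =>
    TT_TT hf hM hd0 hb (by rw [hcsq]; ring) e
  have hval : c⁻¹ * tr (SK ddk c f1 x) * (b / c) = b⁻¹ * tr (SK ddk b f x) := by
    have hfun : TT c f1 = TT b f := funext hTc
    have g1 : (fun x => -c⁻¹ • SK dk c f1 x) = fun x => -b⁻¹ • SK dk b f x := by
      funext x
      refine HasFDerivAt.unique (TT_hasFDerivAt hf1c0 hf1M hc0 x) ?_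
      rw [hfun]; exact TT_hasFDerivAt hf hM hb x
    have h1 := (SKdk_hasFDerivAt hf1c0 hf1M hc0 x).const_smul (-c⁻¹)
    have h2 := (SKdk_hasFDerivAt hf hM hb x).const_smul (-b⁻¹)
    have g2 := HasFDerivAt.unique (h1.congr_of_eventuallyEq (Eventually.of_forall fun y =>
      (congrFun g1 y).symm)) h2
    have g3 : c⁻¹ * c⁻¹ * tr (SK ddk c f1 x) = b⁻¹ * b⁻¹ * tr (SK ddk b f x) := by
      have := congrArg tr g2
      simp only [tr, ContinuousLinearMap.smul_apply, smul_eq_mul] at this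
      rw [← Finset.mul_sum, ← Finset.mul_sum, ← Finset.mul_sum, ← Finset.mul_sum] at this
      simp only [tr]; linarith
    have : c⁻¹ * tr (SK ddk c f1 x) * (b / c) = b * (c⁻¹ * c⁻¹ * tr (SK ddk c f1 x)) := by
      field_simp
    rw [this, g3]; field_simp
  rw [← hval]
  refine hcomp.congr_of_eventuallyEq ?_
  filter_upwards [lt_mem_nhds (show d < b by rw [hd]; linarith)] with y hy
  have hy0 : 0 < y := hd0.trans hy
  simp only [Function.comp]
  exact (TT_TT hf hM hd0 hy0 (by rw [Real.sq_sqrt (by nlinarith)]; ring) x).symm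

end kern2

section duh
variable {m : ℕ}

/-- Duhamel term -/
def UU (β : ℝ) (h : ℝ → Spc m → ℝ) (B : ℝ) (x : Spc m) : ℝ := ∫ b in (0 : ℝ)..B, (β * b) * TT b (h b) x
/-- its differential -/
def QQ (β : ℝ) (h : ℝ → Spc m → ℝ) (B : ℝ) (x : Spc m) : Spc m →L[ℝ] ℝ :=
  ∫ b in (0 : ℝ)..B, (-β) • SK dk b (h b) x

/-- L1 norm of the kernels -/
def n1 (m : ℕ) : ℝ := ∫ z : Spc m, ‖dk z‖
def n2 (m : ℕ) : ℝ := ∫ z : Spc m, ‖ddk z‖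
lemma n1_nonneg : 0 ≤ n1 m := integral_nonneg fun _ => norm_nonneg _
lemma n2_nonneg : 0 ≤ n2 m := integral_nonneg fun _ => norm_nonneg _

variable {β : ℝ} {h : ℝ → Spc m → ℝ} {M : ℝ}

lemma fam_cont (hc : Continuous (Function.uncurry h)) (b : ℝ) : Continuous (h b) :=
  hc.comp (by fun_prop : Continuous fun x => (b, x))

lemma TTb_cont (hc : Continuous (Function.uncurry h)) (hM : ∀ b x, |h b x| ≤ M) (x : Spc m) :
    Continuous fun b => TT b (h b) x :=
  TT_cont (X := ℝ) hc hM continuous_id continuous_const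

lemma SKb_cont {F : Type*} [NormedAddCommGroup F] [NormedSpace ℝ F] {K : Spc m → F} (hK : RD K)
    (hc : Continuous (Function.uncurry h)) (hM : ∀ b x, |h b x| ≤ M) (x : Spc m) :
    Continuous fun b => SK K b (h b) x :=
  SK_cont (X := ℝ) hK hc hM continuous_id continuous_const

lemma SKx_cont {F : Type*} [NormedAddCommGroup F] [NormedSpace ℝ F] {K : Spc m → F} (hK : RD K)
    {f : Spc m → ℝ} (hc : Continuous f) (hM : ∀ x, |f x| ≤ M) (b : ℝ) :
    Continuous fun x => SK K b f x :=
  SK_cont (X := Spc m) (f := fun _ => f) hK (by fun_prop) (fun _ => hM) continuous_const continuous_id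

lemma UU_bound (hβ : 0 ≤ β) (hM : ∀ b x, |h b x| ≤ M) {B : ℝ} (hB : 0 ≤ B)
    (x : Spc m) : |UU β h B x| ≤ β * B * M * B := by
  have hM0 : 0 ≤ M := (abs_nonneg _).trans (hM 0 0)
  have := intervalIntegral.norm_integral_le_of_norm_le_const (a := (0 : ℝ)) (b := B)
    (f := fun b => (β * b) * TT b (h b) x) (C := β * B * M) fun b hb => by
      rw [uIoc_of_le hB] at hb
      rw [norm_mul, Real.norm_of_nonneg (mul_nonneg hβ hb.1.le)]
      gcongr
      · exact hb.2
      · exact TT_bound (hM b) b x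
  simpa [UU, abs_of_nonneg hB] using this

lemma QQ_bound (hβ : 0 ≤ β) (hM : ∀ b x, |h b x| ≤ M) {B : ℝ} (hB : 0 ≤ B)
    (x : Spc m) : ‖QQ β h B x‖ ≤ β * (M * n1 m) * B := by
  have := intervalIntegral.norm_integral_le_of_norm_le_const (a := (0 : ℝ)) (b := B)
    (f := fun b => (-β) • SK dk b (h b) x) (C := β * (M * n1 m)) fun b hb => by
      rw [norm_smul, norm_neg, Real.norm_of_nonneg hβ]
      gcongr
      exact SK_bound RD_dk (hM b) b x
  simpa [QQ, abs_of_nonneg hB] using this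

lemma UU_hasFDerivAt (hc : Continuous (Function.uncurry h)) (hM : ∀ b x, |h b x| ≤ M)
    {B : ℝ} (hB : 0 ≤ B) (x : Spc m) : HasFDerivAt (UU β h B) (QQ β h B x) x := by
  have hM0 : 0 ≤ M := (abs_nonneg _).trans (hM 0 0)
  refine intervalIntegral.hasFDerivAt_integral_of_dominated_of_fderiv_le (s := univ)
    (F' := fun x b => (-β) • SK dk b (h b) x) (bound := fun _ => |β| * (M * n1 m))
    univ_mem ?_ ?_ ?_ ?_ ?_ ?_
  · refine Eventually.of_forall fun x => Continuous.aestronglyMeasurable ?_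
    have := TTb_cont hc hM x
    fun_prop
  · have := TTb_cont hc hM x
    exact Continuous.intervalIntegrable (by fun_prop) _ _
  · exact Continuous.aestronglyMeasurable ((SKb_cont RD_dk hc hM x).const_smul (-β))
  · refine Eventually.of_forall fun b _ x _ => ?_
    rw [norm_smul, norm_neg, Real.norm_eq_abs]
    gcongr; exact SK_bound RD_dk (hM b) b x
  · exact intervalIntegrable_const
  · refine Eventually.of_forall fun b hb x _ => ?_
    rw [uIoc_of_le hB] at hb
    refine ((TT_hasFDerivAt (fam_cont hc b) (hM b) hb.1 x).const_mul (β * b)).congr_fderiv ?_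
    rw [smul_smul]
    congr 1
    have := hb.1.ne'
    field_simp

lemma interp {a r κ C : ℝ} (hκ : 0 ≤ κ) (hκ1 : κ ≤ 1) (hr : 0 ≤ r) (hC : 0 ≤ C) (h1 : a ≤ C)
    (h2 : a ≤ C * r) : a ≤ C * r ^ κ := by
  by_cases hr1 : r ≤ 1
  · rcases hr.eq_or_lt with rfl | hr0
    · exact h2.trans (by rw [mul_zero]; positivity)
    · exact h2.trans (by gcongr; simpa using Real.rpow_le_rpow_of_exponent_ge hr0 hr1 hκ1)
  · exact h1.trans (le_mul_of_one_le_right hC (Real.one_le_rpow (by linarith) hκ))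

lemma SKdk_holder {f : Spc m → ℝ} (hf : Continuous f) (hM : ∀ x, |f x| ≤ M) {b κ : ℝ} (hb : 0 < b)
    (hκ : 0 ≤ κ) (hκ1 : κ ≤ 1) (x y : Spc m) :
    ‖SK dk b f x - SK dk b f y‖ ≤ M * (2 * n1 m + n2 m) * (b ^ (-κ) * ‖x - y‖ ^ κ) := by
  have hM0 : 0 ≤ M := (abs_nonneg _).trans (hM 0)
  have := n1_nonneg (m := m)
  have := n2_nonneg (m := m)
  have e : b ^ (-κ) * ‖x - y‖ ^ κ = (b⁻¹ * ‖x - y‖) ^ κ := by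
    rw [Real.mul_rpow (by positivity) (by positivity), Real.rpow_neg hb.le, Real.inv_rpow hb.le]
  rw [e]
  refine interp hκ hκ1 (by positivity) (by positivity) ?_ ?_
  · refine (norm_sub_le _ _).trans ?_
    have h1 := SK_bound RD_dk hM b x
    have h2 := SK_bound RD_dk hM b y
    change _ ≤ M * n1 m at h1
    change _ ≤ M * n1 m at h2
    nlinarith
  · have := Convex.norm_image_sub_le_of_norm_hasFDerivWithin_le (s := univ) (f := SK dk b f)
      (C := b⁻¹ * (M * n2 m)) (x := y) (y := x)
      (fun x _ => (SKdk_hasFDerivAt hf hM hb x).hasFDerivWithinAt)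
      (fun x _ => by
        rw [norm_smul, norm_neg, norm_inv, Real.norm_of_nonneg hb.le]
        gcongr; exact SK_bound RD_ddk hM b x) convex_univ (mem_univ _) (mem_univ _)
    refine this.trans ?_
    calc b⁻¹ * (M * n2 m) * ‖x - y‖ = M * n2 m * (b⁻¹ * ‖x - y‖) := by ring
      _ ≤ _ := by gcongr; linarith

lemma QQ_holder (hβ : 0 ≤ β) (hc : Continuous (Function.uncurry h)) (hM : ∀ b x, |h b x| ≤ M)
    {B κ : ℝ} (hB : 0 ≤ B) (hκ : 0 ≤ κ) (hκ1 : κ < 1) (x y : Spc m) :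
    ‖QQ β h B x - QQ β h B y‖ ≤
      β * (M * (2 * n1 m + n2 m)) * (B ^ (1 - κ) / (1 - κ)) * ‖x - y‖ ^ κ := by
  have hii : ∀ x, IntervalIntegrable (fun b => (-β) • SK dk b (h b) x) volume 0 B := fun x =>
    ((SKb_cont RD_dk hc hM x).const_smul (-β)).intervalIntegrable _ _
  rw [QQ, QQ, ← intervalIntegral.integral_sub (hii x) (hii y)]
  have hi := intervalIntegral.intervalIntegrable_rpow' (a := 0) (b := B) (r := -κ) (by linarith)
  refine (intervalIntegral.norm_integral_le_of_norm_le hB (g := fun b =>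
    β * (M * (2 * n1 m + n2 m) * ‖x - y‖ ^ κ) * b ^ (-κ)) (Eventually.of_forall fun b hb => ?_)
    (hi.const_mul _)).trans (le_of_eq ?_)
  · rw [← smul_sub, norm_smul, norm_neg, Real.norm_of_nonneg hβ, mul_assoc β]
    gcongr
    refine (SKdk_holder (fam_cont hc b) (hM b) hb.1 hκ hκ1.le x y).trans (le_of_eq (by ring))
  · rw [intervalIntegral.integral_const_mul, integral_rpow (Or.inl (by linarith)),
      Real.zero_rpow (by linarith), sub_zero, show -κ + 1 = 1 - κ by ring]; ring

/-! ### second derivatives -/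

lemma ddk_symm (z v w : Spc m) : ddk z v w = ddk z w v := by
  simp only [ddk, dk, ContinuousLinearMap.neg_apply, ContinuousLinearMap.add_apply,
    ContinuousLinearMap.smul_apply, ContinuousLinearMap.smulRight_apply, smul_eq_mul, LL_symm v w]
  ring

lemma SKddk_apply {f : Spc m → ℝ} (hf : Continuous f) (hM : ∀ x, |f x| ≤ M) (b : ℝ) (x v w : Spc m) :
    SK ddk b f x v w = ∫ z, f (x + b • z) * ddk z v w := by
  have hI := SK_integrable RD_ddk hf hM b x
  rw [SK, ContinuousLinearMap.integral_apply hI, ContinuousLinearMap.integral_apply (hI.apply_continuousLinearMap v)]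
  rfl

lemma SKddk_y {f : Spc m → ℝ} (hf : Continuous f) (hM : ∀ x, |f x| ≤ M) {b κ H : ℝ} (hb : 0 < b)
    (hκ : 0 ≤ κ) (hH0 : 0 ≤ H) (hH : ∀ (x1 : ℝ) y y', |f (x1, y) - f (x1, y')| ≤ H * ‖y - y'‖ ^ κ)
    (x v w : Spc m) (hw : w.1 = 0) :
    |SK ddk b f x v w| ≤ H * b ^ κ * (∫ z : Spc m, ‖z‖ ^ κ * ‖ddk z‖) * (‖v‖ * ‖w‖) := by
  set f0 : Spc m → ℝ := fun z => f (z.1, x.2) with hf0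
  have hf0c : Continuous f0 := by fun_prop
  have hf0M : ∀ z, |f0 z| ≤ M := fun z => hM _
  have z1 : ∀ x', SK dk b f0 x' w = 0 := by
    intro x'
    have hd := (TT_hasFDerivAt hf0c hf0M hb x')
    have h1 : HasDerivAt (fun s : ℝ => x' + s • w) ((1 : ℝ) • w) 0 :=
      ((hasDerivAt_id (0 : ℝ)).smul_const w).const_add x'
    have h2 := HasFDerivAt.comp_hasDerivAt (f := fun s : ℝ => x' + s • w) 0 (by simpa using hd) h1
    have h3 : (TT b f0 ∘ fun s : ℝ => x' + s • w) = fun _ => TT b f0 x' := by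
      funext s; simp [TT, hf0, hw]
    rw [h3] at h2
    have := h2.unique (hasDerivAt_const _ _)
    simpa [hb.ne'] using this
  have z2 : SK ddk b f0 x v w = 0 := by
    have h1 := (SKdk_hasFDerivAt hf0c hf0M hb x).clm_apply (hasFDerivAt_const w x)
    simp only [z1] at h1
    have := congrArg (fun L : Spc m →L[ℝ] ℝ => L v) (h1.unique (hasFDerivAt_const _ _))
    simpa [hb.ne'] using this
  have hI : Integrable fun z : Spc m => H * b ^ κ * (‖v‖ * ‖w‖) * (‖z‖ ^ κ * ‖ddk z‖) :=
    (RD_ddk.moment κ hκ).const_mul _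
  have hi : ∀ {g : Spc m → ℝ}, Continuous g → (∀ x, |g x| ≤ M) →
      Integrable fun z : Spc m => g (x + b • z) * ddk z v w := by
    intro g hg hgM
    have h1 := SK_integrable RD_ddk hg hgM b x
    have h2 : Integrable fun z : Spc m => (g (x + b • z) • ddk z) v := h1.apply_continuousLinearMap v
    exact Integrable.apply_continuousLinearMap (H := Spc m) (E := ℝ) h2 w
  rw [← sub_zero (SK ddk b f x v w), ← z2, SKddk_apply hf hM, SKddk_apply hf0c hf0M,
    ← integral_sub (hi hf hM) (hi hf0c hf0M)]
  calc _ ≤ ∫ z : Spc m, H * b ^ κ * (‖v‖ * ‖w‖) * (‖z‖ ^ κ * ‖ddk z‖) := by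
        rw [← Real.norm_eq_abs]
        refine norm_integral_le_of_norm_le hI (Eventually.of_forall fun z => ?_)
        rw [← sub_mul, norm_mul]
        have h1 : ‖f (x + b • z) - f0 (x + b • z)‖ ≤ H * (b ^ κ * ‖z‖ ^ κ) := by
          refine (hH _ _ _).trans ?_
          rw [← Real.mul_rpow hb.le (norm_nonneg z)]
          gcongr
          have : (x + b • z).2 - x.2 = b • z.2 := by simp
          refine (congrArg norm this).le.trans ?_
          rw [norm_smul, Real.norm_of_nonneg hb.le]
          gcongr
          exact norm_snd_le z
        have h2 : ‖ddk z v w‖ ≤ ‖ddk z‖ * ‖v‖ * ‖w‖ := (ddk z).le_opNorm₂ v w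
        calc _ ≤ H * (b ^ κ * ‖z‖ ^ κ) * (‖ddk z‖ * ‖v‖ * ‖w‖) := by gcongr
          _ = _ := by ring
    _ = _ := by rw [integral_const_mul]; ring

lemma bil_norm (A : Spc m →L[ℝ] Spc m →L[ℝ] ℝ) {P Q : ℝ} (hP : 0 ≤ P) (hQ : 0 ≤ Q)
    (h1 : ∀ v w : Spc m, w.1 = 0 → |A v w| ≤ P * (‖v‖ * ‖w‖))
    (h2 : ∀ v w : Spc m, A v w = A w v) (h3 : |tr A| ≤ Q) : ‖A‖ ≤ Q + (m + 2) * P := by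
  have ne : ‖e1 m‖ = 1 := by simp [e1, Prod.norm_def]
  have nC : ∀ i, ‖eC m i‖ ≤ 1 := fun i => by
    simp only [eC, Prod.norm_def, norm_zero]
    exact max_le zero_le_one (by rw [Pi.norm_single]; simp)
  have hs : |∑ i, A (eC m i) (eC m i)| ≤ m * P := by
    refine (Finset.abs_sum_le_sum_abs _ _).trans ?_
    have : ∀ i ∈ Finset.univ, |A (eC m i) (eC m i)| ≤ P := fun i _ =>
      (h1 _ _ (by simp [eC])).trans (by
        have := nC i
        have h0 := norm_nonneg (eC m i)
        nlinarith [mul_le_one₀ this h0 this])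
    simpa using Finset.sum_le_sum this
  have h11 : |A (e1 m) (e1 m)| ≤ Q + m * P := by
    have : A (e1 m) (e1 m) = tr A - ∑ i, A (eC m i) (eC m i) := by simp [tr]
    rw [this]; exact (abs_sub _ _).trans (by linarith)
  refine A.opNorm_le_bound₂ (by positivity) fun v w => ?_
  have dec : ∀ v : Spc m, v = v.1 • e1 m + (0, v.2) := fun v => by ext <;> simp [e1]
  have nd : ∀ v : Spc m, ‖((0 : ℝ), v.2)‖ ≤ ‖v‖ := fun v => by
    simp [Prod.norm_def]
  have n1 : ∀ v : Spc m, |v.1| ≤ ‖v‖ := fun v => norm_fst_le v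
  have ex : A v w = v.1 * w.1 * A (e1 m) (e1 m) + v.1 * A (e1 m) (0, w.2) + A w (0, v.2) := by
    rw [h2 w]
    conv_lhs => rw [dec v]
    rw [map_add, ContinuousLinearMap.add_apply, map_smul, ContinuousLinearMap.smul_apply]
    congr 1
    conv_lhs => rw [dec w]
    rw [map_add, map_smul]; simp only [smul_eq_mul]; ring
  have b2 := h1 (e1 m) (0, w.2) rfl
  have b3 := h1 w (0, v.2) rfl
  rw [ne, one_mul] at b2
  rw [Real.norm_eq_abs, ex]
  calc _ ≤ |v.1 * w.1 * A (e1 m) (e1 m)| + |v.1 * A (e1 m) (0, w.2)| + |A w (0, v.2)| := abs_add_three _ _ _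
    _ ≤ ‖v‖ * ‖w‖ * (Q + m * P) + ‖v‖ * (P * ‖w‖) + P * (‖w‖ * ‖v‖) := by
      rw [abs_mul, abs_mul, abs_mul]
      gcongr
      · exact n1 v
      · exact n1 w
      · exact n1 v
      · exact b2.trans (by gcongr; exact nd w)
      · exact b3.trans (by gcongr; exact nd v)
    _ = _ := by ring

/-- moment constant of the second derivative -/
def mdd (m : ℕ) (κ : ℝ) : ℝ := ∫ z : Spc m, ‖z‖ ^ κ * ‖ddk z‖
lemma mdd_nonneg (κ : ℝ) : 0 ≤ mdd m κ := integral_nonneg fun z => by positivity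

lemma TT_tr_ftc {f : Spc m → ℝ} (hf : Continuous f) (hM : ∀ x, |f x| ≤ M) {a b : ℝ} (ha : 0 < a)
    (hab : a ≤ b) (x : Spc m) :
    ∫ s in a..b, s⁻¹ * tr (SK ddk s f x) = TT b f x - TT a f x := by
  have hc : Continuous (Function.uncurry fun (_ : ℝ) => f) := by fun_prop
  refine intervalIntegral.integral_eq_sub_of_hasDerivAt (f := fun s => TT s f x)
    (f' := fun s => s⁻¹ * tr (SK ddk s f x)) (fun s hs => ?_) ?_
  · rw [uIcc_of_le hab] at hs
    exact TT_hasDerivAt hf hM (ha.trans_le hs.1) x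
  · refine ContinuousOn.intervalIntegrable ?_
    rw [uIcc_of_le hab]
    refine ContinuousOn.mul (continuousOn_inv₀.mono fun s hs => (ha.trans_le hs.1).ne') ?_
    have := SKb_cont RD_ddk hc (fun _ => hM) x
    unfold tr
    fun_prop

lemma tr_bound (A : Spc m →L[ℝ] Spc m →L[ℝ] ℝ) : |tr A| ≤ (m + 1) * ‖A‖ := by
  have ne : ‖e1 m‖ ≤ 1 := by simp [e1, Prod.norm_def]
  have nC : ∀ i, ‖eC m i‖ ≤ 1 := fun i => by
    simp only [eC, Prod.norm_def, norm_zero]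
    exact max_le zero_le_one (by rw [Pi.norm_single]; simp)
  have hv : ∀ v : Spc m, ‖v‖ ≤ 1 → |A v v| ≤ ‖A‖ := fun v hv => by
    refine (A.le_opNorm₂ v v).trans ?_
    have := norm_nonneg v
    have h0 := norm_nonneg A
    calc ‖A‖ * ‖v‖ * ‖v‖ ≤ ‖A‖ * 1 * 1 := by gcongr
      _ = _ := by ring
  refine (abs_add_le _ _).trans ?_
  have : |∑ i, A (eC m i) (eC m i)| ≤ m * ‖A‖ := by
    refine (Finset.abs_sum_le_sum_abs _ _).trans ?_
    simpa using Finset.sum_le_sum fun i (_ : i ∈ Finset.univ) => hv _ (nC i)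
  linarith [hv _ ne]

lemma SKdd_ii (hc : Continuous (Function.uncurry h)) (hM : ∀ b x, |h b x| ≤ M) {a b : ℝ} (ha : 0 < a)
    (hab : a ≤ b) (x : Spc m) :
    IntervalIntegrable (fun s => (β * s⁻¹) • SK ddk s (h s) x) volume a b := by
  refine ContinuousOn.intervalIntegrable ?_
  rw [uIcc_of_le hab]
  refine ContinuousOn.smul (continuousOn_const.mul
    (continuousOn_inv₀.mono fun s hs => (ha.trans_le hs.1).ne')) (SKb_cont RD_ddk hc hM x).continuousOn

def c2 (m : ℕ) (κ : ℝ) : ℝ := ((m + 1) * n2 m + (m + 2) * mdd m κ) / κ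

/-- applying a continuous linear functional -/
lemma clm_ii {F : Type*} [NormedAddCommGroup F] [NormedSpace ℝ F] [CompleteSpace F] (L : F →L[ℝ] ℝ) {f : ℝ → F} {a b : ℝ}
    (hf : IntervalIntegrable f volume a b) : L (∫ s in a..b, f s) = ∫ s in a..b, L (f s) :=
  (L.intervalIntegral_comp_comm hf).symm

def ev2 (v w : Spc m) : (Spc m →L[ℝ] Spc m →L[ℝ] ℝ) →L[ℝ] ℝ :=
  (ContinuousLinearMap.apply ℝ ℝ w).comp (ContinuousLinearMap.apply ℝ (Spc m →L[ℝ] ℝ) v)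
def trL (m : ℕ) : (Spc m →L[ℝ] Spc m →L[ℝ] ℝ) →L[ℝ] ℝ := ev2 (e1 m) (e1 m) + ∑ i, ev2 (eC m i) (eC m i)
lemma trL_apply (A : Spc m →L[ℝ] Spc m →L[ℝ] ℝ) : trL m A = tr A := by
  simp [trL, ev2, tr]

lemma int_rpow_le {a b κ : ℝ} (ha : 0 < a) (hab : a ≤ b) (hκ : 0 < κ) :
    ∫ s in a..b, s ^ (κ - 1) ≤ b ^ κ / κ := by
  rw [integral_rpow (Or.inl (by linarith))]
  simp only [sub_add_cancel]
  gcongr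
  have := Real.rpow_nonneg ha.le κ
  linarith

lemma D2key (hβ : 0 ≤ β) (hc : Continuous (Function.uncurry h)) (hM : ∀ b x, |h b x| ≤ M)
    {B κ H : ℝ} (hκ : 0 < κ) (hH0 : 0 ≤ H)
    (ht : ∀ b x, 0 ≤ b → b ≤ B → |h b x - h 0 x| ≤ H * b ^ κ)
    (hy : ∀ b, 0 ≤ b → b ≤ B → ∀ (x1 : ℝ) y y', |h b (x1, y) - h b (x1, y')| ≤ H * ‖y - y'‖ ^ κ)
    {a b : ℝ} (ha : 0 < a) (hab : a ≤ b) (hbB : b ≤ B) (x : Spc m) :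
    ‖∫ s in a..b, (β * s⁻¹) • SK ddk s (h s) x‖ ≤
      β * c2 m κ * H * b ^ κ + β * |TT b (h 0) x - TT a (h 0) x| := by
  have hii := SKdd_ii (β := β) hc hM ha hab x
  have hpi : IntervalIntegrable (fun s : ℝ => s ^ (κ - 1)) volume a b := by
    refine ContinuousOn.intervalIntegrable ?_
    rw [uIcc_of_le hab]
    exact fun s hs => (Real.continuousAt_rpow_const _ _ (Or.inl (ha.trans_le hs.1).ne')).continuousWithinAt
  have hpw : ∀ s : ℝ, 0 < s → s⁻¹ * s ^ κ = s ^ (κ - 1) := fun s hs => by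
    rw [Real.rpow_sub_one hs.ne']; field_simp
  have e : ∀ v w : Spc m, (∫ s in a..b, (β * s⁻¹) • SK ddk s (h s) x) v w =
      ∫ s in a..b, (β * s⁻¹) * SK ddk s (h s) x v w := fun v w => clm_ii (ev2 v w) hii
  refine (bil_norm (P := β * H * mdd m κ * (b ^ κ / κ))
    (Q := β * ((m + 1) * n2 m) * H * (b ^ κ / κ) + β * |TT b (h 0) x - TT a (h 0) x|) _ ?_ ?_ ?_ ?_ ?_).trans
    (le_of_eq ?_)
  · have := mdd_nonneg (m := m) κ
    have := ha.trans_le hab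
    positivity
  · have := n2_nonneg (m := m)
    have := ha.trans_le hab
    positivity
  · intro v w hw
    rw [e, ← Real.norm_eq_abs]
    refine (intervalIntegral.norm_integral_le_of_norm_le hab
      (g := fun s => β * H * mdd m κ * (‖v‖ * ‖w‖) * s ^ (κ - 1)) (Eventually.of_forall fun s hs => ?_)
      (hpi.const_mul _)).trans ?_
    · have hs0 : 0 < s := ha.trans hs.1
      have := SKddk_y (fam_cont hc s) (hM s) hs0 hκ.le hH0 (hy s hs0.le (hs.2.trans hbB)) x v w hw
      rw [norm_mul, Real.norm_of_nonneg (by positivity), Real.norm_eq_abs, ← hpw s hs0]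
      calc _ ≤ β * s⁻¹ * (H * s ^ κ * mdd m κ * (‖v‖ * ‖w‖)) := by gcongr; exact this
        _ = _ := by ring
    · rw [intervalIntegral.integral_const_mul]
      have := int_rpow_le ha hab hκ
      have h0 := mdd_nonneg (m := m) κ
      calc _ ≤ β * H * mdd m κ * (‖v‖ * ‖w‖) * (b ^ κ / κ) := by gcongr
        _ = _ := by ring
  · intro v w
    rw [e, e]
    congr 1; funext s
    rw [SKddk_apply (fam_cont hc s) (hM s), SKddk_apply (fam_cont hc s) (hM s)]
    simp only [ddk_symm]
  · have hc0 : Continuous (Function.uncurry fun (_ : ℝ) => h 0) :=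
      (fam_cont hc 0).comp continuous_snd
    have hii0 := SKdd_ii (β := β) hc0 (fun _ => hM 0) ha hab x
    have e1 : tr (∫ s in a..b, (β * s⁻¹) • SK ddk s (h s) x) =
        (∫ s in a..b, ((β * s⁻¹) * tr (SK ddk s (fun x => h s x - h 0 x) x))) +
        β * (TT b (h 0) x - TT a (h 0) x) := by
      rw [← TT_tr_ftc (fam_cont hc 0) (hM 0) ha hab, ← trL_apply, clm_ii (trL m) hii,
        ← intervalIntegral.integral_const_mul, ← intervalIntegral.integral_add]
      · congr 1; funext s
        rw [map_smul, trL_apply, smul_eq_mul]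
        have : SK ddk s (h s) x = SK ddk s (fun x => h s x - h 0 x) x + SK ddk s (h 0) x := by
          simp only [SK]
          rw [← integral_add]
          · congr 1; funext z; rw [← add_smul]; ring_nf
          · exact SK_integrable RD_ddk ((fam_cont hc s).sub (fam_cont hc 0))
              (fun x => (abs_sub _ _).trans (add_le_add (hM _ _) (hM _ _))) s x
          · exact SK_integrable RD_ddk (fam_cont hc 0) (hM 0) s x
        rw [this, ← trL_apply, ← trL_apply, ← trL_apply, map_add]; ring
      · have hcd : Continuous (Function.uncurry fun s x => h s x - h 0 x) :=
          hc.sub ((fam_cont hc 0).comp continuous_snd)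
        have := (SKdd_ii (β := β) hcd (fun s x => (abs_sub _ _).trans (add_le_add (hM _ _) (hM _ _))) ha hab x)
        have h2 : IntervalIntegrable (fun s => trL m ((β * s⁻¹) • SK ddk s (fun x => h s x - h 0 x) x)) volume a b :=
          ⟨(trL m).integrable_comp this.1, (trL m).integrable_comp this.2⟩
        simpa only [map_smul, trL_apply, smul_eq_mul] using h2
      · have h2 : IntervalIntegrable (fun s => trL m ((β * s⁻¹) • SK ddk s (h 0) x)) volume a b :=
          ⟨(trL m).integrable_comp hii0.1, (trL m).integrable_comp hii0.2⟩
        simpa only [map_smul, trL_apply, smul_eq_mul, mul_assoc] using h2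
    rw [e1]
    refine (abs_add_le _ _).trans (add_le_add ?_ (by rw [abs_mul, abs_of_nonneg hβ]))
    rw [← Real.norm_eq_abs]
    refine (intervalIntegral.norm_integral_le_of_norm_le hab
      (g := fun s => β * ((m + 1) * n2 m) * H * s ^ (κ - 1)) (Eventually.of_forall fun s hs => ?_)
      (hpi.const_mul _)).trans ?_
    · have hs0 : 0 < s := ha.trans hs.1
      rw [norm_mul, Real.norm_of_nonneg (by positivity), Real.norm_eq_abs, ← hpw s hs0]
      have h1 := SK_bound (RD_ddk (m := m)) (f := fun x => h s x - h 0 x)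
        (fun x => ht s x hs0.le (hs.2.trans hbB)) s x
      have h2 := tr_bound (SK ddk s (fun x => h s x - h 0 x) x)
      calc _ ≤ β * s⁻¹ * ((m + 1) * (H * s ^ κ * n2 m)) := by
            gcongr; exact h2.trans (by gcongr; exact h1)
        _ = _ := by ring
    · rw [intervalIntegral.integral_const_mul]
      have := int_rpow_le ha hab hκ
      have h0 := n2_nonneg (m := m)
      gcongr
  · rw [c2]; ring

lemma D2 (hβ : 0 ≤ β) (hc : Continuous (Function.uncurry h)) (hM : ∀ b x, |h b x| ≤ M)
    (hu : UniformContinuous (h 0)) {B κ H : ℝ} (hB : 0 < B) (hκ : 0 < κ) (hH0 : 0 ≤ H)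
    (ht : ∀ b x, 0 ≤ b → b ≤ B → |h b x - h 0 x| ≤ H * b ^ κ)
    (hy : ∀ b, 0 ≤ b → b ≤ B → ∀ (x1 : ℝ) y y', |h b (x1, y) - h b (x1, y')| ≤ H * ‖y - y'‖ ^ κ) :
    ∃ A : Spc m → Spc m →L[ℝ] Spc m →L[ℝ] ℝ, Continuous A ∧
      (∀ x, HasFDerivAt (QQ β h B) (A x) x) ∧
      ∀ x, ‖A x‖ ≤ β * c2 m κ * H * B ^ κ + β * (2 * M) := by
  have hM0 : 0 ≤ M := (abs_nonneg _).trans (hM 0 0)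
  have hc20 : 0 ≤ c2 m κ := by
    have := n2_nonneg (m := m); have := mdd_nonneg (m := m) κ
    unfold c2; positivity
  set ep : ℕ → ℝ := fun n => B / (n + 1) with hep
  have ep0 : ∀ n, 0 < ep n := fun n => by positivity
  have epB : ∀ n, ep n ≤ B := fun n => div_le_self hB.le (by linarith [Nat.cast_nonneg (α := ℝ) n])
  have epa : ∀ n k, n ≤ k → ep k ≤ ep n := fun n k hnk => by
    simp only [hep]; gcongr
  have ept : Tendsto ep atTop (nhds 0) := by
    refine ((tendsto_const_div_atTop_nhds_zero_nat B).comp (tendsto_add_atTop_nat 1)).congr fun n => ?_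
    simp [hep]
  set A : ℕ → Spc m → Spc m →L[ℝ] Spc m →L[ℝ] ℝ := fun n x =>
    ∫ s in (ep n)..B, (β * s⁻¹) • SK ddk s (h s) x with hA
  set f : ℕ → Spc m → Spc m →L[ℝ] ℝ := fun n x => ∫ s in (ep n)..B, (-β) • SK dk s (h s) x with hf
  have hAc : ∀ n, Continuous (A n) := by
    intro n
    have e : A n = fun x => ∫ s in (ep n)..B, (β * (max s (ep n))⁻¹) • SK ddk s (h s) x := by
      funext x
      refine intervalIntegral.integral_congr fun s hs => ?_
      rw [uIcc_of_le (epB n)] at hs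
      simp only [max_eq_left hs.1]
    rw [e]
    refine intervalIntegral.continuous_parametric_intervalIntegral_of_continuous' ?_ _ _
    refine Continuous.smul (f := fun q : Spc m × ℝ => β * (max q.2 (ep n))⁻¹)
      (g := fun q : Spc m × ℝ => SK ddk q.2 (h q.2) q.1) (continuous_const.mul ?_) ?_
    · exact Continuous.inv₀ (by fun_prop) fun q => ((ep0 n).trans_le (le_max_right _ _)).ne'
    · exact SK_cont (X := Spc m × ℝ) (f := fun q => h q.2) RD_ddk
        (hc.comp (by fun_prop : Continuous fun q : (Spc m × ℝ) × Spc m => (q.1.2, q.2)))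
        (fun q => hM q.2) continuous_snd continuous_fst
  have hbd : ∀ (b : ℝ) x, ‖SK ddk b (h b) x‖ ≤ M * n2 m := fun b x => SK_bound RD_ddk (hM b) b x
  have hfd : ∀ n x, HasFDerivAt (f n) (A n x) x := by
    intro n x
    refine (intervalIntegral.hasFDerivAt_integral_of_dominated_of_fderiv_le
      (F := fun x s => (-β) • SK dk s (h s) x) (F' := fun x s => (β * s⁻¹) • SK ddk s (h s) x)
      (s := univ) (bound := fun _ => β * (ep n)⁻¹ * (M * n2 m)) univ_mem ?_ ?_ ?_ ?_ ?_ ?_)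
    · exact Eventually.of_forall fun x => ((SKb_cont RD_dk hc hM x).const_smul (-β)).aestronglyMeasurable
    · exact ((SKb_cont RD_dk hc hM x).const_smul (-β)).intervalIntegrable _ _
    · have := (SKdd_ii (β := β) hc hM (ep0 n) (epB n) x).1.aestronglyMeasurable
      rwa [uIoc_of_le (epB n)]
    · refine Eventually.of_forall fun s hs x _ => ?_
      rw [uIoc_of_le (epB n)] at hs
      have := (ep0 n)
      have hs0 : 0 < s := this.trans hs.1
      have h1 : s⁻¹ ≤ (ep n)⁻¹ := by gcongr; exact hs.1.le
      rw [norm_smul, Real.norm_of_nonneg (by positivity)]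
      gcongr
      exact hbd s x
    · exact intervalIntegrable_const
    · refine Eventually.of_forall fun s hs x _ => ?_
      rw [uIoc_of_le (epB n)] at hs
      have := (SKdk_hasFDerivAt (fam_cont hc s) (hM s) ((ep0 n).trans hs.1) x).const_smul (-β)
      refine this.congr_fderiv ?_
      rw [smul_smul, neg_mul_neg]
  have hft : ∀ x, Tendsto (fun n => f n x) atTop (nhds (QQ β h B x)) := by
    intro x
    have hcf := (SKb_cont RD_dk hc hM x).const_smul (-β)
    have h1 : ∀ n, f n x = QQ β h B x - QQ β h (ep n) x := fun n => by
      rw [hf, QQ, QQ]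
      exact eq_sub_of_add_eq (by
        rw [add_comm]
        exact intervalIntegral.integral_add_adjacent_intervals (hcf.intervalIntegrable _ _) (hcf.intervalIntegrable _ _))
    have h2 : Tendsto (fun n => QQ β h (ep n) x) atTop (nhds 0) := by
      refine squeeze_zero_norm (fun n => QQ_bound hβ hM (ep0 n).le x) ?_
      simpa using ept.const_mul (β * (M * n1 m))
    simpa [h1] using h2.const_sub (QQ β h B x)
  have hTT : ∀ a b x, |TT b (h 0) x - TT a (h 0) x| ≤ |TT b (h 0) x - h 0 x| + |TT a (h 0) x - h 0 x| :=
    fun a b x => by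
      have := abs_sub (TT b (h 0) x - h 0 x) (TT a (h 0) x - h 0 x)
      simpa using this
  have hdiff : ∀ n k x, n ≤ k → ‖A k x - A n x‖ ≤ β * c2 m κ * H * (ep n) ^ κ +
      β * |TT (ep n) (h 0) x - TT (ep k) (h 0) x| := by
    intro n k x hnk
    have : A k x - A n x = ∫ s in (ep k)..(ep n), (β * s⁻¹) • SK ddk s (h s) x := by
      rw [sub_eq_iff_eq_add]
      exact (intervalIntegral.integral_add_adjacent_intervals (SKdd_ii hc hM (ep0 k) (epa n k hnk) x)
        (SKdd_ii hc hM (ep0 n) (epB n) x)).symm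
    rw [this]
    exact D2key hβ hc hM hκ hH0 ht hy (ep0 k) (epa n k hnk) (epB n) x
  have hcau : UniformCauchySeqOn A atTop univ := by
    rw [Metric.uniformCauchySeqOn_iff]
    intro η hη
    obtain ⟨δ, hδ, hδ'⟩ := TT_unif (f := h 0) hu (hM 0) (ε := η / (8 * (β + 1))) (by positivity)
    have h1 : Tendsto (fun n => β * c2 m κ * H * (ep n) ^ κ) atTop (nhds 0) := by
      have := (ept.rpow_const (Or.inr hκ.le)).const_mul (β * c2 m κ * H)
      simpa [Real.zero_rpow hκ.ne'] using this
    obtain ⟨N, hN⟩ := ((ept.eventually_lt_const hδ).and (h1.eventually_lt_const (by positivity : (0:ℝ) < η / 4))).exists_forall_of_atTop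
    have key : ∀ n ≥ N, ∀ x, ‖A n x - A N x‖ < η / 2 := by
      intro n hn x
      refine (hdiff N n x hn).trans_lt ?_
      have a1 := hδ' (ep N) (ep0 N).le (hN N le_rfl).1 x
      have a2 := hδ' (ep n) (ep0 n).le (hN n hn).1 x
      rw [Real.norm_eq_abs] at a1 a2
      have a3 := (hN N le_rfl).2
      have a4 : β * |TT (ep N) (h 0) x - TT (ep n) (h 0) x| ≤ β * (η / (8 * (β + 1)) + η / (8 * (β + 1))) := by
        gcongr; exact (hTT _ _ _).trans (add_le_add a1 a2)
      have a5 : β * (η / (8 * (β + 1)) + η / (8 * (β + 1))) ≤ η / 4 := by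
        have : η / 4 - β * (η / (8 * (β + 1)) + η / (8 * (β + 1))) = η / (4 * (β + 1)) := by field_simp; ring
        have h2 : 0 ≤ η / (4 * (β + 1)) := by positivity
        linarith
      linarith
    refine ⟨N, fun n hn k hk x _ => ?_⟩
    rw [dist_eq_norm]
    calc ‖A n x - A k x‖ = ‖(A n x - A N x) - (A k x - A N x)‖ := by congr 1; abel
      _ ≤ _ := norm_sub_le _ _
      _ < η := by linarith [key n hn x, key k hk x]
  have hlim : ∀ x, ∃ y, Tendsto (fun n => A n x) atTop (nhds y) := fun x =>
    cauchySeq_tendsto_of_complete (hcau.cauchySeq (mem_univ x))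
  choose A' hA' using hlim
  have hun : TendstoUniformly A A' atTop := by
    rw [← tendstoUniformlyOn_univ]
    exact hcau.tendstoUniformlyOn_of_tendsto fun x _ => hA' x
  refine ⟨A', hun.continuous (Frequently.of_forall hAc), fun x =>
    hasFDerivAt_of_tendstoUniformly hun hfd hft x, fun x => ?_⟩
  refine le_of_tendsto (hA' x).norm (Eventually.of_forall fun n => ?_)
  refine (D2key hβ hc hM hκ hH0 ht hy (ep0 n) (epB n) le_rfl x).trans ?_
  gcongr
  refine (abs_sub _ _).trans ?_
  have a1 := TT_bound (f := h 0) (hM 0) B x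
  have a2 := TT_bound (f := h 0) (hM 0) (ep n) x
  rw [Real.norm_eq_abs] at a1 a2
  linarith

end duh

section nice
variable {m : ℕ}

/-- lattice vectors -/
def lv (k : ℤ) (j : Fin m → ℤ) : Spc m := ((k : ℝ), fun i => (j i : ℝ))
/-- periodicity, any target -/
def Per {F : Type*} (f : Spc m → F) : Prop := ∀ (k : ℤ) (j : Fin m → ℤ) x, f (x + lv k j) = f x

lemma per_iff {f : Spc m → ℝ} : IsPeriodic f ↔ Per f :=
  ⟨fun h k j x => h x k j, fun h x k j => h k j x⟩

lemma Per.comp {F G : Type*} {f : Spc m → F} (h : Per f) (g : F → G) : Per (fun x => g (f x)) :=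
  fun k j x => congrArg g (h k j x)
lemma Per.fderiv {F : Type*} [NormedAddCommGroup F] [NormedSpace ℝ F] {f : Spc m → F} (h : Per f) :
    Per (fderiv ℝ f) := fun k j x => by
  have : f = fun y => f (y + lv k j) := funext fun y => (h k j y).symm
  conv_rhs => rw [this, fderiv_comp_add_right]
lemma Per.pd {f : Spc m → ℝ} (h : Per f) (v : Spc m) : Per (pd v f) :=
  h.fderiv.comp fun L => L v

/-- reduction to the cube -/
lemma exists_lv (x : Spc m) : ∃ k j, x + lv k j ∈ cube m := by
  refine ⟨-⌊x.1⌋, fun i => -⌊x.2 i⌋, ?_, ?_⟩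
  · simp only [lv, Prod.fst_add]
    push_cast
    exact ⟨by linarith [Int.floor_le x.1], by linarith [Int.lt_floor_add_one x.1]⟩
  · intro i _
    simp only [lv, Prod.snd_add, Pi.add_apply]
    push_cast
    exact ⟨by linarith [Int.floor_le (x.2 i)], by linarith [Int.lt_floor_add_one (x.2 i)]⟩

def ccube (m : ℕ) : Set (Spc m) := Icc 0 1
lemma cube_sub : cube m ⊆ ccube m := fun x hx =>
  ⟨⟨hx.1.1, fun i => (hx.2 i trivial).1⟩, ⟨hx.1.2.le, fun i => (hx.2 i trivial).2.le⟩⟩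
lemma ccube_compact : IsCompact (ccube m) := isCompact_Icc

lemma Per.bounded {F : Type*} [NormedAddCommGroup F] {f : Spc m → F} (h : Per f) (hc : Continuous f) :
    ∃ C, 0 ≤ C ∧ ∀ x, ‖f x‖ ≤ C := by
  obtain ⟨C, hC⟩ := ccube_compact.exists_bound_of_continuousOn (hc.continuousOn (s := ccube m))
  refine ⟨max C 0, le_max_right _ _, fun x => ?_⟩
  obtain ⟨k, j, hx⟩ := exists_lv x
  rw [← h k j x]
  exact (hC _ (cube_sub hx)).trans (le_max_left _ _)

instance finC1 : IsFiniteMeasure (volume.restrict (cube1 m)) := by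
  refine ⟨?_⟩
  rw [Measure.restrict_apply_univ, cube1, volume_pi, Measure.pi_pi]
  simp
lemma vol_cube1 : volume.real (cube1 m) = 1 := by
  rw [measureReal_def, cube1, volume_pi, Measure.pi_pi]; simp
lemma volR_cube1 : (volume.restrict (cube1 m)).real univ = 1 := by
  simp [measureReal_restrict_apply_univ, vol_cube1]

abbrev St (m : ℕ) : Type := ℝ × (Spc m →L[ℝ] ℝ)

structure Nice (A : (Spc m → St m) → Spc m → ℝ) : Prop where
  ex : ∃ C, 0 ≤ C ∧ (∀ W x, |A W x| ≤ C) ∧ ∀ W W' D, Continuous W → Continuous W' →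
    (∀ x, ‖W x - W' x‖ ≤ D) → ∀ x, |A W x - A W' x| ≤ C * D
  cont : ∀ W : ℝ → Spc m → St m, Continuous (Function.uncurry W) →
    Continuous (Function.uncurry fun t x => A (W t) x)
  per : ∀ W, Per W → Per (A W)

lemma Nice.cont1 {A : (Spc m → St m) → Spc m → ℝ} (h : Nice A) {W : Spc m → St m} (hW : Continuous W) :
    Continuous (A W) :=
  (h.cont (fun _ => W) (hW.comp continuous_snd)).comp (by fun_prop : Continuous fun x : Spc m => ((0:ℝ), x))

def YH (A : (Spc m → St m) → Spc m → ℝ) : Prop :=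
  ∃ C, 0 ≤ C ∧ ∀ (W : Spc m → St m) (H κ : ℝ), 0 ≤ H → 0 ≤ κ → κ ≤ 1 →
    (∀ x y, ‖W x - W y‖ ≤ H * ‖x - y‖ ^ κ) → ∀ (x1 : ℝ) y y', |A W (x1, y) - A W (x1, y')| ≤ C * (1 + H) * ‖y - y'‖ ^ κ

variable {A B : (Spc m → St m) → Spc m → ℝ}

lemma Nice.add (hA : Nice A) (hB : Nice B) : Nice fun W x => A W x + B W x := by
  obtain ⟨C, hC, h1, h2⟩ := hA.ex
  obtain ⟨C', hC', h1', h2'⟩ := hB.ex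
  refine ⟨⟨C + C', by positivity, fun W x => (abs_add_le _ _).trans (add_le_add (h1 _ _) (h1' _ _)),
    fun W W' D hW hW' hD x => ?_⟩, fun W hW => (hA.cont W hW).add (hB.cont W hW), fun W hW k j x => ?_⟩
  · have a := h2 W W' D hW hW' hD x
    have b := h2' W W' D hW hW' hD x
    rw [add_sub_add_comm]
    exact (abs_add_le _ _).trans (by linarith)
  · simp only [hA.per W hW k j x, hB.per W hW k j x]

lemma Nice.mul (hA : Nice A) (hB : Nice B) : Nice fun W x => A W x * B W x := by
  obtain ⟨C, hC, h1, h2⟩ := hA.ex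
  obtain ⟨C', hC', h1', h2'⟩ := hB.ex
  refine ⟨⟨C * C' + C * C', by positivity, fun W x => ?_,
    fun W W' D hW hW' hD x => ?_⟩, fun W hW => (hA.cont W hW).mul (hB.cont W hW), fun W hW k j x => ?_⟩
  · rw [abs_mul]
    have := mul_le_mul (h1 W x) (h1' W x) (abs_nonneg _) hC
    nlinarith [mul_nonneg hC hC']
  · have a := h2 W W' D hW hW' hD x
    have b := h2' W W' D hW hW' hD x
    have e : A W x * B W x - A W' x * B W' x = A W x * (B W x - B W' x) + (A W x - A W' x) * B W' x := by ring
    have hD0 : 0 ≤ D := (norm_nonneg _).trans (hD x)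
    rw [e]
    refine (abs_add_le _ _).trans ?_
    rw [abs_mul, abs_mul]
    calc _ ≤ C * (C' * D) + (C * D) * C' := by
          gcongr
          · exact h1 _ _
          · exact h1' _ _
      _ = _ := by ring
  · simp only [hA.per W hW k j x, hB.per W hW k j x]

lemma Nice.const {c : Spc m → ℝ} (hc : Continuous c) (hp : Per c) : Nice fun _ x => c x := by
  obtain ⟨C, hC, h⟩ := hp.bounded hc
  refine ⟨⟨C, hC, fun _ x => h x, fun W W' D _ _ hD x => ?_⟩, fun W hW => hc.comp continuous_snd, fun W hW => hp⟩
  have hD0 : 0 ≤ D := (norm_nonneg _).trans (hD x)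
  simp; positivity

lemma Nice.num (c : ℝ) : Nice fun (_ : Spc m → St m) (_ : Spc m) => c :=
  Nice.const continuous_const fun _ _ _ => rfl

lemma Nice.neg (hA : Nice A) : Nice fun W x => -A W x := by
  have := (Nice.num (-1)).mul hA
  simpa using this
lemma Nice.sub (hA : Nice A) (hB : Nice B) : Nice fun W x => A W x - B W x := by
  simpa [sub_eq_add_neg] using hA.add hB.neg

lemma Nice.sum {ι : Type*} (s : Finset ι) {A : ι → (Spc m → St m) → Spc m → ℝ} (h : ∀ i, Nice (A i)) :
    Nice fun W x => ∑ i ∈ s, A i W x := by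
  classical
  induction s using Finset.induction_on with
  | empty => simpa using Nice.num 0
  | insert i s hi ih => simp only [Finset.sum_insert hi]; exact (h i).add ih

/-- clipping -/
def cl (R a : ℝ) : ℝ := max (-R) (min R a)
lemma cl_bound {R : ℝ} (hR : 0 ≤ R) (a : ℝ) : |cl R a| ≤ R :=
  abs_le.2 ⟨le_max_left _ _, max_le (by linarith) (min_le_left _ _)⟩
lemma cl_eq {R a : ℝ} (h : |a| ≤ R) : cl R a = a := by
  rw [abs_le] at h; rw [cl, min_eq_right h.2, max_eq_right h.1]
lemma cl_lip (R a b : ℝ) : |cl R a - cl R b| ≤ |a - b| :=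
  (abs_max_sub_max_le_max _ _ _ _).trans (by
    simp only [sub_self, abs_zero]
    exact max_le (abs_nonneg _) ((abs_min_sub_min_le_max _ _ _ _).trans (by simp)))
lemma cl_cont (R : ℝ) : Continuous (cl R) := by unfold cl; fun_prop

lemma Nice.clip {R : ℝ} (hR : 0 ≤ R) (L : St m →L[ℝ] ℝ) : Nice fun W x => cl R (L (W x)) := by
  refine ⟨⟨R + ‖L‖, by positivity, fun W x => (cl_bound hR _).trans (by linarith [norm_nonneg L]),
    fun W W' D _ _ hD x => (cl_lip _ _ _).trans ?_⟩,
    fun W hW => (cl_cont R).comp (L.continuous.comp hW), fun W hW => hW.comp fun w => cl R (L w)⟩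
  have hD0 : 0 ≤ D := (norm_nonneg _).trans (hD x)
  rw [← map_sub, ← Real.norm_eq_abs]
  refine (L.le_opNorm _).trans ?_
  calc _ ≤ ‖L‖ * D := by gcongr; exact hD x
    _ ≤ _ := by gcongr; linarith

lemma YH.clip {R : ℝ} (L : St m →L[ℝ] ℝ) : YH fun W x => cl R (L (W x)) := by
  refine ⟨‖L‖, norm_nonneg _, fun W H κ hH _ _ hW x1 y y' => (cl_lip _ _ _).trans ?_⟩
  rw [← map_sub, ← Real.norm_eq_abs]
  refine (L.le_opNorm _).trans ?_
  have := hW (x1, y) (x1, y')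
  have e : ‖((x1, y) : Spc m) - (x1, y')‖ = ‖y - y'‖ := by simp [Prod.norm_def]
  rw [e] at this
  rw [mul_assoc]
  gcongr
  refine this.trans ?_
  gcongr; linarith

lemma Nice.integ (hA : Nice A) : Nice fun W x => ∫ y in cube1 m, A W (x.1, y) := by
  obtain ⟨C, hC, h1, h2⟩ := hA.ex
  have hI : ∀ (W : Spc m → St m) x1, Continuous W → Integrable (fun y => A W (x1, y)) (volume.restrict (cube1 m)) :=
    fun W x1 hW => Integrable.of_bound ((hA.cont1 hW).comp (by fun_prop)).aestronglyMeasurable C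
      (Eventually.of_forall fun y => h1 _ _)
  refine ⟨⟨C, hC, fun W x => ?_, fun W W' D hW hW' hD x => ?_⟩, fun W hW => ?_, fun W hW k j x => ?_⟩
  · have := norm_integral_le_of_norm_le_const (μ := volume.restrict (cube1 m)) (C := C) (f := fun y => A W (x.1, y))
      (Eventually.of_forall fun y => h1 _ _)
    rwa [volR_cube1, mul_one] at this
  · rw [← integral_sub (hI W x.1 hW) (hI W' x.1 hW')]
    have := norm_integral_le_of_norm_le_const (μ := volume.restrict (cube1 m)) (C := C * D)
      (f := fun y => A W (x.1, y) - A W' (x.1, y)) (Eventually.of_forall fun y => h2 W W' D hW hW' hD _)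
    rwa [volR_cube1, mul_one] at this
  · refine continuous_of_dominated (bound := fun _ => C) (F := fun (q : ℝ × Spc m) y => A (W q.1) (q.2.1, y))
      (fun q => ?_) (fun q => Eventually.of_forall fun y => h1 _ _) (integrable_const C)
      (Eventually.of_forall fun y => ?_)
    · exact ((hA.cont W hW).comp (by fun_prop : Continuous fun y : Fin m → ℝ => (q.1, ((q.2.1, y) : Spc m)))).aestronglyMeasurable
    · exact (hA.cont W hW).comp (by fun_prop : Continuous fun q : ℝ × Spc m => (q.1, ((q.2.1, y) : Spc m)))
  · congr 1; funext y
    have := hA.per W hW k 0 (x.1, y)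
    rw [← this]; congr 1
    ext <;> simp [lv]

lemma Nice.inv {κ : ℝ} (hκ : 0 < κ) (hA : Nice A) : Nice fun W x => (max κ (A W x))⁻¹ := by
  obtain ⟨C, hC, h1, h2⟩ := hA.ex
  have hp : ∀ a : ℝ, 0 < max κ a := fun a => hκ.trans_le (le_max_left _ _)
  have hi : ∀ a : ℝ, (max κ a)⁻¹ ≤ κ⁻¹ := fun a => by gcongr; exact le_max_left _ _
  refine ⟨⟨κ⁻¹ + κ⁻¹ * κ⁻¹ * C, by positivity, fun W x => ?_, fun W W' D hW hW' hD x => ?_⟩,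
    fun W hW => ?_, fun W hW => (hA.per W hW).comp fun a => (max κ a)⁻¹⟩
  · rw [abs_of_pos (inv_pos.2 (hp _))]
    have : 0 ≤ κ⁻¹ * κ⁻¹ * C := by positivity
    linarith [hi (A W x)]
  · have a := h2 W W' D hW hW' hD x
    have hD0 : 0 ≤ D := (norm_nonneg _).trans (hD x)
    rw [inv_sub_inv (hp _).ne' (hp _).ne', abs_div, div_eq_mul_inv, abs_of_pos (mul_pos (hp _) (hp _)), mul_inv]
    have : |max κ (A W' x) - max κ (A W x)| ≤ C * D := by
      refine (abs_max_sub_max_le_max _ _ _ _).trans ?_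
      rw [sub_self, abs_zero, abs_sub_comm]
      exact max_le (by positivity) a
    calc _ ≤ C * D * (κ⁻¹ * κ⁻¹) := by
          gcongr
          · exact le_max_left _ _
          · exact le_max_left _ _
      _ ≤ _ := by
        have : 0 ≤ κ⁻¹ * D := by positivity
        nlinarith
  · exact Continuous.inv₀ (continuous_const.max (hA.cont W hW)) fun q => (hp _).ne'

lemma YH.of_yc (h : ∀ W x1 y y', A W (x1, y) = A W (x1, y')) : YH A :=
  ⟨0, le_rfl, fun W H κ hH _ _ _ x1 y y' => by rw [h W x1 y y']; simp⟩

lemma YH.const {c : Spc m → ℝ} (hc : Continuous c) (hp : Per c) {L : ℝ} (hL : ∀ x y, |c x - c y| ≤ L * ‖x - y‖) :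
    YH fun _ x => c x := by
  obtain ⟨C, hC, h⟩ := hp.bounded hc
  refine ⟨2 * C + |L|, by positivity, fun W H κ hH hκ hκ1 hW x1 y y' => ?_⟩
  have e : ‖((x1, y) : Spc m) - (x1, y')‖ = ‖y - y'‖ := by simp [Prod.norm_def]
  have h1 := hL (x1, y) (x1, y')
  rw [e] at h1
  have h2 : |c (x1, y) - c (x1, y')| ≤ 2 * C + |L| := by
    refine (abs_sub _ _).trans ?_
    have a := h (x1, y)
    have b := h (x1, y')
    rw [Real.norm_eq_abs] at a b
    linarith [abs_nonneg L]
  refine (interp hκ hκ1 (norm_nonneg (y - y')) (by positivity) h2 (h1.trans ?_)).trans ?_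
  · gcongr
    linarith [le_abs_self L]
  · gcongr
    nlinarith [abs_nonneg L]

lemma YH.add (hA : YH A) (hB : YH B) : YH fun W x => A W x + B W x := by
  obtain ⟨C, hC, h⟩ := hA
  obtain ⟨C', hC', h'⟩ := hB
  refine ⟨C + C', by positivity, fun W H κ hH hκ hκ1 hW x1 y y' => ?_⟩
  have a := h W H κ hH hκ hκ1 hW x1 y y'
  have b := h' W H κ hH hκ hκ1 hW x1 y y'
  rw [add_sub_add_comm]
  exact (abs_add_le _ _).trans (by linarith)

lemma YH.mul (nA : Nice A) (nB : Nice B) (hA : YH A) (hB : YH B) : YH fun W x => A W x * B W x := by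
  obtain ⟨C, hC, h⟩ := hA
  obtain ⟨C', hC', h'⟩ := hB
  obtain ⟨K, hK, k, -⟩ := nA.ex
  obtain ⟨K', hK', k', -⟩ := nB.ex
  refine ⟨K * C' + K' * C, by positivity, fun W H κ hH hκ hκ1 hW x1 y y' => ?_⟩
  have a := h W H κ hH hκ hκ1 hW x1 y y'
  have b := h' W H κ hH hκ hκ1 hW x1 y y'
  have e : A W (x1, y) * B W (x1, y) - A W (x1, y') * B W (x1, y') =
    A W (x1, y) * (B W (x1, y) - B W (x1, y')) + B W (x1, y') * (A W (x1, y) - A W (x1, y')) := by ring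
  rw [e]
  refine (abs_add_le _ _).trans ?_
  rw [abs_mul, abs_mul]
  calc _ ≤ K * (C' * (1 + H) * ‖y - y'‖ ^ κ) + K' * (C * (1 + H) * ‖y - y'‖ ^ κ) := by
        gcongr
        · exact k _ _
        · exact k' _ _
    _ = _ := by ring
lemma YH.neg (hA : YH A) : YH fun W x => -A W x := by
  obtain ⟨C, hC, h⟩ := hA
  refine ⟨C, hC, fun W H κ hH hκ hκ1 hW x1 y y' => ?_⟩
  rw [← neg_sub', abs_neg]; exact h W H κ hH hκ hκ1 hW x1 y y'
lemma YH.sum {ι : Type*} (s : Finset ι) {A : ι → (Spc m → St m) → Spc m → ℝ} (h : ∀ i, YH (A i)) :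
    YH fun W x => ∑ i ∈ s, A i W x := by
  classical
  induction s using Finset.induction_on with
  | empty => simpa using YH.of_yc (A := fun (_ : Spc m → St m) (_ : Spc m) => (0:ℝ)) fun _ _ _ _ => rfl
  | insert i s hi ih => simp only [Finset.sum_insert hi]; exact (h i).add ih

/-! ### the nonlinearity -/
variable (V : Spc m → ℝ) (β R κ : ℝ)
def wt (x : Spc m) : ℝ := Real.exp (-β * V x)
def uL : St m →L[ℝ] ℝ := ContinuousLinearMap.fst ℝ _ _
def qL (v : Spc m) : St m →L[ℝ] ℝ := (ContinuousLinearMap.apply ℝ ℝ v).comp (ContinuousLinearMap.snd ℝ _ _)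
lemma uL_apply (w : St m) : uL w = w.1 := rfl
lemma qL_apply (v : Spc m) (w : St m) : qL v w = w.2 v := rfl

def fN (W : Spc m → St m) (x : Spc m) : ℝ :=
  ∫ y in cube1 m, (pd (e1 m) V (x.1, y) * wt V β (x.1, y)) * cl R (uL (W (x.1, y)))
def fR (W : Spc m → St m) (x : Spc m) : ℝ :=
  ∫ y in cube1 m, wt V β (x.1, y) * cl R (uL (W (x.1, y)))
def fN1 (W : Spc m → St m) (x : Spc m) : ℝ :=
  ∫ y in cube1 m, (((pd (e1 m) (pd (e1 m) V) (x.1, y) - β * pd (e1 m) V (x.1, y) ^ 2) * wt V β (x.1, y)) *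
    cl R (uL (W (x.1, y))) + (pd (e1 m) V (x.1, y) * wt V β (x.1, y)) * cl R (qL (e1 m) (W (x.1, y))))
def fR1 (W : Spc m → St m) (x : Spc m) : ℝ :=
  ∫ y in cube1 m, ((-β * pd (e1 m) V (x.1, y) * wt V β (x.1, y)) *
    cl R (uL (W (x.1, y))) + wt V β (x.1, y) * cl R (qL (e1 m) (W (x.1, y))))
def fP (W : Spc m → St m) (x : Spc m) : ℝ := fN V β R W x * (max κ (fR V β R W x))⁻¹
def fP1 (W : Spc m → St m) (x : Spc m) : ℝ :=
  (fN1 V β R W x - fP V β R κ W x * fR1 V β R W x) * (max κ (fR V β R W x))⁻¹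
def GG (W : Spc m → St m) (x : Spc m) : ℝ :=
  -(pd (e1 m) V x * cl R (qL (e1 m) (W x)) + ∑ i, pd (eC m i) V x * cl R (qL (eC m i) (W x)))
  + -(fP V β R κ W x * cl R (qL (e1 m) (W x))) + (β * pd (e1 m) V x) * (fP V β R κ W x * cl R (uL (W x)))
  + -(fP1 V β R κ W x * cl R (uL (W x)))

variable {V β R κ}
section
variable (hV : ContDiff ℝ 2 V) (hp : Per V)
include hV
lemma pdV_c1 (v : Spc m) : ContDiff ℝ 1 (pd v V) :=
  (hV.fderiv_right (m := 1) (by norm_num)).clm_apply contDiff_const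
lemma pdV_cont (v : Spc m) : Continuous (pd v V) := (pdV_c1 hV v).continuous
lemma pdpdV_cont (v w : Spc m) : Continuous (pd w (pd v V)) :=
  ((pdV_c1 hV v).continuous_fderiv (by norm_num)).clm_apply continuous_const
lemma wt_cont : Continuous (wt V β) := by
  have := hV.continuous
  unfold wt; fun_prop
include hp
omit hV in
lemma wt_per : Per (wt V β) := hp.comp fun a => Real.exp (-β * a)
lemma pdV_lip (v : Spc m) : ∃ L, ∀ x y, |pd v V x - pd v V y| ≤ L * ‖x - y‖ := by
  obtain ⟨C, hC, h⟩ := ((hp.pd v).fderiv).bounded ((pdV_c1 hV v).continuous_fderiv (by norm_num))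
  exact ⟨C, fun x y => Convex.norm_image_sub_le_of_norm_fderiv_le (s := univ)
    (fun x _ => ((pdV_c1 hV v).differentiable (by norm_num)).differentiableAt) (fun x _ => h x) convex_univ trivial trivial⟩
variable (hR : 0 ≤ R) (hκ : 0 < κ)
include hR
lemma fN_nice : Nice (fN V β R) :=
  (((Nice.const (pdV_cont hV (e1 m)) (hp.pd _)).mul (Nice.const (wt_cont hV) (wt_per hp))).mul (Nice.clip hR uL)).integ
lemma fR_nice : Nice (fR V β R) :=
  ((Nice.const (wt_cont hV) (wt_per hp)).mul (Nice.clip hR uL)).integ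
lemma fN1_nice : Nice (fN1 V β R) := by
  have h2 : Nice fun _ x => pd (e1 m) (pd (e1 m) V) x - β * pd (e1 m) V x ^ 2 := by
    refine Nice.const (c := fun x => pd (e1 m) (pd (e1 m) V) x - β * pd (e1 m) V x ^ 2) ?_ fun k j x => ?_
    · have := pdV_cont hV (e1 m)
      have := pdpdV_cont hV (e1 m) (e1 m)
      fun_prop
    · simp only [hp.pd (e1 m) k j x, (hp.pd (e1 m)).pd (e1 m) k j x]
  exact (((h2.mul (Nice.const (wt_cont hV) (wt_per hp))).mul (Nice.clip hR uL)).add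
    (((Nice.const (pdV_cont hV (e1 m)) (hp.pd _)).mul (Nice.const (wt_cont hV) (wt_per hp))).mul
      (Nice.clip hR (qL (e1 m))))).integ
lemma fR1_nice : Nice (fR1 V β R) :=
  (((((Nice.num (-β)).mul (Nice.const (pdV_cont hV (e1 m)) (hp.pd _))).mul (Nice.const (wt_cont hV) (wt_per hp))).mul
    (Nice.clip hR uL)).add ((Nice.const (wt_cont hV) (wt_per hp)).mul (Nice.clip hR (qL (e1 m))))).integ
include hκ
lemma fP_nice : Nice (fP V β R κ) := (fN_nice hV hp hR).mul ((fR_nice hV hp hR).inv hκ)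
lemma fP1_nice : Nice (fP1 V β R κ) :=
  ((fN1_nice hV hp hR).sub ((fP_nice hV hp hR hκ).mul (fR1_nice hV hp hR))).mul ((fR_nice hV hp hR).inv hκ)
lemma GG_nice : Nice (GG V β R κ) := by
  have hq : ∀ v, Nice fun W x => pd v V x * cl R (qL v (W x)) := fun v =>
    (Nice.const (pdV_cont hV v) (hp.pd _)).mul (Nice.clip hR (qL v))
  exact ((((hq _).add (Nice.sum Finset.univ fun i => hq (eC m i))).neg.add
    ((fP_nice hV hp hR hκ).mul (Nice.clip hR (qL (e1 m)))).neg).add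
    (((Nice.num β).mul (Nice.const (pdV_cont hV (e1 m)) (hp.pd _))).mul
      ((fP_nice hV hp hR hκ).mul (Nice.clip hR uL)))).add ((fP1_nice hV hp hR hκ).mul (Nice.clip hR uL)).neg
lemma GG_YH : YH (GG V β R κ) := by
  have nq : ∀ v, Nice fun (_ : Spc m → St m) x => pd v V x := fun v => Nice.const (pdV_cont hV v) (hp.pd _)
  have hq0 : ∀ v, YH fun (_ : Spc m → St m) x => pd v V x := fun v =>
    YH.const (pdV_cont hV v) (hp.pd _) (pdV_lip hV hp v).choose_spec
  have hq : ∀ v, YH fun W x => pd v V x * cl R (qL v (W x)) := fun v =>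
    YH.mul (nq v) (Nice.clip hR (qL v)) (hq0 v) (YH.clip _)
  have y1 : YH (fP V β R κ) := YH.of_yc fun _ _ _ _ => rfl
  have y2 : YH (fP1 V β R κ) := YH.of_yc fun _ _ _ _ => rfl
  have y3 : YH fun (_ : Spc m → St m) (_ : Spc m) => β := YH.of_yc fun _ _ _ _ => rfl
  have nP := fP_nice (β := β) hV hp hR hκ
  exact ((((hq _).add (YH.sum Finset.univ fun i => hq (eC m i))).neg.add
    (YH.mul nP (Nice.clip hR (qL (e1 m))) y1 (YH.clip _)).neg).add
    (YH.mul ((Nice.num β).mul (nq _)) (nP.mul (Nice.clip hR uL)) (YH.mul (Nice.num β) (nq _) y3 (hq0 _))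
      (YH.mul nP (Nice.clip hR uL) y1 (YH.clip _)))).add
      (YH.mul (fP1_nice hV hp hR hκ) (Nice.clip hR uL) y2 (YH.clip _)).neg
end
end nice

section fixpt
variable {m : ℕ} {β : ℝ}

def bb (β t : ℝ) : ℝ := √(2 * t / β)
lemma bb_nonneg (t : ℝ) : 0 ≤ bb β t := Real.sqrt_nonneg _
lemma bb_cont : Continuous (bb β) := by unfold bb; fun_prop
lemma bb_zero : bb β 0 = 0 := by simp [bb]
lemma bb_sq (hβ : 0 < β) {t : ℝ} (ht : 0 ≤ t) : bb β t ^ 2 = 2 * t / β := Real.sq_sqrt (by positivity)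
lemma bb_mono (hβ : 0 < β) {s t : ℝ} (h : s ≤ t) : bb β s ≤ bb β t := Real.sqrt_le_sqrt (by gcongr)
lemma bb_pos (hβ : 0 < β) {t : ℝ} (ht : 0 < t) : 0 < bb β t := Real.sqrt_pos.2 (by positivity)
lemma bb_time (hβ : 0 < β) {t b : ℝ} (ht : 0 ≤ t) (hb : 0 ≤ b) (h : b ≤ bb β t) : β * b ^ 2 / 2 ≤ t := by
  have := pow_le_pow_left₀ hb h 2
  rw [bb_sq hβ ht, le_div_iff₀ hβ] at this
  linarith
lemma bb_inv (hβ : 0 < β) {b : ℝ} (hb : 0 ≤ b) : bb β (β * b ^ 2 / 2) = b := by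
  rw [bb, show 2 * (β * b ^ 2 / 2) / β = b ^ 2 by field_simp, Real.sqrt_sq hb]

def ct (T t : ℝ) : ℝ := max 0 (min t T)
lemma ct_cont (T : ℝ) : Continuous (ct T) := by unfold ct; fun_prop
lemma ct_nonneg (T t : ℝ) : 0 ≤ ct T t := le_max_left _ _
lemma ct_le {T : ℝ} (hT : 0 ≤ T) (t : ℝ) : ct T t ≤ T := max_le hT (min_le_right _ _)
lemma ct_eq {T t : ℝ} (h0 : 0 ≤ t) (h1 : t ≤ T) : ct T t = t := by rw [ct, min_eq_left h1, max_eq_right h0]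
lemma ct_ct {T : ℝ} (hT : 0 ≤ T) (t : ℝ) : ct T (ct T t) = ct T t := ct_eq (ct_nonneg _ _) (ct_le hT _)

lemma GI (hβ : 0 < β) {η : ℝ} (hη : 0 < η) : ∃ l > 0, ∀ B, 0 ≤ B → ∫ b in (0:ℝ)..B, Real.exp (-l * (β * b ^ 2 / 2)) ≤ η := by
  refine ⟨2 * Real.pi / (β * η ^ 2), by positivity, fun B hB => ?_⟩
  have e : (fun b : ℝ => Real.exp (-(2 * Real.pi / (β * η ^ 2)) * (β * b ^ 2 / 2))) =
      fun b => Real.exp (-(Real.pi / η ^ 2) * b ^ 2) := by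
    funext b; congr 1; field_simp
  simp only [e]
  have hi : Integrable fun b : ℝ => Real.exp (-(Real.pi / η ^ 2) * b ^ 2) := integrable_exp_neg_mul_sq (by positivity)
  rw [intervalIntegral.integral_of_le hB]
  refine (setIntegral_le_integral hi (Eventually.of_forall fun b => (Real.exp_pos _).le)).trans ?_
  rw [integral_gaussian, show Real.pi / (Real.pi / η ^ 2) = η ^ 2 by field_simp, Real.sqrt_sq hη.le]

variable {F : Type*} [NormedAddCommGroup F] [NormedSpace ℝ F]
lemma TT_sub_fun {f g : Spc m → F} (hf : Continuous f) (hg : Continuous g) {M M' : ℝ} (hM : ∀ x, ‖f x‖ ≤ M)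
    (hM' : ∀ x, ‖g x‖ ≤ M') (b : ℝ) (x : Spc m) : TT b (fun x => f x - g x) x = TT b f x - TT b g x := by
  simp only [TT, smul_sub]
  exact integral_sub (TT_integrable hf hM b x) (TT_integrable hg hM' b x)
lemma SK_sub_fun {K : Spc m → F} (hK : RD K) {f g : Spc m → ℝ} (hf : Continuous f) (hg : Continuous g) {M M' : ℝ}
    (hM : ∀ x, |f x| ≤ M) (hM' : ∀ x, |g x| ≤ M') (b : ℝ) (x : Spc m) :
    SK K b (fun x => f x - g x) x = SK K b f x - SK K b g x := by
  simp only [SK, sub_smul]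
  exact integral_sub (SK_integrable hK hf hM b x) (SK_integrable hK hg hM' b x)

lemma UU_sub {h h' : ℝ → Spc m → ℝ} (hc : Continuous (Function.uncurry h)) (hc' : Continuous (Function.uncurry h'))
    {M M' : ℝ} (hM : ∀ b x, |h b x| ≤ M) (hM' : ∀ b x, |h' b x| ≤ M') (B : ℝ) (x : Spc m) :
    UU β h B x - UU β h' B x = UU β (fun b x => h b x - h' b x) B x := by
  rw [UU, UU, UU, ← intervalIntegral.integral_sub]
  · congr 1; funext b
    rw [TT_sub_fun (fam_cont hc b) (fam_cont hc' b) (hM b) (hM' b), mul_sub]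
  · have := TTb_cont hc hM x
    exact Continuous.intervalIntegrable (by fun_prop) _ _
  · have := TTb_cont hc' hM' x
    exact Continuous.intervalIntegrable (by fun_prop) _ _
lemma QQ_sub {h h' : ℝ → Spc m → ℝ} (hc : Continuous (Function.uncurry h)) (hc' : Continuous (Function.uncurry h'))
    {M M' : ℝ} (hM : ∀ b x, |h b x| ≤ M) (hM' : ∀ b x, |h' b x| ≤ M') (B : ℝ) (x : Spc m) :
    QQ β h B x - QQ β h' B x = QQ β (fun b x => h b x - h' b x) B x := by
  rw [QQ, QQ, QQ, ← intervalIntegral.integral_sub]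
  · congr 1; funext b
    rw [SK_sub_fun RD_dk (fam_cont hc b) (fam_cont hc' b) (hM b) (hM' b), smul_sub]
  · have := SKb_cont RD_dk hc hM x
    exact Continuous.intervalIntegrable (by fun_prop) _ _
  · have := SKb_cont RD_dk hc' hM' x
    exact Continuous.intervalIntegrable (by fun_prop) _ _

/-- weighted bounds -/
lemma UU_wbound (hβ : 0 ≤ β) {h : ℝ → Spc m → ℝ} {l B M η : ℝ} (hB : 0 ≤ B) (hM0 : 0 ≤ M)
    (hM : ∀ b, 0 ≤ b → b ≤ B → ∀ x, |h b x| ≤ M * Real.exp (-l * (β * b ^ 2 / 2)))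
    (hη : ∫ b in (0:ℝ)..B, Real.exp (-l * (β * b ^ 2 / 2)) ≤ η) (x : Spc m) : |UU β h B x| ≤ β * B * M * η := by
  rw [UU, ← Real.norm_eq_abs]
  have := intervalIntegral.norm_integral_le_of_norm_le hB (f := fun b => (β * b) * TT b (h b) x)
    (g := fun b => β * B * M * Real.exp (-l * (β * b ^ 2 / 2))) (μ := volume)
    (Eventually.of_forall fun b hb => by
      rw [norm_mul, Real.norm_of_nonneg (mul_nonneg hβ hb.1.le), mul_assoc (β * B)]
      gcongr
      · exact hb.2
      · exact TT_bound (hM b hb.1.le hb.2) b x) (Continuous.intervalIntegrable (by fun_prop) _ _)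
  refine this.trans ?_
  rw [intervalIntegral.integral_const_mul]
  gcongr
lemma QQ_wbound (hβ : 0 ≤ β) {h : ℝ → Spc m → ℝ} {l B M η : ℝ} (hB : 0 ≤ B) (hM0 : 0 ≤ M)
    (hM : ∀ b, 0 ≤ b → b ≤ B → ∀ x, |h b x| ≤ M * Real.exp (-l * (β * b ^ 2 / 2)))
    (hη : ∫ b in (0:ℝ)..B, Real.exp (-l * (β * b ^ 2 / 2)) ≤ η) (x : Spc m) : ‖QQ β h B x‖ ≤ β * M * n1 m * η := by
  rw [QQ]
  have := intervalIntegral.norm_integral_le_of_norm_le hB (f := fun b => (-β) • SK dk b (h b) x)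
    (g := fun b => β * M * n1 m * Real.exp (-l * (β * b ^ 2 / 2))) (μ := volume)
    (Eventually.of_forall fun b hb => by
      rw [norm_smul, norm_neg, Real.norm_of_nonneg hβ]
      refine (mul_le_mul_of_nonneg_left (SK_bound RD_dk (hM b hb.1.le hb.2) b x) hβ).trans (le_of_eq ?_)
      rw [n1]; ring) (Continuous.intervalIntegrable (by fun_prop) _ _)
  refine this.trans ?_
  have := n1_nonneg (m := m)
  rw [intervalIntegral.integral_const_mul]
  gcongr

/-- Duhamel terms -/
def DU (β : ℝ) (g : ℝ → Spc m → ℝ) (t : ℝ) (x : Spc m) : ℝ := UU β (fun b => g (t - β * b ^ 2 / 2)) (bb β t) x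
def DQ (β : ℝ) (g : ℝ → Spc m → ℝ) (t : ℝ) (x : Spc m) : Spc m →L[ℝ] ℝ :=
  QQ β (fun b => g (t - β * b ^ 2 / 2)) (bb β t) x

variable {g : ℝ → Spc m → ℝ} {M : ℝ}
lemma shift_cont (hg : Continuous (Function.uncurry g)) (t : ℝ) :
    Continuous (Function.uncurry fun b => g (t - β * b ^ 2 / 2)) :=
  hg.comp (by fun_prop : Continuous fun q : ℝ × Spc m => (t - β * q.1 ^ 2 / 2, q.2))
lemma DU_cont (hg : Continuous (Function.uncurry g)) (hM : ∀ s x, |g s x| ≤ M) :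
    Continuous (Function.uncurry fun t x => DU β g t x) := by
  have h := TT_cont (X := (ℝ × Spc m) × ℝ) (f := fun q => g (q.1.1 - β * q.2 ^ 2 / 2)) (M := M)
    (hg.comp (by fun_prop : Continuous fun r : ((ℝ × Spc m) × ℝ) × Spc m => (r.1.1.1 - β * r.1.2 ^ 2 / 2, r.2)))
    (fun q x => hM _ _) (b := fun q => q.2) (by fun_prop) (x := fun q => q.1.2) (by fun_prop)
  refine intervalIntegral.continuous_parametric_intervalIntegral_of_continuous (a₀ := 0)
    (f := fun (q : ℝ × Spc m) b => (β * b) * TT b (g (q.1 - β * b ^ 2 / 2)) q.2) ?_ (bb_cont.comp continuous_fst)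
  exact (by fun_prop : Continuous fun q : (ℝ × Spc m) × ℝ => β * q.2).mul h
lemma DQ_cont (hg : Continuous (Function.uncurry g)) (hM : ∀ s x, |g s x| ≤ M) :
    Continuous (Function.uncurry fun t x => DQ β g t x) := by
  have h := SK_cont (X := (ℝ × Spc m) × ℝ) RD_dk (f := fun q => g (q.1.1 - β * q.2 ^ 2 / 2)) (M := M)
    (hg.comp (by fun_prop : Continuous fun r : ((ℝ × Spc m) × ℝ) × Spc m => (r.1.1.1 - β * r.1.2 ^ 2 / 2, r.2)))
    (fun q x => hM _ _) (b := fun q => q.2) (by fun_prop) (x := fun q => q.1.2) (by fun_prop)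
  refine intervalIntegral.continuous_parametric_intervalIntegral_of_continuous (a₀ := 0)
    (f := fun (q : ℝ × Spc m) b => (-β) • SK dk b (g (q.1 - β * b ^ 2 / 2)) q.2) ?_ (bb_cont.comp continuous_fst)
  exact h.const_smul (-β)

lemma TT_per {f : Spc m → F} (h : Per f) (b : ℝ) : Per (TT b f) := fun k j x => by
  simp only [TT]; congr 1; funext z; rw [add_right_comm, h]
lemma SK_per {K : Spc m → F} {f : Spc m → ℝ} (h : Per f) (b : ℝ) : Per (SK K b f) := fun k j x => by
  simp only [SK]; congr 1; funext z; rw [add_right_comm, h]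
lemma UU_per {h : ℝ → Spc m → ℝ} (hp : ∀ b, Per (h b)) (B : ℝ) : Per (UU β h B) := fun k j x => by
  simp only [UU]; congr 1; funext b; rw [TT_per (hp b)]
lemma QQ_per {h : ℝ → Spc m → ℝ} (hp : ∀ b, Per (h b)) (B : ℝ) : Per (QQ β h B) := fun k j x => by
  simp only [QQ]; congr 1; funext b; rw [SK_per (hp b)]

section fp
variable {A : (Spc m → St m) → Spc m → ℝ}
abbrev XX (m : ℕ) := BoundedContinuousFunction (ℝ × Spc m) (St m)

def ww (l T : ℝ) (W : XX m) (s : ℝ) (x : Spc m) : St m := Real.exp (l * ct T s) • W (ct T s, x)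
lemma ww_cont (l T : ℝ) (W : XX m) : Continuous (Function.uncurry (ww l T W)) := by
  have := ct_cont T
  have := W.continuous
  unfold ww Function.uncurry
  fun_prop

lemma fixpt_exists (hβ : 0 < β) (hA : Nice A) {T : ℝ} (hT : 0 ≤ T) {u0 : Spc m → ℝ} {q0 : Spc m → Spc m →L[ℝ] ℝ}
    (hu0 : Continuous u0) (hq0 : Continuous q0) (pu0 : Per u0) (pq0 : Per q0) :
    ∃ w : ℝ → Spc m → St m, Continuous (Function.uncurry w) ∧ (∀ t, Per (w t)) ∧ (∃ M, ∀ t x, ‖w t x‖ ≤ M) ∧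
      (∀ t, w t = w (ct T t)) ∧
      ∀ t, 0 ≤ t → t ≤ T → ∀ x, w t x = (TT (bb β t) u0 x + DU β (fun s => A (w s)) t x,
        TT (bb β t) q0 x + DQ β (fun s => A (w s)) t x) := by
  obtain ⟨C, hC, hCb, hCl⟩ := hA.ex
  obtain ⟨Mu, hMu0, hMu⟩ := pu0.bounded hu0
  obtain ⟨Mq, hMq0, hMq⟩ := pq0.bounded hq0
  have hn1 := n1_nonneg (m := m)
  set BT := bb β T
  have hBT : 0 ≤ BT := bb_nonneg T
  set Z := β * C * (BT + n1 m) + 1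
  have hZ : 0 < Z := by positivity
  obtain ⟨l, hl, hGI⟩ := GI hβ (show 0 < 1 / (2 * Z) by positivity)
  have gcont : ∀ W : XX m, Continuous (Function.uncurry fun s => A (ww l T W s)) := fun W => hA.cont _ (ww_cont l T W)
  let f : XX m → ℝ × Spc m → St m := fun W q => Real.exp (-l * ct T q.1) •
    (TT (bb β (ct T q.1)) u0 q.2 + DU β (fun s => A (ww l T W s)) (ct T q.1) q.2,
      TT (bb β (ct T q.1)) q0 q.2 + DQ β (fun s => A (ww l T W s)) (ct T q.1) q.2)
  have hcc := ct_cont T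
  have hpair : Continuous fun q : ℝ × Spc m => (ct T q.1, q.2) := by fun_prop
  have fcont : ∀ W, Continuous (f W) := fun W => by
    have h1 := TT_cont (X := ℝ × Spc m) (f := fun _ => u0) (hu0.comp continuous_snd) (fun _ => hMu)
      (b := fun q => bb β (ct T q.1)) (bb_cont.comp (hcc.comp continuous_fst)) continuous_snd
    have h2 := TT_cont (X := ℝ × Spc m) (f := fun _ => q0) (hq0.comp continuous_snd) (fun _ => hMq)
      (b := fun q => bb β (ct T q.1)) (bb_cont.comp (hcc.comp continuous_fst)) continuous_snd
    have h3 := (DU_cont (β := β) (gcont W) (fun s => hCb _)).comp hpair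
    have h4 := (DQ_cont (β := β) (gcont W) (fun s => hCb _)).comp hpair
    exact Continuous.smul (f := fun q : ℝ × Spc m => Real.exp (-l * ct T q.1)) (by fun_prop) ((h1.add h3).prodMk (h2.add h4))
  have fbd : ∀ W q, ‖f W q‖ ≤ Mu + β * BT * C * BT + (Mq + β * (C * n1 m) * BT) := fun W q => by
    rw [norm_smul, Real.norm_of_nonneg (Real.exp_pos _).le]
    have hb : bb β (ct T q.1) ≤ BT := bb_mono hβ (ct_le hT _)
    have hb0 := bb_nonneg (β := β) (ct T q.1)
    have e1 : Real.exp (-l * ct T q.1) ≤ 1 := Real.exp_le_one_iff.2 (by nlinarith [ct_nonneg T q.1])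
    have n1' : ‖TT (bb β (ct T q.1)) u0 q.2 + DU β (fun s => A (ww l T W s)) (ct T q.1) q.2‖ ≤ Mu + β * BT * C * BT := by
      refine (norm_add_le _ _).trans (add_le_add (TT_bound hMu _ _) ?_)
      refine (UU_bound hβ.le (fun b => hCb _) hb0 q.2).trans ?_
      gcongr
    have n2' : ‖TT (bb β (ct T q.1)) q0 q.2 + DQ β (fun s => A (ww l T W s)) (ct T q.1) q.2‖ ≤ Mq + β * (C * n1 m) * BT := by
      refine (norm_add_le _ _).trans (add_le_add (TT_bound hMq _ _) ?_)
      refine (QQ_bound hβ.le (fun b => hCb _) hb0 q.2).trans ?_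
      gcongr
    refine (mul_le_of_le_one_left (norm_nonneg _) e1).trans (max_le ?_ ?_)
    · refine n1'.trans ?_; simp only [le_add_iff_nonneg_right]; positivity
    · refine n2'.trans ?_; simp only [le_add_iff_nonneg_left]; positivity
  let Φ : XX m → XX m := fun W => BoundedContinuousFunction.ofNormedAddCommGroup (f W) (fcont W) _ (fbd W)
  have hΦ : ContractingWith (1/2) Φ := by
    refine ⟨by norm_num, LipschitzWith.of_dist_le_mul fun W W' => ?_⟩
    rw [BoundedContinuousFunction.dist_le (by positivity)]
    intro q
    rw [dist_eq_norm, dist_eq_norm]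
    show ‖f W q - f W' q‖ ≤ _
    set τ := ct T q.1
    have hτ0 : 0 ≤ τ := ct_nonneg _ _
    have hτT : τ ≤ T := ct_le hT _
    have hb : bb β τ ≤ BT := bb_mono hβ hτT
    have hb0 := bb_nonneg (β := β) τ
    set D := ‖W - W'‖
    have hD : 0 ≤ D := norm_nonneg _
    have hd : ∀ b, 0 ≤ b → b ≤ bb β τ → ∀ x, |A (ww l T W (τ - β * b ^ 2 / 2)) x - A (ww l T W' (τ - β * b ^ 2 / 2)) x|
        ≤ (C * Real.exp (l * τ) * D) * Real.exp (-l * (β * b ^ 2 / 2)) := fun b h0 h1 x => by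
      have ht := bb_time hβ hτ0 h0 h1
      have hbq : 0 ≤ β * b ^ 2 / 2 := by positivity
      have hct : ct T (τ - β * b ^ 2 / 2) = τ - β * b ^ 2 / 2 := ct_eq (by linarith) (by linarith)
      refine (hCl (ww l T W (τ - β * b ^ 2 / 2)) (ww l T W' (τ - β * b ^ 2 / 2)) (Real.exp (l * (τ - β * b ^ 2 / 2)) * D) ((ww_cont l T W).comp (by fun_prop : Continuous fun x => (_, x))) ((ww_cont l T W').comp (by fun_prop : Continuous fun x => (_, x))) (fun x => ?_) x).trans
        (le_of_eq ?_)
      · simp only [ww]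
        rw [← smul_sub, norm_smul, Real.norm_of_nonneg (Real.exp_pos _).le, hct]
        gcongr
        exact (W - W').norm_coe_le_norm _
      · rw [show l * (τ - β * b ^ 2 / 2) = l * τ + -l * (β * b ^ 2 / 2) by ring, Real.exp_add]; ring
    have key : f W q - f W' q = Real.exp (-l * τ) • (UU β (fun b x => A (ww l T W (τ - β * b ^ 2 / 2)) x - A (ww l T W' (τ - β * b ^ 2 / 2)) x) (bb β τ) q.2,
       QQ β (fun b x => A (ww l T W (τ - β * b ^ 2 / 2)) x - A (ww l T W' (τ - β * b ^ 2 / 2)) x) (bb β τ) q.2) := by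
      rw [← UU_sub (shift_cont (gcont W) τ) (shift_cont (gcont W') τ) (fun b => hCb _) (fun b => hCb _),
        ← QQ_sub (shift_cont (gcont W) τ) (shift_cont (gcont W') τ) (fun b => hCb _) (fun b => hCb _)]
      show _ • _ - _ • _ = _
      rw [← smul_sub]
      congr 1
      simp only [Prod.mk_sub_mk, DU, DQ, add_sub_add_left_eq_sub]
      rfl
    rw [key, norm_smul, Real.norm_of_nonneg (Real.exp_pos _).le]
    have hM0 : 0 ≤ C * Real.exp (l * τ) * D := by positivity
    have b1 := UU_wbound hβ.le hb0 hM0 hd (hGI _ hb0) q.2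
    have b2 := QQ_wbound hβ.le hb0 hM0 hd (hGI _ hb0) q.2
    have hZ2 : (Z - 1) * (1 / (2 * Z)) ≤ 1 / 2 := by
      rw [mul_one_div, div_le_div_iff₀ (by positivity) (by norm_num)]; linarith
    have b3 : Real.exp (-l * τ) * Real.exp (l * τ) = 1 := by rw [← Real.exp_add]; simp
    have : Real.exp (-l * τ) * ((C * Real.exp (l * τ) * D) * (β * (BT + n1 m)) * (1 / (2 * Z))) ≤ ((1/2 : NNReal) : ℝ) * D := by
      have : Real.exp (-l * τ) * ((C * Real.exp (l * τ) * D) * (β * (BT + n1 m)) * (1 / (2 * Z))) = ((Z - 1) * (1 / (2 * Z))) * D := by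
        calc _ = (Real.exp (-l * τ) * Real.exp (l * τ)) * (C * D * (β * (BT + n1 m)) * (1 / (2 * Z))) := by ring
          _ = _ := by rw [b3]; simp only [Z]; ring
      rw [this]; push_cast
      gcongr
    refine (mul_le_mul_of_nonneg_left ?_ (Real.exp_pos _).le).trans this
    refine max_le (b1.trans ?_) (b2.trans ?_)
    · rw [mul_comm (C * Real.exp (l * τ) * D)]
      gcongr; linarith
    · rw [mul_comm (C * Real.exp (l * τ) * D), mul_right_comm β]
      gcongr; linarith
  set W := ContractingWith.fixedPoint Φ hΦ
  have hW : Φ W = W := hΦ.fixedPoint_isFixedPt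
  have hper : ∀ t, Per (fun x => W (t, x)) := by
    let S : Set (XX m) := {W | ∀ t, Per (fun x => W (t, x))}
    have hS : IsClosed S := by
      have : S = ⋂ (t : ℝ), ⋂ (k : ℤ), ⋂ (j : Fin m → ℤ), ⋂ (x : Spc m), {W : XX m | W (t, x + lv k j) = W (t, x)} := by
        ext W; simp [S, Per]
      rw [this]
      refine isClosed_iInter fun t => isClosed_iInter fun k => isClosed_iInter fun j => isClosed_iInter fun x => ?_
      exact isClosed_eq (continuous_eval_const _) (continuous_eval_const _)
    have hst : ∀ W ∈ S, Φ W ∈ S := fun W hW t => by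
      have hg : ∀ s, Per (A (ww l T W s)) := fun s => hA.per _ ((hW (ct T s)).comp fun v => Real.exp (l * ct T s) • v)
      intro k j x
      show f W _ = f W _
      simp only [f, DU, DQ]
      rw [TT_per pu0, TT_per pq0, UU_per (fun b => hg _), QQ_per (fun b => hg _)]
    have hit : ∀ n, Φ^[n] 0 ∈ S := fun n => by
      induction n with
      | zero => exact fun t k j x => rfl
      | succ n ih => rw [Function.iterate_succ_apply']; exact hst _ ih
    exact hS.mem_of_tendsto (hΦ.tendsto_iterate_fixedPoint 0) (Eventually.of_forall hit)
  refine ⟨ww l T W, ww_cont l T W, fun t => (hper (ct T t)).comp fun v => Real.exp (l * ct T t) • v,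
    ⟨Real.exp (l * T) * ‖W‖, fun t x => ?_⟩, fun t => ?_, fun t h0 h1 x => ?_⟩
  · rw [ww, norm_smul, Real.norm_of_nonneg (Real.exp_pos _).le]
    gcongr
    · exact ct_le hT _
    · exact W.norm_coe_le_norm _
  · funext x; simp only [ww, ct_ct hT]
  · have h2 : W (t, x) = f W (t, x) := by
      conv_lhs => rw [← hW]
      rfl
    rw [ww, ct_eq h0 h1, h2]
    simp only [f, ct_eq h0 h1]
    rw [smul_smul, ← Real.exp_add]
    simp
end fp
end fixpt

section reg
variable {m : ℕ} {β : ℝ}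

lemma Per.unifCont {F : Type*} [NormedAddCommGroup F] {f : Spc m → F} (h : Per f) (hc : Continuous f) :
    UniformContinuous f := by
  have hK : IsCompact (Icc (-1) 2 : Set (Spc m)) := isCompact_Icc
  have := hK.uniformContinuousOn_of_continuous hc.continuousOn
  rw [Metric.uniformContinuousOn_iff] at this
  rw [Metric.uniformContinuous_iff]
  intro ε hε
  obtain ⟨δ, hδ, H⟩ := this ε hε
  refine ⟨min δ 1, by positivity, fun {x y} hxy => ?_⟩
  obtain ⟨k, j, hx⟩ := exists_lv x
  have hd : dist (x + lv k j) (y + lv k j) < min δ 1 := by simpa using hxy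
  rw [← h k j x, ← h k j y]
  have h1 := hd.trans_le (min_le_right _ _)
  rw [dist_eq_norm, Prod.norm_def, max_lt_iff] at h1
  have hx' := cube_sub hx
  refine H _ ⟨(by exact ⟨by have := hx'.1.1; simp at this ⊢; linarith, fun i => by have := hx'.1.2 i; simp at this ⊢; linarith⟩),
    (by exact ⟨by have := hx'.2.1; simp at this ⊢; linarith, fun i => by have := hx'.2.2 i; simp at this ⊢; linarith⟩)⟩ _ ⟨?_, ?_⟩
    (hd.trans_le (min_le_left _ _))
  · refine ⟨?_, fun i => ?_⟩
    · have a := (abs_lt.1 h1.1).2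
      have := hx'.1.1
      simp at a this ⊢; linarith
    · have a := (abs_lt.1 ((norm_le_pi_norm _ i).trans_lt h1.2)).2
      have := hx'.1.2 i
      simp at a this ⊢; linarith
  · refine ⟨?_, fun i => ?_⟩
    · have a := (abs_lt.1 h1.1).1
      have := hx'.2.1
      simp at a this ⊢; linarith
    · have a := (abs_lt.1 ((norm_le_pi_norm _ i).trans_lt h1.2)).1
      have := hx'.2.2 i
      simp at a this ⊢; linarith

lemma TT_swap {f : ℝ → Spc m → ℝ} (hf : Continuous (Function.uncurry f)) {B M : ℝ} (hB : 0 ≤ B)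
    (hM : ∀ b, 0 < b → b ≤ B → ∀ x, |f b x| ≤ M) (a : ℝ) (x : Spc m) :
    TT a (fun y => ∫ b in (0:ℝ)..B, f b y) x = ∫ b in (0:ℝ)..B, TT a (f b) x := by
  simp only [TT, intervalIntegral.integral_of_le hB, ← integral_smul]
  refine integral_integral_swap ?_
  have hi : Integrable (fun q : Spc m × ℝ => kk q.1 * M) (volume.prod (volume.restrict (Ioc 0 B))) :=
    RD_kk.integrable.mul_prod (integrable_const M)
  have hk := RD_kk (m := m).1
  have hc : Continuous fun q : Spc m × ℝ => kk q.1 • f q.2 (x + a • q.1) :=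
    (hk.comp continuous_fst).smul (hf.comp (by fun_prop : Continuous fun q : Spc m × ℝ => (q.2, x + a • q.1)))
  refine hi.mono' hc.aestronglyMeasurable ?_
  have hae : ∀ᵐ q : Spc m × ℝ ∂(volume.prod (volume.restrict (Ioc 0 B))), q.2 ∈ Ioc 0 B :=
    (Measure.quasiMeasurePreserving_snd).ae (ae_restrict_mem measurableSet_Ioc)
  filter_upwards [hae] with q hq
  show ‖kk q.1 • f q.2 (x + a • q.1)‖ ≤ _
  rw [norm_smul, Real.norm_of_nonneg (kk_pos _).le]
  exact mul_le_mul_of_nonneg_left (hM _ hq.1 hq.2 _) (kk_pos _).le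

lemma TT_const_mul (c a : ℝ) (f : Spc m → ℝ) (x : Spc m) : TT a (fun y => c * f y) x = c * TT a f x := by
  simp only [TT, ← integral_const_mul, smul_eq_mul]
  congr 1; funext z; ring
lemma TT_add_fun {f g : Spc m → ℝ} (hf : Continuous f) (hg : Continuous g) {M M' : ℝ} (hM : ∀ x, |f x| ≤ M)
    (hM' : ∀ x, |g x| ≤ M') (b : ℝ) (x : Spc m) : TT b (fun x => f x + g x) x = TT b f x + TT b g x := by
  simp only [TT, smul_add]
  exact integral_add (TT_integrable hf hM b x) (TT_integrable hg hM' b x)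

lemma TT_UU (hβ : 0 < β) {g : ℝ → Spc m → ℝ} (hg : Continuous (Function.uncurry g)) {M : ℝ} (hM : ∀ s x, |g s x| ≤ M)
    {s t : ℝ} (hs : 0 ≤ s) (hst : s < t) (x : Spc m) :
    TT (bb β (t - s)) (DU β g s) x = DU β g t x - UU β (fun b => g (t - β * b ^ 2 / 2)) (bb β (t - s)) x := by
  have hM0 : 0 ≤ M := (abs_nonneg _).trans (hM 0 0)
  set a := bb β (t - s)
  have ha : 0 < a := bb_pos hβ (by linarith)
  have ha2 : a ^ 2 = 2 * (t - s) / β := bb_sq hβ (by linarith)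
  have hsc := shift_cont (β := β) hg s
  have hcT : Continuous (Function.uncurry fun b y => (β * b) * TT b (g (s - β * b ^ 2 / 2)) y) := by
    refine (by fun_prop : Continuous fun q : ℝ × Spc m => β * q.1).mul ?_
    exact TT_cont (X := ℝ × Spc m) (f := fun q => g (s - β * q.1 ^ 2 / 2))
      (hg.comp (by fun_prop : Continuous fun q : (ℝ × Spc m) × Spc m => (s - β * q.1.1 ^ 2 / 2, q.2)))
      (fun q => hM _) continuous_fst continuous_snd
  have e1 : TT a (DU β g s) x = ∫ b in (0:ℝ)..bb β s, TT a (fun y => (β * b) * TT b (g (s - β * b ^ 2 / 2)) y) x := by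
    refine TT_swap (M := β * bb β s * M) hcT (bb_nonneg s) (fun b h0 h1 y => ?_) a x
    have := bb_nonneg (β := β) s
    rw [abs_mul, abs_of_nonneg (by positivity)]
    gcongr
    exact TT_bound (f := g (s - β * b ^ 2 / 2)) (hM _) _ _
  set G : ℝ → ℝ := fun c => (β * c) * TT c (g (t - β * c ^ 2 / 2)) x
  have hGc : Continuous G := by
    have := TTb_cont (shift_cont (β := β) hg t) (fun b => hM _) x
    exact (by fun_prop : Continuous fun c : ℝ => β * c).mul this
  have e2 : ∀ b ∈ Ioc 0 (bb β s), TT a (fun y => (β * b) * TT b (g (s - β * b ^ 2 / 2)) y) x =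
      (G ∘ fun b => √(a ^ 2 + b ^ 2)) b * (b / √(a ^ 2 + b ^ 2)) := fun b hb => by
    have hp : 0 < √(a ^ 2 + b ^ 2) := Real.sqrt_pos.2 (by positivity)
    have hsq : √(a ^ 2 + b ^ 2) ^ 2 = a ^ 2 + b ^ 2 := Real.sq_sqrt (by positivity)
    rw [TT_const_mul, TT_TT (fam_cont hg _) (hM _) hb.1 hp hsq]
    simp only [G, Function.comp, hsq]
    rw [show t - β * (a ^ 2 + b ^ 2) / 2 = s - β * b ^ 2 / 2 by rw [ha2]; field_simp; ring]
    field_simp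
  have e3 : ∫ b in (0:ℝ)..bb β s, (G ∘ fun b => √(a ^ 2 + b ^ 2)) b * (b / √(a ^ 2 + b ^ 2)) = ∫ c in a..bb β t, G c := by
    have hne : ∀ b : ℝ, a ^ 2 + b ^ 2 ≠ 0 := fun b => by positivity
    rw [intervalIntegral.integral_comp_mul_deriv (fun b _ => ?_) ?_ hGc]
    · congr 1
      · simp [Real.sqrt_sq ha.le]
      · rw [ha2, bb_sq hβ hs, bb]; congr 1; ring
    · refine Continuous.continuousOn ?_
      exact continuous_id.div (by fun_prop) fun b => (Real.sqrt_pos.2 (by positivity)).ne'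
    · have := ((((hasDerivAt_id b).pow 2).const_add (a ^ 2)).sqrt (hne b))
      refine this.congr_deriv ?_
      simp
      field_simp
  rw [e1, intervalIntegral.integral_congr_ae (Eventually.of_forall fun b hb => e2 b (by rwa [uIoc_of_le (bb_nonneg s)] at hb)), e3]
  rw [DU, UU, UU, intervalIntegral.integral_interval_sub_left (hGc.intervalIntegrable _ _) (hGc.intervalIntegrable _ _)]

/-- second order heat expansion -/
lemma TT_ftc2 {f : Spc m → ℝ} {f' : Spc m → Spc m →L[ℝ] ℝ} {f'' : Spc m → Spc m →L[ℝ] Spc m →L[ℝ] ℝ}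
    (h1 : ∀ x, HasFDerivAt f (f' x) x) (h2 : ∀ x, HasFDerivAt f' (f'' x) x) (hc : Continuous f'') {M : ℝ}
    (b0 : ∀ x, ‖f x‖ ≤ M) (b1 : ∀ x, ‖f' x‖ ≤ M) (b2 : ∀ x, ‖f'' x‖ ≤ M) {B : ℝ} (hB : 0 ≤ B) (x : Spc m) :
    TT B f x - f x = ∫ b in (0:ℝ)..B, b * TT b (fun y => tr (f'' y)) x := by
  have hf : Continuous f := continuous_iff_continuousAt.2 fun x => (h1 x).continuousAt
  have hf' : Continuous f' := continuous_iff_continuousAt.2 fun x => (h2 x).continuousAt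
  have htr : Continuous fun y => tr (f'' y) := by
    simp only [← trL_apply]; exact (trL m).continuous.comp hc
  have htb : ∀ y, |tr (f'' y)| ≤ (m + 1) * M := fun y => (tr_bound _).trans (by gcongr; exact b2 y)
  have hd : ∀ b, 0 < b → HasDerivAt (fun b => TT b f x) (b * TT b (fun y => tr (f'' y)) x) b := fun b hb => by
    convert TT_hasDerivAt hf b0 hb x using 1
    have e1 : TT b f' = fun x => -b⁻¹ • SK dk b f x := funext fun x =>
      (TT_comm_hasFDerivAt h1 hf' b0 b1 b x).unique (TT_hasFDerivAt hf b0 hb x)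
    have e2 : TT b f'' x = -b⁻¹ • (-b⁻¹ • SK ddk b f x) := by
      have a := TT_comm_hasFDerivAt h2 hc b1 b2 b x
      rw [e1] at a
      exact a.unique ((SKdk_hasFDerivAt hf b0 hb x).const_smul (-b⁻¹))
    have e3 : TT b (fun y => tr (f'' y)) x = trL m (TT b f'' x) := by
      simp only [TT, ← trL_apply]
      rw [← ContinuousLinearMap.integral_comp_comm _ (TT_integrable hc b2 b x)]
      simp only [map_smul]
    rw [e3, e2, map_smul, map_smul, trL_apply]
    simp only [smul_eq_mul]
    field_simp
  have hcont : Continuous fun b => TT b f x := TTb_cont (h := fun _ => f) (hf.comp continuous_snd) (fun _ => b0) x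
  have hcont2 : Continuous fun b => TT b (fun y => tr (f'' y)) x :=
    TTb_cont (h := fun _ y => tr (f'' y)) (htr.comp continuous_snd) (fun _ => htb) x
  rw [intervalIntegral.integral_eq_sub_of_hasDeriv_right_of_le hB hcont.continuousOn
    (fun b hb => (hd b hb.1).hasDerivWithinAt) ((continuous_id.mul hcont2).intervalIntegrable _ _), TT_zero]

/-- a mild solution of the (clipped) problem on [0,T] -/
structure Sol (β T : ℝ) (A : (Spc m → St m) → Spc m → ℝ) (w : ℝ → Spc m → St m) : Prop where
  wc : Continuous (Function.uncurry w)
  per : ∀ t, Per (w t)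
  bd : ∃ M, ∀ t x, ‖w t x‖ ≤ M
  clamp : ∀ t, w t = w (ct T t)
  der : ∀ t x, HasFDerivAt (fun y => (w t y).1) (w t x).2 x
  re : ∀ s t, 0 ≤ s → s ≤ t → t ≤ T → ∀ x, (w t x).1 = TT (bb β (t - s)) (fun y => (w s y).1) x +
    UU β (fun b => A (w (t - β * b ^ 2 / 2))) (bb β (t - s)) x
  req : ∀ s t, 0 ≤ s → s ≤ t → t ≤ T → ∀ x, (w t x).2 = TT (bb β (t - s)) (fun y => (w s y).2) x +
    QQ β (fun b => A (w (t - β * b ^ 2 / 2))) (bb β (t - s)) x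

variable {A : (Spc m → St m) → Spc m → ℝ}
lemma TT_add_fun' {f g : Spc m → ℝ} (hf : Continuous f) (hg : Continuous g) {M M' : ℝ} (hM : ∀ x, |f x| ≤ M)
    (hM' : ∀ x, |g x| ≤ M') {f2 : Spc m → ℝ} (h : ∀ x, f2 x = f x + g x) (b : ℝ) (x : Spc m) :
    TT b f2 x = TT b f x + TT b g x := by
  rw [show f2 = fun x => f x + g x from funext h, TT_add_fun hf hg hM hM']

lemma sol_exists (hβ : 0 < β) (hA : Nice A) {T : ℝ} (hT : 0 ≤ T) {u0 : Spc m → ℝ} {q0 : Spc m → Spc m →L[ℝ] ℝ}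
    (hu0 : ∀ x, HasFDerivAt u0 (q0 x) x) (hq0 : Continuous q0) (pu0 : Per u0) (pq0 : Per q0) :
    ∃ w, Sol β T A w ∧ ∀ x, w 0 x = (u0 x, q0 x) := by
  have cu0 : Continuous u0 := continuous_iff_continuousAt.2 fun x => (hu0 x).continuousAt
  obtain ⟨w, wc, wp, wb, wcl, h⟩ := fixpt_exists hβ hA hT cu0 hq0 pu0 pq0
  obtain ⟨C, hC, hCb, hCl⟩ := hA.ex
  obtain ⟨M, hM⟩ := wb
  obtain ⟨Mu, hMu0, hMu⟩ := pu0.bounded cu0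
  obtain ⟨Mq, hMq0, hMq⟩ := pq0.bounded hq0
  have gc : Continuous (Function.uncurry fun s => A (w s)) := hA.cont w wc
  have gb : ∀ s x, |A (w s) x| ≤ C := fun s => hCb _
  have wc1 : ∀ s, Continuous (w s) := fun s => wc.comp (by fun_prop : Continuous fun x => (s, x))
  have der : ∀ t x, HasFDerivAt (fun y => (w t y).1) (w t x).2 x := by
    have : ∀ t, 0 ≤ t → t ≤ T → ∀ x, HasFDerivAt (fun y => (w t y).1) (w t x).2 x := fun t h0 h1 x => by
      have e : (fun y => (w t y).1) = fun y => TT (bb β t) u0 y + DU β (fun s => A (w s)) t y := by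
        funext y; rw [h t h0 h1 y]
      rw [e, h t h0 h1 x]
      exact (TT_comm_hasFDerivAt hu0 hq0 hMu hMq _ x).add
        (UU_hasFDerivAt (shift_cont gc t) (fun b => gb _) (bb_nonneg _) x)
    intro t x
    rw [wcl t]
    exact this _ (ct_nonneg _ _) (ct_le hT _) x
  have n1 : ∀ s x, |(w s x).1| ≤ M := fun s x => (norm_fst_le _).trans (hM s x)
  have n2 : ∀ s x, ‖(w s x).2‖ ≤ M := fun s x => (norm_snd_le _).trans (hM s x)
  have re : ∀ s t, 0 ≤ s → s ≤ t → t ≤ T → ∀ x, (w t x).1 = TT (bb β (t - s)) (fun y => (w s y).1) x +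
      UU β (fun b => A (w (t - β * b ^ 2 / 2))) (bb β (t - s)) x := by
    intro s t h0 hst hT' x
    rcases hst.eq_or_lt with rfl | hlt
    · rw [sub_self, bb_zero, TT_zero, UU]; simp
    · have hDb : ∀ y, |DU β (fun s => A (w s)) s y| ≤ _ := fun y => UU_bound hβ.le (fun b => gb _) (bb_nonneg s) y
      have hDc : Continuous (DU β (fun s => A (w s)) s) :=
        (DU_cont gc gb).comp (by fun_prop : Continuous fun x => (s, x))
      have hTc : Continuous (TT (bb β s) u0) :=
        TT_cont (X := Spc m) (f := fun _ => u0) (cu0.comp continuous_snd) (fun _ => hMu) continuous_const continuous_id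
      rw [TT_add_fun' hTc hDc (fun y => TT_bound hMu _ y) hDb (fun y => by rw [h s h0 (hst.trans hT')]),
        TT_UU hβ gc gb h0 hlt, h t (h0.trans hst) hT']
      have : TT (bb β (t - s)) (TT (bb β s) u0) x = TT (bb β t) u0 x := by
        rcases h0.eq_or_lt with rfl | hs
        · rw [bb_zero, TT_zero, sub_zero]
        · refine TT_TT cu0 hMu (bb_pos hβ hs) (bb_pos hβ (hs.trans hlt)) ?_ x
          rw [bb_sq hβ (h0.trans hst), bb_sq hβ h0, bb_sq hβ (by linarith)]; ring
      rw [this]; ring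
  refine ⟨w, ⟨wc, wp, ⟨M, hM⟩, wcl, der, re, fun s t h0 hst hT' x => ?_⟩, fun x => ?_⟩
  · have a := (TT_comm_hasFDerivAt (der s) ((wc1 s).snd) (n1 s) (n2 s) (bb β (t - s)) x).add
      (UU_hasFDerivAt (β := β) (shift_cont (β := β) gc t) (fun b => gb _) (bb_nonneg (β := β) (t - s)) x)
    have e : (fun y => (w t y).1) = TT (bb β (t - s)) (fun y => (w s y).1) +
      UU β (fun b => A (w (t - β * b ^ 2 / 2))) (bb β (t - s)) := funext fun y => re s t h0 hst hT' y
    rw [← e] at a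
    exact (der t x).unique a
  · rw [h 0 le_rfl hT x, bb_zero, TT_zero, TT_zero, DU, DQ, UU, QQ, bb_zero]; simp
end reg

section reg2
variable {m : ℕ} {β T : ℝ} {A : (Spc m → St m) → Spc m → ℝ} {w : ℝ → Spc m → St m}

lemma Sol.c (h : Sol β T A w) (s : ℝ) : Continuous (w s) := h.wc.comp (by fun_prop : Continuous fun x => (s, x))

lemma lip_of_bd {F : Type*} [NormedAddCommGroup F] [NormedSpace ℝ F] {f : Spc m → F} {f' : Spc m → Spc m →L[ℝ] F}
    (h : ∀ x, HasFDerivAt f (f' x) x) {M : ℝ} (hM : ∀ x, ‖f' x‖ ≤ M) (x y : Spc m) : ‖f x - f y‖ ≤ M * ‖x - y‖ :=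
  Convex.norm_image_sub_le_of_norm_hasFDerivWithin_le (s := univ)
    (fun x _ => (h x).hasFDerivWithinAt) (fun x _ => hM x) convex_univ trivial trivial

lemma bb_rpow (hβ : 0 < β) {t : ℝ} (ht : 0 ≤ t) (k : ℝ) : bb β t ^ k = (2 / β) ^ (k / 2) * t ^ (k / 2) := by
  rw [bb, Real.sqrt_eq_rpow, ← Real.rpow_mul (by positivity), ← Real.mul_rpow (by positivity) ht]
  congr 1 <;> ring

lemma Sol.holder (hβ : 0 < β) (hA : Nice A) (h : Sol β T A w) {a : ℝ} (ha : 0 < a) :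
    ∃ H, 0 ≤ H ∧ (∀ t, a ≤ t → t ≤ T → ∀ x y, ‖w t x - w t y‖ ≤ H * ‖x - y‖ ^ (3/4 : ℝ)) ∧
      ∀ s t, a ≤ s → s ≤ t → t ≤ T → ∀ x, ‖w t x - w s x‖ ≤ H * (t - s) ^ (3/8 : ℝ) := by
  obtain ⟨C, hC, hCb, hCl⟩ := hA.ex
  obtain ⟨M, hM⟩ := h.bd
  have hM0 : 0 ≤ M := (norm_nonneg _).trans (hM 0 0)
  have gc : Continuous (Function.uncurry fun s => A (w s)) := hA.cont w h.wc
  have gb : ∀ s x, |A (w s) x| ≤ C := fun s => hCb _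
  have k1 : ∀ s x, |(w s x).1| ≤ M := fun s x => (norm_fst_le _).trans (hM s x)
  have k2 : ∀ s x, ‖(w s x).2‖ ≤ M := fun s x => (norm_snd_le _).trans (hM s x)
  have hn1 := n1_nonneg (m := m)
  have hn2 := n2_nonneg (m := m)
  have hmo := mom_nonneg (m := m) (3/4)
  set BT := bb β T
  have hBT : 0 ≤ BT := bb_nonneg T
  have hba : 0 < bb β a := bb_pos hβ ha
  set N := 2 * n1 m + n2 m
  have hN : 0 ≤ N := by positivity
  set H1 := 2 * M + ((bb β a)⁻¹ * (M * N * (bb β a) ^ (-(3/4 : ℝ))) + β * (C * N) * (BT ^ (1 - (3/4 : ℝ)) / (1 - (3/4:ℝ))))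
  have h34 : (0:ℝ) < 1 - 3/4 := by norm_num
  have hH1 : 0 ≤ H1 := by positivity
  have X : ∀ t, a ≤ t → t ≤ T → ∀ x y, ‖w t x - w t y‖ ≤ H1 * ‖x - y‖ ^ (3/4 : ℝ) := by
    intro t hat htT x y
    have hbt : bb β a ≤ bb β t := bb_mono hβ hat
    have hbt0 : 0 < bb β t := hba.trans_le hbt
    have f1 : ‖(w t x - w t y).1‖ ≤ 2 * M * ‖x - y‖ ^ (3/4 : ℝ) := by
      refine interp (by norm_num) (by norm_num) (norm_nonneg _) (by positivity) ?_ ?_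
      · refine (norm_sub_le _ _).trans ?_
        have := k1 t x; have := k1 t y
        simp only [Real.norm_eq_abs]; linarith
      · refine (lip_of_bd (h.der t) (k2 t) x y).trans ?_
        gcongr; linarith
    have f2 : ‖(w t x - w t y).2‖ ≤ ((bb β a)⁻¹ * (M * N * (bb β a) ^ (-(3/4 : ℝ))) + β * (C * N) * (BT ^ (1 - (3/4 : ℝ)) / (1 - (3/4:ℝ)))) * ‖x - y‖ ^ (3/4 : ℝ) := by
      have e : ∀ x, (w t x).2 = -(bb β t)⁻¹ • SK dk (bb β t) (fun y => (w 0 y).1) x + QQ β (fun b => A (w (t - β * b ^ 2 / 2))) (bb β t) x := fun x => by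
        have := h.req 0 t le_rfl (ha.le.trans hat) htT x
        rw [sub_zero] at this
        rw [this]
        congr 1
        exact (TT_comm_hasFDerivAt (h.der 0) (h.c 0).snd (k1 0) (k2 0) _ x).unique
          (TT_hasFDerivAt (h.c 0).fst (k1 0) hbt0 x)
      have q1 := SKdk_holder (h.c 0).fst (k1 0) hbt0 (κ := 3/4) (by norm_num) (by norm_num) x y
      have q2 := QQ_holder hβ.le (shift_cont (β := β) gc t) (fun b => gb _) hbt0.le (κ := 3/4) (by norm_num) (by norm_num) x y
      show ‖(w t x).2 - (w t y).2‖ ≤ _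
      rw [e, e, add_sub_add_comm, ← smul_sub, add_mul]
      refine (norm_add_le _ _).trans (add_le_add ?_ (q2.trans ?_))
      · rw [norm_smul, norm_neg, Real.norm_of_nonneg (by positivity), mul_assoc]
        refine mul_le_mul (by gcongr) (q1.trans ?_) (norm_nonneg _) (by positivity)
        rw [mul_assoc (M * N)]
        gcongr ?_ * (?_ * ?_)
        exact Real.rpow_le_rpow_of_nonpos hba hbt (by norm_num)
      · have hbT : bb β t ≤ BT := bb_mono hβ htT
        gcongr
    refine max_le (f1.trans ?_) (f2.trans ?_)
    · gcongr; simp only [H1, le_add_iff_nonneg_right]; positivity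
    · gcongr; simp only [H1, le_add_iff_nonneg_left]; positivity
  set H2 := (H1 * mom m (3/4) + (β * BT * C * BT ^ (1/4:ℝ) + β * (C * n1 m) * BT ^ (1/4:ℝ))) * (2 / β) ^ (3/8:ℝ)
  have hH2 : 0 ≤ H2 := by positivity
  refine ⟨H1 + H2, by positivity, fun t h1 h2 x y => (X t h1 h2 x y).trans (by gcongr; linarith),
    fun s t h1 h2 h3 x => ?_⟩
  have hb0 := bb_nonneg (β := β) (t - s)
  have hbT : bb β (t - s) ≤ BT := bb_mono hβ (by linarith)
  have hX := X s h1 (h2.trans h3)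
  have hb1 : bb β (t - s) ≤ BT ^ (1/4:ℝ) * bb β (t - s) ^ (3/4:ℝ) := by
    calc bb β (t - s) = bb β (t - s) ^ (1/4:ℝ) * bb β (t - s) ^ (3/4:ℝ) := by
          rw [← Real.rpow_add_of_nonneg hb0 (by norm_num) (by norm_num)]; norm_num
      _ ≤ _ := by gcongr
  have t1 : ‖TT (bb β (t - s)) (fun y => (w s y).1) x - (w s x).1‖ ≤ 0 + H1 * bb β (t - s) ^ (3/4:ℝ) * mom m (3/4) :=
    TT_sub_le (h.c s).fst (k1 s) (by norm_num) hb0 x fun y => by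
      rw [zero_add]; exact (norm_fst_le (w s y - w s x)).trans (hX y x)
  have t2 : ‖TT (bb β (t - s)) (fun y => (w s y).2) x - (w s x).2‖ ≤ 0 + H1 * bb β (t - s) ^ (3/4:ℝ) * mom m (3/4) :=
    TT_sub_le (h.c s).snd (k2 s) (by norm_num) hb0 x fun y => by
      rw [zero_add]; exact (norm_snd_le (w s y - w s x)).trans (hX y x)
  have v1 := UU_bound hβ.le (fun b => gb (t - β * b ^ 2 / 2)) hb0 x
  have v2 := QQ_bound hβ.le (fun b => gb (t - β * b ^ 2 / 2)) hb0 x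
  have v1' : |UU β (fun b => A (w (t - β * b ^ 2 / 2))) (bb β (t - s)) x| ≤ β * BT * C * BT ^ (1/4:ℝ) * bb β (t - s) ^ (3/4:ℝ) := by
    refine v1.trans ?_
    rw [mul_assoc _ (BT ^ (1/4:ℝ))]
    gcongr
  have v2' : ‖QQ β (fun b => A (w (t - β * b ^ 2 / 2))) (bb β (t - s)) x‖ ≤ β * (C * n1 m) * BT ^ (1/4:ℝ) * bb β (t - s) ^ (3/4:ℝ) := by
    refine v2.trans ?_
    rw [mul_assoc _ (BT ^ (1/4:ℝ))]
    gcongr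
  have e := bb_rpow hβ (sub_nonneg.2 h2) (3/4)
  rw [show (3/4 / 2 : ℝ) = 3/8 by norm_num] at e
  have fin : (H1 * mom m (3/4) + (β * BT * C * BT ^ (1/4:ℝ) + β * (C * n1 m) * BT ^ (1/4:ℝ))) * bb β (t - s) ^ (3/4:ℝ) ≤ (H1 + H2) * (t - s) ^ (3/8:ℝ) := by
    rw [e, ← mul_assoc]
    have : 0 ≤ (t - s) ^ (3/8:ℝ) := Real.rpow_nonneg (sub_nonneg.2 h2) _
    gcongr
    simp only [H2, le_add_iff_nonneg_left]; exact hH1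
  have P1 : 0 ≤ β * BT * C * BT ^ (1/4:ℝ) * bb β (t - s) ^ (3/4:ℝ) := by positivity
  have P2 : 0 ≤ β * (C * n1 m) * BT ^ (1/4:ℝ) * bb β (t - s) ^ (3/4:ℝ) := by positivity
  refine le_trans (max_le ?_ ?_) fin
  · show ‖(w t x).1 - (w s x).1‖ ≤ _
    rw [h.re s t (ha.le.trans h1) h2 h3 x, add_sub_right_comm]
    refine (norm_add_le _ _).trans ?_
    rw [Real.norm_eq_abs (UU _ _ _ _)]
    linarith
  · show ‖(w t x).2 - (w s x).2‖ ≤ _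
    rw [h.req s t (ha.le.trans h1) h2 h3 x, add_sub_right_comm]
    refine (norm_add_le _ _).trans ?_
    linarith
end reg2

section reg3
variable {m : ℕ} {β T : ℝ} {A : (Spc m → St m) → Spc m → ℝ} {w : ℝ → Spc m → St m}

lemma interp2 {a C D E : ℝ} (hC : 0 ≤ C) (hD : 0 ≤ D) (hE : 0 ≤ E) (h1 : a ≤ C * D) (h2 : a ≤ C * E) :
    a ≤ C * D ^ (2/3:ℝ) * E ^ (1/3:ℝ) := by
  rcases le_or_gt a 0 with ha | ha
  · exact ha.trans (by positivity)
  calc a = a ^ (2/3:ℝ) * a ^ (1/3:ℝ) := by rw [← Real.rpow_add ha]; norm_num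
    _ ≤ (C * D) ^ (2/3:ℝ) * (C * E) ^ (1/3:ℝ) := by gcongr
    _ = C ^ (2/3:ℝ) * C ^ (1/3:ℝ) * D ^ (2/3:ℝ) * E ^ (1/3:ℝ) := by
        rw [Real.mul_rpow hC hD, Real.mul_rpow hC hE]; ring
    _ = _ := by
        rw [← Real.rpow_add_of_nonneg hC (by norm_num) (by norm_num)]; norm_num

lemma restart_D2 (hβ : 0 ≤ β) {h : ℝ → Spc m → ℝ} {M Mf : ℝ} {f : Spc m → ℝ} (hf : Continuous f) (hMf : ∀ x, |f x| ≤ Mf)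
    (hc : Continuous (Function.uncurry h)) (hM : ∀ b x, |h b x| ≤ M)
    (hu : UniformContinuous (h 0)) {B κ H : ℝ} (hB : 0 < B) (hκ : 0 < κ) (hH0 : 0 ≤ H)
    (ht : ∀ b x, 0 ≤ b → b ≤ B → |h b x - h 0 x| ≤ H * b ^ κ)
    (hy : ∀ b, 0 ≤ b → b ≤ B → ∀ (x1 : ℝ) y y', |h b (x1, y) - h b (x1, y')| ≤ H * ‖y - y'‖ ^ κ) :
    ∃ A : Spc m → Spc m →L[ℝ] Spc m →L[ℝ] ℝ, Continuous A ∧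
      (∀ x, HasFDerivAt (fun x => -B⁻¹ • SK dk B f x + QQ β h B x) (A x) x) ∧
      ∀ x, ‖A x‖ ≤ B⁻¹ * (B⁻¹ * (Mf * n2 m)) + (β * c2 m κ * H * B ^ κ + β * (2 * M)) := by
  obtain ⟨A, h1, h2, h3⟩ := D2 hβ hc hM hu hB hκ hH0 ht hy
  refine ⟨fun x => -B⁻¹ • (-B⁻¹ • SK ddk B f x) + A x, ?_, fun x => ?_, fun x => ?_⟩
  · exact (((SKx_cont RD_ddk hf hMf B).const_smul (-B⁻¹)).const_smul (-B⁻¹)).add h1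
  · exact ((SKdk_hasFDerivAt hf hMf hB x).const_smul (-B⁻¹)).add (h2 x)
  · refine (norm_add_le _ _).trans (add_le_add ?_ (h3 x))
    rw [norm_smul, norm_smul, norm_neg, Real.norm_of_nonneg (by positivity)]
    gcongr
    exact SK_bound RD_ddk hMf B x

def dd (w : ℝ → Spc m → St m) (t : ℝ) (x : Spc m) : Spc m →L[ℝ] Spc m →L[ℝ] ℝ := fderiv ℝ (fun y => (w t y).2) x
def PP (β : ℝ) (A : (Spc m → St m) → Spc m → ℝ) (w : ℝ → Spc m → St m) (t : ℝ) (x : Spc m) : ℝ :=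
  β⁻¹ * tr (dd w t x) + A (w t) x

lemma Sol.reg1 (hβ : 0 < β) (hA : Nice A) (hY : YH A) (h : Sol β T A w) {a : ℝ} (ha : 0 < a) (hT : 2 * a ≤ T) :
    ∃ K, 0 ≤ K ∧ (∀ t, 2 * a ≤ t → t ≤ T → Continuous (dd w t) ∧ ∀ x,
        HasFDerivAt (fun y => (w t y).2) (dd w t x) x ∧ ‖dd w t x‖ ≤ K) ∧
      (∀ s t, 2 * a ≤ s → s ≤ t → t ≤ T → ∀ x, ‖dd w t x - dd w s x‖ ≤ K * (t - s) ^ (1/4:ℝ) ∧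
        ‖w t x - w s x‖ ≤ K * (t - s) ^ (1/4:ℝ) ∧ |A (w t) x - A (w s) x| ≤ K * (t - s) ^ (1/4:ℝ)) := by
  obtain ⟨C, hC, hCb, hCl⟩ := hA.ex
  obtain ⟨CY, hCY, hY⟩ := hY
  obtain ⟨M, hM⟩ := h.bd
  have hM0 : 0 ≤ M := (norm_nonneg _).trans (hM 0 0)
  obtain ⟨H, hH, hx, htm⟩ := h.holder hβ hA ha
  have k1 : ∀ s x, |(w s x).1| ≤ M := fun s x => (norm_fst_le _).trans (hM s x)
  have k2 : ∀ s x, ‖(w s x).2‖ ≤ M := fun s x => (norm_snd_le _).trans (hM s x)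
  have hn2 := n2_nonneg (m := m)
  have gc : Continuous (Function.uncurry fun s => A (w s)) := hA.cont w h.wc
  set B := bb β a
  have hB : 0 < B := bb_pos hβ ha
  set cta : ℝ → ℝ := fun s => max a (min s T)
  have cta0 : ∀ s, a ≤ cta s := fun s => le_max_left _ _
  have ctaT : ∀ s, cta s ≤ T := fun s => max_le (by linarith) (min_le_right _ _)
  have ctae : ∀ s, a ≤ s → s ≤ T → cta s = s := fun s h1 h2 => by simp only [cta]; rw [min_eq_left h2, max_eq_right h1]
  have ctal : ∀ s s', |cta s - cta s'| ≤ |s - s'| := fun s s' =>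
    (abs_max_sub_max_le_max _ _ _ _).trans (max_le (by simp) ((abs_min_sub_min_le_max _ _ _ _).trans (max_le le_rfl (by simp))))
  set g : ℝ → Spc m → ℝ := fun s => A (w (cta s))
  have gcc : Continuous (Function.uncurry g) := gc.comp (by fun_prop : Continuous fun q : ℝ × Spc m => (cta q.1, q.2))
  have gper : ∀ s, Per (g s) := fun s => hA.per _ (h.per _)
  set G := C * H + CY * (1 + H)
  have hG : 0 ≤ G := by positivity
  have A1 : ∀ s t x, a ≤ s → s ≤ t → t ≤ T → |A (w t) x - A (w s) x| ≤ G * (t - s) ^ (3/8:ℝ) := fun s t x h1 h2 h3 => by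
    refine (hCl _ _ _ (h.c _) (h.c _) (htm s t h1 h2 h3) x).trans ?_
    have : 0 ≤ (t - s) ^ (3/8:ℝ) := Real.rpow_nonneg (by linarith) _
    rw [← mul_assoc]; gcongr; simp only [G, le_add_iff_nonneg_right]; positivity
  have g1' : ∀ s t x, s ≤ t → |g t x - g s x| ≤ G * |t - s| ^ (3/8:ℝ) := fun s t x hst => by
    have hm : cta s ≤ cta t := max_le_max le_rfl (min_le_min hst le_rfl)
    refine (A1 _ _ x (cta0 s) hm (ctaT t)).trans ?_
    have : 0 ≤ cta t - cta s := by linarith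
    gcongr
    exact (le_abs_self _).trans (ctal _ _)
  have g1 : ∀ s t x, |g t x - g s x| ≤ G * |t - s| ^ (3/8:ℝ) := fun s t x => by
    rcases le_total s t with hst | hst
    · exact g1' s t x hst
    · rw [abs_sub_comm, abs_sub_comm t s]; exact g1' t s x hst
  have g2 : ∀ s x1 y y', |g s (x1, y) - g s (x1, y')| ≤ G * ‖y - y'‖ ^ (3/4:ℝ) := fun s x1 y y' => by
    refine (hY (w (cta s)) H (3/4) hH (by norm_num) (by norm_num) (hx _ (cta0 s) (ctaT s)) x1 y y').trans ?_
    gcongr; simp only [G, le_add_iff_nonneg_left]; positivity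
  set e := (β / 2) ^ (3/8:ℝ)
  have he : 0 ≤ e := by positivity
  have hbe : ∀ b : ℝ, 0 ≤ b → |β * b ^ 2 / 2| ^ (3/8:ℝ) = e * b ^ (3/4:ℝ) := fun b hb => by
    rw [abs_of_nonneg (by positivity), show β * b ^ 2 / 2 = β / 2 * b ^ 2 by ring, Real.mul_rpow (by positivity) (by positivity),
      ← Real.rpow_natCast, ← Real.rpow_mul hb]; norm_num [e]
  set hh : ℝ → ℝ → Spc m → ℝ := fun t b => g (t - β * b ^ 2 / 2)
  have hhc : ∀ t, Continuous (Function.uncurry (hh t)) := fun t => shift_cont (β := β) gcc t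
  have hhb : ∀ t b x, |hh t b x| ≤ C := fun t b x => hCb _ _
  have hhu : ∀ t, UniformContinuous (hh t 0) := fun t => (gper _).unifCont (fam_cont (hhc t) 0)
  have hh1 : ∀ t b x, 0 ≤ b → |hh t b x - hh t 0 x| ≤ G * e * b ^ (3/4:ℝ) := fun t b x hb => by
    refine (g1 _ _ x).trans ?_
    rw [show t - β * b ^ 2 / 2 - (t - β * 0 ^ 2 / 2) = -(β * b ^ 2 / 2) by ring, abs_neg, hbe b hb, mul_assoc]
  have q_eq : ∀ t, 2 * a ≤ t → t ≤ T → (fun x => (w t x).2) = fun x => -B⁻¹ • SK dk B (fun y => (w (t - a) y).1) x + QQ β (hh t) B x := by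
    intro t h1 h2
    funext x
    have := h.req (t - a) t (by linarith) (by linarith) h2 x
    rw [show t - (t - a) = a by ring] at this
    rw [this]
    congr 1
    · exact (TT_comm_hasFDerivAt (h.der _) (h.c _).snd (k1 _) (k2 _) _ x).unique
          (TT_hasFDerivAt (h.c _).fst (k1 _) hB x)
    · refine intervalIntegral.integral_congr fun b hb => ?_
      rw [uIcc_of_le hB.le] at hb
      have := bb_time hβ ha.le hb.1 hb.2
      have : 0 ≤ β * b ^ 2 / 2 := by positivity
      simp only [hh, g]
      rw [ctae _ (by linarith) (by linarith)]
  have F1 : ∀ t, 2 * a ≤ t → t ≤ T → ∃ A' : Spc m → Spc m →L[ℝ] Spc m →L[ℝ] ℝ, Continuous A' ∧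
      (∀ x, HasFDerivAt (fun y => (w t y).2) (A' x) x) ∧ ∀ x, ‖A' x‖ ≤ B⁻¹ * (B⁻¹ * (M * n2 m)) + (β * c2 m (3/4) * (G * (e + 1)) * B ^ (3/4:ℝ) + β * (2 * C)) := by
    intro t h1 h2
    rw [q_eq t h1 h2]
    refine restart_D2 hβ.le (h.c (t - a)).fst (k1 _) (hhc t) (hhb t) (hhu t) hB (by norm_num) (by positivity)
      (fun b x hb _ => (hh1 t b x hb).trans ?_) (fun b hb _ x1 y y' => (g2 _ x1 y y').trans ?_)
    · gcongr; linarith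
    · gcongr; exact le_mul_of_one_le_right hG (by linarith)
  have F1' : ∀ t, 2 * a ≤ t → t ≤ T → Continuous (dd w t) ∧ (∀ x, HasFDerivAt (fun y => (w t y).2) (dd w t x) x) ∧
      ∀ x, ‖dd w t x‖ ≤ B⁻¹ * (B⁻¹ * (M * n2 m)) + (β * c2 m (3/4) * (G * (e + 1)) * B ^ (3/4:ℝ) + β * (2 * C)) := by
    intro t h1 h2
    obtain ⟨A', a1, a2, a3⟩ := F1 t h1 h2
    have : dd w t = A' := funext fun x => (a2 x).fderiv
    rw [this]; exact ⟨a1, a2, a3⟩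
  have F2 : ∀ s t, 2 * a ≤ s → s < t → t ≤ T → ∀ x, ‖dd w t x - dd w s x‖ ≤
      B⁻¹ * (B⁻¹ * (H * (t - s) ^ (3/8:ℝ) * n2 m)) + (β * c2 m (1/4) * (2 * G * (e + 1) * (t - s) ^ (1/4:ℝ)) * B ^ (1/4:ℝ) + β * (2 * (G * (t - s) ^ (3/8:ℝ)))) := by
    intro s t h1 h2 h3 x
    have hd : 0 < t - s := by linarith
    have hb1 : ∀ b x, |hh t b x - hh s b x| ≤ G * (t - s) ^ (3/8:ℝ) := fun b x => by
      refine (g1 _ _ x).trans ?_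
      rw [show t - β * b ^ 2 / 2 - (s - β * b ^ 2 / 2) = t - s by ring, abs_of_pos hd]
    have hD : 0 ≤ (t - s) ^ (3/8:ℝ) := by positivity
    have e1 : ((t - s) ^ (3/8:ℝ)) ^ (2/3:ℝ) = (t - s) ^ (1/4:ℝ) := by rw [← Real.rpow_mul hd.le]; norm_num
    have e2 : ∀ r : ℝ, 0 ≤ r → (r ^ (3/4:ℝ)) ^ (1/3:ℝ) = r ^ (1/4:ℝ) := fun r hr => by rw [← Real.rpow_mul hr]; norm_num
    obtain ⟨A', a1, a2, a3⟩ := restart_D2 (f := fun y => (w (t - a) y).1 - (w (s - a) y).1) (h := fun b x => hh t b x - hh s b x)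
      (Mf := H * (t - s) ^ (3/8:ℝ)) (M := G * (t - s) ^ (3/8:ℝ)) (κ := 1/4) (H := 2 * G * (e + 1) * (t - s) ^ (1/4:ℝ)) hβ.le
      ((h.c _).fst.sub (h.c _).fst) (fun x => by
        have := htm (s - a) (t - a) (by linarith) (by linarith) (by linarith) x
        rw [sub_sub_sub_cancel_right] at this
        exact (norm_fst_le (w (t - a) x - w (s - a) x)).trans this)
      ((hhc t).sub (hhc s)) hb1 ((hhu t).sub (hhu s)) hB (by norm_num) (by positivity)
      (fun b x hb _ => by
        rw [← e1, ← e2 b hb]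
        refine interp2 (by positivity) hD (by positivity) ?_ ?_
        · have := abs_sub (hh t b x - hh s b x) (hh t 0 x - hh s 0 x)
          have i1 := hb1 b x; have i2 := hb1 0 x
          have : G * (t - s) ^ (3/8:ℝ) ≤ G * (e + 1) * (t - s) ^ (3/8:ℝ) := by
            gcongr; exact le_mul_of_one_le_right hG (by linarith)
          linarith
        · have := abs_sub (hh t b x - hh t 0 x) (hh s b x - hh s 0 x)
          rw [show hh t b x - hh t 0 x - (hh s b x - hh s 0 x) = hh t b x - hh s b x - (hh t 0 x - hh s 0 x) by ring] at this
          have i1 := hh1 t b x hb; have i2 := hh1 s b x hb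
          have : G * e * b ^ (3/4:ℝ) ≤ G * (e + 1) * b ^ (3/4:ℝ) := by
            gcongr; linarith
          linarith)
      (fun b hb _ x1 y y' => by
        rw [← e1, ← e2 _ (norm_nonneg (y - y'))]
        refine interp2 (by positivity) hD (by positivity) ?_ ?_
        · have := abs_sub (hh t b (x1, y) - hh s b (x1, y)) (hh t b (x1, y') - hh s b (x1, y'))
          have i1 := hb1 b (x1, y); have i2 := hb1 b (x1, y')
          have : G * (t - s) ^ (3/8:ℝ) ≤ G * (e + 1) * (t - s) ^ (3/8:ℝ) := by
            gcongr; exact le_mul_of_one_le_right hG (by linarith)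
          linarith
        · have := abs_sub (hh t b (x1, y) - hh t b (x1, y')) (hh s b (x1, y) - hh s b (x1, y'))
          rw [show hh t b (x1, y) - hh t b (x1, y') - (hh s b (x1, y) - hh s b (x1, y')) = hh t b (x1, y) - hh s b (x1, y) - (hh t b (x1, y') - hh s b (x1, y')) by ring] at this
          have i1 := g2 (t - β * b ^ 2 / 2) x1 y y'; have i2 := g2 (s - β * b ^ 2 / 2) x1 y y'
          have : G * ‖y - y'‖ ^ (3/4:ℝ) ≤ G * (e + 1) * ‖y - y'‖ ^ (3/4:ℝ) := by
            gcongr; exact le_mul_of_one_le_right hG (by linarith)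
          simp only [hh] at *
          linarith)
    have hq : (fun x => -B⁻¹ • SK dk B (fun y => (w (t - a) y).1 - (w (s - a) y).1) x + QQ β (fun b x => hh t b x - hh s b x) B x)
        = fun x => (w t x).2 - (w s x).2 := by
      funext x
      rw [congrFun (q_eq t (by linarith) h3) x, congrFun (q_eq s h1 (by linarith)) x,
        ← QQ_sub (hhc t) (hhc s) (hhb t) (hhb s), SK_sub_fun RD_dk (h.c _).fst (h.c _).fst (k1 _) (k1 _), smul_sub]
      abel
    rw [hq] at a2
    rw [((F1' t (by linarith) h3).2.1 x).sub ((F1' s h1 (by linarith)).2.1 x) |>.unique (a2 x)]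
    exact a3 x
  have pw : ∀ r : ℝ, 0 ≤ r → r ≤ T → r ^ (3/8:ℝ) ≤ T ^ (1/8:ℝ) * r ^ (1/4:ℝ) := fun r h0 h1 => by
    calc r ^ (3/8:ℝ) = r ^ (1/8:ℝ) * r ^ (1/4:ℝ) := by
          rw [← Real.rpow_add_of_nonneg h0 (by norm_num) (by norm_num)]; norm_num
      _ ≤ _ := by gcongr
  have hT0 : 0 ≤ T := by linarith
  set T8 := T ^ (1/8:ℝ)
  have hT8 : 0 ≤ T8 := by positivity
  set K1 := B⁻¹ * (B⁻¹ * (M * n2 m)) + (β * c2 m (3/4) * (G * (e + 1)) * B ^ (3/4:ℝ) + β * (2 * C))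
  set K2 := B⁻¹ * (B⁻¹ * (H * T8 * n2 m)) + (β * c2 m (1/4) * (2 * G * (e + 1)) * B ^ (1/4:ℝ) + β * (2 * (G * T8)))
  have hK1 : 0 ≤ K1 := (norm_nonneg _).trans ((F1' T hT le_rfl).2.2 0)
  refine ⟨K1 + |K2| + H * T8 + G * T8, by positivity, fun t h1 h2 => ⟨(F1' t h1 h2).1, fun x => ⟨(F1' t h1 h2).2.1 x, ((F1' t h1 h2).2.2 x).trans ?_⟩⟩, ?_⟩
  · have : 0 ≤ |K2| + H * T8 + G * T8 := by positivity
    linarith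
  intro s t h1 h2 h3 x
  have hr : 0 ≤ (t - s) ^ (1/4:ℝ) := Real.rpow_nonneg (by linarith) _
  have hp := pw (t - s) (by linarith) (by linarith)
  have p1 : 0 ≤ H * T8 := by positivity
  have p2 : 0 ≤ G * T8 := by positivity
  refine ⟨?_, ?_, ?_⟩
  · rcases h2.eq_or_lt with rfl | h2
    · simp
    refine (F2 s t h1 h2 h3 x).trans ?_
    calc _ ≤ B⁻¹ * (B⁻¹ * (H * (T8 * (t - s) ^ (1/4:ℝ)) * n2 m)) + (β * c2 m (1/4) * (2 * G * (e + 1) * (t - s) ^ (1/4:ℝ)) * B ^ (1/4:ℝ) + β * (2 * (G * (T8 * (t - s) ^ (1/4:ℝ))))) := by gcongr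
      _ = K2 * (t - s) ^ (1/4:ℝ) := by simp only [K2]; ring
      _ ≤ _ := by gcongr; linarith [le_abs_self K2]
  · refine (htm s t (by linarith) h2 h3 x).trans ?_
    calc _ ≤ H * (T8 * (t - s) ^ (1/4:ℝ)) := by gcongr
      _ = H * T8 * (t - s) ^ (1/4:ℝ) := by ring
      _ ≤ _ := by gcongr; linarith [abs_nonneg K2]
  · refine (A1 s t x (by linarith) h2 h3).trans ?_
    calc _ ≤ G * (T8 * (t - s) ^ (1/4:ℝ)) := by gcongr
      _ = G * T8 * (t - s) ^ (1/4:ℝ) := by ring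
      _ ≤ _ := by gcongr; linarith [abs_nonneg K2]
end reg3

section reg4
variable {m : ℕ} {β T : ℝ} {A : (Spc m → St m) → Spc m → ℝ} {w : ℝ → Spc m → St m}

lemma tr_sub (P Q : Spc m →L[ℝ] Spc m →L[ℝ] ℝ) : tr (P - Q) = tr P - tr Q := by
  rw [← trL_apply, ← trL_apply, ← trL_apply, map_sub]

lemma UU_const_sub (hβ : 0 ≤ β) {f : Spc m → ℝ} (hf : Continuous f) {M : ℝ} (hM : ∀ x, |f x| ≤ M) {B ε : ℝ} (hB : 0 ≤ B) (x : Spc m)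
    (h : ∀ b, 0 ≤ b → b ≤ B → |TT b f x - f x| ≤ ε) :
    |UU β (fun _ => f) B x - β * B ^ 2 / 2 * f x| ≤ β * B ^ 2 / 2 * ε := by
  have e : ∀ c : ℝ, ∫ b in (0:ℝ)..B, (β * b) * c = β * B ^ 2 / 2 * c := fun c => by
    rw [intervalIntegral.integral_mul_const, intervalIntegral.integral_const_mul, integral_id]; ring
  have hc : Continuous fun b => TT b f x := TTb_cont (h := fun _ => f) (by fun_prop) (fun _ => hM) x
  rw [← e, ← e ε, UU, ← intervalIntegral.integral_sub (Continuous.intervalIntegrable (by fun_prop) _ _) (Continuous.intervalIntegrable (by fun_prop) _ _),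
    ← Real.norm_eq_abs]
  refine intervalIntegral.norm_integral_le_of_norm_le hB ?_ (Continuous.intervalIntegrable (by fun_prop) _ _)
  refine Eventually.of_forall fun b hb => ?_
  rw [← mul_sub, norm_mul, Real.norm_of_nonneg (mul_nonneg hβ hb.1.le)]
  exact mul_le_mul_of_nonneg_left (h b hb.1.le hb.2) (mul_nonneg hβ hb.1.le)

lemma Sol.reg2 (hβ : 0 < β) (hA : Nice A) (hY : YH A) (h : Sol β T A w) {a : ℝ} (ha : 0 < a) (hT : 2 * a ≤ T) :
    ∃ K, 0 ≤ K ∧ (∀ t, 2 * a ≤ t → t ≤ T → Continuous (dd w t) ∧ ∀ x,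
        HasFDerivAt (fun y => (w t y).2) (dd w t x) x ∧ ‖dd w t x‖ ≤ K) ∧
      (∀ s t, 2 * a ≤ s → s ≤ t → t ≤ T → ∀ x, ‖dd w t x - dd w s x‖ ≤ K * (t - s) ^ (1/4:ℝ) ∧
        ‖w t x - w s x‖ ≤ K * (t - s) ^ (1/4:ℝ) ∧ |PP β A w t x - PP β A w s x| ≤ K * (t - s) ^ (1/4:ℝ)) ∧
      (∀ s t, 2 * a ≤ s → s ≤ t → t ≤ T → ∀ x, ∀ r ∈ Icc s t, |(w t x).1 - (w s x).1 - (t - s) * PP β A w r x| ≤ K * (t - s) ^ (1/4:ℝ) * (t - s)) := by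
  obtain ⟨K, hK, r1, r2⟩ := h.reg1 hβ hA hY ha hT
  obtain ⟨C, hC, hCb, hCl⟩ := hA.ex
  obtain ⟨M, hM⟩ := h.bd
  have hM0 : 0 ≤ M := (norm_nonneg _).trans (hM 0 0)
  have k1 : ∀ s x, |(w s x).1| ≤ M := fun s x => (norm_fst_le _).trans (hM s x)
  have k2 : ∀ s x, ‖(w s x).2‖ ≤ M := fun s x => (norm_snd_le _).trans (hM s x)
  have gc : Continuous (Function.uncurry fun s => A (w s)) := hA.cont w h.wc
  set K2 := β⁻¹ * ((m + 1) * K) + K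
  have hKK : K ≤ K2 := by simp only [K2, le_add_iff_nonneg_left]; positivity
  have P1 : ∀ s t, 2 * a ≤ s → s ≤ t → t ≤ T → ∀ x, |PP β A w t x - PP β A w s x| ≤ K2 * (t - s) ^ (1/4:ℝ) := by
    intro s t h1 h2 h3 x
    obtain ⟨q1, q2, q3⟩ := r2 s t h1 h2 h3 x
    rw [PP, PP, add_sub_add_comm, ← mul_sub, ← tr_sub]
    refine (abs_add_le _ _).trans ?_
    rw [abs_mul, abs_of_pos (inv_pos.2 hβ)]
    calc _ ≤ β⁻¹ * ((m + 1) * (K * (t - s) ^ (1/4:ℝ))) + K * (t - s) ^ (1/4:ℝ) := by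
          gcongr; exact (tr_bound _).trans (by gcongr)
      _ = _ := by simp only [K2]; ring
  have dc : ∀ s, 2 * a ≤ s → s ≤ T → Continuous (PP β A w s) := fun s h1 h2 => by
    have : Continuous fun x => trL m (dd w s x) := (trL m).continuous.comp (r1 s h1 h2).1
    simp only [trL_apply] at this
    exact (continuous_const.mul this).add (hA.cont1 (h.c s))
  have db : ∀ s, 2 * a ≤ s → s ≤ T → ∀ x, |PP β A w s x| ≤ β⁻¹ * ((m + 1) * K) + C := fun s h1 h2 x => by
    refine (abs_add_le _ _).trans (add_le_add ?_ (hCb _ _))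
    rw [abs_mul, abs_of_pos (inv_pos.2 hβ)]
    gcongr; exact (tr_bound _).trans (by gcongr; exact ((r1 s h1 h2).2 x).2)
  have main : ∀ s t, 2 * a ≤ s → s ≤ t → t ≤ T → ∀ x ε, (∀ b, 0 ≤ b → b ≤ bb β (t - s) → |TT b (PP β A w s) x - PP β A w s x| ≤ ε) →
      |(w t x).1 - (w s x).1 - (t - s) * PP β A w s x| ≤ (t - s) * (ε + 2 * K * (t - s) ^ (1/4:ℝ)) := by
    intro s t h1 h2 h3 x ε hε
    have hsT : s ≤ T := h2.trans h3
    set B := bb β (t - s)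
    have hB : 0 ≤ B := bb_nonneg _
    have hBB : β * B ^ 2 / 2 = t - s := by rw [bb_sq hβ (by linarith)]; field_simp
    set hh : ℝ → Spc m → ℝ := fun b => A (w (max s (t - β * b ^ 2 / 2)))
    have hhc : Continuous (Function.uncurry hh) := gc.comp (by fun_prop : Continuous fun q : ℝ × Spc m => (max s (t - β * q.1 ^ 2 / 2), q.2))
    have e1 := h.re s t (by linarith) h2 h3 x
    have e2 : UU β (fun b => A (w (t - β * b ^ 2 / 2))) B x = UU β hh B x := by
      refine intervalIntegral.integral_congr fun b hb => ?_
      rw [uIcc_of_le hB] at hb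
      have := bb_time hβ (by linarith) hb.1 hb.2
      simp only [hh]
      rw [max_eq_right (by linarith)]
    have e3 := TT_ftc2 (h.der s) (fun x => ((r1 s h1 hsT).2 x).1) (r1 s h1 hsT).1 (M := M + K) (fun x => (k1 s x).trans (by linarith))
      (fun x => (k2 s x).trans (by linarith)) (fun x => ((r1 s h1 hsT).2 x).2.trans (by linarith)) hB x
    have ctr : Continuous fun x => trL m (dd w s x) := (trL m).continuous.comp (r1 s h1 hsT).1
    simp only [trL_apply] at ctr
    have btr : ∀ x, |tr (dd w s x)| ≤ (m + 1) * K := fun x => (tr_bound _).trans (by gcongr; exact ((r1 s h1 hsT).2 x).2)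
    have cA : Continuous (A (w s)) := hA.cont1 (h.c s)
    have e4 : (∫ b in (0:ℝ)..B, b * TT b (fun y => tr (dd w s y)) x) + UU β (fun _ => A (w s)) B x = UU β (fun _ => PP β A w s) B x := by
      have c1 : Continuous fun b => TT b (fun y => tr (dd w s y)) x := TTb_cont (h := fun _ y => tr (dd w s y)) (ctr.comp continuous_snd) (fun _ => btr) x
      have c2 : Continuous fun b => TT b (A (w s)) x := TTb_cont (h := fun _ => A (w s)) (by fun_prop) (fun _ => hCb _) x
      rw [UU, UU, ← intervalIntegral.integral_add (Continuous.intervalIntegrable (by fun_prop) _ _) (Continuous.intervalIntegrable (by fun_prop) _ _)]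
      congr 1; funext b
      rw [TT_add_fun' (f := fun y => β⁻¹ * tr (dd w s y)) (g := A (w s)) (f2 := PP β A w s) (M := β⁻¹ * ((m + 1) * K)) (M' := C) (continuous_const.mul ctr) cA
        (fun x => by rw [abs_mul, abs_of_pos (inv_pos.2 hβ)]; gcongr; exact btr x) (hCb _) (fun x => rfl), TT_const_mul]
      field_simp
    have e5 := UU_sub (β := β) hhc (by fun_prop : Continuous (Function.uncurry fun (_ : ℝ) => A (w s))) (fun b => hCb _) (fun _ => hCb _) B x
    have e6 := UU_const_sub hβ.le (dc s h1 hsT) (db s h1 hsT) hB x hε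
    have e7 : |UU β (fun b x => hh b x - A (w s) x) B x| ≤ (t - s) * (2 * K * (t - s) ^ (1/4:ℝ)) := by
      refine (UU_bound hβ.le (M := K * (t - s) ^ (1/4:ℝ)) (fun b x => ?_) hB x).trans (le_of_eq ?_)
      · refine (r2 s (max s (t - β * b ^ 2 / 2)) h1 (le_max_left _ _) (max_le hsT ?_) x).2.2.trans ?_
        · have : 0 ≤ β * b ^ 2 / 2 := by positivity
          linarith
        · have : 0 ≤ max s (t - β * b ^ 2 / 2) - s := by linarith [le_max_left s (t - β * b ^ 2 / 2)]
          gcongr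
          have : 0 ≤ β * b ^ 2 / 2 := by positivity
          exact max_le h2 (by linarith)
      · rw [← hBB]; ring
    rw [hBB] at e6
    rw [e1, e2]
    rw [show TT B (fun y => (w s y).1) x + UU β hh B x - (w s x).1 - (t - s) * PP β A w s x =
      (UU β (fun _ => PP β A w s) B x - (t - s) * PP β A w s x) + UU β (fun b x => hh b x - A (w s) x) B x by
        rw [← e4, ← e3, ← e5]; ring, mul_add]
    exact (abs_add_le _ _).trans (add_le_add e6 e7)
  have rd : ∀ s, 2 * a ≤ s → s < T → ∀ x, HasDerivWithinAt (fun t => (w t x).1) (PP β A w s x) (Ioi s) s := by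
    intro s h1 h2 x
    rw [hasDerivWithinAt_iff_isLittleO, Asymptotics.isLittleO_iff]
    intro c hc
    have c1 : Continuous fun b => TT b (PP β A w s) x := TTb_cont (h := fun _ => PP β A w s) (by have := dc s h1 h2.le; fun_prop) (fun _ => db s h1 h2.le) x
    have t1 : Tendsto (fun b => TT b (PP β A w s) x) (nhds 0) (nhds (PP β A w s x)) := by
      have := c1.tendsto 0; rwa [TT_zero] at this
    obtain ⟨δ, hδ, hd⟩ := Metric.tendsto_nhds_nhds.1 t1 (c/2) (by positivity)
    have c2 : Continuous fun t => bb β (t - s) := bb_cont.comp (by fun_prop)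
    have c3 : Continuous fun t : ℝ => 2 * K * |t - s| ^ (1/4:ℝ) := by
      refine continuous_const.mul (Continuous.rpow_const (by fun_prop) fun _ => Or.inr (by norm_num))
    have t2 : ∀ᶠ t in nhdsWithin s (Ioi s), bb β (t - s) < δ := by
      refine (c2.tendsto s).mono_left nhdsWithin_le_nhds |>.eventually_lt_const ?_
      simpa [bb_zero] using hδ
    have t3 : ∀ᶠ t in nhdsWithin s (Ioi s), 2 * K * |t - s| ^ (1/4:ℝ) < c / 2 := by
      refine (c3.tendsto s).mono_left nhdsWithin_le_nhds |>.eventually_lt_const ?_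
      simp; positivity
    filter_upwards [t2, t3, Ioo_mem_nhdsGT h2] with t i2 i3 i4
    have hts : 0 < t - s := by linarith [i4.1]
    have := main s t h1 i4.1.le i4.2.le x (c/2) fun b hb0 hb1 => by
      have := hd (x := b) (by rw [dist_zero_right, Real.norm_of_nonneg hb0]; linarith)
      exact this.le
    rw [smul_eq_mul, Real.norm_eq_abs, Real.norm_eq_abs, abs_of_pos hts]
    refine this.trans ?_
    rw [abs_of_pos hts] at i3
    rw [mul_comm c]; gcongr; linarith
  have Pc : ∀ x, ContinuousOn (fun t => PP β A w t x) (Icc (2 * a) T) := by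
    intro x s hs
    rw [ContinuousWithinAt, tendsto_iff_norm_sub_tendsto_zero]
    have c3 : Continuous fun t : ℝ => K2 * |t - s| ^ (1/4:ℝ) :=
      continuous_const.mul (Continuous.rpow_const (by fun_prop) fun _ => Or.inr (by norm_num))
    have c4 : Tendsto (fun t : ℝ => K2 * |t - s| ^ (1/4:ℝ)) (nhdsWithin s (Icc (2 * a) T)) (nhds 0) := by
      have := (c3.tendsto s).mono_left (nhdsWithin_le_nhds (s := Icc (2 * a) T)); simpa using this
    refine squeeze_zero' (Eventually.of_forall fun _ => norm_nonneg _) ?_ c4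
    filter_upwards [self_mem_nhdsWithin] with t ht
    rw [Real.norm_eq_abs]
    rcases le_total s t with hst | hst
    · rw [abs_of_nonneg (by linarith : 0 ≤ t - s)]; exact P1 s t hs.1 hst ht.2 x
    · rw [abs_sub_comm, abs_sub_comm t, abs_of_nonneg (by linarith : 0 ≤ s - t)]; exact P1 t s ht.1 hst hs.2 x
  refine ⟨K2, hK.trans hKK, fun t h1 h2 => ⟨(r1 t h1 h2).1, fun x => ⟨((r1 t h1 h2).2 x).1, ((r1 t h1 h2).2 x).2.trans hKK⟩⟩,
    fun s t h1 h2 h3 x => ?_, fun s t h1 h2 h3 x r hr => ?_⟩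
  · have hr : 0 ≤ (t - s) ^ (1/4:ℝ) := Real.rpow_nonneg (by linarith) _
    exact ⟨(r2 s t h1 h2 h3 x).1.trans (by gcongr), (r2 s t h1 h2 h3 x).2.1.trans (by gcongr), P1 s t h1 h2 h3 x⟩
  · have hK2 : 0 ≤ K2 := hK.trans hKK
    have sub : uIcc s t ⊆ Icc (2 * a) T := by rw [uIcc_of_le h2]; exact Icc_subset_Icc h1 h3
    have ii : IntervalIntegrable (fun t => PP β A w t x) volume s t := ((Pc x).mono sub).intervalIntegrable
    have I := intervalIntegral.integral_eq_sub_of_hasDeriv_right (f := fun t => (w t x).1) (f' := fun t => PP β A w t x) (a := s) (b := t)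
      (by have : Continuous fun t => w t x := h.wc.comp (by fun_prop : Continuous fun t => (t, x))
          exact this.fst.continuousOn)
      (fun y hy => by
        rw [min_eq_left h2, max_eq_right h2] at hy
        exact rd y (h1.trans hy.1.le) (hy.2.trans_le h3) x) ii
    have J : ∫ y in s..t, PP β A w r x = (t - s) * PP β A w r x := by simp
    rw [← I, ← J, ← intervalIntegral.integral_sub ii (by simp), ← Real.norm_eq_abs]
    have := intervalIntegral.norm_integral_le_of_norm_le_const (a := s) (b := t) (C := K2 * (t - s) ^ (1/4:ℝ)) (f := fun y => PP β A w y x - PP β A w r x) fun y hy => by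
      rw [uIoc_of_le h2] at hy
      rw [Real.norm_eq_abs]
      rcases le_total r y with hst | hst
      · refine (P1 r y (h1.trans hr.1) hst (hy.2.trans h3) x).trans ?_
        have : 0 ≤ y - r := by linarith
        gcongr
        · linarith [hr.1, hy.2]
        · linarith [hr.1, hy.2]
      · rw [abs_sub_comm]; refine (P1 y r (by linarith [hy.1]) hst (hr.2.trans h3) x).trans ?_
        have : 0 ≤ r - y := by linarith
        gcongr
        · linarith [hr.2, hy.1]
        · linarith [hr.2, hy.1]
    rwa [abs_of_nonneg (by linarith : 0 ≤ t - s)] at this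
end reg4

section alg
variable {m : ℕ} {V : Spc m → ℝ} {β : ℝ}

lemma pd_of {f : Spc m → ℝ} {L : Spc m →L[ℝ] ℝ} {x : Spc m} (h : HasFDerivAt f L x) (v : Spc m) : pd v f x = L v := by
  rw [pd, h.fderiv]

lemma Per.mul {f g : Spc m → ℝ} (hf : Per f) (hg : Per g) : Per fun x => f x * g x := fun k j x => by
  show f _ * g _ = _; rw [hf, hg]

lemma Per.of_der {F : Type*} [NormedAddCommGroup F] [NormedSpace ℝ F] {f : Spc m → F} {f' : Spc m → Spc m →L[ℝ] F}
    (h : ∀ x, HasFDerivAt f (f' x) x) (hp : Per f) : Per f' := by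
  have : f' = _root_.fderiv ℝ f := funext fun x => (h x).fderiv.symm
  rw [this]; exact hp.fderiv

lemma cont_of_der {F : Type*} [NormedAddCommGroup F] [NormedSpace ℝ F] {f : Spc m → F} {f' : Spc m → Spc m →L[ℝ] F}
    (h : ∀ x, HasFDerivAt f (f' x) x) : Continuous f := continuous_iff_continuousAt.2 fun x => (h x).continuousAt

lemma marg_der {f : Spc m → ℝ} {f' : Spc m → Spc m →L[ℝ] ℝ} (h : ∀ x, HasFDerivAt f (f' x) x) (hc : Continuous f')
    (hp : Per f) (s : ℝ) : HasDerivAt (fun s => ∫ y in cube1 m, f (s, y)) (∫ y in cube1 m, f' (s, y) (e1 m)) s := by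
  have cf : Continuous f := cont_of_der h
  obtain ⟨C, hC, hb⟩ := (Per.of_der h hp).bounded hc
  obtain ⟨C', hC', hb'⟩ := hp.bounded cf
  refine (hasDerivAt_integral_of_dominated_loc_of_deriv_le (bound := fun _ => C * ‖e1 m‖) (s := univ) (F' := fun s y => f' (s, y) (e1 m)) univ_mem
    (Eventually.of_forall fun s => (cf.comp (by fun_prop : Continuous fun y => (s, y))).aestronglyMeasurable)
    ?_ ?_ (Eventually.of_forall fun y t _ => ?_) (integrable_const _) (Eventually.of_forall fun y t _ => ?_)).2
  · exact (integrable_const C').mono' (cf.comp (by fun_prop : Continuous fun y => (s, y))).aestronglyMeasurable (Eventually.of_forall fun y => hb' _)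
  · exact ((hc.comp (by fun_prop : Continuous fun y => (s, y))).clm_apply continuous_const).aestronglyMeasurable
  · exact ((f' (t, y)).le_opNorm _).trans (by gcongr; exact hb _)
  · have h1 : HasDerivAt (fun t : ℝ => ((t, y) : Spc m)) (e1 m) t := (hasDerivAt_id t).prodMk (hasDerivAt_const t y)
    exact (h (t, y)).comp_hasDerivAt t h1

variable (hV : ContDiff ℝ 2 V) (hp : Per V)
include hV

lemma V_der (x : Spc m) : HasFDerivAt V (fderiv ℝ V x) x := (hV.differentiable (by norm_num) x).hasFDerivAt
lemma pdV_der (v x : Spc m) : HasFDerivAt (pd v V) (fderiv ℝ (pd v V) x) x :=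
  ((pdV_c1 hV v).differentiable (by norm_num) x).hasFDerivAt
lemma wt_der (x : Spc m) : HasFDerivAt (wt V β) ((-β * wt V β x) • fderiv ℝ V x) x := by
  have := ((V_der hV x).const_mul (-β)).exp
  refine this.congr_fderiv ?_
  rw [smul_smul, mul_comm]; rfl

include hp
lemma phi_der {f : Spc m → ℝ} {f' : Spc m → Spc m →L[ℝ] ℝ} (h : ∀ x, HasFDerivAt f (f' x) x) (hc : Continuous f')
    (pf : Per f) {s : ℝ} (hm : marg f s ≠ 0) :
    HasDerivAt (phiF V f) (((∫ y in cube1 m, (pd (e1 m) V (s, y) * f' (s, y) (e1 m) + f (s, y) * pd (e1 m) (pd (e1 m) V) (s, y))) -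
      phiF V f s * ∫ y in cube1 m, f' (s, y) (e1 m)) / marg f s) s := by
  have a := marg_der h hc pf s
  have cf : Continuous f := cont_of_der h
  have b := marg_der (f := fun x => pd (e1 m) V x * f x) (fun x => (pdV_der hV (e1 m) x).mul (h x)) (by
    have := pdV_cont hV (e1 m)
    have := (pdV_c1 hV (e1 m)).continuous_fderiv (by norm_num)
    fun_prop) ((hp.pd _).mul pf) s
  refine (b.div a hm).congr_deriv ?_
  have e : marg f s = ∫ y in cube1 m, f (s, y) := rfl
  rw [← e, phiF]
  simp only [ContinuousLinearMap.add_apply, ContinuousLinearMap.smul_apply, smul_eq_mul, ← pd.eq_def]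
  field_simp

lemma Fop_eq {f : Spc m → ℝ} {f' : Spc m → Spc m →L[ℝ] ℝ} (h : ∀ x, HasFDerivAt f (f' x) x) (hc : Continuous f')
    (pf : Per f) (x : Spc m) (hm : marg f x.1 ≠ 0) : Fop V f x = gradDot V f x + lap V x * f x -
      (phiF V f x.1 * f' x (e1 m) + f x * (((∫ y in cube1 m, (pd (e1 m) V (x.1, y) * f' (x.1, y) (e1 m) + f (x.1, y) * pd (e1 m) (pd (e1 m) V) (x.1, y))) -
      phiF V f x.1 * ∫ y in cube1 m, f' (x.1, y) (e1 m)) / marg f x.1)) := by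
  have a : HasFDerivAt (fun z : Spc m => phiF V f z.1) _ x :=
    (phi_der hV hp h hc pf hm).hasFDerivAt.comp x hasFDerivAt_fst
  have a2 : HasFDerivAt (fun z : Spc m => phiF V f z.1 * f z) _ x := a.mul (h x)
  rw [Fop, pd_of a2]
  simp [e1]

lemma alg {R κ : ℝ} {W : Spc m → St m} {Q : Spc m → Spc m →L[ℝ] Spc m →L[ℝ] ℝ} (hκ : 0 < κ) (hW : Per W) 
    (h1 : ∀ x, HasFDerivAt (fun y => (W y).1) (W x).2 x) (h2 : ∀ x, HasFDerivAt (fun y => (W y).2) (Q x) x)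
    (hR : ∀ x, ‖W x‖ ≤ R) (hm : ∀ s, κ ≤ marg (fun x => wt V β x * (W x).1) s) (x : Spc m) (hβ : β ≠ 0) :
    β⁻¹ * lap (fun x => wt V β x * (W x).1) x + Fop V (fun x => wt V β x * (W x).1) x = wt V β x * (β⁻¹ * tr (Q x) + GG V β R κ W x) := by
  have cu : Continuous fun y => (W y).1 := cont_of_der h1
  have cq : Continuous fun y => (W y).2 := cont_of_der h2
  have d1 : ∀ x, HasFDerivAt (fun x => wt V β x * (W x).1) (wt V β x • (W x).2 + (W x).1 • ((-β * wt V β x) • fderiv ℝ V x)) x :=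
    fun x => (wt_der hV x).mul (h1 x)
  have cw := wt_cont (β := β) hV
  have cdV : Continuous (fderiv ℝ V) := hV.continuous_fderiv (by norm_num)
  have d1c : Continuous fun x => wt V β x • (W x).2 + (W x).1 • ((-β * wt V β x) • fderiv ℝ V x) := by fun_prop
  have pu : Per fun y => (W y).1 := hW.comp Prod.fst
  have pw := wt_per (β := β) hp
  have e1' : ∀ v, pd v (fun x => wt V β x * (W x).1) = fun x => wt V β x * ((W x).2 v - β * (pd v V x * (W x).1)) := fun v => by
    funext x
    rw [pd_of (d1 x)]
    simp only [ContinuousLinearMap.add_apply, ContinuousLinearMap.smul_apply, smul_eq_mul, ← pd.eq_def]; ring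
  have e2' : ∀ v x, pd v (pd v (fun x => wt V β x * (W x).1)) x = wt V β x * (Q x v v - 2 * β * pd v V x * (W x).2 v + (β ^ 2 * pd v V x ^ 2 - β * pd v (pd v V) x) * (W x).1) := fun v x => by
    rw [e1' v]
    have hq : HasFDerivAt (fun x => (W x).2 v) _ x := (h2 x).clm_apply (hasFDerivAt_const v x)
    have h3 := ((((pdV_der hV v x).mul (h1 x)).const_mul β))
    have h4 : HasFDerivAt (fun x => wt V β x * ((W x).2 v - β * (pd v V x * (W x).1))) _ x := (wt_der hV x).mul (hq.sub h3)
    rw [pd_of h4]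
    simp only [ContinuousLinearMap.add_apply, ContinuousLinearMap.sub_apply, ContinuousLinearMap.smul_apply, smul_eq_mul, ← pd.eq_def,
      ContinuousLinearMap.comp_zero, ContinuousLinearMap.flip_apply, zero_add, ContinuousLinearMap.zero_apply]
    ring
  have k1 : ∀ x, cl R (uL (W x)) = (W x).1 := fun x => cl_eq ((norm_fst_le (W x)).trans (hR x))
  have k2 : ∀ v, ‖v‖ ≤ 1 → ∀ x, cl R (qL v (W x)) = (W x).2 v := fun v hv x => cl_eq (by
    have := ((W x).2.le_opNorm v).trans (mul_le_of_le_one_right (norm_nonneg _) hv)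
    exact this.trans ((norm_snd_le (W x)).trans (hR x)))
  have ne : ‖e1 m‖ ≤ 1 := by simp [e1, Prod.norm_def]
  have nC : ∀ i, ‖eC m i‖ ≤ 1 := fun i => by
    simp only [eC, Prod.norm_def, norm_zero]
    exact max_le zero_le_one (by rw [Pi.norm_single]; simp)
  have m0 := hm x.1
  have i1 : fR V β R W x = marg (fun x => wt V β x * (W x).1) x.1 := by simp only [fR, marg, k1]
  have i2 : fP V β R κ W x = phiF V (fun x => wt V β x * (W x).1) x.1 := by
    rw [fP, phiF, i1, max_eq_right m0, div_eq_mul_inv]; simp only [fN, k1, mul_assoc]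
  have i3 : fP1 V β R κ W x = ((∫ y in cube1 m, (pd (e1 m) V (x.1, y) * (wt V β (x.1, y) • (W (x.1, y)).2 + (W (x.1, y)).1 • ((-β * wt V β (x.1, y)) • fderiv ℝ V (x.1, y))) (e1 m) + (wt V β (x.1, y) * (W (x.1, y)).1) * pd (e1 m) (pd (e1 m) V) (x.1, y))) -
      phiF V (fun x => wt V β x * (W x).1) x.1 * ∫ y in cube1 m, (wt V β (x.1, y) • (W (x.1, y)).2 + (W (x.1, y)).1 • ((-β * wt V β (x.1, y)) • fderiv ℝ V (x.1, y))) (e1 m)) / marg (fun x => wt V β x * (W x).1) x.1 := by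
    rw [fP1, i2, i1, max_eq_right m0, div_eq_mul_inv]
    simp only [fN1, fR1, k1, k2 _ ne, ContinuousLinearMap.add_apply, ContinuousLinearMap.smul_apply, smul_eq_mul, ← pd.eq_def]
    congr 3
    · congr 1; funext y; ring
    · congr 1; funext y; ring
  rw [Fop_eq hV hp d1 d1c (pw.mul pu) x (by linarith), ← i3, ← i2, GG]
  simp only [lap, gradDot, e2']
  simp only [e1', k1, k2 _ ne, k2 _ (nC _), tr, ContinuousLinearMap.add_apply, ContinuousLinearMap.smul_apply, smul_eq_mul, ← pd.eq_def]
  have S : ∀ (a b c d g : Fin m → ℝ), β⁻¹ * ∑ i, wt V β x * (a i - 2 * β * b i * c i + (β ^ 2 * b i ^ 2 - β * d i) * (W x).1)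
      = wt V β x * (β⁻¹ * ∑ i, a i) - wt V β x * (2 * ∑ i, b i * c i) + wt V β x * (W x).1 * (β * ∑ i, b i ^ 2 - ∑ i, d i) := fun a b c d g => by
    simp only [Finset.mul_sum, ← Finset.sum_sub_distrib, ← Finset.sum_add_distrib]
    refine Finset.sum_congr rfl fun i _ => ?_
    field_simp
  have S2 : ∑ i, pd (eC m i) V x * (wt V β x * ((W x).2 (eC m i) - β * (pd (eC m i) V x * (W x).1))) =
      wt V β x * (∑ i, pd (eC m i) V x * (W x).2 (eC m i)) - wt V β x * (W x).1 * (β * ∑ i, pd (eC m i) V x ^ 2) := by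
    simp only [Finset.mul_sum, ← Finset.sum_sub_distrib]
    refine Finset.sum_congr rfl fun i _ => ?_
    ring
  rw [mul_add, S _ _ _ _ (fun _ => 0), S2]
  field_simp
  ring
end alg

section lp
variable {m : ℕ} {V : Spc m → ℝ} {β σ p : ℝ}

def CC (f : Spc m → ℝ) (ε : ℝ) : Prop := ∃ (q : Spc m → Spc m →L[ℝ] ℝ) (Q : Spc m → Spc m →L[ℝ] Spc m →L[ℝ] ℝ),
  (∀ x, HasFDerivAt f (q x) x) ∧ (∀ x, HasFDerivAt q (Q x) x) ∧ ∀ x, |f x| ≤ ε ∧ ‖q x‖ ≤ ε ∧ ‖Q x‖ ≤ ε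

lemma wmul (hV : ContDiff ℝ 2 V) (hp : Per V) (β : ℝ) : ∃ C, 0 ≤ C ∧ (∀ x, wt V β x ≤ C) ∧ ∀ f ε, CC f ε → CC (fun x => wt V β x * f x) (C * ε) := by
  have h2 : ContDiff ℝ 2 (wt V β) := (contDiff_const.mul hV).exp
  have h1 : ContDiff ℝ 1 (fderiv ℝ (wt V β)) := h2.fderiv_right (by norm_num)
  have p0 := wt_per (β := β) hp
  obtain ⟨a, ha, hab⟩ := p0.bounded h2.continuous
  obtain ⟨b, hb, hbb⟩ := p0.fderiv.bounded h1.continuous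
  obtain ⟨c, hc, hcb⟩ := p0.fderiv.fderiv.bounded (h1.continuous_fderiv (by norm_num))
  refine ⟨a + b + b + c, by positivity, fun x => (le_abs_self _).trans ((hab x).trans (by linarith)), ?_⟩
  rintro f ε ⟨q, Q, d1, d2, hε⟩
  have hε0 : 0 ≤ ε := (abs_nonneg _).trans (hε 0).1
  have k0 : ∀ x, HasFDerivAt (wt V β) (fderiv ℝ (wt V β) x) x := fun x => (h2.differentiable (by norm_num) x).hasFDerivAt
  have k1 : ∀ x, HasFDerivAt (fderiv ℝ (wt V β)) (fderiv ℝ (fderiv ℝ (wt V β)) x) x := fun x => (h1.differentiable (by norm_num) x).hasFDerivAt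
  refine ⟨_, _, fun x => (k0 x).mul (d1 x), fun x => ((k0 x).smul (d2 x)).add ((d1 x).smul (k1 x)), fun x => ?_⟩
  obtain ⟨e0, e1, e2⟩ := hε x
  have w0 := hab x
  have w1 := hbb x
  have w2 := hcb x
  refine ⟨?_, ?_, ?_⟩
  · rw [abs_mul]
    calc _ ≤ a * ε := by gcongr; exact w0
      _ ≤ _ := by gcongr; linarith
  · calc _ ≤ ‖wt V β x‖ * ‖q x‖ + ‖f x‖ * ‖fderiv ℝ (wt V β) x‖ := (norm_add_le _ _).trans (by rw [norm_smul, norm_smul])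
      _ ≤ a * ε + ε * b := by gcongr; exact e0
      _ ≤ _ := by nlinarith
  · calc _ ≤ (‖wt V β x‖ * ‖Q x‖ + ‖fderiv ℝ (wt V β) x‖ * ‖q x‖) + (‖f x‖ * ‖fderiv ℝ (fderiv ℝ (wt V β)) x‖ + ‖q x‖ * ‖fderiv ℝ (wt V β) x‖) := by
          refine (norm_add_le _ _).trans (add_le_add ((norm_add_le _ _).trans ?_) ((norm_add_le _ _).trans ?_)) <;>
          rw [norm_smul, ContinuousLinearMap.norm_smulRight_apply]
      _ ≤ (a * ε + b * ε) + (ε * c + ε * b) := by gcongr; exact e0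
      _ = _ := by ring

def Rh (V : Spc m → ℝ) (β : ℝ) (f : Spc m → ℝ) (x : Spc m) : ℝ := β⁻¹ * lap f x + Fop V f x

def NS (V : Spc m → ℝ) (β T : ℝ) (ψ : ℝ → Spc m → ℝ) : Prop := ∃ (R κ : ℝ) (w : ℝ → Spc m → St m), 0 < κ ∧
  Sol β T (GG V β R κ) w ∧ (∀ t, 0 ≤ t → t ≤ T → (∀ x, ‖w t x‖ ≤ R) ∧ (∀ s, κ ≤ marg (ψ t) s) ∧ ψ t = fun x => wt V β x * (w t x).1)

lemma NS.reg (hV : ContDiff ℝ 2 V) (hp : Per V) (hβ : 0 < β) {T : ℝ} {ψ : ℝ → Spc m → ℝ} (h : NS V β T ψ) {a : ℝ} (ha : 0 < a) (hT : 2 * a ≤ T) :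
    ∃ K, 0 ≤ K ∧ (∀ t, 2 * a ≤ t → t ≤ T → CC (ψ t) K) ∧
      (∀ s t, 2 * a ≤ s → s ≤ t → t ≤ T → CC (fun x => ψ t x - ψ s x) (K * (t - s) ^ (1/4:ℝ)) ∧
        ∀ x, |Rh V β (ψ t) x - Rh V β (ψ s) x| ≤ K * (t - s) ^ (1/4:ℝ) ∧
         ∀ r ∈ Icc s t, |ψ t x - ψ s x - (t - s) * Rh V β (ψ r) x| ≤ K * (t - s) ^ (1/4:ℝ) * (t - s)) := by
  obtain ⟨R, κ, w, hκ, S, hw⟩ := h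
  have hR : 0 ≤ R := (norm_nonneg _).trans ((hw T (by linarith) le_rfl).1 0)
  obtain ⟨K, hK, r1, r2, r3⟩ := S.reg2 hβ (GG_nice hV hp hR hκ) (GG_YH hV hp hR hκ) ha hT
  obtain ⟨C, hC, hCw, hCC⟩ := wmul hV hp β
  have hRh : ∀ t, 2 * a ≤ t → t ≤ T → ∀ x, Rh V β (ψ t) x = wt V β x * PP β (GG V β R κ) w t x := fun t h1 h2 x => by
    obtain ⟨a1, a2, a3⟩ := hw t (by linarith) h2
    rw [a3] at a2 ⊢
    exact alg hV hp hκ (S.per t) (S.der t) (fun x => ((r1 t h1 h2).2 x).1) a1 a2 x hβ.ne'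
  have wp : ∀ x, 0 ≤ wt V β x := fun x => (Real.exp_pos _).le
  refine ⟨C * (K + R), by positivity, fun t h1 h2 => ?_, fun s t h1 h2 h3 => ⟨?_, fun x => ⟨?_, fun r hr => ?_⟩⟩⟩
  · rw [(hw t (by linarith) h2).2.2]
    refine hCC _ _ ⟨_, _, S.der t, fun x => ((r1 t h1 h2).2 x).1, fun x => ⟨?_, ?_, ?_⟩⟩
    · exact (norm_fst_le (w t x)).trans (((hw t (by linarith) h2).1 x).trans (by linarith))
    · exact (norm_snd_le (w t x)).trans (((hw t (by linarith) h2).1 x).trans (by linarith))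
    · exact ((r1 t h1 h2).2 x).2.trans (by linarith)
  · have e : (fun x => ψ t x - ψ s x) = fun x => wt V β x * ((w t x).1 - (w s x).1) := by
      rw [(hw t (by linarith) h3).2.2, (hw s (by linarith) (by linarith)).2.2]; funext x; ring
    have hs : (0:ℝ) ≤ (t - s) ^ (1/4:ℝ) := Real.rpow_nonneg (by linarith) _
    rw [e, mul_assoc]
    refine hCC _ _ ⟨_, _, fun x => (S.der t x).sub (S.der s x), fun x => ((r1 t (by linarith) h3).2 x).1.sub ((r1 s h1 (by linarith)).2 x).1, fun x => ?_⟩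
    obtain ⟨b1, b2, b3⟩ := r2 s t h1 h2 h3 x
    have b4 : K * (t - s) ^ (1/4:ℝ) ≤ (K + R) * (t - s) ^ (1/4:ℝ) := by gcongr; linarith
    exact ⟨((norm_fst_le (w t x - w s x)).trans b2).trans b4, ((norm_snd_le (w t x - w s x)).trans b2).trans b4, b1.trans b4⟩
  · rw [hRh t (by linarith) h3, hRh s h1 (by linarith), ← mul_sub, abs_mul, abs_of_nonneg (wp x), mul_assoc]
    have hs : (0:ℝ) ≤ (t - s) ^ (1/4:ℝ) := Real.rpow_nonneg (by linarith) _
    have b4 : K * (t - s) ^ (1/4:ℝ) ≤ (K + R) * (t - s) ^ (1/4:ℝ) := by gcongr; linarith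
    exact mul_le_mul (hCw x) ((r2 s t h1 h2 h3 x).2.2.trans b4) (abs_nonneg _) hC
  · have e : ψ t x - ψ s x - (t - s) * Rh V β (ψ r) x = wt V β x * ((w t x).1 - (w s x).1 - (t - s) * PP β (GG V β R κ) w r x) := by
      rw [hRh r (by linarith [hr.1]) (by linarith [hr.2]), (hw t (by linarith) h3).2.2, (hw s (by linarith) (by linarith)).2.2]; ring
    have hs : (0:ℝ) ≤ (t - s) ^ (1/4:ℝ) := Real.rpow_nonneg (by linarith) _
    have hts : 0 ≤ t - s := by linarith
    have b4 : K * (t - s) ^ (1/4:ℝ) * (t - s) ≤ (K + R) * (t - s) ^ (1/4:ℝ) * (t - s) := by gcongr; linarith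
    rw [e, abs_mul, abs_of_nonneg (wp x), mul_assoc C, mul_assoc C]
    exact mul_le_mul (hCw x) ((r3 s t h1 h2 h3 x r hr).trans b4) (abs_nonneg _) hC

lemma cube_meas : MeasurableSet (cube m) := measurableSet_Ico.prod (MeasurableSet.pi countable_univ fun i _ => measurableSet_Ico)
instance finT : IsProbabilityMeasure (μT m) := by
  refine ⟨?_⟩
  have : volume (cube1 m) = 1 := by rw [cube1, volume_pi, Measure.pi_pi]; simp
  rw [μT, Measure.restrict_apply_univ, cube, Measure.volume_eq_prod, Measure.prod_prod, this]; simp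

lemma eLp_le {F : Type*} [NormedAddCommGroup F] {f : Spc m → F} {C : ℝ} {q : ℝ≥0∞} (h : ∀ x, ‖f x‖ ≤ C) : eLpNorm f q (μT m) ≤ ENNReal.ofReal C := by
  have := eLpNorm_le_of_ae_bound (p := q) (μ := μT m) (Eventually.of_forall h)
  simpa using this

lemma W2_le {f : Spc m → ℝ} {ε : ℝ} (h : CC f ε) : WNorm 2 p f ≤ ENNReal.ofReal (3 * ε) := by
  obtain ⟨q, Q, d1, d2, hε⟩ := h
  have hε0 : 0 ≤ ε := (abs_nonneg _).trans (hε 0).1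
  have e1 : grd f = q := funext fun x => (d1 x).fderiv
  have e2 : ∀ x, ‖iteratedFDeriv ℝ 2 f x‖ = ‖Q x‖ := fun x => by
    rw [← norm_iteratedFDeriv_fderiv (n := 1), norm_iteratedFDeriv_one, show fderiv ℝ f = q from e1, (d2 x).fderiv]
  rw [WNorm, if_neg (by norm_num), if_neg (by norm_num), if_neg (by norm_num), LpN, show 3 * ε = ε + ε + ε by ring,
    ENNReal.ofReal_add (by positivity) hε0, ENNReal.ofReal_add hε0 hε0]
  refine add_le_add (add_le_add (eLp_le fun x => (hε x).1) (eLp_le fun x => ?_)) (eLp_le fun x => ?_)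
  · rw [norm_norm, e1]; exact (hε x).2.1
  · rw [norm_norm, e2]; exact (hε x).2.2

lemma Wn0 {τ : ℝ} (h : τ ≤ 0) (f : Spc m → ℝ) : WNorm τ p f = LpN p f := if_pos h

/-- Riesz-type integral. -/
lemma riesz {δ : ℝ} (hδ : 0 < δ) {r : ℝ} : IntegrableOn (fun z : Spc m => ‖z‖ ^ (-((m:ℝ) + 1) + δ)) (Metric.ball 0 r) := by
  rw [integrableOn_fun_norm_addHaar (μ := (volume : Measure (Spc m))) (f := fun y => y ^ (-((m:ℝ) + 1) + δ))]
  have : IntegrableOn (fun y : ℝ => y ^ (δ - 1)) (Ioo 0 r) := by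
    rcases le_or_gt r 0 with h | h
    · simp [Ioo_eq_empty (not_lt.2 h)]
    · exact (intervalIntegral.integrableOn_Ioo_rpow_iff h).2 (by linarith)
  refine this.congr_fun (fun y hy => ?_) measurableSet_Ioo
  simp only [Module.finrank_prod, Module.finrank_self, Module.finrank_fin_fun, Nat.add_sub_cancel_left, smul_eq_mul]
  rw [← Real.rpow_natCast, ← Real.rpow_add hy.1]; congr 1; ring

def rz (m : ℕ) (δ : ℝ) : ℝ := ∫ z in Metric.ball (0 : Spc m) 2, ‖z‖ ^ (-((m:ℝ) + 1) + δ)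
lemma rz_nonneg (δ : ℝ) : 0 ≤ rz m δ := integral_nonneg fun z => by positivity
lemma cube_diam {x y : Spc m} (hx : x ∈ cube m) (hy : y ∈ cube m) : ‖x - y‖ ≤ 1 := by
  have h1 := cube_sub hx
  have h2 := cube_sub hy
  refine max_le ?_ ((pi_norm_le_iff_of_nonneg zero_le_one).2 fun i => ?_)
  · show |x.1 - y.1| ≤ 1
    have a := h1.1.1; have b := h1.2.1; have c := h2.1.1; have d := h2.2.1
    simp only [Prod.fst_zero, Prod.fst_one] at a b c d
    rw [abs_le]; constructor <;> linarith
  · show |x.2 i - y.2 i| ≤ 1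
    have a := h1.1.2 i; have b := h1.2.2 i; have c := h2.1.2 i; have d := h2.2.2 i
    simp only [Prod.snd_zero, Prod.snd_one, Pi.zero_apply, Pi.one_apply] at a b c d
    rw [abs_le]; constructor <;> linarith
lemma riesz_le {δ : ℝ} (hδ : 0 < δ) {x : Spc m} (hx : x ∈ cube m) :
    ∫⁻ y in cube m, ENNReal.ofReal (‖x - y‖ ^ (-((m:ℝ) + 1) + δ)) ≤ ENNReal.ofReal (rz m δ) := by
  have e : ∫⁻ z in Metric.ball (0 : Spc m) 2, ENNReal.ofReal (‖z‖ ^ (-((m:ℝ) + 1) + δ)) = ENNReal.ofReal (rz m δ) :=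
    (ofReal_integral_eq_lintegral_ofReal (riesz hδ) (Eventually.of_forall fun z => by positivity)).symm
  rw [← e, ← lintegral_indicator Metric.isOpen_ball.measurableSet, ← lintegral_indicator cube_meas]
  rw [← lintegral_sub_left_eq_self _ x]
  refine lintegral_mono fun y => ?_
  by_cases hy : x - y ∈ cube m
  · rw [indicator_of_mem hy, indicator_of_mem]
    · simp
    · rw [mem_ball_zero_iff]; have := cube_diam hx hy; rw [sub_sub_self] at this; exact this.trans_lt one_lt_two
  · rw [indicator_of_notMem hy]; exact bot_le

lemma gagl_lip {F : Type*} [NormedAddCommGroup F] {f : Spc m → F} {K s : ℝ} (hp : 0 < p) (hs : s < 1) (h : ∀ x y, ‖f x - f y‖ ≤ K * ‖x - y‖) :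
    gagl s p f < ⊤ := by
  refine ENNReal.rpow_lt_top_of_nonneg (by positivity) (ne_of_lt ?_)
  have hδ : 0 < (1 - s) * p := mul_pos (by linarith) hp
  have : ∀ x ∈ cube m, ∫⁻ y in cube m, ENNReal.ofReal (‖f x - f y‖ ^ p / ‖x - y‖ ^ ((m : ℝ) + 1 + s * p)) ≤
      ENNReal.ofReal (|K| ^ p) * ENNReal.ofReal (rz m ((1 - s) * p)) := fun x hx => by
    refine le_trans ?_ (mul_le_mul_right (riesz_le hδ hx) _)
    rw [← lintegral_const_mul _ (by fun_prop)]
    refine lintegral_mono fun y => ?_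
    rw [← ENNReal.ofReal_mul (by positivity)]
    refine ENNReal.ofReal_le_ofReal ?_
    rcases eq_or_ne x y with rfl | hxy
    · simp [hp.ne']; positivity
    have h0 : 0 < ‖x - y‖ := norm_pos_iff.2 (sub_ne_zero.2 hxy)
    rw [div_le_iff₀ (by positivity), mul_assoc, ← Real.rpow_add h0]
    calc ‖f x - f y‖ ^ p ≤ (|K| * ‖x - y‖) ^ p := by
          gcongr; exact (h x y).trans (by gcongr; exact le_abs_self K)
      _ = _ := by rw [Real.mul_rpow (abs_nonneg _) h0.le]; congr 2; ring
  refine (setLIntegral_mono' cube_meas this).trans_lt ?_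
  rw [setLIntegral_const]
  refine ENNReal.mul_lt_top (ENNReal.mul_lt_top ofReal_lt_top ofReal_lt_top) ?_
  have := measure_lt_top (μT m) univ
  rwa [μT, Measure.restrict_apply_univ] at this

lemma memW_of {f : Spc m → ℝ} {K : ℝ} (hp0 : 0 < p) (h1 : 1 < σ) (h2 : σ < 2) (hp : Per f) (h : CC f K) : MemW 2 p f ∧ MemW σ p f := by
  have hw := W2_le (p := p) h
  obtain ⟨q, Q, d1, d2, hε⟩ := id h
  have e1 : grd f = q := funext fun x => (d1 x).fderiv
  have df : Differentiable ℝ f := fun x => (d1 x).differentiableAt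
  have ms : Measurable f := df.continuous.measurable
  refine ⟨⟨per_iff.2 hp, ms, fun _ => df, fun _ => ?_, hw.trans_lt ofReal_lt_top⟩, per_iff.2 hp, ms, fun _ => df, fun h => absurd h (not_le.2 h2), ?_⟩
  · rw [e1]; exact fun x => (d2 x).differentiableAt
  · rw [WNorm, if_neg (by linarith), if_neg (by linarith), if_pos h2, if_neg (by linarith), e1]
    refine ENNReal.add_lt_top.2 ⟨ENNReal.add_lt_top.2 ⟨(eLp_le fun x => (hε x).1).trans_lt ofReal_lt_top, (eLp_le (C := K) fun x => ?_).trans_lt ofReal_lt_top⟩, ?_⟩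
    · rw [norm_norm]; exact (hε x).2.1
    · exact gagl_lip (K := K) hp0 (by linarith) fun x y => lip_of_bd d2 (fun x => (hε x).2.2) x y

lemma NS.cont (hV : ContDiff ℝ 2 V) {T : ℝ} {ψ : ℝ → Spc m → ℝ} (h : NS V β T ψ) :
    ContinuousOn (Function.uncurry ψ) (Icc 0 T ×ˢ univ) := by
  obtain ⟨R, κ, w, hκ, S, hw⟩ := h
  have : Continuous fun q : ℝ × Spc m => wt V β q.2 * (w q.1 q.2).1 := by
    have := wt_cont (β := β) hV
    have : Continuous fun q : ℝ × Spc m => w q.1 q.2 := S.wc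
    fun_prop
  refine this.continuousOn.congr fun q hq => ?_
  show ψ q.1 q.2 = _
  rw [(hw q.1 hq.1.1 hq.1.2).2.2]

lemma NS.per (hp : Per V) {T : ℝ} {ψ : ℝ → Spc m → ℝ} (h : NS V β T ψ) {t : ℝ} (h0 : 0 ≤ t) (h1 : t ≤ T) : Per (ψ t) := by
  obtain ⟨R, κ, w, hκ, S, hw⟩ := h
  rw [(hw t h0 h1).2.2]
  exact (wt_per hp).mul ((S.per t).comp Prod.fst)

lemma NS.unif (hV : ContDiff ℝ 2 V) (hp : Per V) {T : ℝ} {ψ : ℝ → Spc m → ℝ} (h : NS V β T ψ) {ε : ℝ} (hε : 0 < ε) :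
    ∃ δ > 0, ∀ s t, 0 ≤ s → s ≤ T → 0 ≤ t → t ≤ T → |t - s| < δ → ∀ x, |ψ t x - ψ s x| < ε := by
  have hc := h.cont hV
  have hk : IsCompact (Icc 0 T ×ˢ ccube m) := isCompact_Icc.prod ccube_compact
  have := hk.uniformContinuousOn_of_continuous (hc.mono (prod_mono_right (subset_univ _)))
  obtain ⟨δ, hδ, hd⟩ := Metric.uniformContinuousOn_iff.1 this ε hε
  refine ⟨δ, hδ, fun s t h1 h2 h3 h4 h5 x => ?_⟩
  obtain ⟨k, j, hkj⟩ := exists_lv x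
  have := hd (t, x + lv k j) ⟨⟨h3, h4⟩, cube_sub hkj⟩ (s, x + lv k j) ⟨⟨h1, h2⟩, cube_sub hkj⟩ (by
    rw [Prod.dist_eq, dist_self]; exact max_lt (by rwa [Real.dist_eq]) hδ)
  rw [Real.dist_eq] at this
  simpa [Function.uncurry, h.per hp h3 h4 k j x, h.per hp h1 h2 k j x] using this

lemma lp_of (hV : ContDiff ℝ 2 V) (hp : Per V) (hβ : 0 < β) (hp0 : 0 < p) (h1 : 1 < σ) (h2 : σ < 2) {ψ : ℝ → Spc m → ℝ} {Tm : ℝ≥0∞}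
    (h : ∀ t, 0 ≤ t → ENNReal.ofReal t < Tm → ∃ T > t, NS V β T ψ) : IsLpSolution V β σ p (ψ 0) Tm ψ ∧ ContW 2 p (Ioo0 Tm) ψ ∧
    ∀ a b : ℝ, 0 < a → a ≤ b → ENNReal.ofReal b < Tm → ∀ ν, 0 ≤ ν → ν ≤ 1/4 → HolderW ν 0 p (Icc a b) fun t x => β⁻¹ * lap (ψ t) x + Fop V (ψ t) x := by
  have key : ∀ t ∈ Ioo0 Tm, ∃ T > t, ∃ a > 0, 2 * a < t ∧ NS V β T ψ ∧ ∃ K, 0 ≤ K ∧ (∀ t, 2 * a ≤ t → t ≤ T → CC (ψ t) K) ∧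
      (∀ s t, 2 * a ≤ s → s ≤ t → t ≤ T → CC (fun x => ψ t x - ψ s x) (K * (t - s) ^ (1/4:ℝ)) ∧
        ∀ x, |Rh V β (ψ t) x - Rh V β (ψ s) x| ≤ K * (t - s) ^ (1/4:ℝ) ∧
         ∀ r ∈ Icc s t, |ψ t x - ψ s x - (t - s) * Rh V β (ψ r) x| ≤ K * (t - s) ^ (1/4:ℝ) * (t - s)) := fun t ht => by
    obtain ⟨T, hT, hN⟩ := h t ht.1.le ht.2
    have := ht.1
    obtain ⟨K, hK⟩ := hN.reg hV hp hβ (a := t / 4) (by linarith) (by linarith)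
    exact ⟨T, hT, t / 4, by linarith, by linarith, hN, K, hK⟩
  have small : ∀ K ε : ℝ, 0 ≤ K → 0 < ε → ∃ δ > 0, ∀ r : ℝ, 0 ≤ r → r < δ → K * r ^ (1/4:ℝ) < ε := fun K ε hK hε => by
    have hc : Continuous fun r : ℝ => K * r ^ (1/4:ℝ) := continuous_const.mul (Real.continuous_rpow_const (by norm_num))
    obtain ⟨δ, hδ, hd⟩ := Metric.continuousAt_iff.1 (hc.continuousAt (x := 0)) ε hε
    refine ⟨δ, hδ, fun r hr hr' => ?_⟩
    have := hd (x := r) (by rw [Real.dist_eq, sub_zero, abs_of_nonneg hr]; exact hr')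
    rw [Real.dist_eq, Real.zero_rpow (by norm_num), mul_zero, sub_zero] at this
    exact (le_abs_self _).trans_lt this
  have CCn : ∀ f g : Spc m → ℝ, ∀ ε, CC (fun x => f x - g x) ε → CC (fun x => g x - f x) ε := by
    rintro f g ε ⟨q, Q, d1, d2, hε⟩
    refine ⟨fun x => -q x, fun x => -Q x, fun x => ?_, fun x => (d2 x).neg, fun x => ?_⟩
    · have : (fun x => g x - f x) = -(fun x => f x - g x) := by funext x; simp
      rw [this]; exact (d1 x).neg
    · rw [norm_neg, norm_neg, abs_sub_comm]; exact hε x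
  refine ⟨⟨fun _ => rfl, fun t ht ε hε => ?_, fun t ht => ?_, fun t ht => ?_, fun t ht => ?_, fun t ht ε hε => ?_⟩, fun t ht ε hε => ?_, fun a b ha hab hb ν h0 h1 => ?_⟩
  · obtain ⟨T, hT, hN⟩ := h t ht.1 ht.2
    obtain ⟨δ, hδ, hd⟩ := hN.unif hV hp (half_pos hε)
    refine ⟨min δ (T - t), lt_min hδ (by linarith), fun t' ht' hd' => ?_⟩
    rw [Wn0 le_rfl]
    have := (lt_min_iff.1 hd')
    refine (eLp_le fun x => (hd t t' ht.1 hT.le ht'.1 (by linarith [(abs_lt.1 this.2).2]) this.1 x).le).trans_lt ((ENNReal.ofReal_lt_ofReal_iff hε).2 (by linarith))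
  · obtain ⟨T, hT, a, ha, hat, hN, K, hK, k1, k2⟩ := key t ht
    exact (memW_of hp0 h1 h2 (hN.per hp ht.1.le hT.le) (k1 t hat.le hT.le)).1
  · obtain ⟨T, hT, a, ha, hat, hN, K, hK, k1, k2⟩ := key t ht
    refine ⟨(memW_of hp0 h1 h2 (hN.per hp ht.1.le hT.le) (k1 t hat.le hT.le)).2, fun s => ?_⟩
    obtain ⟨R, κ, w, hκ, S, hw⟩ := hN
    exact hκ.trans_le ((hw t ht.1.le hT.le).2.1 s)
  · obtain ⟨T, hT, a, ha, hat, hN, K, hK, k1, k2⟩ := key t ht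
    rw [ENNReal.tendsto_nhds_zero]
    intro ε hε
    obtain ⟨ε', hε', hee⟩ : ∃ ε' : ℝ, 0 < ε' ∧ ENNReal.ofReal ε' ≤ ε := by
      rcases eq_or_ne ε ⊤ with rfl | h
      · exact ⟨1, one_pos, le_top⟩
      · exact ⟨ε.toReal, ENNReal.toReal_pos hε.ne' h, ENNReal.ofReal_toReal_le⟩
    obtain ⟨δ, hδ, hd⟩ := small K ε' hK hε'
    have : ∀ᶠ h in nhdsWithin (0:ℝ) {h | h ≠ 0}, |h| < min δ (min (T - t) (t - 2 * a)) := by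
      refine nhdsWithin_le_nhds ?_
      have : Tendsto (fun h : ℝ => |h|) (nhds 0) (nhds 0) := by simpa using (continuous_abs.tendsto (0:ℝ))
      exact this.eventually (gt_mem_nhds (lt_min hδ (lt_min (by linarith) (by linarith))))
    filter_upwards [this, self_mem_nhdsWithin] with h hh hne
    obtain ⟨q1, q2⟩ := lt_min_iff.1 hh
    obtain ⟨q2, q3⟩ := lt_min_iff.1 q2
    refine (eLp_le fun x => ?_).trans hee
    have hpos : 0 < |h| := abs_pos.2 hne
    have e : |ψ (t + h) x - ψ t x - h * Rh V β (ψ t) x| ≤ K * |h| ^ (1/4:ℝ) * |h| := by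
      rcases le_total 0 h with h0 | h0
      · rw [abs_of_nonneg h0] at *
        have := ((k2 t (t + h) hat.le (by linarith) (by linarith)).2 x).2 t ⟨le_rfl, by linarith⟩
        simpa using this
      · rw [abs_of_nonpos h0] at *
        have := ((k2 (t + h) t (by linarith) (by linarith) (by linarith)).2 x).2 t ⟨by linarith, le_rfl⟩
        rw [show t - (t + h) = -h by ring] at this
        rw [abs_sub_comm]; convert this using 2; ring
    have e2 : (ψ (t + h) x - ψ t x) / h - (β⁻¹ * lap (ψ t) x + Fop V (ψ t) x) = (ψ (t + h) x - ψ t x - h * Rh V β (ψ t) x) / h := by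
      have : h ≠ 0 := hne
      rw [Rh]; field_simp
    rw [e2, Real.norm_eq_abs, abs_div, div_le_iff₀ hpos]
    exact e.trans (by gcongr; exact (hd _ (abs_nonneg _) q1).le)
  · obtain ⟨T, hT, a, ha, hat, hN, K, hK, k1, k2⟩ := key t ht
    obtain ⟨δ, hδ, hd⟩ := small K (ε / 2) hK (half_pos hε)
    refine ⟨min δ (min (T - t) (t - 2 * a)), lt_min hδ (lt_min (by linarith) (by linarith)), fun t' ht' hd' => ?_⟩
    obtain ⟨q1, q2⟩ := lt_min_iff.1 hd'
    obtain ⟨q2, q3⟩ := lt_min_iff.1 q2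
    rw [Wn0 le_rfl]
    refine (eLp_le (C := ε / 2) fun x => ?_).trans_lt ((ENNReal.ofReal_lt_ofReal_iff hε).2 (by linarith))
    show |Rh V β (ψ t') x - Rh V β (ψ t) x| ≤ _
    have r := hd _ (abs_nonneg _) q1
    rcases le_total t t' with h0 | h0
    · rw [abs_of_nonneg (by linarith)] at q2 r
      exact ((k2 t t' hat.le h0 (by linarith)).2 x).1.trans r.le
    · rw [abs_of_nonpos (by linarith)] at q3 r
      rw [abs_sub_comm]
      rw [neg_sub] at r
      exact ((k2 t' t (by linarith) h0 (by linarith)).2 x).1.trans r.le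
  · obtain ⟨T, hT, a, ha, hat, hN, K, hK, k1, k2⟩ := key t ht
    obtain ⟨δ, hδ, hd⟩ := small K (ε / 4) hK (by linarith)
    refine ⟨min δ (min (T - t) (t - 2 * a)), lt_min hδ (lt_min (by linarith) (by linarith)), fun t' ht' hd' => ?_⟩
    obtain ⟨q1, q2⟩ := lt_min_iff.1 hd'
    obtain ⟨q2, q3⟩ := lt_min_iff.1 q2
    have r := hd _ (abs_nonneg _) q1
    rcases le_total t t' with h0 | h0
    · rw [abs_of_nonneg (by linarith)] at q2 r
      refine (W2_le (k2 t t' hat.le h0 (by linarith)).1).trans_lt ((ENNReal.ofReal_lt_ofReal_iff hε).2 (by linarith))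
    · rw [abs_of_nonpos (by linarith)] at q3 r
      rw [neg_sub] at r
      refine (W2_le (CCn _ _ _ (k2 t' t (by linarith) h0 (by linarith)).1)).trans_lt ((ENNReal.ofReal_lt_ofReal_iff hε).2 (by linarith))
  · obtain ⟨T, hT, hN⟩ := h b (by linarith) hb
    obtain ⟨K, hK, k1, k2⟩ := hN.reg hV hp hβ (a := a / 2) (by linarith) (by linarith)
    have B : ∀ r : ℝ, 0 ≤ r → r ≤ b → r ^ (1/4:ℝ) ≤ (max b 1) ^ (1/4:ℝ) * r ^ ν := fun r hr hrb => by
      rcases hr.eq_or_lt with rfl | hr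
      · rw [Real.zero_rpow (by norm_num)]; positivity
      rw [show (1/4:ℝ) = (1/4 - ν) + ν by ring, Real.rpow_add hr, ← show (1/4:ℝ) = (1/4 - ν) + ν by ring]
      gcongr
      calc r ^ (1/4 - ν) ≤ (max b 1) ^ (1/4 - ν) := Real.rpow_le_rpow hr.le (hrb.trans (le_max_left _ _)) (by linarith)
        _ ≤ _ := Real.rpow_le_rpow_of_exponent_le (le_max_right _ _) (by linarith)
    have L : ∀ s t, a ≤ s → s ≤ t → t ≤ b → ∀ x, |Rh V β (ψ t) x - Rh V β (ψ s) x| ≤ K * (max b 1) ^ (1/4:ℝ) * (t - s) ^ ν := fun s t h1 h2 h3 x => by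
      refine ((k2 s t (by linarith) h2 (by linarith)).2 x).1.trans ?_
      rw [mul_assoc]; gcongr; exact B _ (by linarith) (by linarith)
    refine ⟨K * (max b 1) ^ (1/4:ℝ), fun s hs t ht => ?_⟩
    rw [Wn0 le_rfl]
    refine eLp_le fun x => ?_
    show |Rh V β (ψ t) x - Rh V β (ψ s) x| ≤ _
    rcases le_total s t with h0 | h0
    · rw [abs_of_nonneg (sub_nonneg.2 h0)]; exact L s t hs.1 h0 ht.2 x
    · rw [abs_sub_comm, abs_sub_comm t s, abs_of_nonneg (sub_nonneg.2 h0)]; exact L t s ht.1 h0 hs.2 x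

end lp

section div
variable {m : ℕ} {V : Spc m → ℝ} {β σ p : ℝ}

def eL (m : ℕ) : Spc m ≃L[ℝ] (Fin (m + 1) → ℝ) := Fin.consEquivL ℝ fun _ => ℝ
lemma eL_apply (x : Spc m) : eL m x = Fin.cons x.1 x.2 := rfl
lemma eL_symm (y : Fin (m + 1) → ℝ) : (eL m).symm y = (y 0, fun j => y j.succ) := rfl
def vv (i : Fin (m + 1)) : Spc m := (eL m).symm (Pi.single i 1)
lemma vv_zero : vv (0 : Fin (m + 1)) = e1 m := by
  rw [vv, eL_symm, e1]; ext <;> simp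
lemma vv_succ (j : Fin m) : vv j.succ = eC m j := by
  rw [vv, eL_symm, eC]
  refine Prod.ext (by simp) (funext fun k => ?_)
  simp [Pi.single_apply]
lemma eL_ord (x y : Spc m) : eL m x ≤ eL m y ↔ x ≤ y := by
  rw [eL_apply, eL_apply, Fin.cons_le_cons]; rfl
lemma eL_vol : MeasurePreserving (eL m) volume volume := by
  have := (volume_preserving_piFinSuccAbove (fun _ : Fin (m + 1) => ℝ) 0).symm
  have e : ⇑(eL m) = ⇑(MeasurableEquiv.piFinSuccAbove (fun _ : Fin (m + 1) => ℝ) 0).symm := by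
    funext x
    rw [eL_apply]
    simp [MeasurableEquiv.piFinSuccAbove, Fin.insertNthEquiv]
  rw [e]; exact this

lemma box_div (i : Fin (m + 1)) {f : Spc m → ℝ} {f' : Spc m → Spc m →L[ℝ] ℝ} {a b : Spc m} (hab : a ≤ b)
    (h : ∀ x, HasFDerivAt f (f' x) x) (hi : IntegrableOn (fun x => f' x (vv i)) (Icc a b)) :
    ∫ x in Icc a b, f' x (vv i) = (∫ x in Icc (eL m a ∘ i.succAbove) (eL m b ∘ i.succAbove), f ((eL m).symm (i.insertNth (eL m b i) x))) -
      ∫ x in Icc (eL m a ∘ i.succAbove) (eL m b ∘ i.succAbove), f ((eL m).symm (i.insertNth (eL m a i) x)) := by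
  have key := integral_divergence_of_hasFDerivAt_off_countable_of_equiv (eL m) eL_ord eL_vol
    (fun k => if k = i then f else 0) (fun k => if k = i then f' else 0) ∅ countable_empty a b hab
    (fun k => by split_ifs; exacts [(cont_of_der h).continuousOn, continuousOn_const])
    (fun x _ k => by
      show HasFDerivAt (if k = i then f else 0) ((if k = i then f' else 0) x) x
      split_ifs
      exacts [h x, hasFDerivAt_const 0 x]) (fun x => f' x (vv i)) (fun x => by
      rw [Finset.sum_eq_single i]
      · rw [if_pos rfl]; rfl
      · intro k _ hk; rw [if_neg hk]; rfl
      · simp) hi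
  rw [key, Finset.sum_eq_single i]
  · simp only [if_true]
  · intro k _ hk; simp [hk]
  · simp

lemma ccube_eq : ccube m = Icc (0:ℝ) 1 ×ˢ (Set.pi univ fun _ : Fin m => Icc (0:ℝ) 1) := by
  ext x; simp only [ccube, mem_Icc, mem_prod, Set.mem_pi, mem_univ, forall_true_left]
  constructor
  · rintro ⟨a, b⟩; exact ⟨⟨a.1, b.1⟩, fun i => ⟨a.2 i, b.2 i⟩⟩
  · rintro ⟨a, b⟩; exact ⟨⟨a.1, fun i => (b i).1⟩, ⟨a.2, fun i => (b i).2⟩⟩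
lemma cube_ae : cube m =ᵐ[volume] ccube m := by
  rw [ccube_eq, cube, Measure.volume_eq_prod]
  refine Measure.set_prod_ae_eq Ico_ae_eq_Icc ?_
  rw [cube1, volume_pi]
  exact Measure.ae_eq_set_pi fun i _ => Ico_ae_eq_Icc

lemma Per.vv {F : Type*} {f : Spc m → F} (h : Per f) (i : Fin (m + 1)) (x : Spc m) : f (x + vv i) = f x := by
  have : ∃ k j, _root_.vv i = lv (m := m) k j := by
    refine Fin.cases ?_ (fun j => ?_) i
    · exact ⟨1, 0, by rw [vv_zero]; simp [e1, lv]; rfl⟩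
    · refine ⟨0, Pi.single j 1, ?_⟩
      rw [vv_succ]; simp only [eC, lv, Int.cast_zero]
      refine Prod.ext rfl (funext fun k => ?_)
      by_cases hk : k = j
      · subst hk; simp
      · simp [hk]
  obtain ⟨k, j, e⟩ := this
  rw [e, h]

lemma int_pd_zero (i : Fin (m + 1)) {f : Spc m → ℝ} {f' : Spc m → Spc m →L[ℝ] ℝ} (hp : Per f)
    (h : ∀ x, HasFDerivAt f (f' x) x) (hi : Integrable (fun x => f' x (vv i)) (μT m)) : ∫ x, f' x (vv i) ∂(μT m) = 0 := by
  have e : (μT m) = volume.restrict (Icc (0 : Spc m) 1) := Measure.restrict_congr_set cube_ae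
  rw [e] at hi ⊢
  rw [box_div i (zero_le_one) h hi, sub_eq_zero]
  congr 1
  funext y
  have : (eL m).symm (i.insertNth (eL m 1 i) y) = (eL m).symm (i.insertNth (eL m 0 i) y) + vv i := by
    rw [vv, ← map_add]; congr 1
    funext k
    rcases Fin.eq_self_or_eq_succAbove i k with rfl | ⟨j, rfl⟩
    · simp only [Fin.insertNth_apply_same, Pi.add_apply, Pi.single_eq_same, map_zero, Pi.zero_apply, zero_add]
      rw [eL_apply]; refine Fin.cases ?_ (fun j => ?_) k <;> rfl
    · simp [Fin.succAbove_ne]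
  rw [this, hp.vv]

end div

section en
variable {m : ℕ} {V : Spc m → ℝ} {β σ p : ℝ}

lemma dini {N : ℝ → ℝ} {b C : ℝ} (hb : 0 < b) (hC : 0 ≤ C) (hc : ContinuousOn N (Icc 0 b))
    (h : ∀ t, 0 < t → t ≤ b → ∃ (L : ℝ → ℝ) (l : ℝ), (∀ᶠ s in nhdsWithin t (Iio t), N t - N s ≤ (t - s) * L (s - t)) ∧ l ≤ C * N t ∧
      Tendsto L (nhdsWithin 0 {h | h ≠ 0}) (nhds l)) : N b ≤ Real.exp (C * b) * N 0 := by
  have key : ∀ η > 0, -N 0 ≤ -(N b) * Real.exp (-C * b) + η * b := fun η hη => by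
    have := image_le_of_liminf_slope_right_lt_deriv_boundary' (f := fun x => -N (-x)) (f' := fun x => C * N (-x)) (a := -b) (b := 0)
      (B := fun x => -(N b) * Real.exp (-C * (x + b)) + η * (x + b)) (B' := fun x => -(N b) * (Real.exp (-C * (x + b)) * -C) + η) ?_ ?_ ?_ ?_ ?_ ?_ (x := 0) ⟨by linarith, le_rfl⟩
    · simpa using this
    · refine (hc.comp continuousOn_neg fun x hx => ?_).neg
      exact ⟨by linarith [hx.2], by linarith [hx.1]⟩
    · intro x hx r hr
      obtain ⟨L, l, h1, h2, h3⟩ := h (-x) (by linarith [hx.2]) (by linarith [hx.1])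
      have tn : Tendsto (fun z : ℝ => -z) (nhdsWithin x (Ioi x)) (nhdsWithin (-x) (Iio (-x))) := by
        refine tendsto_nhdsWithin_iff.2 ⟨(continuous_neg.tendsto x).mono_left nhdsWithin_le_nhds, ?_⟩
        filter_upwards [self_mem_nhdsWithin] with z hz
        have : x < z := hz
        show -z < -x
        linarith
      have tm : Tendsto (fun z : ℝ => -z - -x) (nhdsWithin x (Ioi x)) (nhdsWithin 0 {h | h ≠ 0}) := by
        refine tendsto_nhdsWithin_iff.2 ⟨?_, ?_⟩
        · have : Tendsto (fun z : ℝ => -z - -x) (nhds x) (nhds (-x - -x)) := (by fun_prop : Continuous fun z : ℝ => -z - -x).tendsto x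
          rw [sub_self] at this
          exact this.mono_left nhdsWithin_le_nhds
        · filter_upwards [self_mem_nhdsWithin] with z hz
          have : x < z := hz
          show -z - -x ≠ 0
          intro h; linarith
      have e1 := (h3.comp tm).eventually (gt_mem_nhds (h2.trans_lt hr))
      have e2 := tn.eventually h1
      refine Eventually.frequently ?_
      filter_upwards [e1, e2, self_mem_nhdsWithin] with z h1 h2 hz
      have hz' : 0 < z - x := sub_pos.2 hz
      rw [slope_def_field, div_lt_iff₀ hz']
      simp only [Function.comp] at h1
      have : (- x - -z) * L (-z - -x) < r * (z - x) := by
        rw [mul_comm]; rw [show -x - -z = z - x by ring]; gcongr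
      linarith
    · simp
    · fun_prop
    · intro x hx
      have : HasDerivAt (fun x => -(N b) * Real.exp (-C * (x + b)) + η * (x + b)) (-(N b) * (Real.exp (-C * (x + b)) * (-C * 1)) + η * 1) x :=
        ((((hasDerivAt_id x).add_const b).const_mul (-C)).exp.const_mul (-(N b))).add (((hasDerivAt_id x).add_const b).const_mul η)
      simpa using this.hasDerivWithinAt
    · intro x hx e
      have e' : -N (-x) = -(N b) * Real.exp (-C * (x + b)) + η * (x + b) := e
      have : N (-x) = N b * Real.exp (-C * (x + b)) - η * (x + b) := by linarith
      show C * N (-x) < -(N b) * (Real.exp (-C * (x + b)) * -C) + η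
      rw [this]
      have h0 : 0 ≤ C * (η * (x + b)) := mul_nonneg hC (mul_nonneg hη.le (by linarith [hx.1]))
      nlinarith
  have k2 : -N 0 ≤ -(N b) * Real.exp (-C * b) := by
    refine le_of_forall_pos_le_add fun ε hε => ?_
    have := key (ε / b) (by positivity)
    rwa [div_mul_cancel₀ _ hb.ne'] at this
  have e : Real.exp (C * b) * Real.exp (-C * b) = 1 := by rw [← Real.exp_add]; simp
  have k3 := mul_le_mul_of_nonneg_left k2 (Real.exp_pos (C * b)).le
  rw [show Real.exp (C * b) * (-(N b) * Real.exp (-C * b)) = -(N b) * (Real.exp (C * b) * Real.exp (-C * b)) by ring, e] at k3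
  linarith

/-- continuous periodic-like functions are integrable on the torus -/
lemma ci {F : Type*} [NormedAddCommGroup F] {f : Spc m → F} (hf : Continuous f) : Integrable f (μT m) :=
  (hf.continuousOn.integrableOn_compact ccube_compact).mono_set cube_sub

lemma ofReal_int_le (hp : 1 ≤ p) {f : Spc m → ℝ} (hf : Integrable f (μT m)) : ENNReal.ofReal (∫ x, |f x| ∂(μT m)) ≤ LpN p f := by
  have := ofReal_integral_norm_eq_lintegral_enorm hf
  simp only [Real.norm_eq_abs] at this
  rw [this, ← eLpNorm_one_eq_lintegral_enorm]
  refine eLpNorm_le_eLpNorm_of_exponent_le ?_ hf.1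
  rw [← ENNReal.ofReal_one]; exact ENNReal.ofReal_le_ofReal hp

lemma ofReal_sq_le (hp : 2 ≤ p) {f : Spc m → ℝ} (hf : Continuous f) : ENNReal.ofReal (∫ x, f x ^ 2 ∂(μT m)) ≤ LpN p f ^ 2 := by
  have : ENNReal.ofReal (∫ x, f x ^ 2 ∂(μT m)) = (eLpNorm f 2 (μT m)) ^ 2 := by
    rw [eLpNorm_eq_lintegral_rpow_enorm_toReal (by norm_num) (by norm_num), ← ENNReal.rpow_natCast, ← ENNReal.rpow_mul]
    rw [ofReal_integral_eq_lintegral_ofReal (ci (by fun_prop)) (Eventually.of_forall fun x => by positivity)]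
    simp only [ENNReal.toReal_ofNat, Nat.cast_ofNat, one_div, ne_eq, OfNat.ofNat_ne_zero, not_false_eq_true, inv_mul_cancel₀, ENNReal.rpow_one]
    refine lintegral_congr fun x => ?_
    rw [← ofReal_norm_eq_enorm, ENNReal.ofReal_rpow_of_nonneg (norm_nonneg _) (by norm_num)]
    congr 1
    rw [show (2:ℝ) = ((2:ℕ):ℝ) by norm_num, Real.rpow_natCast, Real.norm_eq_abs, sq_abs]
  rw [this]
  gcongr
  refine eLpNorm_le_eLpNorm_of_exponent_le ?_ hf.aestronglyMeasurable
  rw [show (2:ℝ≥0∞) = ENNReal.ofReal 2 by simp]; exact ENNReal.ofReal_le_ofReal hp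

variable {ψ0 : Spc m → ℝ} {Tm : ℝ≥0∞} {ψ : ℝ → Spc m → ℝ}

lemma pd_meas (v : Spc m) (f : Spc m → ℝ) : Measurable (pd v f) := measurable_fderiv_apply_const ℝ f v

structure Dat (f : Spc m → ℝ) : Prop where
  per : Per f
  d1 : ∀ x, HasFDerivAt f (grd f x) x
  d2 : ∀ x, HasFDerivAt (grd f) (fderiv ℝ (grd f) x) x
  i2 : ∀ v, Integrable (fun x => fderiv ℝ (grd f) x v v) (μT m)
  mp : ∀ s, 0 < marg f s

lemma Dat.of (hp : 1 ≤ p) {f : Spc m → ℝ} (h : MemW 2 p f) (h' : ∀ s, 0 < marg f s) : Dat f := by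
  obtain ⟨a, b, c, d, e⟩ := h
  have d1 : ∀ x, HasFDerivAt f (grd f x) x := fun x => (c (by norm_num) x).hasFDerivAt
  have d2 : ∀ x, HasFDerivAt (grd f) (fderiv ℝ (grd f) x) x := fun x => (d le_rfl x).hasFDerivAt
  refine ⟨per_iff.1 a, d1, d2, fun v => ?_, h'⟩
  rw [WNorm, if_neg (by norm_num), if_neg (by norm_num), if_neg (by norm_num), ENNReal.add_lt_top] at e
  have e2 : ∀ x, ‖iteratedFDeriv ℝ 2 f x‖ = ‖fderiv ℝ (grd f) x‖ := fun x => by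
    rw [← norm_iteratedFDeriv_fderiv (n := 1), norm_iteratedFDeriv_one]; rfl
  simp only [e2] at e
  have ms : Measurable fun x => fderiv ℝ (grd f) x := measurable_fderiv ℝ _
  have : MemLp (fun x => ‖fderiv ℝ (grd f) x‖) (ENNReal.ofReal p) (μT m) := ⟨ms.norm.aestronglyMeasurable, e.2⟩
  have i := (this.integrable (by rw [← ENNReal.ofReal_one]; exact ENNReal.ofReal_le_ofReal hp)).mul_const (‖v‖ * ‖v‖)
  refine i.mono' ?_ (Eventually.of_forall fun x => ?_)
  · exact ((ContinuousLinearMap.apply ℝ ℝ v).continuous.measurable.comp ((ContinuousLinearMap.apply ℝ (Spc m →L[ℝ] ℝ) v).continuous.measurable.comp ms)).aestronglyMeasurable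
  · rw [← mul_assoc]; exact ContinuousLinearMap.le_opNorm₂ _ _ _

lemma Dat.gc {f : Spc m → ℝ} (h : Dat f) : Continuous (grd f) := cont_of_der h.d2
lemma Dat.c {f : Spc m → ℝ} (h : Dat f) : Continuous f := cont_of_der h.d1

lemma marg_cont {g : Spc m → ℝ} (hg : Continuous g) : Continuous fun s => ∫ y in cube1 m, g (s, y) := by
  have : ∀ s, ∫ y in cube1 m, g (s, y) = ∫ y in Icc (0 : Fin m → ℝ) 1, g (s, y) := fun s => by
    refine setIntegral_congr_set ?_
    rw [cube1, ← pi_univ_Icc, volume_pi]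
    exact Measure.ae_eq_set_pi fun i _ => Ico_ae_eq_Icc
  simp only [this]
  exact continuous_parametric_integral_of_continuous (f := fun s y => g (s, y)) hg isCompact_Icc

def phD (V f : Spc m → ℝ) (s : ℝ) : ℝ := ((∫ y in cube1 m, (pd (e1 m) V (s, y) * grd f (s, y) (e1 m) + f (s, y) * pd (e1 m) (pd (e1 m) V) (s, y))) -
      phiF V f s * ∫ y in cube1 m, grd f (s, y) (e1 m)) / marg f s

lemma phi_c (hV : ContDiff ℝ 2 V) (hp : Per V) {f : Spc m → ℝ} (h : Dat f) : (∀ s, HasDerivAt (phiF V f) (phD V f s) s) ∧ Continuous (phiF V f) ∧ Continuous (phD V f) := by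
  have a : ∀ s, HasDerivAt (phiF V f) (phD V f s) s := fun s => phi_der hV hp h.d1 h.gc h.per (h.mp s).ne'
  have c : Continuous (phiF V f) := continuous_iff_continuousAt.2 fun s => (a s).continuousAt
  refine ⟨a, c, ?_⟩
  have := h.c; have := h.gc; have := pdV_cont hV (e1 m); have := pdpdV_cont hV (e1 m) (e1 m)
  have k1 : Continuous fun x : Spc m => pd (e1 m) V x * grd f x (e1 m) + f x * pd (e1 m) (pd (e1 m) V) x := by fun_prop
  have k2 : Continuous fun x : Spc m => grd f x (e1 m) := by fun_prop
  exact ((marg_cont k1).sub (c.mul (marg_cont k2))).div (marg_cont h.c) fun s => (h.mp s).ne'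

lemma sum_vv {M : Type*} [AddCommMonoid M] (g : Spc m → M) : g (e1 m) + ∑ i, g (eC m i) = ∑ i, g (vv i) := by
  rw [Fin.sum_univ_succ, vv_zero]; simp only [vv_succ]

/-- flux divergence form -/
lemma Rh_eq (hV : ContDiff ℝ 2 V) (hp : Per V) {f : Spc m → ℝ} (h : Dat f) (x : Spc m) : Rh V β f x =
    (∑ i, (β⁻¹ * fderiv ℝ (grd f) x (vv i) (vv i) + (pd (vv i) V x * grd f x (vv i) + f x * pd (vv i) (pd (vv i) V) x))) -
      (phiF V f x.1 * grd f x (vv 0) + f x * phD V f x.1) := by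
  have ee : ∀ v x, pd v (pd v f) x = fderiv ℝ (grd f) x v v := fun v x => by
    have : HasFDerivAt (pd v f) _ x := (h.d2 x).clm_apply (hasFDerivAt_const v x)
    rw [pd_of this]; simp
  rw [Rh, Fop_eq hV hp h.d1 h.gc h.per x (h.mp _).ne', lap, gradDot, lap]
  simp only [ee]
  rw [sum_vv (fun v => fderiv ℝ (grd f) x v v), sum_vv (fun v => pd v V x * pd v f x), sum_vv (fun v => pd v (pd v V) x)]
  rw [vv_zero, phD, Finset.mul_sum, Finset.sum_mul, ← Finset.sum_add_distrib, ← add_sub_assoc, ← Finset.sum_add_distrib] 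
  congr 1
  refine Finset.sum_congr rfl fun i _ => ?_
  simp only [pd, grd]; ring

lemma Rh_int (hV : ContDiff ℝ 2 V) (hp : Per V) {f : Spc m → ℝ} (h : Dat f) : Integrable (Rh V β f) (μT m) := by
  have : Rh V β f = _ := funext fun x => Rh_eq (β := β) hV hp h x
  rw [this]
  obtain ⟨_, p1, p2⟩ := phi_c hV hp h
  have := h.c; have := h.gc
  refine (integrable_finsetSum _ fun i _ => ((h.i2 _).const_mul _).add (ci ?_)).sub (ci ?_)
  · have := pdV_cont hV (vv i); have := pdpdV_cont hV (vv i) (vv i)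
    fun_prop
  · fun_prop

lemma phi_per (hp : Per V) {f : Spc m → ℝ} (h : Per f) (s : ℝ) (k : ℤ) : phiF V f (s + k) = phiF V f s := by
  have e : ∀ y : Fin m → ℝ, ((s + k, y) : Spc m) = (s, y) + lv k 0 := fun y => by ext <;> simp [lv]
  simp only [phiF, marg]
  simp only [e, h k 0 _, hp.pd (e1 m) k 0 _]

lemma ibp (hV : ContDiff ℝ 2 V) (hp : Per V) {f : Spc m → ℝ} (h : Dat f) {Y : Spc m → ℝ} {Y' : Spc m → Spc m →L[ℝ] ℝ}
    (hY : ∀ x, HasFDerivAt Y (Y' x) x) (hYc : Continuous Y') (hYp : Per Y) : ∫ x, Y x * Rh V β f x ∂(μT m) =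
    -∫ x, ((∑ i, Y' x (vv i) * (β⁻¹ * grd f x (vv i) + pd (vv i) V x * f x)) - Y' x (vv 0) * (phiF V f x.1 * f x)) ∂(μT m) := by
  obtain ⟨pD, p1, p2⟩ := phi_c hV hp h
  have c1 := h.c; have c2 := h.gc; have c3 := cont_of_der hY
  have Hy : ∀ g : Spc m → ℝ, Integrable g (μT m) → Integrable (fun x => Y x * g x) (μT m) := fun g hg => by
    obtain ⟨C, _, hC⟩ := hYp.bounded c3
    exact hg.bdd_mul c3.aestronglyMeasurable (Eventually.of_forall hC)
  -- part 1
  have A : ∀ i, Integrable (fun x => Y' x (vv i) * (β⁻¹ * grd f x (vv i) + pd (vv i) V x * f x)) (μT m) ∧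
      Integrable (fun x => Y x * (β⁻¹ * fderiv ℝ (grd f) x (vv i) (vv i) + (pd (vv i) V x * grd f x (vv i) + f x * pd (vv i) (pd (vv i) V) x))) (μT m) ∧
      ∫ x, Y x * (β⁻¹ * fderiv ℝ (grd f) x (vv i) (vv i) + (pd (vv i) V x * grd f x (vv i) + f x * pd (vv i) (pd (vv i) V) x)) ∂(μT m) +
      ∫ x, Y' x (vv i) * (β⁻¹ * grd f x (vv i) + pd (vv i) V x * f x) ∂(μT m) = 0 := fun i => by
    have := pdV_cont hV (vv i); have := pdpdV_cont hV (vv i) (vv i)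
    have i1 : Integrable (fun x => Y' x (vv i) * (β⁻¹ * grd f x (vv i) + pd (vv i) V x * f x)) (μT m) := ci (by fun_prop)
    have i2 : Integrable (fun x => Y x * (β⁻¹ * fderiv ℝ (grd f) x (vv i) (vv i) + (pd (vv i) V x * grd f x (vv i) + f x * pd (vv i) (pd (vv i) V) x))) (μT m) :=
      Hy _ (((h.i2 _).const_mul _).add (ci (by fun_prop)))
    refine ⟨i1, i2, ?_⟩
    rw [← integral_add i2 i1]
    have d : ∀ x, HasFDerivAt (fun x => Y x * (β⁻¹ * grd f x (vv i) + pd (vv i) V x * f x)) _ x := fun x => by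
      have a : HasFDerivAt (fun x => grd f x (vv i)) _ x := (h.d2 x).clm_apply (hasFDerivAt_const (vv i) x)
      exact (hY x).mul ((a.const_mul β⁻¹).add ((pdV_der hV (vv i) x).mul (h.d1 x)))
    have P : Per fun x => Y x * (β⁻¹ * grd f x (vv i) + pd (vv i) V x * f x) := fun k j x => by
      have e1 := h.per.fderiv k j x
      have e2 := hp.pd (vv i) k j x
      simp only [grd]; rw [hYp, e1, e2, h.per]
    have := int_pd_zero i P d (by
      refine (i2.add i1).congr (Eventually.of_forall fun x => ?_)
      simp [pd]; ring)
    rw [← this]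
    refine integral_congr_ae (Eventually.of_forall fun x => ?_)
    simp [pd]; ring
  have B : Integrable (fun x => Y' x (vv 0) * (phiF V f x.1 * f x)) (μT m) ∧ Integrable (fun x => Y x * (phiF V f x.1 * grd f x (vv 0) + f x * phD V f x.1)) (μT m) ∧
    ∫ x, Y x * (phiF V f x.1 * grd f x (vv 0) + f x * phD V f x.1) ∂(μT m) + ∫ x, Y' x (vv 0) * (phiF V f x.1 * f x) ∂(μT m) = 0 := by
    have i1 : Integrable (fun x => Y' x (vv 0) * (phiF V f x.1 * f x)) (μT m) := ci (by fun_prop)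
    have i2 : Integrable (fun x => Y x * (phiF V f x.1 * grd f x (vv 0) + f x * phD V f x.1)) (μT m) := ci (by fun_prop)
    refine ⟨i1, i2, ?_⟩
    rw [← integral_add i2 i1]
    have d : ∀ x, HasFDerivAt (fun x => Y x * (phiF V f x.1 * f x)) _ x := fun x => by
      have a : HasFDerivAt (fun z : Spc m => phiF V f z.1) _ x := (pD x.1).hasFDerivAt.comp x hasFDerivAt_fst
      exact (hY x).mul (a.mul (h.d1 x))
    have P : Per fun x => Y x * (phiF V f x.1 * f x) := fun k j x => by
      have : (x + lv k j).1 = x.1 + k := by simp [lv]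
      simp only [this]; rw [hYp, phi_per hp h.per, h.per]
    have := int_pd_zero 0 P d (by
      refine (i2.add i1).congr (Eventually.of_forall fun x => ?_)
      simp [vv_zero, e1]; ring)
    rw [← this]
    refine integral_congr_ae (Eventually.of_forall fun x => ?_)
    simp [vv_zero, e1]; ring
  have e : ∀ x, Y x * Rh V β f x = (∑ i, Y x * (β⁻¹ * fderiv ℝ (grd f) x (vv i) (vv i) + (pd (vv i) V x * grd f x (vv i) + f x * pd (vv i) (pd (vv i) V) x))) -
      Y x * (phiF V f x.1 * grd f x (vv 0) + f x * phD V f x.1) := fun x => by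
    rw [Rh_eq hV hp h, mul_sub, Finset.mul_sum]
  simp only [e]
  rw [integral_sub (integrable_finsetSum _ fun i _ => (A i).2.1) B.2.1, integral_sub (integrable_finsetSum _ fun i _ => (A i).1) B.1,
    integral_finsetSum _ (fun i _ => (A i).2.1), integral_finsetSum _ (fun i _ => (A i).1)]
  have S := Finset.sum_congr (rfl : (Finset.univ : Finset (Fin (m + 1))) = Finset.univ) fun i _ => (A i).2.2
  rw [Finset.sum_add_distrib, Finset.sum_const_zero] at S
  linarith [B.2.2]
end en

section en2
variable {m : ℕ} {V : Spc m → ℝ} {β σ p : ℝ} {ψ0 : Spc m → ℝ} {Tm : ℝ≥0∞} {ψ : ℝ → Spc m → ℝ}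

lemma zero_of_int {f : Spc m → ℝ} (hc : Continuous f) (h0 : ∀ x, 0 ≤ f x) (hp : Per f) (hi : ∫ x, f x ∂(μT m) ≤ 0) (x : Spc m) : f x = 0 := by
  have a : f =ᵐ[μT m] 0 := (integral_eq_zero_iff_of_nonneg h0 (ci hc)).1 (le_antisymm hi (integral_nonneg h0))
  have b : f =ᵐ[volume.restrict (ccube m)] (fun _ => 0) := by
    rw [← Measure.restrict_congr_set (cube_ae (m := m))]; exact a
  have c := Measure.eqOn_of_ae_eq b hc.continuousOn continuousOn_const (by
    have hI : (interior (ccube m)).Nonempty := by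
      refine ⟨(1 / 2, fun _ => 1 / 2), ?_⟩
      have : Ioo (0:ℝ) 1 ×ˢ (Set.pi univ fun _ : Fin m => Ioo (0:ℝ) 1) ⊆ ccube m := fun x hx =>
        ⟨⟨hx.1.1.le, fun i => (hx.2 i trivial).1.le⟩, ⟨hx.1.2.le, fun i => (hx.2 i trivial).2.le⟩⟩
      refine interior_maximal this (isOpen_Ioo.prod (isOpen_set_pi finite_univ fun _ _ => isOpen_Ioo)) ⟨?_, fun i _ => ?_⟩ <;> constructor <;> norm_num
    rw [ccube, (convex_Icc (𝕜 := ℝ) (0 : Spc m) 1).closure_interior_eq_closure_of_nonempty_interior hI]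
    exact subset_closure)
  obtain ⟨k, j, hx⟩ := exists_lv x
  rw [← hp k j x]
  exact c (cube_sub hx)

lemma mem_small {t : ℝ} (ht : t ∈ Ioo0 Tm) : ∀ᶠ s in nhds t, s ∈ Ioo0 Tm := by
  have h1 : ∀ᶠ s in nhds t, 0 < s := lt_mem_nhds ht.1
  have h2 : ∀ᶠ s in nhds t, ENNReal.ofReal s < Tm := ENNReal.continuous_ofReal.continuousAt.eventually (gt_mem_nhds ht.2)
  filter_upwards [h1, h2] with s a b using ⟨a, b⟩

lemma sdat (hp : 1 ≤ p) (hs : IsLpSolution V β σ p ψ0 Tm ψ) {t : ℝ} (ht : t ∈ Ioo0 Tm) : Dat (ψ t) := Dat.of hp (hs.regW2 t ht) (hs.regD t ht).2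

lemma scont (hp : 1 ≤ p) (hs : IsLpSolution V β σ p ψ0 Tm ψ) (h0 : Continuous ψ0) {t : ℝ} (ht : t ∈ Ico0 Tm) : Continuous (ψ t) := by
  rcases ht.1.eq_or_lt with h | h
  · rw [← h, show ψ 0 = ψ0 from funext hs.init]; exact h0
  · exact (sdat hp hs ⟨h, ht.2⟩).c

lemma sper (hs : IsLpSolution V β σ p ψ0 Tm ψ) (h0 : Per ψ0) {t : ℝ} (ht : t ∈ Ico0 Tm) : Per (ψ t) := by
  rcases ht.1.eq_or_lt with h | h
  · rw [← h, show ψ 0 = ψ0 from funext hs.init]; exact h0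
  · exact per_iff.1 (hs.regW2 t ⟨h, ht.2⟩).1

lemma bmul {Z g : Spc m → ℝ} {C : ℝ} (hZ : AEStronglyMeasurable Z (μT m)) (hC : ∀ x, |Z x| ≤ C) (hg : Integrable g (μT m)) : Integrable (fun x => Z x * g x) (μT m) :=
  hg.bdd_mul hZ (Eventually.of_forall hC)

lemma test_lim (hV : ContDiff ℝ 2 V) (hpV : Per V) (hp : 1 ≤ p) (hs : IsLpSolution V β σ p ψ0 Tm ψ) {t : ℝ} (ht : t ∈ Ioo0 Tm) {Z : Spc m → ℝ} {C : ℝ}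
    (hZ : AEStronglyMeasurable Z (μT m)) (hC : ∀ x, |Z x| ≤ C) :
    Tendsto (fun h => ∫ x, Z x * ((ψ (t + h) x - ψ t x) / h) ∂(μT m)) (nhdsWithin 0 {h | h ≠ 0}) (nhds (∫ x, Z x * Rh V β (ψ t) x ∂(μT m))) := by
  have C0 : 0 ≤ C := (abs_nonneg _).trans (hC 0)
  have e := hs.eqn t ht
  have ev : ∀ᶠ h in nhdsWithin (0:ℝ) {h | h ≠ 0}, t + h ∈ Ioo0 Tm := by
    have : Tendsto (fun h : ℝ => t + h) (nhdsWithin (0:ℝ) {h | h ≠ 0}) (nhds t) := by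
      have := (by fun_prop : Continuous fun h : ℝ => t + h).tendsto 0
      rw [add_zero] at this
      exact this.mono_left nhdsWithin_le_nhds
    exact this.eventually (mem_small ht)
  have e2 := (ENNReal.tendsto_toReal ENNReal.zero_ne_top).comp e
  have e3 := e2.const_mul C
  simp only [ENNReal.toReal_zero, mul_zero] at e3
  rw [tendsto_iff_norm_sub_tendsto_zero]
  have ft : ∀ᶠ h in nhdsWithin (0:ℝ) {h | h ≠ 0}, LpN p (fun x => (ψ (t + h) x - ψ t x) / h - (β⁻¹ * lap (ψ t) x + Fop V (ψ t) x)) < 1 :=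
    e.eventually (gt_mem_nhds one_pos)
  refine squeeze_zero' (Eventually.of_forall fun h => norm_nonneg _) ?_ e3
  filter_upwards [ev, ft] with h h1 h2
  have i1 : Integrable (fun x => (ψ (t + h) x - ψ t x) / h) (μT m) := ((ci (sdat hp hs h1).c).sub (ci (sdat hp hs ht).c)).div_const _
  have i2 := Rh_int (β := β) hV hpV (sdat hp hs ht)
  rw [← integral_sub (bmul hZ hC i1) (bmul hZ hC i2)]
  have i3 := i1.sub i2
  calc _ ≤ ∫ x, C * |(ψ (t + h) x - ψ t x) / h - Rh V β (ψ t) x| ∂(μT m) := by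
        refine norm_integral_le_of_norm_le (i3.abs.const_mul C) (Eventually.of_forall fun x => ?_)
        rw [← mul_sub, norm_mul]
        exact mul_le_mul_of_nonneg_right (hC x) (abs_nonneg _)
    _ = C * ∫ x, |(ψ (t + h) x - ψ t x) / h - Rh V β (ψ t) x| ∂(μT m) := integral_const_mul _ _
    _ ≤ _ := by
        refine mul_le_mul_of_nonneg_left ?_ C0
        have := ofReal_int_le hp i3
        exact (ENNReal.ofReal_le_iff_le_toReal (h2.trans ENNReal.one_lt_top).ne).1 this

lemma lp_cont (hp : 1 ≤ p) {S : Set ℝ} {d : ℝ → Spc m → ℝ} (hd : ContW 0 p S d) (hc : ∀ t ∈ S, Continuous (d t)) {N : ℝ → ℝ}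
    (hN : ∀ t ∈ S, ∃ K, 0 ≤ K ∧ ∀ s ∈ S, |N s - N t| ≤ K * (∫ x, |d s x - d t x| ∂(μT m)) + ((LpN p fun x => d s x - d t x).toReal) ^ 2) : ContinuousOn N S := by
  rw [Metric.continuousOn_iff]
  intro t ht ε hε
  obtain ⟨K, hK, h⟩ := hN t ht
  obtain ⟨η, hη, h1, h2⟩ : ∃ η > 0, η ≤ 1 ∧ (K + 1) * η ≤ ε := ⟨min 1 (ε / (K + 1)), by positivity, min_le_left _ _, by
    calc _ ≤ (K + 1) * (ε / (K + 1)) := by gcongr; exact min_le_right _ _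
      _ = ε := by field_simp⟩
  obtain ⟨δ, hδ, hh⟩ := hd t ht η hη
  refine ⟨δ, hδ, fun s hs hst => ?_⟩
  have a := hh s hs hst
  rw [Wn0 le_rfl] at a
  have b := (ofReal_int_le hp (ci ((hc s hs).sub (hc t ht)))).trans_lt a
  rw [ENNReal.ofReal_lt_ofReal_iff hη] at b
  have c := (ENNReal.toReal_lt_of_lt_ofReal a)
  have c0 : 0 ≤ (LpN p fun x => d s x - d t x).toReal := ENNReal.toReal_nonneg
  rw [Real.dist_eq]
  simp only [Pi.sub_apply] at b
  have := mul_le_mul_of_nonneg_left b.le hK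
  nlinarith [h s hs]

lemma contW_sub {S : Set ℝ} (hp : 1 ≤ p) {d d' : ℝ → Spc m → ℝ} (h : ContW 0 p S d) (h' : ContW 0 p S d') (hc : ∀ t ∈ S, Continuous (d t)) (hc' : ∀ t ∈ S, Continuous (d' t)) :
    ContW 0 p S (fun t x => d' t x - d t x) := by
  intro t ht ε hε
  obtain ⟨δ, hδ, a⟩ := h t ht (ε / 2) (by positivity)
  obtain ⟨δ', hδ', a'⟩ := h' t ht (ε / 2) (by positivity)
  refine ⟨min δ δ', lt_min hδ hδ', fun s hs hst => ?_⟩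
  have b := a s hs (hst.trans_le (min_le_left _ _)); have b' := a' s hs (hst.trans_le (min_le_right _ _))
  rw [Wn0 le_rfl] at b b' ⊢
  have : (fun x => d' s x - d s x - (d' t x - d t x)) = (fun x => d' s x - d' t x) - fun x => d s x - d t x := by ext x; simp; ring
  rw [this]
  refine (eLpNorm_sub_le ((hc' s hs).sub (hc' t ht)).aestronglyMeasurable ((hc s hs).sub (hc t ht)).aestronglyMeasurable ?_).trans_lt ?_
  · rw [← ENNReal.ofReal_one]; exact ENNReal.ofReal_le_ofReal hp
  · rw [show ε = ε / 2 + ε / 2 by ring, ENNReal.ofReal_add (by positivity) (by positivity)]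
    exact ENNReal.add_lt_add b' b

lemma sgn_ineq (a b : ℝ) : |a| - |b| ≤ Real.sign a * (a - b) := by
  rcases lt_trichotomy a 0 with h | h | h
  · rw [Real.sign_of_neg h, abs_of_neg h]; linarith [neg_abs_le b]
  · simp [h]
  · rw [Real.sign_of_pos h, abs_of_pos h]; linarith [le_abs_self b]

lemma sgn_le (a : ℝ) : |Real.sign a| ≤ 1 := by
  rcases Real.sign_apply_eq a with h | h | h <;> simp [h]

lemma sgn_tend (a : ℝ) : Tendsto (fun n : ℕ => 2 / Real.pi * Real.arctan (n * a)) atTop (nhds (Real.sign a)) := by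
  have pp := Real.pi_pos
  have e : 2 / Real.pi * (Real.pi / 2) = 1 := by field_simp
  rcases lt_trichotomy a 0 with h | h | h
  · rw [Real.sign_of_neg h]
    have : Tendsto (fun n : ℕ => (n : ℝ) * a) atTop atBot := tendsto_natCast_atTop_atTop.atTop_mul_const_of_neg h
    have := ((Real.tendsto_arctan_atBot.mono_right nhdsWithin_le_nhds).comp this).const_mul (2 / Real.pi)
    rwa [show 2 / Real.pi * -(Real.pi / 2) = -1 by rw [mul_neg, e]] at this
  · simp [h]
  · rw [Real.sign_of_pos h]
    have : Tendsto (fun n : ℕ => (n : ℝ) * a) atTop atTop := tendsto_natCast_atTop_atTop.atTop_mul_const h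
    have := ((Real.tendsto_arctan_atTop.mono_right nhdsWithin_le_nhds).comp this).const_mul (2 / Real.pi)
    rwa [e] at this

lemma atn_le (a : ℝ) : |2 / Real.pi * Real.arctan a| ≤ 1 := by
  have pp := Real.pi_pos
  rw [abs_mul, abs_of_pos (by positivity), div_mul_eq_mul_div, div_le_one pp]
  linarith [abs_le.2 ⟨(Real.neg_pi_div_two_lt_arctan a).le, (Real.arctan_lt_pi_div_two a).le⟩]

lemma sgn_meas {f : Spc m → ℝ} (hf : Continuous f) : AEStronglyMeasurable (fun x => Real.sign (f x)) (μT m) :=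
  aestronglyMeasurable_of_tendsto_ae atTop (f := fun (n : ℕ) x => 2 / Real.pi * Real.arctan (n * f x))
    (fun n => (by fun_prop : Continuous fun x => 2 / Real.pi * Real.arctan (n * f x)).aestronglyMeasurable) (Eventually.of_forall fun x => sgn_tend _)

lemma sgn_lim {f g : Spc m → ℝ} (hf : Continuous f) (hg : Integrable g (μT m)) {C : ℝ} (h : ∀ n : ℕ, 0 < n → ∫ x, (2 / Real.pi * Real.arctan (n * f x)) * g x ∂(μT m) ≤ C / n) :
    ∫ x, Real.sign (f x) * g x ∂(μT m) ≤ 0 := by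
  have a : Tendsto (fun n : ℕ => ∫ x, (2 / Real.pi * Real.arctan (n * f x)) * g x ∂(μT m)) atTop (nhds (∫ x, Real.sign (f x) * g x ∂(μT m))) := by
    refine tendsto_integral_of_dominated_convergence (fun x => ‖g x‖) (fun n => ?_) hg.norm (fun n => Eventually.of_forall fun x => ?_) (Eventually.of_forall fun x => (sgn_tend _).mul_const _)
    · exact (by fun_prop : Continuous fun x => 2 / Real.pi * Real.arctan (n * f x)).aestronglyMeasurable.mul hg.1
    · rw [norm_mul]; exact mul_le_of_le_one_left (norm_nonneg _) (atn_le _)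
  have b : Tendsto (fun n : ℕ => C / n) atTop (nhds 0) := tendsto_const_div_atTop_nhds_zero_nat C
  refine le_of_tendsto_of_tendsto a b ?_
  filter_upwards [eventually_gt_atTop 0] with n hn using h n hn

lemma atn_der {f : Spc m → ℝ} {f' : Spc m →L[ℝ] ℝ} {x : Spc m} (h : HasFDerivAt f f' x) (n : ℕ) :
    HasFDerivAt (fun x => 2 / Real.pi * Real.arctan (n * f x)) ((2 / Real.pi * (n / (1 + (n * f x) ^ 2))) • f') x := by
  have := ((h.const_mul (n : ℝ)).arctan).const_mul (2 / Real.pi)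
  refine this.congr_fderiv ?_
  simp only [smul_smul]; congr 1; ring

lemma phi_bdd (hV : ContDiff ℝ 2 V) (hp : Per V) {f : Spc m → ℝ} (h : Dat f) : ∃ C, 0 ≤ C ∧ ∀ s, |phiF V f s| ≤ C := by
  have P : Per fun x : Spc m => phiF V f x.1 := fun k j x => by
    have : (x + lv k j).1 = x.1 + k := by simp [lv]
    simp only [this]; exact phi_per hp h.per _ _
  obtain ⟨C, h0, hC⟩ := P.bounded ((phi_c hV hp h).2.1.comp continuous_fst)
  exact ⟨C, h0, fun s => hC (s, 0)⟩

lemma V_bdd (hV : ContDiff ℝ 2 V) (hp : Per V) : ∃ K, 0 ≤ K ∧ ∀ i x, |pd (vv (m := m) i) V x| ≤ K := by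
  choose C h0 hC using fun i => (hp.pd (vv (m := m) i)).bounded (pdV_cont hV (vv i))
  exact ⟨∑ i, C i, Finset.sum_nonneg fun i _ => h0 i, fun i x => (hC i x).trans (Finset.single_le_sum (f := C) (fun i _ => h0 i) (Finset.mem_univ i))⟩

lemma young {β g b : ℝ} (hβ : 0 < β) : -(g * (β⁻¹ * g + b)) ≤ β / 4 * b ^ 2 := by
  have : β / 4 * b ^ 2 + g * (β⁻¹ * g + b) = β⁻¹ * (g + β / 2 * b) ^ 2 := by field_simp; ring
  have h : 0 ≤ β⁻¹ * (g + β / 2 * b) ^ 2 := by positivity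
  linarith

lemma intle {F G : Spc m → ℝ} (hG : Integrable G (μT m)) (h0 : 0 ≤ ∫ x, G x ∂(μT m)) (h : ∀ x, F x ≤ G x) : ∫ x, F x ∂(μT m) ≤ ∫ x, G x ∂(μT m) := by
  by_cases hF : Integrable F (μT m)
  · exact integral_mono hF hG h
  · rw [integral_undef hF]; exact h0

lemma absint {F G : Spc m → ℝ} (hG : Integrable G (μT m)) (h : ∀ x, |F x| ≤ G x) : |∫ x, F x ∂(μT m)| ≤ ∫ x, G x ∂(μT m) :=
  (norm_integral_le_of_norm_le (f := F) hG (Eventually.of_forall h) : _)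

lemma sum_alg (a b : Fin (m + 1) → ℝ) (c : ℝ) : (∑ i, a i * b i) - a 0 * c = ∑ i, a i * (b i - if i = 0 then c else 0) := by
  simp [mul_sub, Finset.sum_sub_distrib]

lemma sgn_Rh (hV : ContDiff ℝ 2 V) (hp : Per V) (hβ : 0 < β) {f : Spc m → ℝ} (h : Dat f) : ∫ x, Real.sign (f x) * Rh V β f x ∂(μT m) ≤ 0 := by
  obtain ⟨C, C0, hC⟩ := phi_bdd hV hp h
  obtain ⟨K, K0, hK⟩ := V_bdd hV hp
  have hc := h.c; have hg := h.gc
  refine sgn_lim hc (Rh_int hV hp h) (C := ((m:ℝ) + 1) * (2 / Real.pi * (β / 4 * (K + C) ^ 2))) fun n hn => ?_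
  have hn' : (0:ℝ) < n := by exact_mod_cast hn
  have ne : ∀ x, 1 + (n * f x) ^ 2 ≠ 0 := fun x => by positivity
  rw [ibp hV hp h (fun x => atn_der (h.d1 x) n) (by fun_prop (disch := exact ne _)) (fun k j x => by simp only [h.per k j x]), ← integral_neg]
  have : (((m:ℝ) + 1) * (2 / Real.pi * (β / 4 * (K + C) ^ 2))) / n = ∫ x : Spc m, (((m:ℝ) + 1) * (2 / Real.pi * (β / 4 * (K + C) ^ 2))) / n ∂(μT m) := by simp
  rw [this]
  refine intle (integrable_const _) (by simp; positivity) fun x => ?_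
  set r := f x
  have key : ∀ i, -(grd f x (vv i) * (β⁻¹ * grd f x (vv i) + pd (vv i) V x * r - if i = 0 then phiF V f x.1 * r else 0)) ≤ β / 4 * (K + C) ^ 2 * r ^ 2 := fun i => by
    have hb : |pd (vv i) V x - if i = 0 then phiF V f x.1 else 0| ≤ K + C := by
      refine (abs_sub _ _).trans (add_le_add (hK i x) ?_)
      split_ifs
      · exact hC _
      · simpa using C0
    have e : β⁻¹ * grd f x (vv i) + pd (vv i) V x * r - (if i = 0 then phiF V f x.1 * r else 0) = β⁻¹ * grd f x (vv i) + (pd (vv i) V x - if i = 0 then phiF V f x.1 else 0) * r := by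
      split_ifs <;> ring
    rw [e]
    refine (young hβ).trans ?_
    rw [mul_pow, mul_assoc]
    have := sq_le_sq' (abs_le.1 hb).1 (abs_le.1 hb).2
    gcongr
  have c0 : 0 ≤ 2 / Real.pi * (n / (1 + (n * r) ^ 2)) := by have := Real.pi_pos; positivity
  simp only [ContinuousLinearMap.smul_apply, smul_eq_mul]
  rw [sum_alg (fun i => 2 / Real.pi * (n / (1 + (n * r) ^ 2)) * grd f x (vv i)) (fun i => β⁻¹ * grd f x (vv i) + pd (vv i) V x * r), ← Finset.sum_neg_distrib]
  calc _ ≤ ∑ i : Fin (m + 1), 2 / Real.pi * (n / (1 + (n * r) ^ 2)) * (β / 4 * (K + C) ^ 2 * r ^ 2) := by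
        refine Finset.sum_le_sum fun i _ => ?_
        rw [mul_assoc, ← mul_neg]
        exact mul_le_mul_of_nonneg_left (key i) c0
    _ = (((m:ℝ) + 1) * (2 / Real.pi * (β / 4 * (K + C) ^ 2))) * (n * r ^ 2 / (1 + (n * r) ^ 2)) := by
        rw [Finset.sum_const, Finset.card_univ, Fintype.card_fin, nsmul_eq_mul]; push_cast; ring
    _ ≤ (((m:ℝ) + 1) * (2 / Real.pi * (β / 4 * (K + C) ^ 2))) * (1 / n) := by
        have := Real.pi_pos
        refine mul_le_mul_of_nonneg_left ?_ (by positivity)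
        rw [div_le_div_iff₀ (by positivity) hn']; nlinarith
    _ = _ := by ring

lemma neg_mul_sub (a b c : ℝ) (hb : b ≠ 0) : a * c = -b * (a * (-c / b)) := by field_simp

lemma dini_L1 (hV : ContDiff ℝ 2 V) (hpV : Per V) (hp : 1 ≤ p) (hs : IsLpSolution V β σ p ψ0 Tm ψ) {t : ℝ} (ht : t ∈ Ioo0 Tm) {Z : Spc m → ℝ} {C : ℝ}
    (hZ : AEStronglyMeasurable Z (μT m)) (hC : ∀ x, |Z x| ≤ C) {N : ℝ → ℝ} {l : ℝ} (hN : ∀ s, s ∈ Ioo0 Tm → N t - N s ≤ ∫ x, Z x * (ψ t x - ψ s x) ∂(μT m))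
    (hl : ∫ x, Z x * Rh V β (ψ t) x ∂(μT m) ≤ l) :
    ∃ (L : ℝ → ℝ) (l' : ℝ), (∀ᶠ s in nhdsWithin t (Iio t), N t - N s ≤ (t - s) * L (s - t)) ∧ l' ≤ l ∧ Tendsto L (nhdsWithin 0 {h | h ≠ 0}) (nhds l') := by
  refine ⟨_, _, ?_, hl, test_lim hV hpV hp hs ht hZ hC⟩
  have := (mem_small ht).filter_mono (nhdsWithin_le_nhds (s := Iio t))
  filter_upwards [this, self_mem_nhdsWithin] with s h1 h2
  have h2 : s < t := h2
  refine (hN s h1).trans_eq ?_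
  rw [← integral_const_mul]
  refine integral_congr_ae (Eventually.of_forall fun x => ?_)
  have : s - t ≠ 0 := by linarith
  simp only [add_sub_cancel]
  field_simp; ring

lemma Ico_of {b t : ℝ} (hb : ENNReal.ofReal b < Tm) (h0 : 0 ≤ t) (h : t ≤ b) : t ∈ Ico0 Tm := ⟨h0, (ENNReal.ofReal_le_ofReal h).trans_lt hb⟩

lemma contW_mono {S S' : Set ℝ} {d : ℝ → Spc m → ℝ} (h : ContW σ p S d) (hS : S' ⊆ S) : ContW σ p S' d := fun t ht ε hε => by
  obtain ⟨δ, a, b⟩ := h t (hS ht) ε hε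
  exact ⟨δ, a, fun s hs => b s (hS hs)⟩

lemma mass (hV : ContDiff ℝ 2 V) (hpV : Per V) (hβ : 0 < β) (hp : 1 ≤ p) (hs : IsLpSolution V β σ p ψ0 Tm ψ) (h0 : Continuous ψ0) {b : ℝ} (hb : b ∈ Ico0 Tm) :
    ∫ x, ψ b x ∂(μT m) = ∫ x, ψ0 x ∂(μT m) ∧ ∫ x, |ψ b x| ∂(μT m) ≤ ∫ x, |ψ0 x| ∂(μT m) := by
  rcases hb.1.eq_or_lt with h | h
  · rw [← h, show ψ 0 = ψ0 from funext hs.init]; simp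
  have I : ∀ t ∈ Icc 0 b, t ∈ Ico0 Tm := fun t ht => Ico_of hb.2 ht.1 ht.2
  have cW := contW_mono hs.contLp I
  have cc : ∀ t ∈ Ico0 Tm, Continuous (ψ t) := fun t ht => scont hp hs h0 ht
  have I' : ∀ s ∈ Ioo0 Tm, s ∈ Ico0 Tm := fun s hs => ⟨hs.1.le, hs.2⟩
  have key : ∀ c : ℝ, |c| ≤ 1 → ∫ x, c * ψ b x ∂(μT m) ≤ ∫ x, c * ψ0 x ∂(μT m) := fun c hc => by
    have := dini (N := fun t => ∫ x, c * ψ t x ∂(μT m)) h le_rfl ?_ fun t t0 tb => ?_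
    · simpa [hs.init] using this
    · refine lp_cont hp cW (fun t ht => cc t (I t ht)) fun t ht => ⟨1, zero_le_one, fun s hs => ?_⟩
      rw [← integral_sub ((ci (cc s (I s hs))).const_mul c) ((ci (cc t (I t ht))).const_mul c), one_mul]
      refine le_add_of_le_of_nonneg ?_ (by positivity)
      refine absint (ci ((cc s (I s hs)).sub (cc t (I t ht)))).abs fun x => ?_
      rw [← mul_sub, abs_mul]; exact mul_le_of_le_one_left (abs_nonneg _) hc
    · have ht : t ∈ Ioo0 Tm := ⟨t0, (I t ⟨t0.le, tb⟩).2⟩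
      refine dini_L1 hV hpV hp hs ht (N := fun t => ∫ x, c * ψ t x ∂(μT m)) (Z := fun _ => c) (C := 1) (by fun_prop) (fun _ => hc) (fun s hs' => ?_) ?_
      · rw [← integral_sub ((ci (cc t (I' t ht))).const_mul c) ((ci (cc s (I' s hs'))).const_mul c)]
        simp [mul_sub]
      · rw [ibp hV hpV (sdat hp hs ht) (fun x => hasFDerivAt_const c x) continuous_const (fun _ _ _ => rfl)]
        simp
  constructor
  · have a := key 1 (by simp); have b := key (-1) (by simp)
    simp only [one_mul, neg_mul, integral_neg] at a b
    linarith
  · have := dini (N := fun t => ∫ x, |ψ t x| ∂(μT m)) h le_rfl ?_ fun t t0 tb => ?_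
    · simpa [hs.init] using this
    · refine lp_cont hp cW (fun t ht => cc t (I t ht)) fun t ht => ⟨1, zero_le_one, fun s hs => ?_⟩
      rw [← integral_sub (ci (cc s (I s hs))).abs (ci (cc t (I t ht))).abs, one_mul]
      refine le_add_of_le_of_nonneg ?_ (by positivity)
      refine absint (ci ((cc s (I s hs)).sub (cc t (I t ht)))).abs fun x => ?_
      exact abs_abs_sub_abs_le_abs_sub _ _
    · have ht : t ∈ Ioo0 Tm := ⟨t0, (I t ⟨t0.le, tb⟩).2⟩
      refine dini_L1 hV hpV hp hs ht (N := fun t => ∫ x, |ψ t x| ∂(μT m)) (Z := fun x => Real.sign (ψ t x)) (C := 1) (sgn_meas (cc t (I' t ht))) (fun _ => sgn_le _) (fun s hs' => ?_) ?_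
      · have j1 := ci (cc t (I' t ht)); have j2 := ci (cc s (I' s hs'))
        rw [← integral_sub j1.abs j2.abs]
        refine integral_mono (j1.abs.sub j2.abs) (bmul (C := 1) (sgn_meas (cc t (I' t ht))) (fun _ => sgn_le _) (j1.sub j2)) fun x => sgn_ineq _ _
      · rw [zero_mul]; exact sgn_Rh hV hpV hβ (sdat hp hs ht)

lemma nonneg (hV : ContDiff ℝ 2 V) (hpV : Per V) (hβ : 0 < β) (hp : 1 ≤ p) (hs : IsLpSolution V β σ p ψ0 Tm ψ) (h0 : Continuous ψ0) (hp0 : Per ψ0) (hn : ∀ x, 0 ≤ ψ0 x)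
    {b : ℝ} (hb : b ∈ Ico0 Tm) (x : Spc m) : 0 ≤ ψ b x := by
  obtain ⟨a, c⟩ := mass hV hpV hβ hp hs h0 hb
  have cc := scont hp hs h0 hb
  have := zero_of_int (f := fun x => |ψ b x| - ψ b x) (by fun_prop) (fun x => sub_nonneg.2 (le_abs_self _)) (fun k j x => by simp only [sper hs hp0 hb k j x]) (by
    rw [integral_sub (ci cc).abs (ci cc), a]
    simp only [abs_of_nonneg (hn _)] at c; linarith) x
  have := abs_nonneg (ψ b x); linarith

end en2

section en3
variable {m : ℕ} {V : Spc m → ℝ} {β σ p : ℝ} {ψ0 : Spc m → ℝ} {Tm Tm' : ℝ≥0∞} {ψ ψ' : ℝ → Spc m → ℝ}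

lemma muT_prod : μT m = (volume.restrict (Ico (0:ℝ) 1)).prod (volume.restrict (cube1 m)) := by
  rw [Measure.prod_restrict]; rfl

lemma marg_int {Z : ℝ → ℝ} {C : ℝ} (hZ : Measurable Z) (hC : ∀ s, |Z s| ≤ C) {f : Spc m → ℝ} (hf : Continuous f) :
    ∫ x, Z x.1 * f x ∂(μT m) = ∫ x, Z x.1 * marg f x.1 ∂(μT m) := by
  have mZ : AEStronglyMeasurable (fun x : Spc m => Z x.1) (μT m) := (hZ.comp measurable_fst).aestronglyMeasurable
  have i1 := bmul mZ (fun x => hC x.1) (ci hf)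
  have i2 := bmul mZ (fun x => hC x.1) (ci ((marg_cont hf).comp continuous_fst))
  rw [muT_prod] at i1 i2 ⊢
  rw [integral_prod _ i1]
  have i2 : Integrable (fun x : Spc m => Z x.1 * marg f x.1) ((volume.restrict (Ico (0:ℝ) 1)).prod (volume.restrict (cube1 m))) := i2
  rw [integral_prod _ i2]
  refine integral_congr_ae (Eventually.of_forall fun s => ?_)
  simp only [integral_const_mul, marg]
  rw [integral_const, volR_cube1, one_smul]

lemma mcont {f : Spc m → ℝ} (hf : Continuous f) : Continuous (marg f) := marg_cont hf
lemma mcont' {f : Spc m → ℝ} (hf : Continuous f) : Continuous fun x : Spc m => marg f x.1 := (marg_cont hf).comp continuous_fst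

lemma marg_per {f : Spc m → ℝ} (h : Per f) (s : ℝ) (k : ℤ) : marg f (s + k) = marg f s := by
  have e : ∀ y : Fin m → ℝ, ((s + k, y) : Spc m) = (s, y) + lv k 0 := fun y => by ext <;> simp [lv]
  simp only [marg, e, h k 0 _]

lemma per1 {w : ℝ → ℝ} (h : ∀ s (k : ℤ), w (s + k) = w s) : Per fun x : Spc m => w x.1 := fun k j x => by
  have : (x + lv k j).1 = x.1 + k := by simp [lv]
  simp only [this, h]

lemma marg_sub {f g : Spc m → ℝ} (hf : Continuous f) (hg : Continuous g) (s : ℝ) : marg (fun x => f x - g x) s = marg f s - marg g s := by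
  have I : ∀ f : Spc m → ℝ, Continuous f → Integrable (fun y => f (s, y)) (volume.restrict (cube1 m)) := fun f hf => by
    have : IntegrableOn (fun y => f (s, y)) (Icc (0 : Fin m → ℝ) 1) := (by fun_prop : Continuous fun y => f (s, y)).continuousOn.integrableOn_compact isCompact_Icc
    refine this.mono_set fun y hy => ⟨fun i => (hy i trivial).1, fun i => (hy i trivial).2.le⟩
  exact integral_sub (I f hf) (I g hg)

lemma c1_int {f : Spc m → ℝ} (hf : Continuous f) (s : ℝ) : Integrable (fun y => f (s, y)) (volume.restrict (cube1 m)) := by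
  have : IntegrableOn (fun y => f (s, y)) (Icc (0 : Fin m → ℝ) 1) := (by fun_prop : Continuous fun y => f (s, y)).continuousOn.integrableOn_compact isCompact_Icc
  exact this.mono_set fun y hy => ⟨fun i => (hy i trivial).1, fun i => (hy i trivial).2.le⟩

lemma sign_meas : Measurable Real.sign :=
  measurable_of_tendsto_metrizable (f := fun (n : ℕ) a => 2 / Real.pi * Real.arctan (n * a)) (fun n => (by fun_prop : Continuous fun a : ℝ => 2 / Real.pi * Real.arctan (n * a)).measurable)
    (tendsto_pi_nhds.2 sgn_tend)

lemma ibp1 (hV : ContDiff ℝ 2 V) (hp : Per V) {f : Spc m → ℝ} (h : Dat f) {y y' : ℝ → ℝ} (hy : ∀ s, HasDerivAt y (y' s) s) (hc : Continuous y') (hper : ∀ s (k : ℤ), y (s + k) = y s) :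
    ∫ x : Spc m, y x.1 * Rh V β f x ∂(μT m) = -(β⁻¹ * ∫ x : Spc m, y' x.1 * marg (fun x => grd f x (e1 m)) x.1 ∂(μT m)) := by
  have hf := h.c; have hg := h.gc; have hphi := (phi_c hV hp h).2.1; have hv := pdV_cont hV (e1 m)
  have d : ∀ x : Spc m, HasFDerivAt (fun x : Spc m => y x.1) (y' x.1 • ContinuousLinearMap.fst ℝ ℝ (Fin m → ℝ)) x := fun x =>
    (hy x.1).comp_hasFDerivAt x hasFDerivAt_fst
  rw [ibp hV hp h d (by fun_prop) (per1 hper)]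
  have e : ∀ x : Spc m, (∑ i, (y' x.1 • ContinuousLinearMap.fst ℝ ℝ (Fin m → ℝ)) (vv i) * (β⁻¹ * grd f x (vv i) + pd (vv i) V x * f x)) -
      (y' x.1 • ContinuousLinearMap.fst ℝ ℝ (Fin m → ℝ)) (vv 0) * (phiF V f x.1 * f x) =
      y' x.1 * (β⁻¹ * grd f x (e1 m) + pd (e1 m) V x * f x - phiF V f x.1 * f x) := fun x => by
    rw [Fin.sum_univ_succ]
    simp only [vv_zero, vv_succ]
    simp [e1, eC]; ring
  simp only [e]
  -- bounded y'
  have yp : Per fun x : Spc m => y' x.1 := fun k j x => by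
    have : HasDerivAt y (y' (x.1 + k)) x.1 := by
      have := (hy (x.1 + k)).comp_add_const x.1 (k : ℝ)
      refine this.congr_of_eventuallyEq (Eventually.of_forall fun s => (hper s k).symm)
    have e : (x + lv k j).1 = x.1 + k := by simp [lv]
    simp only [e]; exact this.unique (hy x.1)
  obtain ⟨C, _, hC⟩ := yp.bounded (by fun_prop)
  rw [marg_int hc.measurable (fun s => hC (s, 0)) (by fun_prop), ← integral_const_mul]
  congr 1
  refine integral_congr_ae (Eventually.of_forall fun x => ?_)
  have i1 := c1_int (by fun_prop : Continuous fun x : Spc m => β⁻¹ * grd f x (e1 m)) x.1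
  have i2 := c1_int (by fun_prop : Continuous fun x : Spc m => pd (e1 m) V x * f x) x.1
  have i3 := c1_int (by fun_prop : Continuous fun z : Spc m => phiF V f x.1 * f z) x.1
  simp only [marg]
  have : ∫ y in cube1 m, (β⁻¹ * grd f (x.1, y) (e1 m) + pd (e1 m) V (x.1, y) * f (x.1, y) - phiF V f x.1 * f (x.1, y)) =
      β⁻¹ * ∫ y in cube1 m, grd f (x.1, y) (e1 m) := by
    have i12 : Integrable (fun y => β⁻¹ * grd f (x.1, y) (e1 m) + pd (e1 m) V (x.1, y) * f (x.1, y)) (volume.restrict (cube1 m)) := i1.add i2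
    rw [integral_sub i12 i3, integral_add i1 i2, integral_const_mul, integral_const_mul]
    have := (h.mp x.1).ne'
    simp only [phiF]; simp only [marg] at this ⊢; field_simp; ring
  rw [this]; ring

lemma md_der {f : Spc m → ℝ} (h : Dat f) (s : ℝ) : HasDerivAt (marg f) (marg (fun x => grd f x (e1 m)) s) s := marg_der h.d1 h.gc h.per s

lemma ibp_atn (hV : ContDiff ℝ 2 V) (hp : Per V) {f : Spc m → ℝ} (h : Dat f) {w w' : ℝ → ℝ} (hw : ∀ s, HasDerivAt w (w' s) s) (hc : Continuous w') (hper : ∀ s (k : ℤ), w (s + k) = w s) (n : ℕ) :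
    ∫ x : Spc m, (2 / Real.pi * Real.arctan (n * w x.1)) * Rh V β f x ∂(μT m) =
      -(β⁻¹ * ∫ x : Spc m, (2 / Real.pi * (n / (1 + (n * w x.1) ^ 2))) * w' x.1 * marg (fun x => grd f x (e1 m)) x.1 ∂(μT m)) := by
  have ne : ∀ x, 1 + (n * w x) ^ 2 ≠ 0 := fun x => by positivity
  have cw : Continuous w := continuous_iff_continuousAt.2 fun s => (hw s).continuousAt
  refine ibp1 hV hp h (y := fun s => 2 / Real.pi * Real.arctan (n * w s)) (y' := fun s => (2 / Real.pi * (n / (1 + (n * w s) ^ 2))) * w' s) (fun s => ?_)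
    (by fun_prop (disch := exact ne _)) (fun s k => by simp only [hper s k])
  have := (((hw s).const_mul (n : ℝ)).arctan).const_mul (2 / Real.pi)
  refine this.congr_deriv ?_
  ring

lemma dini_L2 (hV : ContDiff ℝ 2 V) (hpV : Per V) (hp : 1 ≤ p) (hs : IsLpSolution V β σ p ψ0 Tm ψ) (hs' : IsLpSolution V β σ p ψ0 Tm' ψ') {t : ℝ} (ht : t ∈ Ioo0 Tm)
    (ht' : t ∈ Ioo0 Tm') {Z : Spc m → ℝ} {C : ℝ}
    (hZ : AEStronglyMeasurable Z (μT m)) (hC : ∀ x, |Z x| ≤ C) {N : ℝ → ℝ} {l : ℝ} (hN : ∀ s, s ∈ Ioo0 Tm → s ∈ Ioo0 Tm' → N t - N s ≤ ∫ x, Z x * ((ψ' t x - ψ t x) - (ψ' s x - ψ s x)) ∂(μT m))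
    (hl : ∫ x, Z x * Rh V β (ψ' t) x ∂(μT m) - ∫ x, Z x * Rh V β (ψ t) x ∂(μT m) ≤ l) :
    ∃ (L : ℝ → ℝ) (l' : ℝ), (∀ᶠ s in nhdsWithin t (Iio t), N t - N s ≤ (t - s) * L (s - t)) ∧ l' ≤ l ∧ Tendsto L (nhdsWithin 0 {h | h ≠ 0}) (nhds l') := by
  refine ⟨_, _, ?_, hl, (test_lim hV hpV hp hs' ht' hZ hC).sub (test_lim hV hpV hp hs ht hZ hC)⟩
  have := (mem_small ht).filter_mono (nhdsWithin_le_nhds (s := Iio t))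
  have h' := (mem_small ht').filter_mono (nhdsWithin_le_nhds (s := Iio t))
  filter_upwards [this, h', self_mem_nhdsWithin] with s h1 h1' h2
  have h2 : s < t := h2
  refine (hN s h1 h1').trans_eq ?_
  simp only [add_sub_cancel]
  have j := bmul hZ hC ((((ci (sdat hp hs h1).c)).sub (ci (sdat hp hs ht).c)).div_const (s - t))
  have j' := bmul hZ hC ((((ci (sdat hp hs' h1').c)).sub (ci (sdat hp hs' ht').c)).div_const (s - t))
  simp only [Pi.sub_apply] at j j'
  rw [← integral_sub j' j, ← integral_const_mul]
  refine integral_congr_ae (Eventually.of_forall fun x => ?_)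
  have : s - t ≠ 0 := by linarith
  simp only
  field_simp; ring

lemma marg_abs {f : Spc m → ℝ} (hf : Continuous f) (s : ℝ) : |marg f s| ≤ marg (fun x => |f x|) s := by
  have := norm_integral_le_integral_norm (μ := volume.restrict (cube1 m)) fun y => f (s, y)
  exact this

lemma marg_abs_int {f : Spc m → ℝ} (hf : Continuous f) : ∫ x : Spc m, |marg f x.1| ∂(μT m) ≤ ∫ x, |f x| ∂(μT m) := by
  have := marg_int (Z := fun _ => 1) (C := 1) measurable_const (fun _ => by simp) hf.abs
  simp only [one_mul] at this
  rw [this]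
  exact integral_mono (ci ((marg_cont hf).comp continuous_fst).abs) (ci ((marg_cont hf.abs).comp continuous_fst)) fun x => marg_abs hf _

lemma marg_lb (hV : ContDiff ℝ 2 V) (hpV : Per V) (hβ : 0 < β) (hp : 1 ≤ p) (hs : IsLpSolution V β σ p ψ0 Tm ψ) (h0 : Continuous ψ0) (hp0 : Per ψ0) {c : ℝ} (hc : ∀ s, c ≤ marg ψ0 s)
    {b : ℝ} (hb : b ∈ Ico0 Tm) (s : ℝ) : c ≤ marg (ψ b) s := by
  rcases hb.1.eq_or_lt with h | h
  · rw [← h, show ψ 0 = ψ0 from funext hs.init]; exact hc s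
  have I : ∀ t ∈ Icc 0 b, t ∈ Ico0 Tm := fun t ht => Ico_of hb.2 ht.1 ht.2
  have cW := contW_mono hs.contLp I
  have cc : ∀ t ∈ Ico0 Tm, Continuous (ψ t) := fun t ht => scont hp hs h0 ht
  have I' : ∀ s ∈ Ioo0 Tm, s ∈ Ico0 Tm := fun s hs => ⟨hs.1.le, hs.2⟩
  have cw : ∀ t ∈ Ico0 Tm, Continuous fun x : Spc m => marg (ψ t) x.1 - c := fun t ht => ((marg_cont (cc t ht)).comp continuous_fst).sub continuous_const
  have key := dini (N := fun t => ∫ x : Spc m, |marg (ψ t) x.1 - c| ∂(μT m)) h le_rfl ?_ fun t t0 tb => ?_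
  · simp only [zero_mul, Real.exp_zero, one_mul, show ψ 0 = ψ0 from funext hs.init] at key
    have mm : ∀ f : Spc m → ℝ, Continuous f → ∫ x, f x ∂(μT m) = ∫ x : Spc m, marg f x.1 ∂(μT m) := fun f hf => by
      have := marg_int (Z := fun _ => 1) (C := 1) measurable_const (fun _ => by simp) hf
      simpa only [one_mul] using this
    have m0 := (mass hV hpV hβ hp hs h0 hb).1
    rw [mm _ (cc b hb), mm _ h0] at m0
    have e0 : ∫ x : Spc m, |marg ψ0 x.1 - c| ∂(μT m) = ∫ x : Spc m, (marg ψ0 x.1 - c) ∂(μT m) :=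
      integral_congr_ae (Eventually.of_forall fun x => abs_of_nonneg (sub_nonneg.2 (hc _)))
    have q : ∀ f : Spc m → ℝ, Continuous f → ∫ x : Spc m, (marg f x.1 - c) ∂(μT m) = ∫ x : Spc m, marg f x.1 ∂(μT m) - c := fun f hf => by
      rw [integral_sub (ci (mcont' hf)) (integrable_const c)]; simp
    have := zero_of_int (f := fun x : Spc m => |marg (ψ b) x.1 - c| - (marg (ψ b) x.1 - c)) ((cw b hb).abs.sub (cw b hb)) (fun x => sub_nonneg.2 (le_abs_self _))
      (per1 (w := fun s => |marg (ψ b) s - c| - (marg (ψ b) s - c)) fun s k => by simp only [marg_per (sper hs hp0 hb)]) (by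
        rw [integral_sub (ci (cw b hb)).abs (ci (cw b hb)), q _ (cc b hb)]
        rw [e0, q _ h0] at key; linarith) (s, 0)
    simp only at this
    have := abs_nonneg (marg (ψ b) s - c); linarith
  · refine lp_cont hp cW (fun t ht => cc t (I t ht)) fun t ht => ⟨1, zero_le_one, fun s hs => ?_⟩
    have c1 := cc t (I t ht); have c2 := cc s (I s hs)
    rw [← integral_sub (ci (cw s (I s hs))).abs (ci (cw t (I t ht))).abs, one_mul]
    refine le_add_of_le_of_nonneg ?_ (by positivity)
    refine le_trans ?_ (marg_abs_int (c2.sub c1))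
    refine absint (ci ((marg_cont (c2.sub c1)).comp continuous_fst)).abs fun x => ?_
    refine (abs_abs_sub_abs_le_abs_sub _ _).trans_eq ?_
    have := marg_sub c2 c1 x.1
    rw [show (marg (ψ s) x.1 - c - (marg (ψ t) x.1 - c)) = marg (ψ s) x.1 - marg (ψ t) x.1 by ring, ← this]
  · have ht : t ∈ Ioo0 Tm := ⟨t0, (I t ⟨t0.le, tb⟩).2⟩
    have D := sdat hp hs ht
    have mz : Measurable fun s => Real.sign (marg (ψ t) s - c) := sign_meas.comp ((marg_cont D.c).sub continuous_const).measurable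
    refine dini_L1 hV hpV hp hs ht (N := fun t => ∫ x : Spc m, |marg (ψ t) x.1 - c| ∂(μT m)) (Z := fun x => Real.sign (marg (ψ t) x.1 - c)) (C := 1)
      (mz.comp measurable_fst).aestronglyMeasurable (fun _ => sgn_le _) (fun s hs' => ?_) ?_
    · have c2 := cc s (I' s hs')
      have j1 := ci (cw t (I' t ht)); have j2 := ci (cw s (I' s hs'))
      rw [← integral_sub j1.abs j2.abs, marg_int mz (C := 1) (fun _ => sgn_le _) (f := fun x => ψ t x - ψ s x) (D.c.sub c2)]
      refine integral_mono (j1.abs.sub j2.abs) (bmul (C := 1) (mz.comp measurable_fst).aestronglyMeasurable (fun _ => sgn_le _) (ci ((marg_cont (D.c.sub c2)).comp continuous_fst))) fun x => ?_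
      refine (sgn_ineq _ _).trans_eq ?_
      have := marg_sub D.c c2 x.1
      rw [show (marg (ψ t) x.1 - c - (marg (ψ s) x.1 - c)) = marg (ψ t) x.1 - marg (ψ s) x.1 by ring, ← this]
    · rw [zero_mul]
      refine sgn_lim (f := fun x : Spc m => marg (ψ t) x.1 - c) (C := 0) (cw t (I' t ht)) (Rh_int hV hpV D) fun n hn => ?_
      have cg := D.gc
      rw [ibp_atn hV hpV D (w := fun s => marg (ψ t) s - c) (fun s => (md_der D s).sub_const c) (mcont (by fun_prop)) (fun s k => by simp only [marg_per D.per])]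
      rw [zero_div, neg_nonpos]
      refine mul_nonneg (by positivity) (integral_nonneg fun x => ?_)
      have := Real.pi_pos
      rw [Pi.zero_apply, mul_assoc]; exact mul_nonneg (by positivity) (mul_self_nonneg _)

lemma marg_eq (hV : ContDiff ℝ 2 V) (hpV : Per V) (hβ : 0 < β) (hp : 1 ≤ p) (hs : IsLpSolution V β σ p ψ0 Tm ψ) (hs' : IsLpSolution V β σ p ψ0 Tm' ψ') (h0 : Continuous ψ0) (hp0 : Per ψ0)
    {b : ℝ} (hb : b ∈ Ico0 Tm) (hb' : b ∈ Ico0 Tm') (s : ℝ) : marg (ψ' b) s = marg (ψ b) s := by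
  rcases hb.1.eq_or_lt with h | h
  · rw [← h, show ψ 0 = ψ0 from funext hs.init, show ψ' 0 = ψ0 from funext hs'.init]
  have I : ∀ t ∈ Icc 0 b, t ∈ Ico0 Tm := fun t ht => Ico_of hb.2 ht.1 ht.2
  have J : ∀ t ∈ Icc 0 b, t ∈ Ico0 Tm' := fun t ht => Ico_of hb'.2 ht.1 ht.2
  have I' : ∀ s ∈ Ioo0 Tm, s ∈ Ico0 Tm := fun s hs => ⟨hs.1.le, hs.2⟩
  have J' : ∀ s ∈ Ioo0 Tm', s ∈ Ico0 Tm' := fun s hs => ⟨hs.1.le, hs.2⟩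
  have cc : ∀ t, t ∈ Ico0 Tm → t ∈ Ico0 Tm' → Continuous fun x => ψ' t x - ψ t x := fun t ht ht' => (scont hp hs' h0 ht').sub (scont hp hs h0 ht)
  have cW := contW_sub hp (contW_mono hs.contLp I) (contW_mono hs'.contLp J) (fun t ht => scont hp hs h0 (I t ht)) (fun t ht => scont hp hs' h0 (J t ht))
  have key := dini (N := fun t => ∫ x : Spc m, |marg (fun x => ψ' t x - ψ t x) x.1| ∂(μT m)) h le_rfl ?_ fun t t0 tb => ?_
  · simp only [zero_mul, Real.exp_zero, one_mul, show ψ 0 = ψ0 from funext hs.init, show ψ' 0 = ψ0 from funext hs'.init, sub_self] at key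
    have := zero_of_int (f := fun x : Spc m => |marg (fun x => ψ' b x - ψ b x) x.1|) (mcont' (cc b hb hb')).abs (fun x => abs_nonneg _)
      (per1 (w := fun s => |marg (fun x => ψ' b x - ψ b x) s|) fun s k => by
        rw [marg_per fun k j x => by simp only [sper hs hp0 hb k j x, sper hs' hp0 hb' k j x]]) (by simpa [marg] using key) (s, 0)
    simp only [abs_eq_zero] at this
    rw [marg_sub (scont hp hs' h0 hb') (scont hp hs h0 hb)] at this; linarith
  · refine lp_cont hp cW (fun t ht => cc t (I t ht) (J t ht)) fun t ht => ⟨1, zero_le_one, fun s hs => ?_⟩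
    have c1 := cc t (I t ht) (J t ht); have c2 := cc s (I s hs) (J s hs)
    rw [← integral_sub (ci (mcont' c2)).abs (ci (mcont' c1)).abs, one_mul]
    refine le_add_of_le_of_nonneg ?_ (by positivity)
    refine le_trans ?_ (marg_abs_int (c2.sub c1))
    refine absint (ci ((marg_cont (c2.sub c1)).comp continuous_fst)).abs fun x => ?_
    refine (abs_abs_sub_abs_le_abs_sub _ _).trans_eq ?_
    rw [← marg_sub c2 c1 x.1]
  · have ht : t ∈ Ioo0 Tm := ⟨t0, (I t ⟨t0.le, tb⟩).2⟩
    have ht' : t ∈ Ioo0 Tm' := ⟨t0, (J t ⟨t0.le, tb⟩).2⟩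
    have D := sdat hp hs ht; have D' := sdat hp hs' ht'
    have c1 := cc t (I' t ht) (J' t ht')
    have mz : Measurable fun s => Real.sign (marg (fun x => ψ' t x - ψ t x) s) := sign_meas.comp (mcont c1).measurable
    have mz' : AEStronglyMeasurable (fun x : Spc m => Real.sign (marg (fun x => ψ' t x - ψ t x) x.1)) (μT m) := (mz.comp measurable_fst).aestronglyMeasurable
    refine dini_L2 hV hpV hp hs hs' ht ht' (N := fun t => ∫ x : Spc m, |marg (fun x => ψ' t x - ψ t x) x.1| ∂(μT m)) (Z := fun x => Real.sign (marg (fun x => ψ' t x - ψ t x) x.1)) (C := 1)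
      mz' (fun _ => sgn_le _) (fun s hs1 hs2 => ?_) ?_
    · have c2 := cc s (I' s hs1) (J' s hs2)
      have j1 := ci (mcont' c1); have j2 := ci (mcont' c2)
      rw [← integral_sub j1.abs j2.abs, marg_int mz (C := 1) (fun _ => sgn_le _) (f := fun x => (ψ' t x - ψ t x) - (ψ' s x - ψ s x)) (c1.sub c2)]
      refine integral_mono (j1.abs.sub j2.abs) (bmul (C := 1) mz' (fun _ => sgn_le _) (ci (mcont' (c1.sub c2)))) fun x => ?_
      refine (sgn_ineq _ _).trans_eq ?_
      simp only [marg_sub c1 c2 x.1]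
    · have cg := D.gc; have cg' := D'.gc
      have r1 := Rh_int (β := β) hV hpV D; have r2 := Rh_int (β := β) hV hpV D'
      rw [zero_mul, ← integral_sub (bmul (C := 1) mz' (fun _ => sgn_le _) r2) (bmul (C := 1) mz' (fun _ => sgn_le _) r1)]
      simp only [← mul_sub]
      have dw : ∀ s, HasDerivAt (marg fun x => ψ' t x - ψ t x) (marg (fun x => grd (ψ' t) x (e1 m)) s - marg (fun x => grd (ψ t) x (e1 m)) s) s := fun s => by
        have := (md_der D' s).sub (md_der D s)
        exact this.congr_of_eventuallyEq (Eventually.of_forall fun s => marg_sub D'.c D.c s)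
      have pw : ∀ s (k : ℤ), marg (fun x => ψ' t x - ψ t x) (s + k) = marg (fun x => ψ' t x - ψ t x) s := fun s k => marg_per (fun k j x => by simp only [D.per k j x, D'.per k j x]) s k
      have cd : Continuous fun s => marg (fun x => grd (ψ' t) x (e1 m)) s - marg (fun x => grd (ψ t) x (e1 m)) s := (mcont (by fun_prop)).sub (mcont (by fun_prop))
      refine sgn_lim (f := fun x : Spc m => marg (fun x => ψ' t x - ψ t x) x.1) (C := 0) (mcont' c1) (r2.sub r1) fun n hn => ?_
      have am : AEStronglyMeasurable (fun x : Spc m => 2 / Real.pi * Real.arctan (n * marg (fun x => ψ' t x - ψ t x) x.1)) (μT m) :=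
        (by have := mcont' c1; fun_prop : Continuous fun x : Spc m => 2 / Real.pi * Real.arctan (n * marg (fun x => ψ' t x - ψ t x) x.1)).aestronglyMeasurable
      simp only [Pi.sub_apply, mul_sub]
      have cA : Continuous fun x : Spc m => 2 / Real.pi * (n / (1 + (n * marg (fun x => ψ' t x - ψ t x) x.1) ^ 2)) *
          (marg (fun x => grd (ψ' t) x (e1 m)) x.1 - marg (fun x => grd (ψ t) x (e1 m)) x.1) := by
        have ne : ∀ x : Spc m, 1 + (n * marg (fun x => ψ' t x - ψ t x) x.1) ^ 2 ≠ 0 := fun x => by positivity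
        have k1 := mcont' c1; have k2 : Continuous fun x : Spc m => marg (fun x => grd (ψ' t) x (e1 m)) x.1 - marg (fun x => grd (ψ t) x (e1 m)) x.1 := cd.comp continuous_fst
        exact (continuous_const.mul (continuous_const.div (by fun_prop) ne)).mul k2
      have g1 := mcont' (by fun_prop : Continuous fun x : Spc m => grd (ψ t) x (e1 m)); have g2 := mcont' (by fun_prop : Continuous fun x : Spc m => grd (ψ' t) x (e1 m))
      rw [integral_sub (bmul (C := 1) am (fun _ => atn_le _) r2) (bmul (C := 1) am (fun _ => atn_le _) r1), ibp_atn hV hpV D' dw cd pw, ibp_atn hV hpV D dw cd pw]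
      have : ∀ a b c : ℝ, -(c * a) - -(c * b) = -(c * (a - b)) := fun a b c => by ring
      have q2 : Integrable (fun x : Spc m => 2 / Real.pi * (n / (1 + (n * marg (fun x => ψ' t x - ψ t x) x.1) ^ 2)) * (marg (fun x => grd (ψ' t) x (e1 m)) x.1 - marg (fun x => grd (ψ t) x (e1 m)) x.1) * marg (fun x => grd (ψ' t) x (e1 m)) x.1) (μT m) := ci (cA.mul g2)
      have q1 : Integrable (fun x : Spc m => 2 / Real.pi * (n / (1 + (n * marg (fun x => ψ' t x - ψ t x) x.1) ^ 2)) * (marg (fun x => grd (ψ' t) x (e1 m)) x.1 - marg (fun x => grd (ψ t) x (e1 m)) x.1) * marg (fun x => grd (ψ t) x (e1 m)) x.1) (μT m) := ci (cA.mul g1)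
      rw [this, ← integral_sub q2 q1, zero_div, neg_nonpos]
      refine mul_nonneg (by positivity) (integral_nonneg fun x => ?_)
      have := Real.pi_pos
      simp only [Pi.zero_apply, Pi.mul_apply]
      rw [← mul_sub, mul_assoc]; exact mul_nonneg (by positivity) (mul_self_nonneg _)

lemma phi_le {f : Spc m → ℝ} {K : ℝ} (hV : ContDiff ℝ 2 V) (hf : Continuous f) (hn : ∀ x, 0 ≤ f x) {s : ℝ} (hm : 0 < marg f s) (hK : ∀ x, |pd (e1 m) V x| ≤ K) : |phiF V f s| ≤ K := by
  have hv := pdV_cont hV (e1 m)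
  rw [phiF, abs_div, abs_of_pos hm, div_le_iff₀ hm, marg, ← integral_const_mul]
  have := norm_integral_le_of_norm_le (μ := volume.restrict (cube1 m)) (f := fun y => pd (e1 m) V (s, y) * f (s, y)) ((c1_int hf s).const_mul K) (Eventually.of_forall fun y => by
    rw [norm_mul, Real.norm_of_nonneg (hn _)]; exact mul_le_mul_of_nonneg_right (hK _) (hn _))
  exact this

lemma marg_sq {d : Spc m → ℝ} (hd : Continuous d) (s : ℝ) : marg (fun x => |d x|) s ^ 2 ≤ marg (fun x => d x ^ 2) s := by
  set A := marg (fun x => |d x|) s with hA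
  have i1 := c1_int (by fun_prop : Continuous fun x => d x ^ 2) s
  have i2 := (c1_int (by fun_prop : Continuous fun x => |d x|) s).const_mul (2 * A)
  have h : 0 ≤ ∫ y in cube1 m, (d (s, y) ^ 2 - 2 * A * |d (s, y)| + A ^ 2) := integral_nonneg fun y => by
    have := sq_nonneg (|d (s, y)| - A)
    have e := sq_abs (d (s, y))
    simp only [Pi.zero_apply]; nlinarith
  have i3 : Integrable (fun y => d (s, y) ^ 2 - 2 * A * |d (s, y)|) (volume.restrict (cube1 m)) := i1.sub i2
  rw [integral_add i3 (integrable_const _), integral_sub i1 i2, integral_const_mul, integral_const, volR_cube1, one_smul] at h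
  have : ∫ y in cube1 m, |d (s, y)| = A := rfl
  rw [this] at h
  simp only [marg]; nlinarith

end en3

section en4
variable {m : ℕ} {V : Spc m → ℝ} {β σ p : ℝ} {ψ0 : Spc m → ℝ} {Tm Tm' : ℝ≥0∞} {ψ ψ' : ℝ → Spc m → ℝ}

lemma Rh_diff (hV : ContDiff ℝ 2 V) (hpV : Per V) (hβ : 0 < β) {f f' : Spc m → ℝ} (D : Dat f) (D' : Dat f') (hn : ∀ x, 0 ≤ f' x) (hm : ∀ s, marg f' s = marg f s) {c K M : ℝ} (hc : 0 < c)
    (hcm : ∀ s, c ≤ marg f s) (hK0 : 0 ≤ K) (hK : ∀ i x, |pd (vv (m := m) i) V x| ≤ K) (hM : ∀ x, |f x| ≤ M) :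
    ∫ x, (2 * (f' x - f x)) * Rh V β f' x ∂(μT m) - ∫ x, (2 * (f' x - f x)) * Rh V β f x ∂(μT m) ≤ (((m:ℝ) + 1) * β * (4 * K ^ 2 + (K * M / c) ^ 2)) * ∫ x, (f' x - f x) ^ 2 ∂(μT m) := by
  have cf := D.c; have cg := D.gc; have cf' := D'.c; have cg' := D'.gc
  have M0 : 0 ≤ M := (abs_nonneg _).trans (hM 0)
  have dY : ∀ x, HasFDerivAt (fun x => 2 * (f' x - f x)) ((2:ℝ) • (grd f' x - grd f x)) x := fun x => ((D'.d1 x).sub (D.d1 x)).const_mul 2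
  have pY : Per fun x => 2 * (f' x - f x) := fun k j x => by simp only [D.per k j x, D'.per k j x]
  have hk1 : ∀ x, |pd (e1 m) V x| ≤ K := fun x => by rw [← vv_zero]; exact hK 0 x
  have p1 := (phi_c hV hpV D).2.1; have p2 := (phi_c hV hpV D').2.1
  rw [ibp hV hpV D dY (by fun_prop) pY, ibp hV hpV D' dY (by fun_prop) pY]
  have hv : ∀ i, Continuous (pd (vv (m := m) i) V) := fun i => pdV_cont hV _
  have cI : ∀ g : Spc m → ℝ, Continuous g → Continuous (grd g) → Continuous (phiF V g) → Continuous fun x : Spc m => (∑ i, ((2:ℝ) • (grd f' x - grd f x)) (vv i) * (β⁻¹ * grd g x (vv i) + pd (vv i) V x * g x)) - ((2:ℝ) • (grd f' x - grd f x)) (vv 0) * (phiF V g x.1 * g x) := fun g h1 h2 h3 => by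
    fun_prop
  rw [neg_sub_neg, ← integral_sub (ci (cI f cf cg p1)) (ci (cI f' cf' cg' p2)), ← integral_const_mul]
  set A : ℝ → ℝ := marg (fun x => |f' x - f x|)
  have cd : Continuous fun x => f' x - f x := cf'.sub cf
  -- difference of the nonlocal coefficient
  have dphi : ∀ s, |phiF V f' s - phiF V f s| ≤ K * A s / c := fun s => by
    have h1 := c1_int (by have := pdV_cont hV (e1 m); fun_prop : Continuous fun x : Spc m => pd (e1 m) V x * f x) s
    have h2 := c1_int (by have := pdV_cont hV (e1 m); fun_prop : Continuous fun x : Spc m => pd (e1 m) V x * f' x) s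
    rw [phiF, phiF, hm, ← sub_div, ← integral_sub h2 h1, abs_div, abs_of_pos (D.mp s)]
    have A0 : 0 ≤ A s := integral_nonneg fun _ => abs_nonneg _
    have := norm_integral_le_of_norm_le (μ := volume.restrict (cube1 m)) (f := fun y => pd (e1 m) V (s, y) * f' (s, y) - pd (e1 m) V (s, y) * f (s, y)) ((c1_int cd.abs s).const_mul K) (Eventually.of_forall fun y => by
      rw [← mul_sub, norm_mul]; exact mul_le_mul_of_nonneg_right (hk1 _) (abs_nonneg _))
    rw [integral_const_mul] at this
    have t2 : |∫ y in cube1 m, (pd (e1 m) V (s, y) * f' (s, y) - pd (e1 m) V (s, y) * f (s, y))| ≤ K * A s := this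
    exact div_le_div₀ (by positivity) t2 hc (hcm s)
  have cA : Continuous fun x : Spc m => A x.1 := mcont' cd.abs
  have cA2 : Continuous fun x : Spc m => A x.1 ^ 2 := cA.pow 2
  have cB : Continuous fun x => ((m:ℝ) + 1) * β * (4 * K ^ 2) * (f' x - f x) ^ 2 := by fun_prop
  have cC : Continuous fun x : Spc m => ((m:ℝ) + 1) * β * (K * M / c) ^ 2 * A x.1 ^ 2 := continuous_const.mul cA2
  have B : ∫ x : Spc m, A x.1 ^ 2 ∂(μT m) ≤ ∫ x, (f' x - f x) ^ 2 ∂(μT m) := by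
    have := marg_int (m := m) (Z := fun _ => 1) (C := 1) measurable_const (fun _ => by simp) (f := fun x => (f' x - f x) ^ 2) (by fun_prop)
    simp only [one_mul] at this
    rw [this]
    exact integral_mono (ci cA2) (ci (mcont' (by fun_prop))) fun x => marg_sq cd x.1
  refine le_trans (intle (G := fun x => ((m:ℝ) + 1) * β * (4 * K ^ 2) * (f' x - f x) ^ 2 + ((m:ℝ) + 1) * β * (K * M / c) ^ 2 * A x.1 ^ 2) (ci (cB.add cC)) (integral_nonneg fun x => by positivity) fun x => ?_) ?_
  · set d := f' x - f x with hd
    have key : ∀ i, -((grd f' x - grd f x) (vv i) * (β⁻¹ * (grd f' x - grd f x) (vv i) + (pd (vv i) V x * d - if i = 0 then phiF V f' x.1 * f' x - phiF V f x.1 * f x else 0))) ≤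
        β / 2 * (4 * K ^ 2 * d ^ 2 + (K * M / c) ^ 2 * A x.1 ^ 2) := fun i => by
      refine (young hβ).trans ?_
      have A0 : 0 ≤ A x.1 := integral_nonneg fun _ => abs_nonneg _
      have hb : |pd (vv i) V x * d - if i = 0 then phiF V f' x.1 * f' x - phiF V f x.1 * f x else 0| ≤ 2 * K * |d| + K * M / c * A x.1 := by
        refine (abs_sub _ _).trans ?_
        have a1 : |pd (vv i) V x * d| ≤ K * |d| := by rw [abs_mul]; exact mul_le_mul_of_nonneg_right (hK i x) (abs_nonneg _)
        have a2 : |if i = 0 then phiF V f' x.1 * f' x - phiF V f x.1 * f x else 0| ≤ K * |d| + K * M / c * A x.1 := by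
          split_ifs
          · have e : phiF V f' x.1 * f' x - phiF V f x.1 * f x = phiF V f' x.1 * d + (phiF V f' x.1 - phiF V f x.1) * f x := by rw [hd]; ring
            rw [e]
            refine (abs_add_le _ _).trans (add_le_add ?_ ?_)
            · rw [abs_mul]; exact mul_le_mul_of_nonneg_right (phi_le hV cf' hn (D'.mp _) hk1) (abs_nonneg _)
            · rw [abs_mul]
              calc _ ≤ K * A x.1 / c * M := mul_le_mul (dphi _) (hM x) (abs_nonneg _) (by positivity)
                _ = _ := by ring
          · simp; positivity
        linarith
      have h2 := sq_le_sq' (abs_le.1 hb).1 (abs_le.1 hb).2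
      have h3 := sq_nonneg (2 * K * |d| - K * M / c * A x.1)
      have h4 := sq_abs d
      have h5 : (2 * K * |d| + K * M / c * A x.1) ^ 2 ≤ 2 * (4 * K ^ 2 * d ^ 2 + (K * M / c) ^ 2 * A x.1 ^ 2) := by
        have e1 : 2 * (4 * K ^ 2 * d ^ 2 + (K * M / c) ^ 2 * A x.1 ^ 2) = (2 * K * |d| + K * M / c * A x.1) ^ 2 + (2 * K * |d| - K * M / c * A x.1) ^ 2 := by
          rw [← h4]; ring
        linarith
      nlinarith
    have S := Finset.sum_le_sum (s := Finset.univ) fun i _ => key i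
    rw [sum_alg (fun i => ((2:ℝ) • (grd f' x - grd f x)) (vv i)) (fun i => β⁻¹ * grd f x (vv i) + pd (vv i) V x * f x),
      sum_alg (fun i => ((2:ℝ) • (grd f' x - grd f x)) (vv i)) (fun i => β⁻¹ * grd f' x (vv i) + pd (vv i) V x * f' x), ← Finset.sum_sub_distrib]
    rw [Finset.sum_const, Finset.card_univ, Fintype.card_fin, nsmul_eq_mul] at S
    rw [Nat.cast_add, Nat.cast_one] at S
    have E : ∑ i : Fin (m + 1), ((((2:ℝ) • (grd f' x - grd f x)) (vv i) * (β⁻¹ * grd f x (vv i) + pd (vv i) V x * f x - if i = 0 then phiF V f x.1 * f x else 0)) -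
        ((2:ℝ) • (grd f' x - grd f x)) (vv i) * (β⁻¹ * grd f' x (vv i) + pd (vv i) V x * f' x - if i = 0 then phiF V f' x.1 * f' x else 0)) =
        2 * ∑ i, -((grd f' x - grd f x) (vv i) * (β⁻¹ * (grd f' x - grd f x) (vv i) + (pd (vv i) V x * d - if i = 0 then phiF V f' x.1 * f' x - phiF V f x.1 * f x else 0))) := by
      rw [Finset.mul_sum]
      refine Finset.sum_congr rfl fun i _ => ?_
      rw [hd]; simp only [ContinuousLinearMap.smul_apply, ContinuousLinearMap.sub_apply, smul_eq_mul]
      split_ifs <;> ring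
    rw [E]
    nlinarith
  · rw [integral_add (ci cB) (ci cC), integral_const_mul, integral_const_mul, integral_const_mul]
    have : 0 ≤ ((m:ℝ) + 1) * β * (K * M / c) ^ 2 := by positivity
    nlinarith [mul_le_mul_of_nonneg_left B this]

theorem uniq (hV : ContDiff ℝ 2 V) (hpV : Per V) (hβ : 0 < β) (hp : 2 ≤ p) (hs : IsLpSolution V β σ p ψ0 Tm ψ) (hs' : IsLpSolution V β σ p ψ0 Tm' ψ') (h0 : Continuous ψ0) (hp0 : Per ψ0)
    (hn : ∀ x, 0 ≤ ψ0 x) {c : ℝ} (hc : 0 < c) (hcm : ∀ s, c ≤ marg ψ0 s)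
    {b : ℝ} (hb : b ∈ Ico0 Tm) (hb' : b ∈ Ico0 Tm') {M : ℝ} (hM : ∀ t, 0 ≤ t → t ≤ b → ∀ x, |ψ t x| ≤ M) : ψ' b = ψ b := by
  have hp1 : 1 ≤ p := by linarith
  rcases hb.1.eq_or_lt with h | h
  · rw [← h, show ψ 0 = ψ0 from funext hs.init, show ψ' 0 = ψ0 from funext hs'.init]
  have I : ∀ t ∈ Icc 0 b, t ∈ Ico0 Tm := fun t ht => Ico_of hb.2 ht.1 ht.2
  have J : ∀ t ∈ Icc 0 b, t ∈ Ico0 Tm' := fun t ht => Ico_of hb'.2 ht.1 ht.2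
  have I' : ∀ s ∈ Ioo0 Tm, s ∈ Ico0 Tm := fun s hs => ⟨hs.1.le, hs.2⟩
  have J' : ∀ s ∈ Ioo0 Tm', s ∈ Ico0 Tm' := fun s hs => ⟨hs.1.le, hs.2⟩
  have cc : ∀ t, t ∈ Ico0 Tm → t ∈ Ico0 Tm' → Continuous fun x => ψ' t x - ψ t x := fun t ht ht' => (scont hp1 hs' h0 ht').sub (scont hp1 hs h0 ht)
  have pc : ∀ t, t ∈ Ico0 Tm → t ∈ Ico0 Tm' → Per fun x => ψ' t x - ψ t x := fun t ht ht' k j x => by simp only [sper hs hp0 ht k j x, sper hs' hp0 ht' k j x]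
  have cW := contW_sub hp1 (contW_mono hs.contLp I) (contW_mono hs'.contLp J) (fun t ht => scont hp1 hs h0 (I t ht)) (fun t ht => scont hp1 hs' h0 (J t ht))
  obtain ⟨K, K0, hK⟩ := V_bdd hV hpV
  have key := dini (N := fun t => ∫ x : Spc m, (ψ' t x - ψ t x) ^ 2 ∂(μT m)) (C := ((m:ℝ) + 1) * β * (4 * K ^ 2 + (K * M / c) ^ 2)) h (by positivity) ?_ fun t t0 tb => ?_
  · simp only [show ψ 0 = ψ0 from funext hs.init, show ψ' 0 = ψ0 from funext hs'.init, sub_self] at key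
    funext x
    have cb := cc b hb hb'
    have := zero_of_int (f := fun x : Spc m => (ψ' b x - ψ b x) ^ 2) (by fun_prop) (fun x => sq_nonneg _) (fun k j x => by simp only [pc b hb hb' k j x]) (by simpa using key) x
    have := pow_eq_zero_iff (two_ne_zero) |>.1 this
    linarith
  · refine lp_cont hp1 cW (fun t ht => cc t (I t ht) (J t ht)) fun t ht => ?_
    have c1 := cc t (I t ht) (J t ht)
    obtain ⟨C, C0, hC⟩ := (pc t (I t ht) (J t ht)).bounded c1
    refine ⟨2 * C, by positivity, fun s hs1 => ?_⟩
    have c2 := cc s (I s hs1) (J s hs1)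
    have q := ofReal_sq_le hp (c2.sub c1)
    have fin : LpN p (fun x => (ψ' s x - ψ s x) - (ψ' t x - ψ t x)) < ⊤ := by
      obtain ⟨C2, C20, hC2⟩ := (pc s (I s hs1) (J s hs1)).bounded c2
      refine (eLp_le (C := C2 + C) fun x => (norm_sub_le _ _).trans (add_le_add (hC2 x) (hC x))).trans_lt ENNReal.ofReal_lt_top
    have q2 := (ENNReal.ofReal_le_iff_le_toReal (ENNReal.pow_lt_top fin).ne).1 q
    rw [ENNReal.toReal_pow] at q2
    rw [← integral_sub (ci (by fun_prop)) (ci (by fun_prop))]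
    refine le_trans (absint (G := fun x => 2 * C * |(ψ' s x - ψ s x) - (ψ' t x - ψ t x)| + ((ψ' s x - ψ s x) - (ψ' t x - ψ t x)) ^ 2) (ci (by fun_prop)) fun x => ?_) ?_
    · have e : (ψ' s x - ψ s x) ^ 2 - (ψ' t x - ψ t x) ^ 2 = 2 * (ψ' t x - ψ t x) * ((ψ' s x - ψ s x) - (ψ' t x - ψ t x)) + ((ψ' s x - ψ s x) - (ψ' t x - ψ t x)) ^ 2 := by ring
      rw [e]
      refine (abs_add_le _ _).trans (add_le_add ?_ (abs_of_nonneg (sq_nonneg _)).le)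
      rw [abs_mul, abs_mul, abs_two]
      exact mul_le_mul_of_nonneg_right (mul_le_mul_of_nonneg_left (hC x) zero_le_two) (abs_nonneg _)
    · rw [integral_add (ci (by fun_prop)) (ci (by fun_prop)), integral_const_mul]
      exact add_le_add_right q2 _
  · have ht : t ∈ Ioo0 Tm := ⟨t0, (I t ⟨t0.le, tb⟩).2⟩
    have ht' : t ∈ Ioo0 Tm' := ⟨t0, (J t ⟨t0.le, tb⟩).2⟩
    have D := sdat hp1 hs ht; have D' := sdat hp1 hs' ht'
    have c1 := cc t (I' t ht) (J' t ht')
    obtain ⟨C, C0, hC⟩ := (pc t (I' t ht) (J' t ht')).bounded c1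
    have cz : Continuous fun x => 2 * (ψ' t x - ψ t x) := by fun_prop
    refine dini_L2 hV hpV hp1 hs hs' ht ht' (N := fun t => ∫ x : Spc m, (ψ' t x - ψ t x) ^ 2 ∂(μT m)) (Z := fun x => 2 * (ψ' t x - ψ t x)) (C := 2 * C)
      cz.aestronglyMeasurable (fun x => by rw [abs_mul, abs_two]; exact mul_le_mul_of_nonneg_left (hC x) zero_le_two) (fun s hs1 hs2 => ?_) ?_
    · have c2 := cc s (I' s hs1) (J' s hs2)
      rw [← integral_sub (ci (by fun_prop)) (ci (by fun_prop))]
      refine integral_mono (ci (by fun_prop)) (ci (by fun_prop)) fun x => ?_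
      have := sq_nonneg ((ψ' s x - ψ s x) - (ψ' t x - ψ t x))
      simp only; nlinarith
    · exact Rh_diff hV hpV hβ D D' (nonneg hV hpV hβ hp1 hs' h0 hp0 hn (J' t ht')) (marg_eq hV hpV hβ hp1 hs hs' h0 hp0 (I' t ht) (J' t ht')) hc
        (marg_lb hV hpV hβ hp1 hs h0 hp0 hcm (I' t ht)) K0 hK (hM t t0.le tb)
end en4

section glob
variable {m : ℕ} {V : Spc m → ℝ} {β : ℝ}

lemma vv_norm (i : Fin (m + 1)) : ‖vv (m := m) i‖ ≤ 1 := by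
  refine Fin.cases ?_ (fun j => ?_) i
  · rw [vv_zero]; simp [e1, Prod.norm_def]
  · rw [vv_succ]; simp only [eC, Prod.norm_def, norm_zero]
    exact max_le zero_le_one (by rw [Pi.norm_single]; simp)

lemma GGx (hV : ContDiff ℝ 2 V) (hp : Per V) {R κ : ℝ} {W : Spc m → St m} (hκ : 0 < κ) (hW : Per W) 
    (h1 : ∀ x, HasFDerivAt (fun y => (W y).1) (W x).2 x) (cq : Continuous fun y => (W y).2)
    (hR : ∀ x, ‖W x‖ ≤ R) (hm : ∀ s, κ ≤ marg (fun x => wt V β x * (W x).1) s) (x : Spc m) :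
    HasDerivAt (phiF V (fun x => wt V β x * (W x).1)) (fP1 V β R κ W x) x.1 ∧
    GG V β R κ W x = -(∑ i, pd (vv i) V x * (W x).2 (vv i)) - phiF V (fun x => wt V β x * (W x).1) x.1 * (W x).2 (e1 m)
      + β * pd (e1 m) V x * (phiF V (fun x => wt V β x * (W x).1) x.1 * (W x).1) - fP1 V β R κ W x * (W x).1 ∧
    fP1 V β R κ W x = (fN1 V β R W x - phiF V (fun x => wt V β x * (W x).1) x.1 * fR1 V β R W x) * (marg (fun x => wt V β x * (W x).1) x.1)⁻¹ := by
  have d1 : ∀ x, HasFDerivAt (fun x => wt V β x * (W x).1) (wt V β x • (W x).2 + (W x).1 • ((-β * wt V β x) • fderiv ℝ V x)) x :=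
    fun x => (wt_der hV x).mul (h1 x)
  have cu : Continuous fun y => (W y).1 := cont_of_der h1
  have cw := wt_cont (β := β) hV
  have cdV : Continuous (fderiv ℝ V) := hV.continuous_fderiv (by norm_num)
  have d1c : Continuous fun x => wt V β x • (W x).2 + (W x).1 • ((-β * wt V β x) • fderiv ℝ V x) := by fun_prop
  have pu : Per fun y => (W y).1 := hW.comp Prod.fst
  have k1 : ∀ x, cl R (uL (W x)) = (W x).1 := fun x => cl_eq ((norm_fst_le (W x)).trans (hR x))
  have k2 : ∀ v, ‖v‖ ≤ 1 → ∀ x, cl R (qL v (W x)) = (W x).2 v := fun v hv x => cl_eq (by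
    have := ((W x).2.le_opNorm v).trans (mul_le_of_le_one_right (norm_nonneg _) hv)
    exact this.trans ((norm_snd_le (W x)).trans (hR x)))
  have ne : ‖e1 m‖ ≤ 1 := by simpa [vv_zero] using vv_norm (m := m) 0
  have nC : ∀ i, ‖eC m i‖ ≤ 1 := fun i => by simpa [vv_succ] using vv_norm (m := m) i.succ
  have m0 := hm x.1
  have i1 : fR V β R W x = marg (fun x => wt V β x * (W x).1) x.1 := by simp only [fR, marg, k1]
  have i2 : fP V β R κ W x = phiF V (fun x => wt V β x * (W x).1) x.1 := by
    rw [fP, phiF, i1, max_eq_right m0, div_eq_mul_inv]; simp only [fN, k1, mul_assoc]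
  have i4 : fP1 V β R κ W x = (fN1 V β R W x - phiF V (fun x => wt V β x * (W x).1) x.1 * fR1 V β R W x) * (marg (fun x => wt V β x * (W x).1) x.1)⁻¹ := by
    rw [fP1, i2, i1, max_eq_right m0]
  refine ⟨(phi_der hV hp d1 d1c ((wt_per (β := β) hp).mul pu) (s := x.1) (by linarith)).congr_deriv ?_, ?_, i4⟩
  · rw [i4, div_eq_mul_inv]
    simp only [fN1, fR1, k1, k2 _ ne, ContinuousLinearMap.add_apply, ContinuousLinearMap.smul_apply, smul_eq_mul, ← pd.eq_def]
    congr 3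
    · congr 1; funext y; ring
    · congr 1; funext y; ring
  · rw [GG, i2, ← sum_vv (fun v => pd v V x * (W x).2 v)]
    simp only [k1, k2 _ ne, k2 _ (nC _)]
    ring

lemma TT_div {f0 : Spc m → ℝ} {f : Fin (m + 1) → Spc m → ℝ} {f' : Fin (m + 1) → Spc m → Spc m →L[ℝ] ℝ} {C0 C1 b : ℝ} (hf0 : Continuous f0) (h0 : ∀ x, |f0 x| ≤ C0)
    (h : ∀ i x, HasFDerivAt (f i) (f' i x) x) (hc : ∀ i, Continuous (f' i)) (h1 : ∀ i x, |f i x| ≤ C1) (h2 : ∀ i, ∃ C, ∀ x, ‖f' i x‖ ≤ C) (hb : 0 < b) (x : Spc m) :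
    |b * TT b (fun x => f0 x + ∑ i, f' i x (vv i)) x| ≤ b * C0 + (m + 1) * (C1 * n1 m) := by
  choose C2 h2 using h2
  have e : ∀ i, TT b (fun x => f' i x (vv i)) x = -b⁻¹ * SK dk b (f i) x (vv i) := fun i => by
    have a := (TT_comm_hasFDerivAt (h i) (hc i) (h1 i) (h2 i) b x).unique (TT_hasFDerivAt (cont_of_der (h i)) (h1 i) hb x)
    have i1 := TT_integrable (hc i) (h2 i) b x
    have : TT b (f' i) x (vv i) = TT b (fun x => f' i x (vv i)) x := by
      rw [TT, ContinuousLinearMap.integral_apply i1]; rfl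
    rw [← this, a]; rfl
  have s : TT b (fun x => f0 x + ∑ i, f' i x (vv i)) x = TT b f0 x + ∑ i, TT b (fun x => f' i x (vv i)) x := by
    have hb2 : ∀ i x, ‖f' i x (vv i)‖ ≤ C2 i := fun i x => ((f' i x).le_opNorm _).trans ((mul_le_of_le_one_right (norm_nonneg _) (vv_norm i)).trans (h2 i x))
    have J : ∀ i, Integrable (fun z => kk z • f' i (x + b • z) (vv i)) := fun i => TT_integrable ((hc i).clm_apply continuous_const) (hb2 i) b x
    simp only [TT, smul_add, Finset.smul_sum]
    rw [integral_add (TT_integrable hf0 h0 b x) (integrable_finset_sum _ fun i _ => J i), integral_finset_sum _ fun i _ => J i]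
  rw [s, mul_add, Finset.mul_sum]
  have t1 : |b * TT b f0 x| ≤ b * C0 := by
    rw [abs_mul, abs_of_pos hb]
    have : ‖TT b f0 x‖ ≤ C0 := TT_bound h0 b x
    exact mul_le_mul_of_nonneg_left this hb.le
  have t2 : |∑ i, b * TT b (fun x => f' i x (vv i)) x| ≤ ∑ i : Fin (m + 1), C1 * n1 m := (Finset.abs_sum_le_sum_abs _ _).trans (Finset.sum_le_sum fun i _ => by
    rw [e, neg_mul, mul_neg, abs_neg, ← mul_assoc, mul_inv_cancel₀ hb.ne', one_mul]
    exact ((SK dk b (f i) x).le_opNorm _).trans ((mul_le_of_le_one_right (norm_nonneg _) (vv_norm i)).trans (SK_bound RD_dk (h1 i) b x)))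
  rw [Finset.sum_const, Finset.card_univ, Fintype.card_fin, nsmul_eq_mul, Nat.cast_add, Nat.cast_one] at t2
  exact (abs_add_le _ _).trans (add_le_add t1 t2)

lemma halve {ι : Type*} {f : ι → ℝ} {A M : ℝ} (hM : ∀ i, f i ≤ M) (h : ∀ N, (∀ i, f i ≤ N) → ∀ i, f i ≤ A + N / 2) (i : ι) : f i ≤ 2 * A := by
  have : Nonempty ι := ⟨i⟩
  have b : BddAbove (range f) := ⟨M, by rintro _ ⟨i, rfl⟩; exact hM i⟩
  have := ciSup_le (h _ fun i => le_ciSup b i)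
  have := le_ciSup b i
  linarith

lemma UU_div (hβ : 0 ≤ β) {h : ℝ → Spc m → ℝ} {l B M η : ℝ} (hB : 0 ≤ B) (hM0 : 0 ≤ M) (x : Spc m)
    (hM : ∀ b, 0 < b → b ≤ B → |b * TT b (h b) x| ≤ M * Real.exp (-l * (β * b ^ 2 / 2)))
    (hη : ∫ b in (0:ℝ)..B, Real.exp (-l * (β * b ^ 2 / 2)) ≤ η) : |UU β h B x| ≤ β * M * η := by
  rw [UU, ← Real.norm_eq_abs]
  have := intervalIntegral.norm_integral_le_of_norm_le hB (f := fun b => (β * b) * TT b (h b) x)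
    (g := fun b => β * M * Real.exp (-l * (β * b ^ 2 / 2))) (μ := volume)
    (Eventually.of_forall fun b hb => by
      rw [mul_assoc, norm_mul, Real.norm_of_nonneg hβ, mul_assoc]
      exact mul_le_mul_of_nonneg_left (hM b hb.1 hb.2) hβ) (Continuous.intervalIntegrable (by fun_prop) _ _)
  refine this.trans ?_
  rw [intervalIntegral.integral_const_mul]
  gcongr

lemma Sol.restrict {T T' : ℝ} {A : (Spc m → St m) → Spc m → ℝ} {w : ℝ → Spc m → St m} (hβ : 0 < β) (h : Sol β T A w) (h0 : 0 ≤ T') (h1 : T' ≤ T) : Sol β T' A fun t => w (ct T' t) := by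
  have key : ∀ s t, 0 ≤ s → s ≤ t → t ≤ T' → ∀ b ∈ uIcc 0 (bb β (t - s)), w (ct T' (t - β * b ^ 2 / 2)) = w (t - β * b ^ 2 / 2) := fun s t hs hst ht b hb => by
    rw [uIcc_of_le (bb_nonneg (β := β) _)] at hb
    have := bb_time hβ (sub_nonneg.2 hst) hb.1 hb.2
    rw [ct_eq (by linarith) (by have := sq_nonneg b; nlinarith [mul_nonneg hβ.le this])]
  refine ⟨?_, fun t => h.per _, h.bd.imp fun M hM t x => hM _ x, fun t => by rw [ct_ct h0], fun t x => h.der _ x, fun s t hs hst ht x => ?_, fun s t hs hst ht x => ?_⟩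
  · exact h.wc.comp (by have := ct_cont T'; fun_prop : Continuous fun z : ℝ × Spc m => (ct T' z.1, z.2))
  · simp only [ct_eq (hs.trans hst) ht, ct_eq hs (hst.trans ht)]
    rw [h.re s t hs hst (ht.trans h1)]
    congr 1
    exact intervalIntegral.integral_congr fun b hb => by simp only [key s t hs hst ht b hb]
  · simp only [ct_eq (hs.trans hst) ht, ct_eq hs (hst.trans ht)]
    rw [h.req s t hs hst (ht.trans h1)]
    congr 1
    exact intervalIntegral.integral_congr fun b hb => by simp only [key s t hs hst ht b hb]

lemma lap_bdd (hV : ContDiff ℝ 2 V) (hp : Per V) : ∃ L, 0 ≤ L ∧ ∀ x, |∑ i, pd (vv (m := m) i) (pd (vv i) V) x| ≤ L := by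
  have := Per.bounded (f := fun x => ∑ i, pd (vv (m := m) i) (pd (vv i) V) x) (fun k j x => by
    refine Finset.sum_congr rfl fun i _ => ?_
    exact ((hp.pd _).pd _) k j x) (by have := fun i : Fin (m + 1) => pdpdV_cont hV (vv i) (vv i); fun_prop)
  exact this

lemma TT_GG (hV : ContDiff ℝ 2 V) (hp : Per V) (hβ : 0 < β) {K L N : ℝ} (K0 : 0 ≤ K) (hK : ∀ i x, |pd (vv (m := m) i) V x| ≤ K) (L0 : 0 ≤ L) (hL : ∀ x, |∑ i, pd (vv (m := m) i) (pd (vv i) V) x| ≤ L)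
    {R κ : ℝ} {W : Spc m → St m} (hκ : 0 < κ) (hW : Per W) (cW : Continuous W)
    (h1 : ∀ x, HasFDerivAt (fun y => (W y).1) (W x).2 x)
    (hR : ∀ x, ‖W x‖ ≤ R) (hm : ∀ s, κ ≤ marg (fun x => wt V β x * (W x).1) s) (hn : ∀ x, 0 ≤ (W x).1) (hN : ∀ x, |(W x).1| ≤ N) {b : ℝ} (hb : 0 < b) (x : Spc m) :
    |b * TT b (GG V β R κ W) x| ≤ b * ((L + β * K * K) * N) + (m + 1) * (2 * K * N * n1 m) := by
  have cq : Continuous fun y => (W y).2 := continuous_snd.comp cW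
  have cu : Continuous fun y => (W y).1 := continuous_fst.comp cW
  have cw := wt_cont (β := β) hV
  have R0 : 0 ≤ R := (norm_nonneg _).trans (hR 0)
  have N0 : 0 ≤ N := (abs_nonneg _).trans (hN 0)
  have G := GGx (β := β) (R := R) hV hp hκ hW h1 cq hR hm
  set φ := phiF V (fun x => wt V β x * (W x).1) with hφ
  have cφ : Continuous φ := continuous_iff_continuousAt.2 fun s => (G (s, 0)).1.continuousAt
  have bφ : ∀ s, |φ s| ≤ K := fun s => phi_le hV (by fun_prop) (fun x => mul_nonneg (Real.exp_pos _).le (hn x)) (hκ.trans_le (hm s)) fun x => by rw [← vv_zero]; exact hK 0 x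
  have pφ : Per fun x : Spc m => φ x.1 := fun k j x => by
    have : (x + lv k j).1 = x.1 + k := by simp [lv]
    show φ (x + lv k j).1 = _
    rw [this]
    exact phi_per hp ((wt_per (β := β) hp).mul (hW.comp Prod.fst)) x.1 k
  have cP : Continuous (fP1 V β R κ W) := (fP1_nice hV hp R0 hκ).cont1 cW
  have cdd : ∀ i : Fin (m + 1), Continuous (fderiv ℝ (pd (vv (m := m) i) V)) := fun i => (pdV_c1 hV (vv i)).continuous_fderiv (by norm_num)
  have cd := fun i : Fin (m + 1) => pdV_cont hV (vv i)
  let f : Fin (m + 1) → Spc m → ℝ := fun i x => -((pd (vv i) V x + (if i = 0 then 1 else 0) * φ x.1) * (W x).1)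
  let f' : Fin (m + 1) → Spc m → Spc m →L[ℝ] ℝ := fun i x => -((pd (vv i) V x + (if i = 0 then 1 else 0) * φ x.1) • (W x).2 + (W x).1 • (fderiv ℝ (pd (vv i) V) x + ((if i = 0 then (1:ℝ) else 0) * fP1 V β R κ W x) • ContinuousLinearMap.fst ℝ ℝ (Fin m → ℝ)))
  have df : ∀ i x, HasFDerivAt (f i) (f' i x) x := fun i x => by
    have a : HasFDerivAt (fun z : Spc m => φ z.1) _ x := (G x).1.hasFDerivAt.comp x hasFDerivAt_fst
    have := (((pdV_der hV (vv i) x).add (a.const_mul (if i = 0 then (1:ℝ) else 0))).mul (h1 x)).neg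
    refine this.congr_fderiv ?_
    have e : ∀ c : ℝ, (ContinuousLinearMap.toSpanSingleton ℝ c).comp (ContinuousLinearMap.fst ℝ ℝ (Fin m → ℝ)) = c • ContinuousLinearMap.fst ℝ ℝ (Fin m → ℝ) := fun c => by
      ext v <;> simp
    rw [e, smul_smul]; rfl
  have pf : ∀ i, Per (f i) := fun i k j x => by
    have a := hp.pd (vv i) k j x; have b := pφ k j x; have c := hW k j x
    simp only [f] at *; rw [a, b, c]
  have cf : ∀ i, Continuous (f' i) := fun i => by simp only [f']; fun_prop
  have key := TT_div (f0 := fun x => (∑ i, pd (vv (m := m) i) (pd (vv i) V) x + β * pd (vv 0) V x * φ x.1) * (W x).1) (f := f) (f' := f') (C0 := (L + β * K * K) * N) (C1 := 2 * K * N) (b := b) (by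
      have := fun i : Fin (m + 1) => pdpdV_cont hV (vv i) (vv i)
      fun_prop) (fun x => ?_) df cf (fun i x => ?_) (fun i => ((Per.of_der (df i) (pf i)).bounded (cf i)).imp fun C h => h.2) hb x
  · refine le_of_eq_of_le ?_ key
    congr 3
    funext x
    rw [(G x).2.1]
    have a : ∀ i, pd (vv i) (pd (vv i) V) x = fderiv ℝ (pd (vv (m := m) i) V) x (vv i) := fun i => rfl
    have s : ∑ i, f' i x (vv i) = -(∑ i, pd (vv i) V x * (W x).2 (vv i)) - φ x.1 * (W x).2 (e1 m) - (W x).1 * (∑ i, pd (vv (m := m) i) (pd (vv i) V) x) - (W x).1 * fP1 V β R κ W x := by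
      have t : ∀ i, f' i x (vv i) = -(pd (vv i) V x * (W x).2 (vv i)) - (W x).1 * pd (vv (m := m) i) (pd (vv i) V) x - (if i = 0 then φ x.1 * (W x).2 (vv i) + (W x).1 * fP1 V β R κ W x * (vv i).1 else 0) := fun i => by
        rw [a]; simp only [f', ContinuousLinearMap.neg_apply, ContinuousLinearMap.add_apply, ContinuousLinearMap.smul_apply, smul_eq_mul, ContinuousLinearMap.coe_fst']
        split_ifs <;> ring
      simp only [t, Finset.sum_sub_distrib, Finset.sum_neg_distrib, ← Finset.mul_sum, Finset.sum_ite_eq', Finset.mem_univ, if_true, vv_zero]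
      simp [e1]; ring
    rw [s, vv_zero]; ring
  · rw [abs_mul]
    refine mul_le_mul ((abs_add_le _ _).trans (add_le_add (hL x) ?_)) (hN x) (abs_nonneg _) (by positivity)
    rw [abs_mul, abs_mul, abs_of_pos hβ]
    have := hK 0 x
    gcongr; exact bφ _
  · simp only [f]
    rw [abs_neg, abs_mul]
    refine mul_le_mul ((abs_add_le _ _).trans ?_) (hN x) (abs_nonneg _) (by positivity)
    have := hK i x; have := bφ x.1
    split_ifs <;> simp <;> linarith

lemma GG_le (hV : ContDiff ℝ 2 V) (hp : Per V) (hβ : 0 < β) {c M1 : ℝ} (hc : 0 < c) (hM1 : 0 ≤ M1) : ∃ a b, 0 ≤ a ∧ 0 ≤ b ∧ ∀ (R κ : ℝ) (W : Spc m → St m) (hκ : 0 < κ) (hW : Per W) (cW : Continuous W)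
    (h1 : ∀ x, HasFDerivAt (fun y => (W y).1) (W x).2 x)
    (hR : ∀ x, ‖W x‖ ≤ R) (hm : ∀ s, κ ≤ marg (fun x => wt V β x * (W x).1) s) (hcm : ∀ s, c ≤ marg (fun x => wt V β x * (W x).1) s) (hn : ∀ x, 0 ≤ (W x).1) (hN : ∀ x, |(W x).1| ≤ M1) (N : ℝ) (hQ : ∀ x, ‖(W x).2‖ ≤ N) (x : Spc m),
    |GG V β R κ W x| ≤ a + b * N := by
  obtain ⟨K, K0, hK⟩ := V_bdd hV hp
  obtain ⟨K2, K20, hK2⟩ := ((hp.pd (e1 m)).pd (e1 m)).bounded (pdpdV_cont hV (e1 m) (e1 m))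
  obtain ⟨Kw, Kw0, hKw⟩ := (wt_per (β := β) hp).bounded (wt_cont (β := β) hV)
  refine ⟨β * K * (K * M1) + ((K2 + β * K ^ 2) * Kw * M1 + K * (β * K * Kw * M1)) / c * M1, (m + 1) * K + K + (K * Kw + K * Kw) / c * M1, by positivity, by positivity, fun R κ W hκ hW cW h1 hR hm hcm hn hN N hQ x => ?_⟩
  have hK1 : ∀ x, |pd (e1 m) V x| ≤ K := fun x => by rw [← vv_zero]; exact hK 0 x
  have cw := wt_cont (β := β) hV
  have N0 : 0 ≤ N := (norm_nonneg _).trans (hQ 0)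
  have cu : Continuous fun y => (W y).1 := continuous_fst.comp cW
  obtain ⟨-, g2, g3⟩ := GGx (β := β) (R := R) hV hp hκ hW h1 (continuous_snd.comp cW) hR hm x
  have bφ : |phiF V (fun x => wt V β x * (W x).1) x.1| ≤ K := phi_le hV (by fun_prop) (fun x => mul_nonneg (Real.exp_pos _).le (hn x)) (hc.trans_le (hcm _)) hK1
  have R0 : 0 ≤ R := (norm_nonneg _).trans (hR 0)
  have clle : ∀ a, |cl R a| ≤ |a| := fun a => by
    have := cl_lip R a 0
    rwa [cl_eq (a := 0) (by simpa using R0), sub_zero, sub_zero] at this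
  have k1 : ∀ x, |cl R (uL (W x))| ≤ M1 := fun x => (clle _).trans (hN x)
  have qv : ∀ v, ‖v‖ ≤ 1 → ∀ x, |(W x).2 v| ≤ N := fun v hv x => ((W x).2.le_opNorm v).trans ((mul_le_of_le_one_right (norm_nonneg _) hv).trans (hQ x))
  have ne : ‖e1 m‖ ≤ 1 := by simpa [vv_zero] using vv_norm (m := m) 0
  have k2 : ∀ x, |cl R (qL (e1 m) (W x))| ≤ N := fun x => (clle _).trans (qv _ ne x)
  have ib : ∀ (g : (Fin m → ℝ) → ℝ) C, (∀ y, |g y| ≤ C) → |∫ y in cube1 m, g y| ≤ C := fun g C h => by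
    have := norm_integral_le_of_norm_le_const (μ := volume.restrict (cube1 m)) (f := g) (C := C) (Eventually.of_forall h)
    rwa [volR_cube1, mul_one] at this
  have ba : ∀ x, |wt V β x| ≤ Kw := hKw
  have b1 : |fN1 V β R W x| ≤ (K2 + β * K ^ 2) * Kw * M1 + K * Kw * N := ib _ _ fun y => by
    refine (abs_add_le _ _).trans (add_le_add ?_ ?_)
    · rw [abs_mul, abs_mul]
      have : |pd (e1 m) (pd (e1 m) V) (x.1, y) - β * pd (e1 m) V (x.1, y) ^ 2| ≤ K2 + β * K ^ 2 := by
        refine (abs_sub _ _).trans (add_le_add (hK2 _) ?_)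
        rw [abs_mul, abs_of_pos hβ, abs_pow]
        have := hK1 (x.1, y)
        gcongr
      exact mul_le_mul (mul_le_mul this (ba _) (abs_nonneg _) (by positivity)) (k1 _) (abs_nonneg _) (by positivity)
    · rw [abs_mul, abs_mul]
      exact mul_le_mul (mul_le_mul (hK1 _) (ba _) (abs_nonneg _) (by positivity)) (k2 _) (abs_nonneg _) (by positivity)
  have b2 : |fR1 V β R W x| ≤ β * K * Kw * M1 + Kw * N := ib _ _ fun y => by
    refine (abs_add_le _ _).trans (add_le_add ?_ ?_)
    · rw [abs_mul, abs_mul, abs_mul, abs_neg, abs_of_pos hβ]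
      exact mul_le_mul (mul_le_mul (mul_le_mul_of_nonneg_left (hK1 _) hβ.le) (ba _) (abs_nonneg _) (by positivity)) (k1 _) (abs_nonneg _) (by positivity)
    · rw [abs_mul]
      exact mul_le_mul (ba _) (k2 _) (abs_nonneg _) (by positivity)
  have b3 : |fP1 V β R κ W x| ≤ (((K2 + β * K ^ 2) * Kw * M1 + K * Kw * N) + K * (β * K * Kw * M1 + Kw * N)) / c := by
    rw [g3, abs_mul, abs_inv, abs_of_pos (hc.trans_le (hcm x.1)), ← div_eq_mul_inv]
    refine div_le_div₀ (by positivity) ((abs_sub _ _).trans (add_le_add b1 ?_)) hc (hcm _)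
    rw [abs_mul]; exact mul_le_mul bφ b2 (abs_nonneg _) K0
  rw [g2]
  refine ((abs_sub _ _).trans (add_le_add ((abs_add_le _ _).trans (add_le_add ((abs_sub _ _).trans (add_le_add (b := (m + 1) * (K * N)) (d := K * N) ?_ ?_)) (b := _) (d := β * K * (K * M1)) ?_))
    (b := _) (d := (((K2 + β * K ^ 2) * Kw * M1 + K * Kw * N) + K * (β * K * Kw * M1 + Kw * N)) / c * M1) ?_)).trans (le_of_eq ?_)
  · rw [abs_neg]
    refine (Finset.abs_sum_le_sum_abs _ _).trans ((Finset.sum_le_sum (g := fun _ => K * N) fun i _ => ?_).trans (by simp))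
    rw [abs_mul]; exact mul_le_mul (hK i x) (qv _ (vv_norm i) x) (abs_nonneg _) K0
  · rw [abs_mul]; exact mul_le_mul bφ (qv _ ne x) (abs_nonneg _) K0
  · rw [abs_mul, abs_mul, abs_mul, abs_of_pos hβ]
    exact mul_le_mul (mul_le_mul_of_nonneg_left (hK1 _) hβ.le) (mul_le_mul bφ (hN x) (abs_nonneg _) K0) (by positivity) (by positivity)
  · rw [abs_mul]; exact mul_le_mul b3 (hN x) (abs_nonneg _) (by positivity)
  · field_simp; ring
end glob

section glob2
variable {m : ℕ} {V : Spc m → ℝ} {β : ℝ}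

set_option maxHeartbeats 1000000 in
lemma apri (hV : ContDiff ℝ 2 V) (hp : Per V) (hβ : 0 < β) {T U0 Q0 c : ℝ} (hU0 : 0 ≤ U0) (hQ0 : 0 ≤ Q0) (hc : 0 < c) : ∃ R0, 0 ≤ R0 ∧ ∀ (T' R κ : ℝ) (w : ℝ → Spc m → St m),
    T' ≤ T → 0 < κ → Sol β T' (GG V β R κ) w → (∀ t, 0 ≤ t → t < T' → (∀ x, ‖w t x‖ ≤ R) ∧ (∀ s, κ ≤ marg (fun x => wt V β x * (w t x).1) s) ∧ (∀ s, c ≤ marg (fun x => wt V β x * (w t x).1) s) ∧ ∀ x, 0 ≤ (w t x).1) →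
    (∀ x, |(w 0 x).1| ≤ U0) → (∀ x, ‖(w 0 x).2‖ ≤ Q0) → ∀ t, 0 ≤ t → t < T' → ∀ x, ‖w t x‖ ≤ R0 := by
  obtain ⟨K, K0, hK⟩ := V_bdd hV hp
  obtain ⟨L, L0, hL⟩ := lap_bdd hV hp
  have hn1 := n1_nonneg (m := m)
  set Kc := bb β T * (L + β * K * K) + (m + 1) * (2 * K * n1 m) with hKc
  have bT := bb_nonneg (β := β) T
  have Kc0 : 0 ≤ Kc := by positivity
  obtain ⟨l, hl, hl2⟩ := GI (β := β) hβ (η := 1 / (2 * β * Kc + 1)) (by positivity)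
  set M1 := 2 * U0 * Real.exp (l * T) with hM1
  have M10 : 0 ≤ M1 := by positivity
  clear_value M1 Kc
  obtain ⟨a, b, a0, b0, hab⟩ := GG_le hV hp hβ hc M10
  obtain ⟨l', hl', hl2'⟩ := GI (β := β) hβ (η := 1 / (2 * β * n1 m * b + 1)) (by positivity)
  set η' := 1 / (2 * β * n1 m * b + 1) with hη'
  have η'0 : 0 ≤ η' := by positivity
  set M2 := 2 * (Q0 + β * a * n1 m * η') * Real.exp (l' * T) with hM2
  have M20 : 0 ≤ M2 := by positivity
  clear_value M2 η'
  refine ⟨max M1 M2, le_max_of_le_left M10, fun T' R κ w hT hκ S hg hu hq => ?_⟩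
  obtain ⟨M, hM⟩ := S.bd
  have wle : ∀ l t : ℝ, 0 < l → 0 ≤ t → Real.exp (-l * t) ≤ 1 := fun l t h1 h2 => Real.exp_le_one_iff.2 (by nlinarith)
  have wm : ∀ l t : ℝ, Real.exp (-l * t) * Real.exp (l * t) = 1 := fun l t => by rw [← Real.exp_add]; simp
  have tim : ∀ t, 0 ≤ t → ∀ b, 0 ≤ b → b ≤ bb β t → 0 ≤ t - β * b ^ 2 / 2 ∧ t - β * b ^ 2 / 2 ≤ t := fun t ht b h1 h2 =>
    ⟨by have := bb_time hβ ht h1 h2; linarith, by have := mul_nonneg hβ.le (sq_nonneg b); linarith⟩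
  have ex : ∀ l t b : ℝ, Real.exp (l * (t - β * b ^ 2 / 2)) = Real.exp (l * t) * Real.exp (-l * (β * b ^ 2 / 2)) := fun l t b => by
    rw [← Real.exp_add]; congr 1; ring
  -- sup bound for u
  have s1 : ∀ t, 0 ≤ t → t < T' → ∀ x, |(w t x).1| ≤ M1 := fun t ht htT x => by
    have := halve (ι := {t : ℝ // 0 ≤ t ∧ t < T'} × Spc m) (f := fun z => Real.exp (-l * z.1.1) * |(w z.1.1 z.2).1|) (A := U0) (M := |M|) (fun z => (mul_le_of_le_one_left (abs_nonneg _) (wle l _ hl z.1.2.1)).trans ((norm_fst_le _).trans ((hM _ _).trans (le_abs_self _)))) (fun N hN z => ?_) (⟨t, ht, htT⟩, x)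
    · have h2 : |(w t x).1| = Real.exp (-l * t) * |(w t x).1| * Real.exp (l * t) := by rw [mul_right_comm, wm, one_mul]
      rw [h2, hM1]
      exact mul_le_mul this (Real.exp_le_exp.2 (by nlinarith)) (Real.exp_pos _).le (by positivity)
    · obtain ⟨⟨t, ht, htT⟩, x⟩ := z
      have N0 : 0 ≤ N := le_trans (by positivity) (hN (⟨t, ht, htT⟩, x))
      have hN' : ∀ s, 0 ≤ s → s < T' → ∀ y, |(w s y).1| ≤ N * Real.exp (l * s) := fun s h1 h2 y => by
        have := hN (⟨s, h1, h2⟩, y)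
        have h2 : |(w s y).1| = Real.exp (-l * s) * |(w s y).1| * Real.exp (l * s) := by rw [mul_right_comm, wm, one_mul]
        rw [h2]; exact mul_le_mul_of_nonneg_right this (Real.exp_pos _).le
      show Real.exp (-l * t) * |(w t x).1| ≤ _
      have r := S.re 0 t le_rfl ht htT.le x
      rw [sub_zero] at r
      have e1 : |TT (bb β t) (fun y => (w 0 y).1) x| ≤ U0 := by
        have : ‖TT (bb β t) (fun y => (w 0 y).1) x‖ ≤ U0 := TT_bound hu _ x
        exact this
      have e2 := UU_div (l := l) (h := fun b => GG V β R κ (w (t - β * b ^ 2 / 2))) (M := Kc * N * Real.exp (l * t)) hβ.le (bb_nonneg (β := β) t) (by positivity) x (fun b h1 h2 => by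
        obtain ⟨q1, q2⟩ := tim t ht b h1.le h2
        obtain ⟨g1, g2, g3, g4⟩ := hg _ q1 (q2.trans_lt htT)
        refine (TT_GG hV hp hβ K0 hK L0 hL hκ (S.per _) (S.c _) (S.der _) g1 g2 g4 (hN' _ q1 (q2.trans_lt htT)) h1 x).trans ?_
        rw [ex, hKc]
        have : b ≤ bb β T := h2.trans (bb_mono hβ (htT.le.trans hT))
        have : b * ((L + β * K * K) * (N * (Real.exp (l * t) * Real.exp (-l * (β * b ^ 2 / 2))))) ≤ bb β T * ((L + β * K * K) * (N * (Real.exp (l * t) * Real.exp (-l * (β * b ^ 2 / 2))))) := by gcongr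
        linarith) (hl2 _ (bb_nonneg (β := β) t))
      have e3 : β * (Kc * N * Real.exp (l * t)) * (1 / (2 * β * Kc + 1)) ≤ N * Real.exp (l * t) / 2 := by
        rw [mul_one_div, div_le_iff₀ (by positivity)]
        nlinarith [mul_nonneg N0 (Real.exp_pos (l * t)).le]
      rw [r]
      refine (mul_le_mul_of_nonneg_left ((abs_add_le _ _).trans (add_le_add e1 (e2.trans e3))) (Real.exp_pos _).le).trans ?_
      have := mul_le_mul_of_nonneg_right (wle l t hl ht) hU0
      have := wm l t
      nlinarith
  have s2 : ∀ t, 0 ≤ t → t < T' → ∀ x, ‖(w t x).2‖ ≤ M2 := fun t ht htT x => by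
    have := halve (ι := {t : ℝ // 0 ≤ t ∧ t < T'} × Spc m) (f := fun z => Real.exp (-l' * z.1.1) * ‖(w z.1.1 z.2).2‖) (A := Q0 + β * a * n1 m * η') (M := |M|) (fun z => (mul_le_of_le_one_left (norm_nonneg _) (wle l' _ hl' z.1.2.1)).trans ((norm_snd_le _).trans ((hM _ _).trans (le_abs_self _)))) (fun N hN z => ?_) (⟨t, ht, htT⟩, x)
    · have h2 : ‖(w t x).2‖ = Real.exp (-l' * t) * ‖(w t x).2‖ * Real.exp (l' * t) := by rw [mul_right_comm, wm, one_mul]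
      rw [h2, hM2]
      exact mul_le_mul this (Real.exp_le_exp.2 (by nlinarith)) (Real.exp_pos _).le (by positivity)
    · obtain ⟨⟨t, ht, htT⟩, x⟩ := z
      have N0 : 0 ≤ N := le_trans (by positivity) (hN (⟨t, ht, htT⟩, x))
      have hN' : ∀ s, 0 ≤ s → s < T' → ∀ y, ‖(w s y).2‖ ≤ N * Real.exp (l' * s) := fun s h1 h2 y => by
        have := hN (⟨s, h1, h2⟩, y)
        have h2 : ‖(w s y).2‖ = Real.exp (-l' * s) * ‖(w s y).2‖ * Real.exp (l' * s) := by rw [mul_right_comm, wm, one_mul]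
        rw [h2]; exact mul_le_mul_of_nonneg_right this (Real.exp_pos _).le
      show Real.exp (-l' * t) * ‖(w t x).2‖ ≤ _
      have r := S.req 0 t le_rfl ht htT.le x
      rw [sub_zero] at r
      have e1 : ‖TT (bb β t) (fun y => (w 0 y).2) x‖ ≤ Q0 := TT_bound hq _ x
      have e2 := QQ_wbound (l := l') (h := fun b => GG V β R κ (w (t - β * b ^ 2 / 2))) (M := (a + b * N) * Real.exp (l' * t)) hβ.le (bb_nonneg (β := β) t) (by positivity) (fun b' h1 h2 y => by
        obtain ⟨q1, q2⟩ := tim t ht b' h1 h2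
        obtain ⟨g1, g2, g3, g4⟩ := hg _ q1 (q2.trans_lt htT)
        refine (hab R κ _ hκ (S.per _) (S.c _) (S.der _) g1 g2 g3 g4 (s1 _ q1 (q2.trans_lt htT)) _ (hN' _ q1 (q2.trans_lt htT)) y).trans ?_
        rw [mul_assoc, ← ex]
        have : 1 ≤ Real.exp (l' * (t - β * b' ^ 2 / 2)) := Real.one_le_exp (mul_nonneg hl'.le q1)
        nlinarith) (hl2' _ (bb_nonneg (β := β) t)) x
      have e3 : β * (b * n1 m) * η' ≤ 1 / 2 := by
        rw [hη', mul_one_div, div_le_iff₀ (by positivity)]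
        linarith
      rw [r]
      refine (mul_le_mul_of_nonneg_left ((norm_add_le _ _).trans (add_le_add e1 e2)) (Real.exp_pos _).le).trans ?_
      have h5 := mul_le_mul_of_nonneg_right (wle l' t hl' ht) hQ0
      have h6 : Real.exp (-l' * t) * (β * ((a + b * N) * Real.exp (l' * t)) * n1 m * η') = β * a * n1 m * η' + N * (β * (b * n1 m) * η') := by
        calc _ = (Real.exp (-l' * t) * Real.exp (l' * t)) * (β * a * n1 m * η' + N * (β * (b * n1 m) * η')) := by ring
          _ = _ := by rw [wm, one_mul]
      rw [mul_add, h6]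
      have := mul_le_mul_of_nonneg_left e3 N0
      linarith
  intro t h1 h2 x
  rw [Prod.norm_def]
  exact max_le_max (s1 t h1 h2 x) (s2 t h1 h2 x)

lemma marg_bd {f : Spc m → ℝ} {C : ℝ} (h : ∀ x, |f x| ≤ C) (s : ℝ) : |marg f s| ≤ C := by
  have := norm_setIntegral_le_of_norm_le_const (μ := volume) (s := cube1 m) (f := fun y => f (s, y)) (C := C) (by have := measure_lt_top (volume.restrict (cube1 m)) univ; rwa [Measure.restrict_apply_univ] at this) (fun y _ => h _)
  rw [vol_cube1, mul_one] at this
  exact this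

lemma Sol.unif {A : (Spc m → St m) → Spc m → ℝ} {T : ℝ} {w : ℝ → Spc m → St m} (h : Sol β T A w) {ε : ℝ} (hε : 0 < ε) :
    ∃ δ > 0, ∀ s t, 0 ≤ s → s ≤ T → 0 ≤ t → t ≤ T → |t - s| < δ → ∀ x, ‖w t x - w s x‖ < ε := by
  have hk : IsCompact (Icc 0 T ×ˢ ccube m) := isCompact_Icc.prod ccube_compact
  obtain ⟨δ, hδ, hd⟩ := Metric.uniformContinuousOn_iff.1 (hk.uniformContinuousOn_of_continuous h.wc.continuousOn) ε hε
  refine ⟨δ, hδ, fun s t h1 h2 h3 h4 h5 x => ?_⟩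
  obtain ⟨k, j, hkj⟩ := exists_lv x
  have := hd (t, x + lv k j) ⟨⟨h3, h4⟩, cube_sub hkj⟩ (s, x + lv k j) ⟨⟨h1, h2⟩, cube_sub hkj⟩ (by
    rw [Prod.dist_eq, dist_self]; exact max_lt (by rwa [Real.dist_eq]) hδ)
  rw [dist_eq_norm] at this
  simpa [Function.uncurry, h.per t k j x, h.per s k j x] using this

lemma glob (hV : ContDiff ℝ 2 V) (hp : Per V) (hβ : 0 < β) {ψ0 : Spc m → ℝ} {d0 : Spc m → Spc m →L[ℝ] ℝ} (hd : ∀ x, HasFDerivAt ψ0 (d0 x) x)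
    (hdc : Continuous d0) (hp0 : Per ψ0) (hn : ∀ x, 0 ≤ ψ0 x) {c : ℝ} (hc : 0 < c) (hcm : ∀ s, c ≤ marg ψ0 s) {T : ℝ} (hT : 0 < T) :
    ∃ ψ, NS V β T ψ ∧ ψ 0 = ψ0 := by
  have wpos : ∀ x, 0 < wt V β x := fun x => Real.exp_pos _
  have hV1 : Continuous (fderiv ℝ V) := hV.continuous_fderiv (by norm_num)
  obtain ⟨u0, q0, hu, hq, pu, hmul⟩ : ∃ u0 : Spc m → ℝ, ∃ q0 : Spc m → Spc m →L[ℝ] ℝ, (∀ x, HasFDerivAt u0 (q0 x) x) ∧ Continuous q0 ∧ Per u0 ∧ ∀ x, wt V β x * u0 x = ψ0 x := by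
    refine ⟨fun x => wt V (-β) x * ψ0 x, fun x => wt V (-β) x • d0 x + ψ0 x • ((- -β * wt V (-β) x) • fderiv ℝ V x), fun x => (wt_der hV x).mul (hd x), ?_, Per.mul (wt_per hp) hp0, fun x => ?_⟩
    · have := wt_cont (β := -β) hV
      have := cont_of_der hd
      fun_prop
    · unfold wt
      rw [← mul_assoc, ← Real.exp_add]; simp
  have pq : Per q0 := Per.of_der hu pu
  obtain ⟨U0, hU0, hU⟩ := Per.bounded pu (cont_of_der hu)
  obtain ⟨Q0, hQ0, hQ⟩ := Per.bounded pq hq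
  obtain ⟨C, hC0, hC, -⟩ := wmul hV hp β
  obtain ⟨R1, R10, hR1⟩ := apri hV hp hβ (T := T) hU0 hQ0 hc
  set R0 := max R1 (max U0 Q0) with hR0
  have R00 : 0 ≤ R0 := le_max_of_le_left R10
  obtain ⟨w, S, w0⟩ := sol_exists hβ (GG_nice (β := β) (R := R0 + 1) (κ := c / 2) hV hp (by linarith) (by linarith)) hT.le hu hq pu pq
  obtain ⟨δ, hδ, hun⟩ := S.unif (ε := min 1 (c / 2 / (C + 1))) (by positivity)
  have wc : ∀ t, Continuous fun x => wt V β x * (w t x).1 := fun t => (wt_cont (β := β) hV).mul (S.c t).fst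
  have i0 : (fun x => wt V β x * (w 0 x).1) = ψ0 := by ext x; rw [w0, hmul]
  have step : ∀ s t, 0 ≤ s → s ≤ T → 0 ≤ t → t ≤ T → |t - s| < δ → (∀ x, ‖w s x‖ ≤ R0) → (∀ r, c ≤ marg (fun x => wt V β x * (w s x).1) r) →
      (∀ x, ‖w t x‖ ≤ R0 + 1) ∧ ∀ r, c / 2 ≤ marg (fun x => wt V β x * (w t x).1) r := fun s t a1 a2 a3 a4 a5 h1 h2 => by
    have h := hun s t a1 a2 a3 a4 a5
    refine ⟨fun x => ?_, fun r => ?_⟩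
    · have := norm_sub_norm_le (w t x) (w s x)
      have := (h x).le.trans (min_le_left _ _)
      linarith [h1 x]
    · have h3 := marg_bd (f := fun x => wt V β x * (w t x).1 - wt V β x * (w s x).1) (C := c / 2) (fun x => by
        rw [← mul_sub, abs_mul, abs_of_pos (wpos x)]
        have b1 : |(w t x).1 - (w s x).1| ≤ c / 2 / (C + 1) := (norm_fst_le (w t x - w s x)).trans ((h x).le.trans (min_le_right _ _))
        refine (mul_le_mul (hC x) b1 (abs_nonneg _) hC0).trans ?_
        rw [mul_div_assoc', div_le_iff₀ (by linarith)]; nlinarith) r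
      rw [marg_sub (wc t) (wc s)] at h3
      linarith [h2 r, (abs_le.1 h3).1]
  have b0 : (∀ x, ‖w 0 x‖ ≤ R0) ∧ ∀ r, c ≤ marg (fun x => wt V β x * (w 0 x).1) r := by
    refine ⟨fun x => ?_, by rw [i0]; exact hcm⟩
    rw [w0, Prod.norm_def]
    exact max_le (((hU x).trans (le_max_left _ _)).trans (le_max_right _ _)) (((hQ x).trans (le_max_right _ _)).trans (le_max_right _ _))
  have main : ∀ k : ℕ, ∀ t, 0 ≤ t → t ≤ T → t ≤ k * (δ / 3) → (∀ x, ‖w t x‖ ≤ R0 + 1) ∧ ∀ r, c / 2 ≤ marg (fun x => wt V β x * (w t x).1) r := by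
    intro k
    induction k with
    | zero =>
      intro t h1 h2 h3
      rw [Nat.cast_zero, zero_mul] at h3
      exact step 0 t le_rfl hT.le h1 h2 (by rw [sub_zero, le_antisymm h3 h1]; simpa) b0.1 b0.2
    | succ k ih =>
      intro t h1 h2 h3
      rw [Nat.cast_add, Nat.cast_one] at h3
      set T' := min (k * (δ / 3)) T with hT'
      have T0 : 0 ≤ T' := le_min (by positivity) hT.le
      have tT : t ≤ T' + δ / 3 := by
        rcases min_cases (k * (δ / 3)) T with h | h <;> rw [hT', h.1] <;> linarith
      by_cases hk : t ≤ T'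
      · exact ih t h1 h2 (hk.trans (min_le_left _ _))
      push Not at hk
      rcases T0.eq_or_lt with h | h
      · exact step 0 t le_rfl hT.le h1 h2 (by rw [sub_zero, abs_of_nonneg h1]; linarith) b0.1 b0.2
      have hr := S.restrict hβ T0 (min_le_right _ _ : T' ≤ T)
      have ct0 : ct T' 0 = 0 := ct_eq le_rfl T0
      have ns : NS V β T' (fun t x => wt V β x * (w (ct T' t) x).1) := by
        refine ⟨R0 + 1, c / 2, _, by linarith, hr, fun t q1 q2 => ?_⟩
        have := ih t q1 (q2.trans (min_le_right _ _)) (q2.trans (min_le_left _ _))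
        simp only [ct_eq q1 q2]
        exact ⟨this.1, this.2, trivial⟩
      have lp := (lp_of (σ := 3 / 2) (p := 2) (Tm := ENNReal.ofReal T') hV hp hβ (by norm_num) (by norm_num) (by norm_num) (fun t q1 q2 => ⟨T', (ENNReal.ofReal_lt_ofReal_iff h).1 q2, ns⟩)).1
      simp only [ct0, i0] at lp
      have bet : ∀ s, 0 ≤ s → s < T' → (∀ x, ‖w s x‖ ≤ R0) ∧ ∀ r, c ≤ marg (fun x => wt V β x * (w s x).1) r := by
        have hI : ∀ s, 0 ≤ s → s < T' → s ∈ Ico0 (ENNReal.ofReal T') := fun s q1 q2 => ⟨q1, (ENNReal.ofReal_lt_ofReal_iff h).2 q2⟩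
        have hm : ∀ s, 0 ≤ s → s < T' → ∀ r, c ≤ marg (fun x => wt V β x * (w s x).1) r := fun s q1 q2 r => by
          have := marg_lb hV hp hβ (by norm_num) lp (cont_of_der hd) hp0 hcm (hI s q1 q2) r
          simpa only [ct_eq q1 q2.le] using this
        refine fun s q1 q2 => ⟨fun x => ?_, hm s q1 q2⟩
        have := hR1 T' (R0 + 1) (c / 2) _ (min_le_right _ _) (by linarith) hr (fun t p1 p2 => by
          have i := ih t p1 (p2.le.trans (min_le_right _ _)) (p2.le.trans (min_le_left _ _))
          have n := nonneg hV hp hβ (by norm_num) lp (cont_of_der hd) hp0 hn (hI t p1 p2)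
          simp only [ct_eq p1 p2.le] at n ⊢
          exact ⟨i.1, i.2, hm t p1 p2, fun x => nonneg_of_mul_nonneg_right (n x) (wpos x)⟩)
          (fun x => by rw [ct0, w0]; exact hU x) (fun x => by rw [ct0, w0]; exact hQ x) s q1 q2 x
        simp only [ct_eq q1 q2.le] at this
        exact this.trans (le_max_left _ _)
      have hs : max 0 (T' - δ / 3) < T' := max_lt h (by linarith)
      have bs := bet _ (le_max_left _ _) hs
      refine step _ t (le_max_left _ _) (hs.le.trans (min_le_right _ _)) h1 h2 ?_ bs.1 bs.2
      rw [abs_lt]; constructor <;> linarith [le_max_right 0 (T' - δ / 3)]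
  obtain ⟨k, hk⟩ := exists_nat_ge (T / (δ / 3))
  rw [div_le_iff₀ (by linarith)] at hk
  exact ⟨fun t x => wt V β x * (w t x).1, ⟨R0 + 1, c / 2, w, by linarith, S, fun t h1 h2 => ⟨(main k t h1 h2 (h2.trans hk)).1, (main k t h1 h2 (h2.trans hk)).2, rfl⟩⟩, i0⟩
end glob2

section lpn
variable {m : ℕ} {p : ℝ} {F : Type*} [NormedAddCommGroup F] [NormedSpace ℝ F]

def LN (p : ℝ) (g : Spc m → F) : ℝ≥0∞ := eLpNorm g (ENNReal.ofReal p) (μT m)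

lemma LN_pow (hp : 0 < p) (g : Spc m → F) : LN p g ^ p = ∫⁻ x, ‖g x‖ₑ ^ p ∂μT m := by
  rw [LN, eLpNorm_eq_lintegral_rpow_enorm_toReal (by simpa) (by simp), ENNReal.toReal_ofReal hp.le, ← ENNReal.rpow_mul, one_div_mul_cancel hp.ne', ENNReal.rpow_one]

lemma LN_le (hp : 0 < p) {g : Spc m → F} {C : ℝ≥0∞} (h : ∫⁻ x, ‖g x‖ₑ ^ p ∂μT m ≤ C ^ p) : LN p g ≤ C := by
  rw [← LN_pow hp] at h
  exact (ENNReal.rpow_le_rpow_iff hp).1 h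

lemma LN_mono {G : Type*} [NormedAddCommGroup G] {g : Spc m → F} {g' : Spc m → G} (h : ∀ x, ‖g x‖ ≤ ‖g' x‖) : LN p g ≤ LN p g' :=
  eLpNorm_mono h

lemma LN_bd {g : Spc m → F} {C : ℝ} (h : ∀ x, ‖g x‖ ≤ C) : LN p g ≤ ENNReal.ofReal C := eLp_le h

lemma LN_add (hp : 1 ≤ p) {f g : Spc m → F} (hf : Continuous f) (hg : Continuous g) {A B : ℝ} (hA : 0 ≤ A) (hB : 0 ≤ B) (h1 : LN p f ≤ ENNReal.ofReal A) (h2 : LN p g ≤ ENNReal.ofReal B) :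
    LN p (fun x => f x + g x) ≤ ENNReal.ofReal (A + B) := by
  rw [ENNReal.ofReal_add hA hB]
  exact (eLpNorm_add_le hf.aestronglyMeasurable hg.aestronglyMeasurable (by simpa)).trans (add_le_add h1 h2)

lemma LN_sub (hp : 1 ≤ p) {f g : Spc m → F} (hf : Continuous f) (hg : Continuous g) {A B : ℝ} (hA : 0 ≤ A) (hB : 0 ≤ B) (h1 : LN p f ≤ ENNReal.ofReal A) (h2 : LN p g ≤ ENNReal.ofReal B) :
    LN p (fun x => f x - g x) ≤ ENNReal.ofReal (A + B) := by
  rw [ENNReal.ofReal_add hA hB]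
  exact (eLpNorm_sub_le hf.aestronglyMeasurable hg.aestronglyMeasurable (by simpa)).trans (add_le_add h1 h2)

lemma LN_cm {f : Spc m → F} {A a : ℝ} (hA : 0 ≤ A) (h : LN p f ≤ ENNReal.ofReal a) : LN p (fun x => A * ‖f x‖) ≤ ENNReal.ofReal (A * a) := by
  rw [ENNReal.ofReal_mul hA]
  have := eLpNorm_const_smul_le (c := A) (f := fun x => ‖f x‖) (p := ENNReal.ofReal p) (μ := μT m)
  rw [Real.enorm_of_nonneg hA, eLpNorm_norm] at this
  exact this.trans (mul_le_mul_right h _)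

/-- pointwise domination `‖g‖ ≤ A‖f‖ + B‖f'‖ + D` -/
lemma LN_dom (hp : 1 ≤ p) {G H : Type*} [NormedAddCommGroup G] [NormedSpace ℝ G] [NormedAddCommGroup H] [NormedSpace ℝ H] {g : Spc m → F} {f : Spc m → G} {f' : Spc m → H} (hf : Continuous f) (hf' : Continuous f') {A B D a b : ℝ} (hA : 0 ≤ A) (hB : 0 ≤ B) (hD : 0 ≤ D)
    (ha : 0 ≤ a) (hb : 0 ≤ b) (h1 : LN p f ≤ ENNReal.ofReal a) (h2 : LN p f' ≤ ENNReal.ofReal b) (h : ∀ x, ‖g x‖ ≤ A * ‖f x‖ + B * ‖f' x‖ + D) :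
    LN p g ≤ ENNReal.ofReal (A * a + B * b + D) := by
  refine (LN_mono (g' := fun x => (A * ‖f x‖ + B * ‖f' x‖) + D) (fun x => (h x).trans (le_abs_self _))).trans ?_
  exact LN_add hp (by fun_prop) continuous_const (by positivity) hD (LN_add hp (by fun_prop) (by fun_prop) (by positivity) (by positivity) (LN_cm hA h1) (LN_cm hB h2)) (LN_bd fun x => (by simp [abs_of_nonneg hD]))

lemma jen {Z : Type*} [MeasurableSpace Z] (P : Measure Z) [IsProbabilityMeasure P] (hp : 1 ≤ p) {g : Z → F} (hg : AEStronglyMeasurable g P) :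
    ‖∫ z, g z ∂P‖ₑ ^ p ≤ ∫⁻ z, ‖g z‖ₑ ^ p ∂P := by
  have h := eLpNorm'_le_eLpNorm'_of_exponent_le (p := 1) (q := p) one_pos hp P hg
  rw [eLpNorm'_eq_lintegral_enorm, eLpNorm'_eq_lintegral_enorm] at h
  simp only [ENNReal.rpow_one, div_one] at h
  refine (ENNReal.rpow_le_rpow ((enorm_integral_le_lintegral_enorm _).trans h) (by linarith)).trans ?_
  rw [← ENNReal.rpow_mul, one_div_mul_cancel (by linarith), ENNReal.rpow_one]

lemma mink {Z : Type*} [MeasurableSpace Z] [TopologicalSpace Z] [SecondCountableTopology Z] [OpensMeasurableSpace Z] (P : Measure Z) [IsProbabilityMeasure P] (hp : 1 ≤ p) {g : Spc m → Z → F} (hg : Continuous (Function.uncurry g)) {N : Z → ℝ} {C : ℝ} (hC : 0 ≤ C)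
    (hN0 : ∀ z, 0 ≤ N z) (hN : ∀ᵐ z ∂P, LN p (fun x => g x z) ≤ ENNReal.ofReal (N z)) (hI : ∫⁻ z, ENNReal.ofReal (N z ^ p) ∂P ≤ ENNReal.ofReal (C ^ p)) :
    LN p (fun x => ∫ z, g x z ∂P) ≤ ENNReal.ofReal C := by
  have p0 : 0 < p := by linarith
  have hc : Continuous fun q : Spc m × Z => g q.1 q.2 := hg
  refine LN_le p0 ?_
  refine (lintegral_mono fun x => jen P hp (hc.comp (by fun_prop : Continuous fun z => (x, z))).aestronglyMeasurable).trans ?_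
  rw [lintegral_lintegral_swap (by
    have : Continuous (Function.uncurry fun (x : Spc m) (z : Z) => ‖g x z‖ₑ ^ p) := (ENNReal.continuous_rpow_const).comp (continuous_enorm.comp hg)
    exact this.measurable.aemeasurable), ENNReal.ofReal_rpow_of_nonneg hC p0.le]
  refine (lintegral_mono_ae ?_).trans hI
  filter_upwards [hN] with z hz
  rw [← LN_pow p0, ← ENNReal.ofReal_rpow_of_nonneg (hN0 z) p0.le]
  exact ENNReal.rpow_le_rpow hz p0.le

def fdB (m : ℕ) : Module.Basis (Fin (m + 1)) ℝ (Spc m) := (Pi.basisFun ℝ (Fin (m + 1))).map (eL m).symm.toLinearEquiv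

lemma fdB_eq : ZSpan.fundamentalDomain (fdB m) = cube m := by
  ext x
  rw [ZSpan.mem_fundamentalDomain]
  have : ∀ i, (fdB m).repr x i = eL m x i := fun i => by simp [fdB]
  simp only [this, Fin.forall_fin_succ, eL_apply, Fin.cons_zero, Fin.cons_succ]
  simp [cube, cube1, Set.mem_prod, Set.mem_pi]

lemma per_lint {f : Spc m → ℝ≥0∞} (h : Per f) (a : Spc m) : ∫⁻ x, f (x + a) ∂μT m = ∫⁻ x, f x ∂μT m := by
  have fd := ZSpan.isAddFundamentalDomain (fdB m) (volume : Measure (Spc m))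
  have inv : ∀ (g : Submodule.span ℤ (range (fdB m))) (x : Spc m), f (g +ᵥ x) = f x := fun g x => by
    obtain ⟨g, hg⟩ := g
    show f (g + x) = f x
    induction hg using Submodule.span_induction generalizing x with
    | mem y hy =>
      obtain ⟨i, rfl⟩ := hy
      have : fdB m i = vv i := by simp [fdB, vv]
      rw [this, add_comm, h.vv]
    | zero => rw [zero_add]
    | add y z _ _ hy hz => rw [add_assoc, hy, hz]
    | smul k y _ hy =>
      have n : ∀ j : ℕ, ∀ x, f ((j : ℤ) • y + x) = f x := fun j => by
        induction j with
        | zero => simp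
        | succ j ih => intro x; rw [Nat.cast_succ, add_smul, one_smul, add_assoc, ih, hy]
      obtain ⟨j, rfl | rfl⟩ := k.eq_nat_or_neg
      · exact n j x
      · rw [← n j, ← add_assoc, neg_smul, add_neg_cancel, zero_add]
  have fd2 : IsAddFundamentalDomain (Submodule.span ℤ (range (fdB m))) ((fun x => x - a) ⁻¹' cube m) (volume : Measure (Spc m)) := by
    refine IsAddFundamentalDomain.mk' ((measurable_sub_const a) cube_meas).nullMeasurableSet fun x => ?_
    have := ZSpan.exist_unique_vadd_mem_fundamentalDomain (fdB m) (x - a)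
    rw [fdB_eq] at this
    refine (existsUnique_congr fun v => ?_).1 this
    show (v : Spc m) + (x - a) ∈ cube m ↔ (v : Spc m) + x - a ∈ cube m
    rw [add_sub_assoc]
  rw [fdB_eq] at fd
  haveI : VAddInvariantMeasure (Submodule.span ℤ (range (fdB m))) (Spc m) volume := ⟨fun c s hs => measure_preimage_add volume (c : Spc m) s⟩
  have := fd.setLIntegral_eq fd2 f inv
  rw [μT, this]
  have mp := (measurePreserving_add_right (volume : Measure (Spc m)) a)
  have := mp.setLIntegral_comp_preimage_emb (MeasurableEquiv.addRight a).measurableEmbedding f ((fun x => x - a) ⁻¹' cube m)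
  rw [← this]
  congr 2
  ext x; simp

lemma LN_tr (hp : 0 < p) {g : Spc m → F} (h : Per g) (a : Spc m) : LN p (fun x => g (x + a)) = LN p g := by
  have : LN p (fun x => g (x + a)) ^ p = LN p g ^ p := by
    rw [LN_pow hp, LN_pow hp, per_lint (f := fun x => ‖g x‖ₑ ^ p) (fun k j x => by simp only [h k j x])]
  exact ENNReal.rpow_left_injective hp.ne' this

def gP (m : ℕ) : Measure (Spc m) := volume.withDensity fun z => ENNReal.ofReal (kk z)

lemma kk_c : Continuous (kk (m := m)) := continuous_iff_continuousAt.2 fun z => (hasFDerivAt_kk z).continuousAt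

instance : IsProbabilityMeasure (gP m) := ⟨by
  rw [gP, withDensity_apply _ MeasurableSet.univ, Measure.restrict_univ, ← ofReal_integral_eq_lintegral_ofReal (RD_kk.integrable) (ae_of_all _ fun z => (kk_pos z).le), integral_kk, ENNReal.ofReal_one]⟩

lemma gP_int (g : Spc m → F) : ∫ z, g z ∂gP m = ∫ z, kk z • g z := by
  rw [gP, integral_withDensity_eq_integral_toReal_smul (f := fun z => ENNReal.ofReal (kk z)) (ENNReal.measurable_ofReal.comp kk_c.measurable) (by simp)]
  simp only [ENNReal.toReal_ofReal (kk_pos _).le]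

lemma kerN (hp : 1 ≤ p) {g : Spc m → Spc m → F} (hg : Continuous (Function.uncurry g)) {C γ b : ℝ} (hC : 0 ≤ C) (hγ : 0 ≤ γ) (hb : 0 ≤ b)
    (h : ∀ z, LN p (fun x => g x z) ≤ ENNReal.ofReal (C * ‖z‖ ^ γ)) :
    LN p (fun x => ∫ z, kk z • g x (b • z)) ≤ ENNReal.ofReal (C * b ^ γ * mom m (γ * p) ^ (1 / p)) := by
  have p0 : 0 < p := by linarith
  have hm := mom_nonneg (m := m) (γ * p)
  simp_rw [← gP_int]
  have hc : Continuous fun q : Spc m × Spc m => g q.1 q.2 := hg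
  refine mink (gP m) hp (g := fun x z => g x (b • z)) (N := fun z => C * b ^ γ * ‖z‖ ^ γ) (hc.comp (by fun_prop : Continuous fun q : Spc m × Spc m => (q.1, b • q.2))) (by positivity) (fun z => by positivity) (ae_of_all _ fun z => ?_) ?_
  · refine (h _).trans (le_of_eq ?_)
    rw [norm_smul, Real.mul_rpow (norm_nonneg _) (norm_nonneg _), Real.norm_of_nonneg hb, mul_assoc]
  · have e : ∀ z : Spc m, (C * b ^ γ * ‖z‖ ^ γ) ^ p = (C * b ^ γ) ^ p * ‖z‖ ^ (γ * p) := fun z => by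
      rw [Real.mul_rpow (by positivity) (by positivity), ← Real.rpow_mul (norm_nonneg _)]
    simp_rw [e, ENNReal.ofReal_mul (by positivity : 0 ≤ (C * b ^ γ) ^ p)]
    rw [lintegral_const_mul _ (by fun_prop), Real.mul_rpow (x := C * b ^ γ) (y := mom m (γ * p) ^ (1 / p)) (by positivity) (by positivity), ← Real.rpow_mul hm, one_div_mul_cancel p0.ne', Real.rpow_one, ENNReal.ofReal_mul (by positivity), gP,
      lintegral_withDensity_eq_lintegral_mul (f := fun z => ENNReal.ofReal (kk z)) _ (ENNReal.measurable_ofReal.comp kk_c.measurable) (by fun_prop), mom, ofReal_integral_eq_lintegral_ofReal (RD_kk.moment _ (by positivity)) (ae_of_all _ fun z => by positivity)]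
    gcongr with z
    simp only [Pi.mul_apply]
    rw [← ENNReal.ofReal_mul (kk_pos z).le, mul_comm, Real.norm_of_nonneg (kk_pos z).le]

variable {f : Spc m → ℝ} {f' : Spc m → Spc m →L[ℝ] ℝ}

lemma ftc (h : ∀ x, HasFDerivAt f (f' x) x) (hc : Continuous f') (x z : Spc m) : f (x + z) - f x = ∫ θ in Icc (0:ℝ) 1, f' (x + θ • z) z := by
  have d : ∀ θ : ℝ, HasDerivAt (fun θ : ℝ => f (x + θ • z)) (f' (x + θ • z) z) θ := fun θ => by
    have : HasDerivAt (fun θ : ℝ => x + θ • z) z θ := by simpa using ((hasDerivAt_id θ).smul_const z).const_add x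
    exact (h _).comp_hasDerivAt θ this
  have := intervalIntegral.integral_eq_sub_of_hasDerivAt (a := 0) (b := 1) (fun θ _ => d θ) (Continuous.intervalIntegrable (by fun_prop) _ _)
  rw [integral_Icc_eq_integral_Ioc, ← intervalIntegral.integral_of_le zero_le_one, this]
  simp

instance : IsProbabilityMeasure (volume.restrict (Icc (0:ℝ) 1)) := ⟨by simp⟩

lemma taylN (hp : 1 ≤ p) (h : ∀ x, HasFDerivAt f (f' x) x) (hc : Continuous f') {C a : ℝ} (hC : 0 ≤ C) (ha : 0 ≤ a)
    (hN : ∀ z, LN p (fun x => f' (x + z) - f' x) ≤ ENNReal.ofReal (C * ‖z‖ ^ a)) (z : Spc m) :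
    LN p (fun x => f (x + z) - f x - f' x z) ≤ ENNReal.ofReal (C * ‖z‖ ^ a * ‖z‖) := by
  have e : (fun x => f (x + z) - f x - f' x z) = fun x => ∫ θ in Icc (0:ℝ) 1, (f' (x + θ • z) - f' x) z := by
    ext x
    have i1 : IntegrableOn (fun θ : ℝ => f' (x + θ • z) z) (Icc 0 1) := (Continuous.continuousOn (by fun_prop)).integrableOn_compact isCompact_Icc
    rw [ftc h hc]
    simp only [ContinuousLinearMap.sub_apply]
    rw [integral_sub i1 (integrable_const _)]; simp
  rw [e]
  refine mink _ hp (g := fun x (θ : ℝ) => (f' (x + θ • z) - f' x) z) (N := fun _ => C * ‖z‖ ^ a * ‖z‖) (by simp only [Function.uncurry_def]; fun_prop) (by positivity) (fun _ => by positivity) ?_ (by simp)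
  refine (ae_restrict_iff' measurableSet_Icc).2 (ae_of_all _ fun θ hθ => ?_)
  have := LN_dom hp (g := fun x => (f' (x + θ • z) - f' x) z) (f := fun x => f' (x + θ • z) - f' x) (f' := fun x => (0:ℝ)) (by fun_prop) (by fun_prop) (A := ‖z‖) (B := 0) (D := 0) (norm_nonneg _) le_rfl le_rfl
    (by positivity) le_rfl (hN (θ • z)) (LN_bd (C := 0) (by simp)) (fun x => by have := (f' (x + θ • z) - f' x).le_opNorm z; simp only [norm_zero]; linarith)
  refine this.trans (ENNReal.ofReal_le_ofReal ?_)
  have : ‖θ • z‖ ≤ ‖z‖ := by rw [norm_smul, Real.norm_of_nonneg hθ.1]; exact mul_le_of_le_one_left (norm_nonneg _) hθ.2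
  have : C * ‖θ • z‖ ^ a ≤ C * ‖z‖ ^ a := by gcongr
  nlinarith [norm_nonneg z]

lemma diffN (hp : 1 ≤ p) (h : ∀ x, HasFDerivAt f (f' x) x) (hc : Continuous f') (hper : Per f') {C : ℝ} (hC : 0 ≤ C)
    (hN : LN p f' ≤ ENNReal.ofReal C) (z : Spc m) : LN p (fun x => f (x + z) - f x) ≤ ENNReal.ofReal (C * ‖z‖) := by
  simp_rw [ftc h hc]
  refine mink _ hp (g := fun x (θ : ℝ) => f' (x + θ • z) z) (N := fun _ => C * ‖z‖) (by simp only [Function.uncurry_def]; fun_prop) (by positivity) (fun _ => by positivity) (ae_of_all _ fun θ => ?_) (by simp)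
  have := LN_dom hp (g := fun x => f' (x + θ • z) z) (f := fun x => f' (x + θ • z)) (f' := fun x => (0:ℝ)) (by fun_prop) (by fun_prop) (A := ‖z‖) (B := 0) (D := 0) (norm_nonneg _) le_rfl le_rfl
    hC le_rfl ((LN_tr (by linarith) hper _).trans_le hN) (LN_bd (C := 0) (by simp)) (fun x => by have := (f' (x + θ • z)).le_opNorm z; simp only [norm_zero]; linarith)
  refine this.trans (ENNReal.ofReal_le_ofReal (by linarith))
end lpn

section est
variable {m : ℕ} {p : ℝ}

lemma kk_odd (L : Spc m →L[ℝ] ℝ) : ∫ z : Spc m, kk z • L z = 0 := by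
  have h := integral_neg_eq_self (fun z : Spc m => kk z • L z) volume
  have e : ∀ z : Spc m, kk (-z) • L (-z) = -(kk z • L z) := fun z => by
    have : kk (-z) = kk z := by simp [kk, qd]
    rw [this]; simp
  simp_rw [e, integral_neg] at h
  linarith

def Est (β T p a : ℝ) (f : ℝ → Spc m → ℝ) (d : ℝ → Spc m → Spc m →L[ℝ] ℝ) : Prop :=
  ∃ C, 0 ≤ C ∧ ∀ s t, 0 ≤ s → s ≤ t → t ≤ T →
    LN p (fun x => f t x - f s x) ≤ ENNReal.ofReal (C * bb β (t - s) ^ (1 + a)) ∧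
    LN p (fun x => d t x - d s x) ≤ ENNReal.ofReal (C * bb β (t - s) ^ a) ∧
    ∀ z, LN p (fun x => d t (x + z) - d t x) ≤ ENNReal.ofReal (C * ‖z‖ ^ a)

set_option maxHeartbeats 1000000 in
lemma base {β T a : ℝ} (hβ : 0 < β) {A : (Spc m → St m) → Spc m → ℝ} (hA : Nice A) {w : ℝ → Spc m → St m} (h : Sol β T A w)
    (ha : 0 < a) (ha1 : a < 1) (hp : 1 ≤ p) {C0 : ℝ} (hC0 : 0 ≤ C0)
    (hN : ∀ z, LN p (fun x => (w 0 (x + z)).2 - (w 0 x).2) ≤ ENNReal.ofReal (C0 * ‖z‖ ^ a)) :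
    Est β T p a (fun t x => (w t x).1) (fun t x => (w t x).2) := by
  obtain ⟨M, hM0, hM, -⟩ := hA.ex
  obtain ⟨N, hNb⟩ := h.bd
  have gc := hA.cont w h.wc
  have qb : ∀ t x, ‖(w t x).2‖ ≤ N := fun t x => (norm_snd_le _).trans (hNb t x)
  have ub : ∀ t x, ‖(w t x).1‖ ≤ N := fun t x => (norm_fst_le _).trans (hNb t x)
  have qc : ∀ t, Continuous fun x => (w t x).2 := fun t => (h.c t).snd
  have uc : ∀ t, Continuous fun x => (w t x).1 := fun t => (h.c t).fst
  have hm := fun α => mom_nonneg (m := m) α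
  have hn1 := n1_nonneg (m := m)
  have hn2 := n2_nonneg (m := m)
  have bT := bb_nonneg (β := β) T
  set K1 := C0 * mom m 0 ^ (1 / p) + β * (M * (2 * n1 m + n2 m)) * (bb β T ^ (1 - a) / (1 - a)) with hK1
  have h1a : 0 < 1 - a := by linarith
  have K10 : 0 ≤ K1 := by have := hm 0; positivity
  have tc : ∀ (f : Spc m → Spc m →L[ℝ] ℝ), Continuous f → (∀ x, ‖f x‖ ≤ N) → ∀ b, Continuous (TT b f) := fun f hf hb b => TT_cont (f := fun (_ : Spc m) => f) (hf.comp continuous_snd) (fun _ => hb) continuous_const continuous_id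
  have tc' : ∀ (f : Spc m → ℝ), Continuous f → (∀ x, ‖f x‖ ≤ N) → ∀ b, Continuous (TT b f) := fun f hf hb b => TT_cont (f := fun (_ : Spc m) => f) (hf.comp continuous_snd) (fun _ => hb) continuous_const continuous_id
  have P3 : ∀ t, 0 ≤ t → t ≤ T → ∀ z, LN p (fun x => (w t (x + z)).2 - (w t x).2) ≤ ENNReal.ofReal (K1 * ‖z‖ ^ a) := by
    intro t h0 hT z
    have k := kerN (b := bb β (t - 0)) hp (g := fun x y => (w 0 (x + z + y)).2 - (w 0 (x + y)).2) (C := C0 * ‖z‖ ^ a) (γ := 0) (by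
      have := qc 0
      exact (this.comp (by fun_prop : Continuous fun q : Spc m × Spc m => q.1 + z + q.2)).sub (this.comp (by fun_prop : Continuous fun q : Spc m × Spc m => q.1 + q.2))) (by positivity) le_rfl (bb_nonneg _) (fun y => by
      have := LN_tr (p := p) (g := fun x => (w 0 (x + z)).2 - (w 0 x).2) (by linarith) (fun k j x => by
        have := h.per 0 k j
        beta_reduce; rw [add_right_comm, this, this]) y
      simp_rw [add_right_comm _ z y]
      rw [this, Real.rpow_zero, mul_one]; exact hN z)
    have e : (fun x => ∫ y, kk y • ((w 0 (x + z + bb β (t - 0) • y)).2 - (w 0 (x + bb β (t - 0) • y)).2)) = fun x => TT (bb β (t - 0)) (fun x => (w 0 x).2) (x + z) - TT (bb β (t - 0)) (fun x => (w 0 x).2) x := by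
      ext1 x
      simp_rw [smul_sub]
      exact integral_sub (TT_integrable (qc 0) (qb 0) _ _) (TT_integrable (qc 0) (qb 0) _ _)
    rw [e] at k
    rw [zero_mul, Real.rpow_zero, mul_one] at k
    have tq := tc _ (qc 0) (qb 0) (bb β (t - 0))
    have := LN_dom hp (g := fun x => (w t (x + z)).2 - (w t x).2) (f := fun x => TT (bb β (t - 0)) (fun x => (w 0 x).2) (x + z) - TT (bb β (t - 0)) (fun x => (w 0 x).2) x) (f' := fun _ => (0:ℝ)) ((tq.comp (by fun_prop)).sub tq) continuous_const (A := 1) (B := 0) (D := β * (M * (2 * n1 m + n2 m)) * (bb β T ^ (1 - a) / (1 - a)) * ‖z‖ ^ a) zero_le_one le_rfl (by positivity) (by have := hm 0; positivity) le_rfl k (LN_bd (C := 0) (by simp)) (fun x => by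
        rw [h.req 0 t le_rfl h0 hT, h.req 0 t le_rfl h0 hT, add_sub_add_comm]
        refine (norm_add_le _ _).trans ?_
        have := QQ_holder hβ.le (shift_cont (β := β) gc t) (fun b x => hM _ x) (bb_nonneg (β := β) (t - 0)) ha.le ha1 (x + z) x
        rw [add_sub_cancel_left] at this
        have hb : bb β (t - 0) ^ (1 - a) ≤ bb β T ^ (1 - a) := Real.rpow_le_rpow (bb_nonneg _) (bb_mono hβ (by linarith)) h1a.le
        have : β * (M * (2 * n1 m + n2 m)) * (bb β (t - 0) ^ (1 - a) / (1 - a)) * ‖z‖ ^ a ≤ β * (M * (2 * n1 m + n2 m)) * (bb β T ^ (1 - a) / (1 - a)) * ‖z‖ ^ a := by gcongr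
        simp only [norm_zero, mul_zero, add_zero, one_mul]
        linarith)
    refine this.trans (ENNReal.ofReal_le_ofReal (le_of_eq ?_))
    rw [hK1]; ring
  set K2 := K1 * mom m (a * p) ^ (1 / p) + β * (M * n1 m) * bb β T ^ (1 - a) with hK2
  set K3 := K1 * mom m ((1 + a) * p) ^ (1 / p) + β * M * bb β T ^ (1 - a) with hK3
  have K20 : 0 ≤ K2 := by have := hm (a * p); positivity
  have K30 : 0 ≤ K3 := by have := hm ((1 + a) * p); positivity
  refine ⟨K1 + K2 + K3, by positivity, fun s t h0 hst hT => ⟨?_, ?_, fun z => (P3 t (h0.trans hst) hT z).trans (ENNReal.ofReal_le_ofReal (by gcongr; linarith))⟩⟩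
  all_goals
    have hb := bb_nonneg (β := β) (t - s)
    have hbT : bb β (t - s) ≤ bb β T := bb_mono hβ (by linarith)
    have hP := P3 s h0 (hst.trans hT)
    set b := bb β (t - s) with hbd
    have hbb : b ≤ b ^ a * bb β T ^ (1 - a) := by
      calc b = b ^ a * b ^ (1 - a) := by rw [← Real.rpow_add' hb (by norm_num)]; simp
        _ ≤ _ := by gcongr
    have ba : 0 ≤ b ^ a := by positivity
    have b1 : b ^ (1 + a) = b * b ^ a := by rw [Real.rpow_add' hb (by linarith), Real.rpow_one]
  · have k := kerN (b := b) hp (g := fun x y => (w s (x + y)).1 - (w s x).1 - (w s x).2 y) (C := K1) (γ := 1 + a) (by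
      have h1 := uc s; have h2 := qc s
      exact ((h1.comp (by fun_prop : Continuous fun q : Spc m × Spc m => q.1 + q.2)).sub (h1.comp continuous_fst)).sub ((h2.comp continuous_fst).clm_apply continuous_snd)) K10 (by positivity) hb (fun y => by
      refine (taylN hp (h.der s) (qc s) K10 ha.le hP y).trans (le_of_eq ?_)
      rw [Real.rpow_add' (norm_nonneg _) (by linarith), Real.rpow_one]; ring_nf)
    have e : (fun x => ∫ y, kk y • ((w s (x + b • y)).1 - (w s x).1 - (w s x).2 (b • y))) = fun x => TT b (fun x => (w s x).1) x - (w s x).1 := by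
      ext1 x
      have i1 := TT_integrable (uc s) (ub s) b x
      have i2 : Integrable fun z : Spc m => kk z • (w s x).1 := (RD_kk.integrable).smul_const _
      have i3 : Integrable fun z : Spc m => b * (kk z • (w s x).2 z) := by
        refine Integrable.const_mul ?_ _
        refine ((RD_kk.moment 1 zero_le_one).const_mul ‖(w s x).2‖).mono' ((kk_c.smul (w s x).2.continuous).aestronglyMeasurable) (ae_of_all _ fun z => ?_)
        rw [norm_smul, Real.rpow_one]
        have := (w s x).2.le_opNorm z
        nlinarith [norm_nonneg (kk z)]
      have : ∀ y : Spc m, kk y • ((w s (x + b • y)).1 - (w s x).1 - (w s x).2 (b • y)) = kk y • (w s (x + b • y)).1 - kk y • (w s x).1 - b * (kk y • (w s x).2 y) := fun y => by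
        simp only [map_smul, smul_eq_mul]; ring
      simp_rw [this]
      have e1' := integral_sub (i1.sub i2) i3
      simp only [Pi.sub_apply] at e1'
      rw [e1', integral_sub i1 i2, integral_const_mul, kk_odd, integral_smul_const, integral_kk]
      simp [TT]
    rw [e] at k
    have tq := tc' _ (uc s) (ub s) b
    have := LN_dom hp (g := fun x => (w t x).1 - (w s x).1) (f := fun x => TT b (fun x => (w s x).1) x - (w s x).1) (f' := fun _ => (0:ℝ)) (tq.sub (uc s)) continuous_const (A := 1) (B := 0) (D := β * b * M * b) zero_le_one le_rfl (by positivity) (by have := hm ((1 + a) * p); positivity) le_rfl k (LN_bd (C := 0) (by simp)) (fun x => by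
        rw [h.re s t h0 hst hT, add_sub_right_comm]
        refine (norm_add_le _ _).trans ?_
        have := UU_bound (h := fun b => A (w (t - β * b ^ 2 / 2))) hβ.le (fun b x => hM _ x) hb x
        simp only [norm_zero, mul_zero, add_zero, one_mul]
        exact add_le_add le_rfl this)
    refine this.trans (ENNReal.ofReal_le_ofReal ?_)
    have h3 : β * b * M * b ≤ β * M * (b * (b ^ a * bb β T ^ (1 - a))) := by
      calc _ = β * M * (b * b) := by ring
        _ ≤ _ := by gcongr
    have : (K1 + K2 + K3) * b ^ (1 + a) ≥ K3 * b ^ (1 + a) := by gcongr; linarith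
    refine le_trans ?_ this
    rw [hK3, b1]; nlinarith
  · have k := kerN (b := b) hp (g := fun x y => (w s (x + y)).2 - (w s x).2) (C := K1) (γ := a) (by
      have h2 := qc s
      exact (h2.comp (by fun_prop : Continuous fun q : Spc m × Spc m => q.1 + q.2)).sub (h2.comp continuous_fst)) K10 ha.le hb hP
    have e : (fun x => ∫ y, kk y • ((w s (x + b • y)).2 - (w s x).2)) = fun x => TT b (fun x => (w s x).2) x - (w s x).2 := by
      ext1 x
      have i1 := TT_integrable (qc s) (qb s) b x
      have i2 : Integrable fun z : Spc m => kk z • (w s x).2 := (RD_kk.integrable).smul_const _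
      simp_rw [smul_sub]
      rw [integral_sub i1 i2, integral_smul_const, integral_kk, one_smul]; rfl
    rw [e] at k
    have tq := tc _ (qc s) (qb s) b
    have := LN_dom hp (g := fun x => (w t x).2 - (w s x).2) (f := fun x => TT b (fun x => (w s x).2) x - (w s x).2) (f' := fun _ => (0:ℝ)) (tq.sub (qc s)) continuous_const (A := 1) (B := 0) (D := β * (M * n1 m) * b) zero_le_one le_rfl (by positivity) (by have := hm (a * p); positivity) le_rfl k (LN_bd (C := 0) (by simp)) (fun x => by
        rw [h.req s t h0 hst hT, add_sub_right_comm]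
        refine (norm_add_le _ _).trans ?_
        have := QQ_bound (h := fun b => A (w (t - β * b ^ 2 / 2))) hβ.le (fun b x => hM _ x) hb x
        simp only [norm_zero, mul_zero, add_zero, one_mul]
        exact add_le_add le_rfl this)
    refine this.trans (ENNReal.ofReal_le_ofReal ?_)
    have h3 : β * (M * n1 m) * b ≤ β * (M * n1 m) * (b ^ a * bb β T ^ (1 - a)) := by gcongr
    have : (K1 + K2 + K3) * b ^ a ≥ K2 * b ^ a := by gcongr; linarith
    refine le_trans ?_ this
    rw [hK2]; nlinarith

end est

section est
variable {m : ℕ} {p : ℝ}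

lemma C2_bd {W : Spc m → ℝ} (h : ContDiff ℝ 2 W) (hp : Per W) : ∃ C, 0 ≤ C ∧ ∀ x, |W x| ≤ C ∧ ‖fderiv ℝ W x‖ ≤ C ∧ ∀ y, |W x - W y| ≤ C * ‖x - y‖ ∧ ‖fderiv ℝ W x - fderiv ℝ W y‖ ≤ C * ‖x - y‖ := by
  have d1 : ContDiff ℝ 1 (fderiv ℝ W) := h.fderiv_right (m := 1) (by norm_num)
  have c2 : Continuous (fderiv ℝ (fderiv ℝ W)) := d1.continuous_fderiv one_ne_zero
  obtain ⟨A, hA, bA⟩ := hp.bounded h.continuous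
  obtain ⟨B, hB, bB⟩ := hp.fderiv.bounded d1.continuous
  obtain ⟨D, hD, bD⟩ := hp.fderiv.fderiv.bounded c2
  refine ⟨A + B + D, by positivity, fun x => ⟨(bA x).trans (by linarith), (bB x).trans (by linarith), fun y => ⟨?_, ?_⟩⟩⟩
  · refine (lip_of_bd (fun x => (h.differentiable (by norm_num) x).hasFDerivAt) bB x y).trans ?_
    gcongr; linarith
  · refine (lip_of_bd (fun x => (d1.differentiable (by norm_num) x).hasFDerivAt) bD x y).trans ?_
    gcongr; linarith

lemma rmin {r K z a : ℝ} (hK : 0 ≤ K) (hz : 0 ≤ z) (ha : 0 ≤ a) (ha1 : a ≤ 1) (h1 : r ≤ K) (h2 : r ≤ K * z) : r ≤ K * z ^ a := by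
  rcases le_total z 1 with h | h
  · refine h2.trans ?_
    gcongr
    simpa using Real.rpow_le_rpow_of_exponent_ge' hz h ha ha1
  · exact h1.trans (le_mul_of_one_le_right hK (Real.one_le_rpow h ha))

lemma nik_mul (hp : 1 ≤ p) {W : Spc m → ℝ} (h : ContDiff ℝ 2 W) {C : ℝ} (hC : 0 ≤ C)
    (hW : ∀ x, |W x| ≤ C ∧ ‖fderiv ℝ W x‖ ≤ C ∧ ∀ y, |W x - W y| ≤ C * ‖x - y‖ ∧ ‖fderiv ℝ W x - fderiv ℝ W y‖ ≤ C * ‖x - y‖)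
    {f : Spc m → ℝ} {d : Spc m → Spc m →L[ℝ] ℝ} (hd : ∀ x, HasFDerivAt f (d x) x) (dc : Continuous d) {N : ℝ} (hf : ∀ x, |f x| ≤ N) (hdb : ∀ x, ‖d x‖ ≤ N)
    {K a : ℝ} (hK : 0 ≤ K) (ha : 0 ≤ a) (ha1 : a ≤ 1) (z : Spc m) (hN : LN p (fun x => d (x + z) - d x) ≤ ENNReal.ofReal (K * ‖z‖ ^ a)) :
    LN p (fun x => (W (x + z) • d (x + z) + f (x + z) • fderiv ℝ W (x + z)) - (W x • d x + f x • fderiv ℝ W x)) ≤ ENNReal.ofReal ((C * K + 8 * C * N) * ‖z‖ ^ a) := by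
  have N0 : 0 ≤ N := (abs_nonneg _).trans (hf 0)
  have := LN_dom hp (g := fun x => (W (x + z) • d (x + z) + f (x + z) • fderiv ℝ W (x + z)) - (W x • d x + f x • fderiv ℝ W x)) (f := fun x => d (x + z) - d x) (f' := fun _ => (0:ℝ)) (by fun_prop) continuous_const (A := C) (B := 0) (D := 8 * C * N * ‖z‖ ^ a) hC le_rfl (by positivity) (by positivity) le_rfl hN (LN_bd (C := 0) (by simp)) (fun x => by
    obtain ⟨w1, w2, w3⟩ := hW (x + z)
    obtain ⟨w4, w5, w6⟩ := hW x
    obtain ⟨w3, w7⟩ := w3 x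
    have l := lip_of_bd hd hdb (x + z) x
    rw [add_sub_cancel_left] at w3 w7 l
    have e : (W (x + z) • d (x + z) + f (x + z) • fderiv ℝ W (x + z)) - (W x • d x + f x • fderiv ℝ W x) = W (x + z) • (d (x + z) - d x) + ((W (x + z) - W x) • d x + f (x + z) • (fderiv ℝ W (x + z) - fderiv ℝ W x) + (f (x + z) - f x) • fderiv ℝ W x) := by module
    rw [e]
    refine (norm_add_le _ _).trans ?_
    simp only [norm_zero, mul_zero, add_zero]
    refine add_le_add (by rw [norm_smul]; gcongr; exact w1) ?_
    refine rmin (by positivity) (norm_nonneg _) ha ha1 ?_ ?_ <;> refine (norm_add₃_le).trans ?_ <;> simp only [norm_smul, Real.norm_eq_abs]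
    · have h1 : |W (x + z) - W x| ≤ 2 * C := (abs_sub _ _).trans (by linarith)
      have h2 : ‖fderiv ℝ W (x + z) - fderiv ℝ W x‖ ≤ 2 * C := (norm_sub_le _ _).trans (by linarith)
      have h3 : |f (x + z) - f x| ≤ 2 * N := (abs_sub _ _).trans (by linarith [hf x, hf (x + z)])
      have := mul_le_mul h1 (hdb x) (norm_nonneg _) (by linarith)
      have := mul_le_mul (hf (x + z)) h2 (norm_nonneg _) N0
      have := mul_le_mul h3 w5 (norm_nonneg _) (by linarith)
      have := mul_nonneg hC N0
      linarith
    · have := mul_le_mul w3 (hdb x) (norm_nonneg _) (by positivity)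
      have := mul_le_mul (hf (x + z)) w7 (norm_nonneg _) N0
      have := mul_le_mul l w5 (norm_nonneg _) (by positivity)
      have := mul_nonneg (mul_nonneg hC N0) (norm_nonneg z)
      simp only [Real.norm_eq_abs] at *
      linarith)
  exact this.trans (ENNReal.ofReal_le_ofReal (le_of_eq (by ring)))

variable {V : Spc m → ℝ}
lemma wt_C2 (hV : ContDiff ℝ 2 V) (β : ℝ) : ContDiff ℝ 2 (wt V β) := by
  unfold wt; fun_prop

set_option maxHeartbeats 1000000 in
lemma ns_est {β T a : ℝ} (hV : ContDiff ℝ 2 V) (hpV : Per V) (hβ : 0 < β) (hT : 0 ≤ T) {ψ : ℝ → Spc m → ℝ} (h : NS V β T ψ) {d0 : Spc m → Spc m →L[ℝ] ℝ}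
    (hd : ∀ x, HasFDerivAt (ψ 0) (d0 x) x) (dc : Continuous d0) (ha : 0 < a) (ha1 : a < 1) (hp : 1 ≤ p) {C0 : ℝ} (hC0 : 0 ≤ C0)
    (hN : ∀ z, LN p (fun x => d0 (x + z) - d0 x) ≤ ENNReal.ofReal (C0 * ‖z‖ ^ a)) :
    ∃ d : ℝ → Spc m → Spc m →L[ℝ] ℝ, Est β T p a ψ d ∧ ∀ t, 0 ≤ t → t ≤ T → (∀ x, HasFDerivAt (ψ t) (d t x) x) ∧ Continuous (d t) ∧ Per (d t) ∧ Continuous (ψ t) := by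
  have hp0 : Per (ψ 0) := NS.per hpV h le_rfl hT
  obtain ⟨R, κ, w, hκ, hS, hw⟩ := h
  have hR : 0 ≤ R := (norm_nonneg _).trans ((hw 0 le_rfl hT).1 0)
  have qc : ∀ t, Continuous fun x => (w t x).2 := fun t => (hS.c t).snd
  have uc : ∀ t, Continuous fun x => (w t x).1 := fun t => (hS.c t).fst
  obtain ⟨Nb, hNb⟩ := hS.bd
  have hNb0 : 0 ≤ Nb := (norm_nonneg _).trans (hNb 0 0)
  have qb : ∀ t x, ‖(w t x).2‖ ≤ Nb := fun t x => (norm_snd_le _).trans (hNb t x)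
  have ub : ∀ t x, |(w t x).1| ≤ Nb := fun t x => (norm_fst_le _).trans (hNb t x)
  have w0 : ∀ x, (w 0 x).1 = wt V (-β) x * ψ 0 x := fun x => by
    rw [(hw 0 le_rfl hT).2.2]
    have : wt V (-β) x * wt V β x = 1 := by rw [wt, wt, ← Real.exp_add]; simp
    beta_reduce; rw [← mul_assoc, this, one_mul]
  have dW : ∀ γ x, HasFDerivAt (wt V γ) (fderiv ℝ (wt V γ) x) x := fun γ x => ((wt_C2 hV γ).differentiable (by norm_num) x).hasFDerivAt
  have cW : ∀ γ, Continuous (fderiv ℝ (wt V γ)) := fun γ => (wt_C2 hV γ).continuous_fderiv (by norm_num)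
  have q0 : ∀ x, (w 0 x).2 = wt V (-β) x • d0 x + ψ 0 x • fderiv ℝ (wt V (-β)) x := fun x => by
    have h1 := hS.der 0 x
    have h2 := (dW (-β) x).mul (hd x)
    exact h1.unique (h2.congr_of_eventuallyEq (Eventually.of_forall fun y => w0 y))
  obtain ⟨A, hA, bA⟩ := hp0.bounded (cont_of_der hd)
  obtain ⟨B, hB, bB⟩ := (Per.of_der hd hp0).bounded dc
  obtain ⟨C, hC, bC⟩ := C2_bd (wt_C2 hV (-β)) (wt_per (β := -β) hpV)
  obtain ⟨D, hD, bD⟩ := C2_bd (wt_C2 hV β) (wt_per (β := β) hpV)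
  obtain ⟨K, hK, bK⟩ := base (p := p) (C0 := C * C0 + 8 * C * (A + B)) hβ (GG_nice hV hpV hR hκ) hS ha ha1 hp (by positivity) (fun z => by
    simp_rw [q0]
    exact nik_mul hp (wt_C2 hV _) hC bC hd dc (fun x => (bA x).trans (by linarith)) (fun x => (bB x).trans (by linarith)) hC0 ha.le ha1.le z (hN z))
  refine ⟨fun t x => wt V β x • (w t x).2 + (w t x).1 • fderiv ℝ (wt V β) x, ⟨D * K + 8 * D * Nb + D * K * (1 + bb β T), by have := bb_nonneg (β := β) T; positivity, fun s t h0 hst hT' => ?_⟩, fun t h0 h1 => ?_⟩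
  · obtain ⟨b1, b2, b3⟩ := bK s t h0 hst hT'
    have hb := bb_nonneg (β := β) (t - s)
    have hbT : bb β (t - s) ≤ bb β T := bb_mono hβ (by linarith)
    have hbT0 := bb_nonneg (β := β) T
    set b := bb β (t - s) with hbd
    have ba : 0 ≤ b ^ a := by positivity
    have ba1 : 0 ≤ b ^ (1 + a) := by positivity
    have e1' : b ^ (1 + a) = b * b ^ a := by rw [Real.rpow_add' hb (by linarith), Real.rpow_one]
    refine ⟨?_, ?_, fun z => ?_⟩
    · have := LN_dom hp (g := fun x => ψ t x - ψ s x) (f := fun x => (w t x).1 - (w s x).1) (f' := fun _ => (0:ℝ)) ((uc t).sub (uc s)) continuous_const (A := D) (B := 0) (D := 0) hD le_rfl le_rfl (by positivity) le_rfl b1 (LN_bd (C := 0) (by simp)) (fun x => by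
        rw [(hw t (h0.trans hst) hT').2.2, (hw s h0 (hst.trans hT')).2.2]
        beta_reduce
        rw [← mul_sub, norm_mul]
        simp only [norm_zero, mul_zero, add_zero]
        gcongr; exact (bD x).1)
      refine this.trans (ENNReal.ofReal_le_ofReal ?_)
      have : 0 ≤ (8 * D * Nb + D * K * (1 + bb β T)) * b ^ (1 + a) := by positivity
      linarith
    · have := LN_dom hp (g := fun x => (wt V β x • (w t x).2 + (w t x).1 • fderiv ℝ (wt V β) x) - (wt V β x • (w s x).2 + (w s x).1 • fderiv ℝ (wt V β) x)) (f := fun x => (w t x).2 - (w s x).2) (f' := fun x => (w t x).1 - (w s x).1) ((qc t).sub (qc s)) ((uc t).sub (uc s)) (A := D) (B := D) (D := 0) hD hD le_rfl (by positivity) (by positivity) b2 b1 (fun x => by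
        have e : (wt V β x • (w t x).2 + (w t x).1 • fderiv ℝ (wt V β) x) - (wt V β x • (w s x).2 + (w s x).1 • fderiv ℝ (wt V β) x) = wt V β x • ((w t x).2 - (w s x).2) + ((w t x).1 - (w s x).1) • fderiv ℝ (wt V β) x := by module
        rw [e, add_zero]
        refine (norm_add_le _ _).trans ?_
        rw [norm_smul, norm_smul, mul_comm D ‖(w t x).1 - (w s x).1‖]
        gcongr
        · exact (bD x).1
        · exact (bD x).2.1)
      refine this.trans (ENNReal.ofReal_le_ofReal ?_)
      have h1 : D * (K * b ^ (1 + a)) ≤ D * (K * (bb β T * b ^ a)) := by rw [e1']; gcongr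
      have h2 : 0 ≤ (8 * D * Nb + D * K) * b ^ a := by positivity
      linarith
    · refine (nik_mul hp (wt_C2 hV _) hD bD (hS.der t) (qc t) (ub t) (qb t) hK ha.le ha1.le z (b3 z)).trans (ENNReal.ofReal_le_ofReal ?_)
      have : 0 ≤ D * K * (1 + bb β T) * ‖z‖ ^ a := by positivity
      linarith
  · have hder : ∀ x, HasFDerivAt (ψ t) (wt V β x • (w t x).2 + (w t x).1 • fderiv ℝ (wt V β) x) x := fun x => by
      rw [(hw t h0 h1).2.2]
      exact (dW β x).mul (hS.der t x)
    refine ⟨hder, ((wt_C2 hV β).continuous.smul (qc t)).add ((uc t).smul (cW β)), Per.of_der hder (NS.per hpV ⟨R, κ, w, hκ, hS, hw⟩ h0 h1), cont_of_der hder⟩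

end est

section mor
variable {m : ℕ} {p : ℝ}

lemma μT_eq : μT m = volume.restrict (ccube m) := Measure.restrict_congr_set cube_ae

lemma finr : Module.finrank ℝ (Spc m) = m + 1 := by simp [Spc, add_comm]

lemma scl {s : ℝ} (hs : 0 < s) {α : Spc m} {B : Set (Spc m)} (hB : MeasurableSet B) (h : ∀ u ∈ cube m, α + s • u ∈ B) (F : Spc m → ℝ≥0∞) :
    ∫⁻ u, F (α + s • u) ∂μT m ≤ ENNReal.ofReal ((s ^ (m + 1))⁻¹) * ∫⁻ y in B, F y := by
  haveI := haarSpc (m := m)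
  calc ∫⁻ u, F (α + s • u) ∂μT m ≤ ∫⁻ u, B.indicator F (α + s • u) := by
        rw [μT, ← lintegral_indicator cube_meas]
        refine lintegral_mono fun u => ?_
        by_cases hu : u ∈ cube m
        · simp [hu, h u hu]
        · simp [hu]
    _ = ∫⁻ y, B.indicator F (α + y) ∂(Measure.map (fun x : Spc m => s • x) volume) := by
        exact ((Homeomorph.smulOfNeZero (α := Spc m) s hs.ne').measurableEmbedding.lintegral_map (μ := volume) (fun y => B.indicator F (α + y))).symm
    _ = _ := by
        rw [Measure.map_addHaar_smul _ hs.ne', lintegral_smul_measure, lintegral_add_left_eq_self, lintegral_indicator hB, finr, abs_of_pos (by positivity)]; rfl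

lemma ccube_diam {x y : Spc m} (hx : x ∈ ccube m) (hy : y ∈ ccube m) : ‖x - y‖ ≤ 1 := by
  obtain ⟨⟨a1, a2⟩, a3, a4⟩ := hx
  obtain ⟨⟨b1, b2⟩, b3, b4⟩ := hy
  refine max_le ?_ ((pi_norm_le_iff_of_nonneg zero_le_one).2 fun i => ?_)
  · simp at a1 a3 b1 b3 ⊢; exact abs_sub_le_iff.2 ⟨by linarith, by linarith⟩
  · have := a2 i; have := a4 i; have := b2 i; have := b4 i
    simp at this ⊢; simp at *
    exact abs_sub_le_iff.2 ⟨by linarith, by linarith⟩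

lemma ccube_mix {x u : Spc m} (hx : x ∈ ccube m) (hu : u ∈ ccube m) {s : ℝ} (h0 : 0 ≤ s) (h1 : s ≤ 1) : x + s • (u - x) ∈ ccube m := by
  have := (convex_Icc (0 : Spc m) 1) hx hu (sub_nonneg.2 h1) h0 (by ring)
  rwa [show x + s • (u - x) = (1 - s) • x + s • u by module]

variable {f : Spc m → ℝ} {d : Spc m → Spc m →L[ℝ] ℝ}

lemma shr_int {g : Spc m → ℝ} (hg : Measurable g) (hi : Integrable g (μT m)) {x : Spc m} (hx : x ∈ ccube m) {s : ℝ} (h0 : 0 < s) (h1 : s ≤ 1) :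
    Integrable (fun u => g (x + s • (u - x))) (μT m) := by
  refine ⟨(hg.comp (by fun_prop)).aestronglyMeasurable, ?_⟩
  have := scl h0 (α := x - s • x) (B := ccube m) measurableSet_Icc (fun u hu => by
    have := ccube_mix hx (cube_sub hu) h0.le h1
    rwa [show x - s • x + s • u = x + s • (u - x) by module]) (fun y => ‖g y‖ₑ)
  rw [← μT_eq] at this
  simp_rw [show ∀ u, x - s • x + s • u = x + s • (u - x) from fun u => by module] at this
  exact this.trans_lt (ENNReal.mul_lt_top (by simp) hi.2)

lemma mor_lim (i : Fin (m + 1)) (hd : ∀ x, HasFDerivAt f (d x) x) (hm : Measurable fun x => d x (vv i)) (hi : Integrable (fun x => d x (vv i)) (μT m)) {x : Spc m} (hx : x ∈ ccube m) :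
    Tendsto (fun k : ℕ => ∫ u, d (x + ((1:ℝ)/2) ^ k • (u - x)) (vv i) ∂μT m) atTop (nhds (d x (vv i))) := by
  rw [Metric.tendsto_atTop]
  intro ε hε
  have h1 := (hd x).isLittleO.def (c := ε / 4) (by positivity)
  obtain ⟨δ, hδ, h1⟩ := Metric.eventually_nhds_iff.1 h1
  obtain ⟨K, hK⟩ := exists_pow_lt_of_lt_one hδ (show (1:ℝ)/2 < 1 by norm_num)
  refine ⟨K, fun k hk => ?_⟩
  have s0 : 0 < ((1:ℝ)/2) ^ k := by positivity
  have s1 : ((1:ℝ)/2) ^ k ≤ 1 := pow_le_one₀ (by norm_num) (by norm_num)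
  have sδ : ((1:ℝ)/2) ^ k < δ := (pow_le_pow_of_le_one (by norm_num) (by norm_num) hk).trans_lt hK
  have i1 := shr_int hm hi hx s0 s1
  set s := ((1:ℝ)/2) ^ k with hs
  clear_value s
  have R : ∀ u, HasFDerivAt (fun u => f (x + s • (u - x)) - f x - d x (s • (u - x))) (s • d (x + s • (u - x)) - s • d x) u := fun u => by
    have l : HasFDerivAt (fun u : Spc m => s • (u - x)) (s • ContinuousLinearMap.id ℝ (Spc m)) u := HasFDerivAt.const_smul ((hasFDerivAt_id u).sub_const x) s
    have := (((hd _).comp u (l.const_add x)).sub_const (f x)).sub ((d x).hasFDerivAt.comp u l)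
    refine this.congr_fderiv ?_
    refine ContinuousLinearMap.ext fun v => ?_
    simp
  have Rb : ∀ u ∈ ccube m, ‖f (x + s • (u - x)) - f x - d x (s • (u - x))‖ ≤ ε / 4 * s := fun u hu => by
    have n1' : ‖s • (u - x)‖ ≤ s := by
      rw [norm_smul, Real.norm_of_nonneg s0.le]; exact mul_le_of_le_one_right s0.le (ccube_diam hu hx)
    have := h1 (y := x + s • (u - x)) (by rw [dist_eq_norm, add_sub_cancel_left]; exact n1'.trans_lt sδ)
    rw [add_sub_cancel_left] at this
    exact this.trans (by gcongr)
  have i2 : Integrable (fun u => (s • d (x + s • (u - x)) - s • d x) (vv i)) (μT m) := by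
    exact (i1.const_mul s).sub (integrable_const (s * d x (vv i)))
  have e1' : ∫ u, (s • d (x + s • (u - x)) - s • d x) (vv i) ∂μT m = s * ((∫ u, d (x + s • (u - x)) (vv i) ∂μT m) - d x (vv i)) := by
    simp only [ContinuousLinearMap.sub_apply, ContinuousLinearMap.smul_apply, smul_eq_mul]
    rw [integral_sub (i1.const_mul s) (integrable_const _), integral_const_mul]; simp; ring
  have e2 := i2
  rw [μT_eq] at e2
  have bd := box_div i (zero_le_one) R e2
  rw [μT_eq] at e1' ⊢
  have bd' := e1'.symm.trans bd
  have fc : ∀ c ∈ Icc (0:ℝ) 1, ‖∫ y in Icc ((eL m) 0 ∘ i.succAbove) ((eL m) 1 ∘ i.succAbove), (f (x + s • ((eL m).symm (i.insertNth c y) - x)) - f x - d x (s • ((eL m).symm (i.insertNth c y) - x)))‖ ≤ ε / 4 * s := fun c hc => by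
    have c1 : ∀ k, (eL m) 1 k = 1 := fun k => by rw [eL_apply]; refine Fin.cases ?_ (fun j => ?_) k <;> rfl
    have c0 : ∀ k, (eL m) 0 k = 0 := fun k => by simp
    have v1 : volume.real (Icc ((eL m) 0 ∘ i.succAbove) ((eL m) 1 ∘ i.succAbove)) = 1 := by
      rw [Measure.real, Real.volume_Icc_pi]; simp [c1]
    have vl : volume (Icc ((eL m) 0 ∘ i.succAbove) ((eL m) 1 ∘ i.succAbove)) < ⊤ := isCompact_Icc.measure_lt_top
    refine (norm_setIntegral_le_of_norm_le_const (C := ε / 4 * s) vl fun y hy => Rb _ ?_).trans_eq (by rw [v1, mul_one])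
    constructor
    · rw [← eL_ord, ContinuousLinearEquiv.apply_symm_apply, map_zero]
      intro k
      rcases Fin.eq_self_or_eq_succAbove i k with rfl | ⟨j, rfl⟩
      · simpa using hc.1
      · simpa using hy.1 j
    · rw [← eL_ord, ContinuousLinearEquiv.apply_symm_apply]
      intro k
      rcases Fin.eq_self_or_eq_succAbove i k with rfl | ⟨j, rfl⟩
      · simpa [c1] using hc.2
      · simpa using hy.2 j
  have f1 := fc ((eL m) 1 i) (by rw [eL_apply]; refine Fin.cases ?_ (fun j => ?_) i <;> simp)
  have f0 := fc ((eL m) 0 i) (by simp)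
  have t := (norm_sub_le _ _).trans (add_le_add f1 f0)
  rw [← bd', norm_mul, Real.norm_of_nonneg s0.le] at t
  rw [dist_eq_norm]
  have : s * ‖(∫ u, d (x + s • (u - x)) (vv i) ∂(volume.restrict (ccube m))) - d x (vv i)‖ ≤ s * (ε / 2) := by linarith
  linarith [le_of_mul_le_mul_left this s0]


def qq (p e : ℝ) {F : Type*} [NormedAddCommGroup F] (g : Spc m → F) (y z : Spc m) : ℝ≥0∞ := ENNReal.ofReal (‖g y - g z‖ ^ p / ‖y - z‖ ^ e)

lemma qq_le {F : Type*} [NormedAddCommGroup F] {g : Spc m → F} {e s : ℝ} (hp : 0 < p) (he : 0 ≤ e) {y z : Spc m} (h : ‖y - z‖ ≤ s) : ‖g y - g z‖ₑ ^ p ≤ ENNReal.ofReal (s ^ e) * qq p e g y z := by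
  rcases eq_or_ne y z with rfl | hne
  · simp [hp]
  have h0 : 0 < ‖y - z‖ := norm_pos_iff.2 (sub_ne_zero.2 hne)
  rw [qq, ← ENNReal.ofReal_mul (by have := h0.le.trans h; positivity), ← ofReal_norm, ENNReal.ofReal_rpow_of_nonneg (norm_nonneg _) hp.le]
  refine ENNReal.ofReal_le_ofReal ?_
  rw [mul_div_left_comm]
  refine le_mul_of_one_le_right (by positivity) ?_
  rw [one_le_div (by positivity)]
  gcongr

lemma shr {x : Spc m} (hx : x ∈ ccube m) {s : ℝ} (h0 : 0 < s) (h1 : s ≤ 1) (F : Spc m → ℝ≥0∞) :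
    ∫⁻ u, F (x + s • (u - x)) ∂μT m ≤ ENNReal.ofReal ((s ^ (m + 1))⁻¹) * ∫⁻ u, F u ∂μT m := by
  have := scl h0 (α := x - s • x) (B := ccube m) measurableSet_Icc (fun u hu => by
    have := ccube_mix hx (cube_sub hu) h0.le h1
    rwa [show x - s • x + s • u = x + s • (u - x) by module]) F
  rw [← μT_eq] at this
  simp_rw [show ∀ u, x - s • x + s • u = x + s • (u - x) from fun u => by module] at this
  exact this

set_option maxHeartbeats 1000000 in
lemma mor_unit (hp : 1 ≤ p) {a : ℝ} (ha : (m : ℝ) + 1 < a * p) : ∃ C, 0 < C ∧ ∀ (i : Fin (m + 1)) (f : Spc m → ℝ) (d : Spc m → Spc m →L[ℝ] ℝ), (∀ x, HasFDerivAt f (d x) x) → Measurable (fun x => d x (vv i)) → Integrable (fun x => d x (vv i)) (μT m) →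
    ∀ x ∈ ccube m, ‖(∫ u, d u (vv i) ∂μT m) - d x (vv i)‖ₑ ^ p ≤ ENNReal.ofReal C * ∫⁻ y, ∫⁻ z, qq p ((m : ℝ) + 1 + a * p) (fun x => d x (vv i)) y z ∂μT m ∂μT m := by
  have p0 : 0 < p := by linarith
  set n : ℝ := (m : ℝ) + 1 with hn
  set θ := (a * p - n) / p with hθ
  have θ0 : 0 < θ := div_pos (by linarith) p0
  set r : ℝ := (1 / 2 : ℝ) ^ θ with hr
  have r0 : 0 < r := by positivity
  have r1 : r < 1 := Real.rpow_lt_one (by norm_num) (by norm_num) θ0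
  have r1' : 0 < 1 - r := by linarith
  refine ⟨((2 ^ (m + 1)) ^ (1 / p) / (1 - r)) ^ p, by positivity, fun i f d hd hm hi x hx => ?_⟩
  set g := fun x => d x (vv i) with hg
  set Q := ∫⁻ y, ∫⁻ z, qq p (n + a * p) g y z ∂μT m ∂μT m with hQ
  rcases eq_or_ne Q ⊤ with hT | hT
  · rw [hT, ENNReal.mul_top (by simp; positivity)]; exact le_top
  have hlim := mor_lim i hd hm hi hx
  set M := fun k : ℕ => ∫ u, g (x + ((1:ℝ)/2) ^ k • (u - x)) ∂μT m with hM
  have hn0 : 0 ≤ n := by positivity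
  have step : ∀ k, ‖M k - M (k + 1)‖ₑ ^ p ≤ ENNReal.ofReal (2 ^ (m + 1) * (r ^ k) ^ p) * Q := fun k => by
    have s0 : 0 < ((1:ℝ)/2) ^ k := by positivity
    have s1 : ((1:ℝ)/2) ^ k ≤ 1 := pow_le_one₀ (by norm_num) (by norm_num)
    have hrk : (r ^ k) ^ p = (((1:ℝ)/2) ^ k) ^ (a * p - n) := by
      rw [hr, ← Real.rpow_natCast, ← Real.rpow_natCast, ← Real.rpow_mul (by positivity), ← Real.rpow_mul (by positivity), ← Real.rpow_mul (by positivity)]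
      congr 1; rw [hθ]; field_simp
    rw [hrk]
    simp only [hM]
    rw [pow_succ ((1:ℝ)/2) k]
    set s := ((1:ℝ)/2) ^ k with hs
    clear_value s
    have i1 := shr_int hm hi hx s0 s1
    have i2 := shr_int hm hi hx (s := s * (1 / 2)) (by positivity) (by linarith)
    have ms : Measurable fun u : Spc m => x + s • (u - x) := by fun_prop
    have ms' : Measurable fun u : Spc m => x + (s * (1 / 2)) • (u - x) := by fun_prop
    have e1' : (∫ u, g (x + s • (u - x)) ∂μT m) - ∫ v, g (x + (s * (1 / 2)) • (v - x)) ∂μT m = ∫ u, (∫ v, (g (x + s • (u - x)) - g (x + (s * (1 / 2)) • (v - x))) ∂μT m) ∂μT m := by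
      have : ∀ u, (∫ v, (g (x + s • (u - x)) - g (x + (s * (1 / 2)) • (v - x))) ∂μT m) = g (x + s • (u - x)) - ∫ v, g (x + (s * (1 / 2)) • (v - x)) ∂μT m := fun u => by
        rw [integral_sub (integrable_const _) i2]; simp
      simp_rw [this]
      rw [integral_sub i1 (integrable_const _)]; simp
    rw [e1']
    calc _ ≤ ∫⁻ u, ‖∫ v, (g (x + s • (u - x)) - g (x + (s * (1 / 2)) • (v - x))) ∂μT m‖ₑ ^ p ∂μT m := by
          refine jen _ hp ?_
          have : ∀ u, (∫ v, (g (x + s • (u - x)) - g (x + (s * (1 / 2)) • (v - x))) ∂μT m) = g (x + s • (u - x)) - ∫ v, g (x + (s * (1 / 2)) • (v - x)) ∂μT m := fun u => by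
            rw [integral_sub (integrable_const _) i2]; simp
          simp_rw [this]
          exact (i1.sub (integrable_const _)).1
      _ ≤ ∫⁻ u, ∫⁻ v, ‖g (x + s • (u - x)) - g (x + (s * (1 / 2)) • (v - x))‖ₑ ^ p ∂μT m ∂μT m := lintegral_mono fun u => jen _ hp ((integrable_const _).sub i2).1
      _ ≤ ∫⁻ u, ∫⁻ v, ENNReal.ofReal (s ^ (n + a * p)) * qq p (n + a * p) g (x + s • (u - x)) (x + (s * (1 / 2)) • (v - x)) ∂μT m ∂μT m := by
          refine lintegral_mono_ae ((ae_restrict_iff' cube_meas).2 (ae_of_all _ fun u hu => ?_))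
          refine lintegral_mono_ae ((ae_restrict_iff' cube_meas).2 (ae_of_all _ fun v hv => ?_))
          refine qq_le p0 (by linarith) ?_
          have := ccube_diam (cube_sub hu) (ccube_mix hx (cube_sub hv) (s := 1 / 2) (by norm_num) (by norm_num))
          rw [show x + s • (u - x) - (x + (s * (1 / 2)) • (v - x)) = s • (u - (x + ((1 / 2 : ℝ)) • (v - x))) by module, norm_smul, Real.norm_of_nonneg s0.le]
          exact mul_le_of_le_one_right s0.le this
      _ ≤ ENNReal.ofReal (s ^ (n + a * p)) * (ENNReal.ofReal (((s * (1 / 2)) ^ (m + 1))⁻¹) * (ENNReal.ofReal ((s ^ (m + 1))⁻¹) * Q)) := by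
          simp_rw [lintegral_const_mul' _ _ ENNReal.ofReal_ne_top]
          gcongr
          calc _ ≤ ∫⁻ u, ENNReal.ofReal (((s * (1 / 2)) ^ (m + 1))⁻¹) * ∫⁻ v, qq p (n + a * p) g (x + s • (u - x)) v ∂μT m ∂μT m := lintegral_mono fun u => shr hx (by positivity) (by linarith) _
            _ ≤ _ := by
              rw [lintegral_const_mul' _ _ ENNReal.ofReal_ne_top]
              gcongr
              exact shr hx s0 s1 (fun y => ∫⁻ v, qq p (n + a * p) g y v ∂μT m)
      _ = _ := by
          rw [← mul_assoc, ← mul_assoc, ← ENNReal.ofReal_mul (by positivity), ← ENNReal.ofReal_mul (by positivity)]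
          congr 2
          have h1 : s ^ (n + a * p) = s ^ (a * p - n) * (s ^ (m + 1) * s ^ (m + 1)) := by
            rw [← Real.rpow_natCast s (m + 1), ← Real.rpow_add s0, ← Real.rpow_add s0, Nat.cast_add, Nat.cast_one]
            congr 1; ring
          rw [h1, mul_pow, one_div, inv_pow]
          field_simp
  have step' : ∀ k, dist (M k) (M (k + 1)) ≤ (2 ^ (m + 1) * Q.toReal) ^ (1 / p) * r ^ k := fun k => by
    rw [dist_eq_norm]
    have := step k
    rw [← ENNReal.ofReal_toReal hT, ← ENNReal.ofReal_mul (by positivity), ← ofReal_norm, ENNReal.ofReal_rpow_of_nonneg (norm_nonneg _) p0.le, ENNReal.ofReal_le_ofReal_iff (by positivity)] at this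
    refine (Real.rpow_le_rpow_iff (norm_nonneg _) (by positivity) p0).1 (this.trans (le_of_eq ?_))
    rw [Real.mul_rpow (z := p) (by positivity) (by positivity), ← Real.rpow_mul (by positivity), one_div_mul_cancel p0.ne', Real.rpow_one]; ring
  have fin := dist_le_of_le_geometric_of_tendsto₀ r _ r1 step' hlim
  rw [dist_eq_norm] at fin
  have M0 : M 0 = ∫ u, g u ∂μT m := by simp [hM]
  rw [M0] at fin
  rw [← ENNReal.ofReal_toReal hT, ← ENNReal.ofReal_mul (by positivity), ← ofReal_norm, ENNReal.ofReal_rpow_of_nonneg (norm_nonneg _) p0.le]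
  refine ENNReal.ofReal_le_ofReal ((Real.rpow_le_rpow (norm_nonneg _) fin p0.le).trans (le_of_eq ?_))
  rw [Real.mul_rpow (z := 1 / p) (by positivity) (by positivity), mul_div_right_comm, Real.mul_rpow (z := p) (by positivity) (by positivity), ← Real.rpow_mul ENNReal.toReal_nonneg, one_div_mul_cancel p0.ne', Real.rpow_one]

end mor

section mor
variable {m : ℕ} {p a : ℝ} {f : Spc m → ℝ} {d : Spc m → Spc m →L[ℝ] ℝ}

lemma op_le (A : Spc m →L[ℝ] ℝ) : ‖A‖ ≤ ∑ i, ‖A (vv i)‖ := by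
  refine A.opNorm_le_bound (by positivity) fun z => ?_
  rw [clm_decomp A z, ← sum_vv (fun v => ‖A v‖), add_mul, Finset.sum_mul]
  refine (norm_add_le _ _).trans (add_le_add ?_ ((norm_sum_le _ _).trans (Finset.sum_le_sum fun i _ => ?_))) <;> rw [norm_smul, mul_comm] <;> gcongr
  · exact norm_fst_le z
  · exact (norm_le_pi_norm z.2 i).trans (norm_snd_le z)

set_option maxHeartbeats 1000000 in
lemma osc_cell (hp : 1 ≤ p) (ha : (m : ℝ) + 1 < a * p) (hd : ∀ x, HasFDerivAt f (d x) x) (hm : ∀ i, Measurable fun x => d x (vv i)) (hi : ∀ i, Integrable (fun x => d x (vv i)) (μT m)) :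
    ∃ C, 0 < C ∧ ∀ (l : ℝ) (α : Spc m), 0 < l → (∀ u ∈ cube m, α + l • u ∈ cube m) → ∀ B, MeasurableSet B → (∀ u ∈ cube m, α + l • u ∈ B) → ∀ x ∈ ccube m, ∀ y ∈ ccube m,
      ‖d (α + l • x) - d (α + l • y)‖ₑ ^ p ≤ ENNReal.ofReal (C * l ^ (a * p - ((m : ℝ) + 1))) * ∫⁻ y in B, ∫⁻ z, qq p ((m : ℝ) + 1 + a * p) d y z ∂μT m := by
  have p0 : 0 < p := by linarith
  obtain ⟨C, hC, hU⟩ := mor_unit (m := m) hp ha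
  set e := (m : ℝ) + 1 + a * p with he
  have e0 : 0 < e := by have : (0:ℝ) ≤ m := m.cast_nonneg; linarith
  refine ⟨(2 * ((m : ℝ) + 1)) ^ p * C, by positivity, fun l α hl hc B hB hcB x hx y hy => ?_⟩
  set Q := ∫⁻ u, ∫⁻ v, qq p e d (α + l • u) (α + l • v) ∂μT m ∂μT m with hQ
  have Qb : Q ≤ ENNReal.ofReal ((l ^ (m + 1))⁻¹) * (ENNReal.ofReal ((l ^ (m + 1))⁻¹) * ∫⁻ y in B, ∫⁻ z, qq p e d y z ∂μT m) := by
    calc _ ≤ ∫⁻ u, ENNReal.ofReal ((l ^ (m + 1))⁻¹) * ∫⁻ z, qq p e d (α + l • u) z ∂μT m ∂μT m := lintegral_mono fun u => scl hl cube_meas hc _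
      _ ≤ _ := by
        rw [lintegral_const_mul' _ _ ENNReal.ofReal_ne_top]
        gcongr
        exact scl hl hB hcB (fun y => ∫⁻ z, qq p e d y z ∂μT m)
  have one : ∀ i, ∀ x ∈ ccube m, ‖(∫ u, d (α + l • u) (vv i) ∂μT m) - d (α + l • x) (vv i)‖ₑ ≤ (ENNReal.ofReal (C * l ^ e) * Q) ^ (1 / p) := fun i x hx => by
    rw [one_div, ENNReal.le_rpow_inv_iff p0]
    refine (hU i (fun u => l⁻¹ * f (α + l • u)) (fun u => d (α + l • u)) (fun u => ?_) ((hm i).comp (by fun_prop)) ⟨((hm i).comp (by fun_prop : Measurable fun u : Spc m => α + l • u)).aestronglyMeasurable, ?_⟩ x hx).trans ?_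
    · have h1 : HasFDerivAt (fun u : Spc m => l • u) (l • ContinuousLinearMap.id ℝ (Spc m)) u := HasFDerivAt.const_smul (hasFDerivAt_id u) l
      have := ((hd _).comp u (h1.const_add α)).const_mul l⁻¹
      refine this.congr_fderiv (ContinuousLinearMap.ext fun v => ?_)
      simp [hl.ne']
    · exact (scl hl cube_meas hc (fun y => ‖d y (vv i)‖ₑ)).trans_lt (ENNReal.mul_lt_top (by simp) (hi i).2)
    · rw [ENNReal.ofReal_mul hC.le, mul_assoc]
      gcongr
      rw [hQ, ← lintegral_const_mul' _ _ ENNReal.ofReal_ne_top]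
      refine lintegral_mono fun u => ?_
      rw [← lintegral_const_mul' _ _ ENNReal.ofReal_ne_top]
      refine lintegral_mono fun v => ?_
      rw [qq, qq, ← ENNReal.ofReal_mul (by positivity)]
      refine ENNReal.ofReal_le_ofReal ?_
      rw [show α + l • u - (α + l • v) = l • (u - v) by module, norm_smul, Real.norm_of_nonneg hl.le, Real.mul_rpow hl.le (norm_nonneg _), ← mul_div_assoc, mul_div_mul_left _ _ (by positivity)]
      gcongr
      rw [← ContinuousLinearMap.sub_apply]
      exact (ContinuousLinearMap.le_opNorm _ _).trans (mul_le_of_le_one_right (norm_nonneg _) (vv_norm i))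
  have two : ∀ i, ‖(d (α + l • x) - d (α + l • y)) (vv i)‖ₑ ≤ 2 * (ENNReal.ofReal (C * l ^ e) * Q) ^ (1 / p) := fun i => by
    rw [ContinuousLinearMap.sub_apply, ← sub_sub_sub_cancel_left _ _ (∫ u, d (α + l • u) (vv i) ∂μT m), two_mul]
    exact (enorm_sub_le).trans (add_le_add (one i y hy) (one i x hx))
  have three : ‖d (α + l • x) - d (α + l • y)‖ₑ ≤ ENNReal.ofReal (2 * ((m : ℝ) + 1)) * (ENNReal.ofReal (C * l ^ e) * Q) ^ (1 / p) := by
    calc _ ≤ ∑ i, ‖(d (α + l • x) - d (α + l • y)) (vv i)‖ₑ := by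
          simp_rw [← ofReal_norm]
          rw [← ENNReal.ofReal_sum_of_nonneg (fun i _ => norm_nonneg _)]
          exact ENNReal.ofReal_le_ofReal (op_le _)
      _ ≤ ∑ i : Fin (m + 1), 2 * (ENNReal.ofReal (C * l ^ e) * Q) ^ (1 / p) := Finset.sum_le_sum fun i _ => two i
      _ = _ := by
          rw [Finset.sum_const, Finset.card_univ, Fintype.card_fin, nsmul_eq_mul, ← mul_assoc]
          congr 1
          rw [ENNReal.ofReal_mul (by norm_num), ENNReal.ofReal_add (by positivity) (by norm_num)]
          simp [mul_comm]
  calc _ ≤ (ENNReal.ofReal (2 * ((m : ℝ) + 1)) * (ENNReal.ofReal (C * l ^ e) * Q) ^ (1 / p)) ^ p := ENNReal.rpow_le_rpow three p0.le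
    _ = ENNReal.ofReal ((2 * ((m : ℝ) + 1)) ^ p * (C * l ^ e)) * Q := by
        rw [ENNReal.mul_rpow_of_nonneg _ _ p0.le, ← ENNReal.rpow_mul, one_div_mul_cancel p0.ne', ENNReal.rpow_one, ENNReal.ofReal_rpow_of_nonneg (by positivity) p0.le, ← mul_assoc, ← ENNReal.ofReal_mul (by positivity)]
    _ ≤ _ := by
        refine (mul_le_mul_right Qb _).trans (le_of_eq ?_)
        rw [← mul_assoc, ← mul_assoc, ← ENNReal.ofReal_mul (by positivity), ← ENNReal.ofReal_mul (by positivity)]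
        congr 2
        have h1 : l ^ e = l ^ (a * p - ((m : ℝ) + 1)) * (l ^ (m + 1) * l ^ (m + 1)) := by
          rw [← Real.rpow_natCast l (m + 1), ← Real.rpow_add hl, ← Real.rpow_add hl, Nat.cast_add, Nat.cast_one, he]
          congr 1; ring
        rw [h1]
        field_simp

def crn (N : ℕ) (x : Spc m) : Spc m := ((N:ℝ)⁻¹ * ⌊N * x.1⌋, fun i => (N:ℝ)⁻¹ * ⌊N * x.2 i⌋)
def frN (N : ℕ) (x : Spc m) : Spc m := (Int.fract (N * x.1), fun i => Int.fract (N * x.2 i))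

variable {N : ℕ}
lemma crn_fr (hN : 0 < N) (x : Spc m) : crn N x + (N:ℝ)⁻¹ • frN N x = x := by
  have : (N:ℝ) ≠ 0 := by positivity
  ext <;> simp only [crn, frN, Prod.fst_add, Prod.snd_add, Prod.smul_fst, Prod.smul_snd, Pi.add_apply, Pi.smul_apply, smul_eq_mul] <;> rw [← mul_add, Int.floor_add_fract, inv_mul_cancel_left₀ this]

lemma frN_mem (x : Spc m) : frN N x ∈ cube m := ⟨⟨Int.fract_nonneg _, Int.fract_lt_one _⟩, fun i _ => ⟨Int.fract_nonneg _, Int.fract_lt_one _⟩⟩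

lemma crn_per (hN : 0 < N) (x : Spc m) (k j) : crn N (x + lv k j) = crn N x + lv k j := by
  have h0 : (N:ℝ) ≠ 0 := by positivity
  have : ∀ (t : ℝ) (k : ℤ), (N:ℝ)⁻¹ * (⌊(N:ℝ) * (t + k)⌋ : ℝ) = (N:ℝ)⁻¹ * (⌊(N:ℝ) * t⌋ : ℝ) + k := fun t k => by
    rw [mul_add, show (N:ℝ) * t + N * k = N * t + ((N * k : ℤ) : ℝ) by push_cast; rfl, Int.floor_add_intCast]
    push_cast; field_simp
  ext <;> simp [crn, lv, this]

lemma crn_cell (hN : 0 < N) {x : Spc m} (hx : x ∈ cube m) {u : Spc m} (hu : u ∈ cube m) : crn N x + (N:ℝ)⁻¹ • u ∈ cube m := by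
  have h0 : (0:ℝ) < N := by positivity
  have : ∀ t v : ℝ, t ∈ Ico (0:ℝ) 1 → v ∈ Ico (0:ℝ) 1 → (N:ℝ)⁻¹ * (⌊(N:ℝ) * t⌋ : ℝ) + (N:ℝ)⁻¹ * v ∈ Ico (0:ℝ) 1 := fun t v ht hv => by
    have h1 : (0:ℤ) ≤ ⌊(N:ℝ) * t⌋ := Int.floor_nonneg.2 (mul_nonneg h0.le ht.1)
    have h2 : ⌊(N:ℝ) * t⌋ < (N : ℤ) := by rw [Int.floor_lt]; push_cast; nlinarith [ht.2]
    have h3 : ⌊(N:ℝ) * t⌋ + 1 ≤ (N : ℤ) := h2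
    have h4 : (⌊(N:ℝ) * t⌋ : ℝ) + 1 ≤ N := by exact_mod_cast h3
    have h5 : (0:ℝ) ≤ ⌊(N:ℝ) * t⌋ := by exact_mod_cast h1
    have := hv.1
    refine ⟨by positivity, ?_⟩
    rw [← mul_add, inv_mul_lt_iff₀ h0]; linarith [hv.2]
  exact ⟨this _ _ hx.1 hu.1, fun i _ => this _ _ (hx.2 i trivial) (hu.2 i trivial)⟩

lemma crn_meet (hN : 0 < N) {x y : Spc m} (h : ‖x - y‖ ≤ (N:ℝ)⁻¹) : ∃ u ∈ ccube m, ∃ v ∈ ccube m, crn N x + (N:ℝ)⁻¹ • u = crn N y + (N:ℝ)⁻¹ • v := by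
  have h0 : (0:ℝ) < N := by positivity
  have key : ∀ s t : ℝ, |s - t| ≤ (N:ℝ)⁻¹ → ∃ u ∈ Icc (0:ℝ) 1, ∃ v ∈ Icc (0:ℝ) 1, (N:ℝ)⁻¹ * (⌊(N:ℝ) * s⌋ : ℝ) + (N:ℝ)⁻¹ * u = (N:ℝ)⁻¹ * (⌊(N:ℝ) * t⌋ : ℝ) + (N:ℝ)⁻¹ * v := fun s t hst => by
    have h1 : |N * s - N * t| ≤ 1 := by
      rw [← mul_sub, abs_mul, abs_of_pos h0]
      calc _ ≤ (N:ℝ) * (N:ℝ)⁻¹ := by gcongr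
        _ = 1 := mul_inv_cancel₀ h0.ne'
    obtain ⟨h2, h3⟩ := abs_le.1 h1
    have g1 : ⌊(N:ℝ) * s⌋ ≤ ⌊(N:ℝ) * t⌋ + 1 := by
      rw [← Int.floor_add_one]; exact Int.floor_le_floor (by linarith)
    have g2 : ⌊(N:ℝ) * t⌋ ≤ ⌊(N:ℝ) * s⌋ + 1 := by
      rw [← Int.floor_add_one]; exact Int.floor_le_floor (by linarith)
    have g1 : (⌊(N:ℝ) * s⌋ : ℝ) ≤ ⌊(N:ℝ) * t⌋ + 1 := by exact_mod_cast g1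
    have g2 : (⌊(N:ℝ) * t⌋ : ℝ) ≤ ⌊(N:ℝ) * s⌋ + 1 := by exact_mod_cast g2
    rcases le_total (⌊(N:ℝ) * s⌋ : ℝ) ⌊(N:ℝ) * t⌋ with hle | hle
    · exact ⟨⌊(N:ℝ) * t⌋ - ⌊(N:ℝ) * s⌋, ⟨by linarith, by linarith⟩, 0, ⟨le_rfl, zero_le_one⟩, by ring⟩
    · exact ⟨0, ⟨le_rfl, zero_le_one⟩, ⌊(N:ℝ) * s⌋ - ⌊(N:ℝ) * t⌋, ⟨by linarith, by linarith⟩, by ring⟩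
  obtain ⟨u1, hu1, v1, hv1, e1'⟩ := key x.1 y.1 ((norm_fst_le (x - y)).trans h)
  choose u2 hu2 v2 hv2 e2 using fun i => key (x.2 i) (y.2 i) ((norm_le_pi_norm (x - y).2 i).trans ((norm_snd_le (x - y)).trans h))
  refine ⟨(u1, u2), ⟨⟨hu1.1, fun i => (hu2 i).1⟩, ⟨hu1.2, fun i => (hu2 i).2⟩⟩, (v1, v2), ⟨⟨hv1.1, fun i => (hv2 i).1⟩, ⟨hv1.2, fun i => (hv2 i).2⟩⟩, ?_⟩
  exact Prod.ext e1' (funext e2)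

end mor

section nik
variable {m : ℕ} {p a : ℝ} {f : Spc m → ℝ} {d : Spc m → Spc m →L[ℝ] ℝ}

lemma rd_cont (hp : 1 ≤ p) (ha : (m : ℝ) + 1 < a * p) (hper : Per d) {C : ℝ} (hC : 0 < C)
    (h : ∀ N : ℕ, 0 < N → ∀ x ∈ cube m, ∀ B, MeasurableSet B → (∀ u ∈ cube m, crn N x + (N:ℝ)⁻¹ • u ∈ B) → ∀ u ∈ ccube m,
      ‖d x - d (crn N x + (N:ℝ)⁻¹ • u)‖ₑ ^ p ≤ ENNReal.ofReal (C * (N:ℝ)⁻¹ ^ (a * p - ((m : ℝ) + 1))) * ∫⁻ y in B, ∫⁻ z, qq p ((m : ℝ) + 1 + a * p) d y z ∂μT m)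
    (hG : ∫⁻ y, ∫⁻ z, qq p ((m : ℝ) + 1 + a * p) d y z ∂μT m ∂μT m ≠ ⊤) : Continuous d := by
  have p0 : 0 < p := by linarith
  set G := ∫⁻ y, ∫⁻ z, qq p ((m : ℝ) + 1 + a * p) d y z ∂μT m ∂μT m with hGd
  set δ := a * p - ((m : ℝ) + 1) with hδ
  have d0 : 0 < δ := by linarith
  have g : ∀ N : ℕ, 0 < N → ∀ x, ∀ u ∈ ccube m, ‖d x - d (crn N x + (N:ℝ)⁻¹ • u)‖ ≤ (C * (N:ℝ)⁻¹ ^ δ * G.toReal) ^ p⁻¹ := fun N hN x u hu => by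
    obtain ⟨k, j, hx⟩ := exists_lv x
    have h1 := h N hN _ hx (cube m) cube_meas (fun u hu => crn_cell hN hx hu) u hu
    rw [crn_per hN, hper k j, add_right_comm, hper k j] at h1
    rw [Real.le_rpow_inv_iff_of_pos (norm_nonneg _) (by positivity) p0, ← ENNReal.ofReal_le_ofReal_iff (by positivity), ← ENNReal.ofReal_rpow_of_nonneg (norm_nonneg _) p0.le, ofReal_norm, ENNReal.ofReal_mul (by positivity), ENNReal.ofReal_toReal hG]
    exact h1
  have lim : Tendsto (fun N : ℕ => 2 * (C * (N:ℝ)⁻¹ ^ δ * G.toReal) ^ p⁻¹) atTop (nhds 0) := by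
    have h1 : Tendsto (fun N : ℕ => (N:ℝ)⁻¹) atTop (nhds 0) := tendsto_inv_atTop_nhds_zero_nat
    have h2 := h1.rpow_const (Or.inr d0.le)
    have h3 := (((h2.const_mul C).mul_const G.toReal).rpow_const (p := p⁻¹) (Or.inr (by positivity))).const_mul 2
    simpa [Real.zero_rpow d0.ne', Real.zero_rpow (inv_pos.2 p0).ne'] using h3
  rw [Metric.continuous_iff]
  intro x ε hε
  obtain ⟨N, h1, hN⟩ := ((lim.eventually_lt_const hε).and (eventually_gt_atTop 0)).exists
  refine ⟨(N:ℝ)⁻¹, by positivity, fun y hy => ?_⟩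
  rw [dist_eq_norm] at hy ⊢
  obtain ⟨u, hu, v, hv, e⟩ := crn_meet hN hy.le
  refine lt_of_le_of_lt ?_ h1
  rw [two_mul, ← sub_sub_sub_cancel_right _ _ (d (crn N y + (N:ℝ)⁻¹ • u))]
  refine (norm_sub_le _ _).trans (add_le_add (g N hN y u hu) ?_)
  rw [e]; exact g N hN x v hv

lemma frN_meas : Measurable (frN (m := m) 1) := by
  unfold frN
  exact (measurable_fract.comp (by fun_prop)).prodMk (measurable_pi_lambda _ fun i => measurable_fract.comp (by fun_prop))

lemma frN_cube {x : Spc m} (hx : x ∈ cube m) : frN 1 x = x := by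
  refine Prod.ext ?_ (funext fun i => ?_)
  · simpa [frN] using Int.fract_eq_self.2 hx.1
  · simpa [frN] using Int.fract_eq_self.2 (hx.2 i trivial)

lemma frN_per (x : Spc m) (k j) : frN 1 (x + lv k j) = frN 1 x := by
  ext <;> simp [frN, lv]

set_option maxHeartbeats 1000000 in
lemma rd_nik1 (hp : 1 ≤ p) (a0 : 0 < a) (hper : Per d) (hdc : Continuous d) {C : ℝ} (hC : 0 < C)
    (h : ∀ N : ℕ, 0 < N → ∀ x ∈ cube m, ∀ B, MeasurableSet B → (∀ u ∈ cube m, crn N x + (N:ℝ)⁻¹ • u ∈ B) → ∀ u ∈ ccube m,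
      ‖d x - d (crn N x + (N:ℝ)⁻¹ • u)‖ₑ ^ p ≤ ENNReal.ofReal (C * (N:ℝ)⁻¹ ^ (a * p - ((m : ℝ) + 1))) * ∫⁻ y in B, ∫⁻ z, qq p ((m : ℝ) + 1 + a * p) d y z ∂μT m)
    (hG : ∫⁻ y, ∫⁻ z, qq p ((m : ℝ) + 1 + a * p) d y z ∂μT m ∂μT m ≠ ⊤) :
    ∃ K, 0 ≤ K ∧ ∀ N : ℕ, 0 < N → ∀ z : Spc m, ‖z‖ ≤ (N:ℝ)⁻¹ → LN p (fun x => d (x + z) - d x) ≤ ENNReal.ofReal (K * (N:ℝ)⁻¹ ^ a) := by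
  have p0 : 0 < p := by linarith
  haveI := haarSpc (m := m)
  set F := fun y => ∫⁻ z, qq p ((m : ℝ) + 1 + a * p) d y z ∂μT m with hF
  have Fm : Measurable F := by
    refine Measurable.lintegral_prod_right' (f := fun q : Spc m × Spc m => qq p ((m : ℝ) + 1 + a * p) d q.1 q.2) ?_
    unfold qq
    have h1 : Measurable fun q : Spc m × Spc m => ‖d q.1 - d q.2‖ := by
      refine Continuous.measurable ?_
      exact ((hdc.comp continuous_fst).sub (hdc.comp continuous_snd)).norm
    fun_prop
  set F' := fun y => F (frN 1 y) with hF'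
  have Fm' : Measurable F' := Fm.comp frN_meas
  have Fp : Per F' := fun k j x => by simp only [hF', frN_per]
  set c0 := (volume (Metric.ball (0 : Spc m) 1)).toReal with hc0
  set G := ∫⁻ y, F y ∂μT m with hGd
  have G' : ∫⁻ y, F' y ∂μT m = G := by
    refine lintegral_congr_ae ?_
    exact (ae_restrict_mem cube_meas).mono fun x hx => by simp only [hF', frN_cube hx]
  refine ⟨(2 ^ p * C * c0 * G.toReal) ^ p⁻¹, by positivity, fun N hN z hz => ?_⟩
  set l := (N:ℝ)⁻¹ with hl
  have l0 : 0 < l := by positivity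
  set H := fun x => ∫⁻ w in Metric.closedBall (0 : Spc m) l, F' (x + w) with hH
  have Hp : Per H := fun k j x => by
    simp only [hH]; refine lintegral_congr fun w => ?_
    rw [add_right_comm, Fp k j]
  have Hm : Measurable H := Measurable.lintegral_prod_right' (f := fun q : Spc m × Spc m => F' (q.1 + q.2)) (Fm'.comp (by fun_prop))
  have HI : ∫⁻ x, H x ∂μT m = ENNReal.ofReal (l ^ (m + 1) * c0) * G := by
    simp only [hH]
    rw [lintegral_lintegral_swap (f := fun x w => F' (x + w)) (Fm'.comp (by fun_prop : Measurable fun q : Spc m × Spc m => q.1 + q.2)).aemeasurable]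
    simp_rw [per_lint Fp, G']
    rw [lintegral_const, Measure.restrict_apply_univ, Measure.addHaar_closedBall _ _ l0.le, finr, mul_comm, ENNReal.ofReal_mul (by positivity), hc0, ENNReal.ofReal_toReal measure_ball_lt_top.ne]
  have K1 : ∀ x, ∀ u ∈ ccube m, ‖d x - d (crn N x + l • u)‖ₑ ^ p ≤ ENNReal.ofReal (C * l ^ (a * p - ((m : ℝ) + 1))) * H x := fun x u hu => by
    obtain ⟨k, j, hx⟩ := exists_lv x
    rw [← Hp k j x, ← hper k j x, ← hper k j (crn N x + _), add_right_comm, ← crn_per hN]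
    set y := x + lv k j
    refine (h N hN y hx (Metric.closedBall y l ∩ cube m) (Metric.isClosed_closedBall.measurableSet.inter cube_meas) (fun u hu => ⟨?_, crn_cell hN hx hu⟩) u hu).trans ?_
    · have := crn_fr hN y
      rw [Metric.mem_closedBall, dist_eq_norm]
      nth_rw 2 [← this]
      rw [add_sub_add_left_eq_sub, ← smul_sub, norm_smul, Real.norm_of_nonneg l0.le]
      exact mul_le_of_le_one_right l0.le (cube_diam hu (frN_mem _))
    · gcongr
      calc _ = ∫⁻ y' in Metric.closedBall y l ∩ cube m, F' y' := by
            refine setLIntegral_congr_fun (Metric.isClosed_closedBall.measurableSet.inter cube_meas) fun x hx => ?_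
            simp only [hF', frN_cube hx.2, hF]
        _ ≤ ∫⁻ y' in Metric.closedBall y l, F' y' := lintegral_mono_set inter_subset_left
        _ = _ := by
            simp only [hH]
            rw [← lintegral_indicator Metric.isClosed_closedBall.measurableSet, ← lintegral_indicator Metric.isClosed_closedBall.measurableSet, ← lintegral_add_left_eq_self _ y]
            refine lintegral_congr fun w => ?_
            simp only [indicator, Metric.mem_closedBall, dist_eq_norm, add_sub_cancel_left, sub_zero]
  have K2 : ∀ x, ‖d (x + z) - d x‖ₑ ^ p ≤ (2:ℝ≥0∞) ^ (p - 1) * ENNReal.ofReal (C * l ^ (a * p - ((m : ℝ) + 1))) * (H (x + z) + H x) := fun x => by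
    obtain ⟨u, hu, v, hv, e⟩ := crn_meet hN (x := x + z) (y := x) (by simpa using hz)
    rw [← sub_sub_sub_cancel_right _ _ (d (crn N (x + z) + (N:ℝ)⁻¹ • u))]
    refine (ENNReal.rpow_le_rpow enorm_sub_le p0.le).trans ((ENNReal.rpow_add_le_mul_rpow_add_rpow _ _ hp).trans ?_)
    rw [mul_assoc, mul_add (ENNReal.ofReal _)]
    have k2 : ‖d x - d (crn N (x + z) + (N:ℝ)⁻¹ • u)‖ₑ ^ p ≤ _ := e ▸ K1 x v hv
    exact mul_le_mul_right (add_le_add (K1 _ u hu) k2) _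
  refine LN_le p0 ?_
  calc _ ≤ ∫⁻ x, (2:ℝ≥0∞) ^ (p - 1) * ENNReal.ofReal (C * l ^ (a * p - ((m : ℝ) + 1))) * (H (x + z) + H x) ∂μT m := lintegral_mono K2
    _ = (2:ℝ≥0∞) ^ (p - 1) * ENNReal.ofReal (C * l ^ (a * p - ((m : ℝ) + 1))) * (2 * (ENNReal.ofReal (l ^ (m + 1) * c0) * G)) := by
        rw [lintegral_const_mul' _ _ (ENNReal.mul_ne_top (by simp) (by simp)), lintegral_add_right _ Hm, per_lint Hp, HI, two_mul]
    _ = ENNReal.ofReal (2 ^ p * C * c0 * G.toReal * l ^ (a * p)) := by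
        have e2 : (2:ℝ≥0∞) ^ (p - 1) * 2 = ENNReal.ofReal (2 ^ p) := by
          rw [← ENNReal.ofReal_rpow_of_pos two_pos, ENNReal.ofReal_ofNat]
          nth_rw 2 [← ENNReal.rpow_one 2]
          rw [← ENNReal.rpow_add _ _ (by simp) (by simp)]; simp
        have e3 : l ^ (a * p) = l ^ (a * p - ((m : ℝ) + 1)) * l ^ (m + 1) := by
          rw [← Real.rpow_natCast l (m + 1), ← Real.rpow_add l0]; push_cast; congr 1; ring
        have e4 : G = ENNReal.ofReal G.toReal := (ENNReal.ofReal_toReal hG).symm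
        rw [e3, show (2:ℝ) ^ p * C * c0 * G.toReal * (l ^ (a * p - ((m : ℝ) + 1)) * l ^ (m + 1)) = 2 ^ p * (C * l ^ (a * p - ((m : ℝ) + 1))) * ((l ^ (m + 1) * c0) * G.toReal) by ring,
          ENNReal.ofReal_mul (p := 2 ^ p * (C * l ^ (a * p - ((m : ℝ) + 1)))) (by positivity), ENNReal.ofReal_mul (p := 2 ^ p) (by positivity), ENNReal.ofReal_mul (p := l ^ (m + 1) * c0) (by positivity), ← e2, ← e4]
        ring
    _ = _ := by
        rw [ENNReal.ofReal_rpow_of_nonneg (by positivity) p0.le, Real.mul_rpow (by positivity) (by positivity), ← Real.rpow_mul (by positivity), ← Real.rpow_mul l0.le, inv_mul_cancel₀ p0.ne', Real.rpow_one]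

lemma rd_main (hp : 1 ≤ p) (a0 : 0 < a) (ha : (m : ℝ) + 1 < a * p) (hd : ∀ x, HasFDerivAt f (d x) x) (hf : Per f) (hi : ∀ i, Integrable (fun x => d x (vv i)) (μT m))
    (hG : gagl a p d < ⊤) : Continuous d ∧ ∃ C, 0 ≤ C ∧ ∀ z, LN p (fun x => d (x + z) - d x) ≤ ENNReal.ofReal (C * ‖z‖ ^ a) := by
  have p0 : 0 < p := by linarith
  have hG' : ∫⁻ y, ∫⁻ z, qq p ((m : ℝ) + 1 + a * p) d y z ∂μT m ∂μT m ≠ ⊤ := by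
    intro h
    unfold gagl at hG
    rw [show (∫⁻ x in cube m, ∫⁻ y in cube m, ENNReal.ofReal (‖d x - d y‖ ^ p / ‖x - y‖ ^ ((m : ℝ) + 1 + a * p))) = ⊤ from h, ENNReal.top_rpow_of_pos (by positivity)] at hG
    exact lt_irrefl _ hG
  have hm : ∀ i, Measurable fun x => d x (vv i) := fun i => by
    have := pd_meas (m := m) (vv i) f
    convert this using 2 with x
    rw [pd, (hd x).fderiv]
  have hper : Per d := Per.of_der hd hf
  obtain ⟨C, hC, h⟩ := osc_cell hp ha hd hm hi
  have h' : ∀ N : ℕ, 0 < N → ∀ x ∈ cube m, ∀ B, MeasurableSet B → (∀ u ∈ cube m, crn N x + (N:ℝ)⁻¹ • u ∈ B) → ∀ u ∈ ccube m,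
      ‖d x - d (crn N x + (N:ℝ)⁻¹ • u)‖ₑ ^ p ≤ ENNReal.ofReal (C * (N:ℝ)⁻¹ ^ (a * p - ((m : ℝ) + 1))) * ∫⁻ y in B, ∫⁻ z, qq p ((m : ℝ) + 1 + a * p) d y z ∂μT m := fun N hN x hx B hB hcB u hu => by
    have := h (N:ℝ)⁻¹ (crn N x) (by positivity) (fun u hu => crn_cell hN hx hu) B hB hcB _ (cube_sub (frN_mem (N := N) x)) u hu
    rwa [crn_fr hN] at this
  have dc := rd_cont hp ha hper hC h' hG'
  obtain ⟨K, hK, hk⟩ := rd_nik1 hp a0 hper dc hC h' hG'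
  obtain ⟨S, hS, hs⟩ := hper.bounded dc
  refine ⟨dc, K * 2 ^ a + 2 * S, by positivity, fun z => ?_⟩
  rcases le_or_gt ‖z‖ 1 with h1 | h1
  · rcases eq_or_ne z 0 with rfl | hz
    · simp [LN, Real.zero_rpow a0.ne']
    have z0 : 0 < ‖z‖ := norm_pos_iff.2 hz
    have i1 : 1 ≤ ‖z‖⁻¹ := (one_le_inv₀ z0).2 h1
    have N1 : 1 ≤ ⌊‖z‖⁻¹⌋₊ := Nat.le_floor (by simpa using i1)
    have N2 : (⌊‖z‖⁻¹⌋₊ : ℝ) ≤ ‖z‖⁻¹ := Nat.floor_le (by positivity)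
    have N3 := Nat.lt_floor_add_one ‖z‖⁻¹
    have N4 : (1:ℝ) ≤ ⌊‖z‖⁻¹⌋₊ := by exact_mod_cast N1
    refine (hk ⌊‖z‖⁻¹⌋₊ N1 z ?_).trans (ENNReal.ofReal_le_ofReal ?_)
    · rw [le_inv_comm₀ z0 (by linarith)]; exact N2
    · have : (⌊‖z‖⁻¹⌋₊ : ℝ)⁻¹ ≤ 2 * ‖z‖ := by
        rw [inv_le_comm₀ (by linarith) (by positivity), mul_inv]; linarith
      calc _ ≤ K * (2 * ‖z‖) ^ a := by gcongr
        _ = K * 2 ^ a * ‖z‖ ^ a := by rw [Real.mul_rpow (by norm_num) z0.le]; ring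
        _ ≤ _ := by gcongr; linarith
  · refine LN_bd (C := (K * 2 ^ a + 2 * S) * ‖z‖ ^ a) fun x => (norm_sub_le _ _).trans ?_
    have : 1 ≤ ‖z‖ ^ a := Real.one_le_rpow h1.le a0.le
    have k2 : 0 ≤ K * 2 ^ a := by positivity
    nlinarith [hs x, hs (x + z)]

end nik

section gint
variable {m : ℕ} {p τ κ : ℝ} {F : Type*} [NormedAddCommGroup F] [NormedSpace ℝ F] [SecondCountableTopology F]

def Wk (m : ℕ) (p τ κ : ℝ) (z : Spc m) : ℝ := ‖z‖ ^ (-((m : ℝ) + 1 + τ * p)) * (min 1 (‖z‖ ^ κ)) ^ p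

lemma Wk_nonneg (z : Spc m) : 0 ≤ Wk m p τ κ z := by unfold Wk; positivity

lemma Wk_int (hp : 1 ≤ p) (t0 : 0 < τ) (tk : τ < κ) : Integrable (Wk m p τ κ) := by
  haveI := haarSpc (m := m)
  have p0 : 0 < p := by linarith
  have m0 : (0:ℝ) ≤ m := m.cast_nonneg
  set e := (m : ℝ) + 1 + τ * p with he
  have tp : 0 < τ * p := by positivity
  have e0 : 0 < e := by positivity
  have hδ : 0 < (κ - τ) * p := mul_pos (by linarith) p0
  have i1 := (riesz (m := m) hδ (r := 1)).integrable_indicator Metric.isOpen_ball.measurableSet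
  have i2 := (integrable_one_add_norm (E := Spc m) (μ := volume) (r := e) (by rw [finr]; push_cast; linarith)).const_mul (2 ^ e)
  have ms : Measurable (Wk m p τ κ) := by
    unfold Wk
    exact (measurable_norm.pow_const _).mul ((measurable_const.min (measurable_norm.pow_const _)).pow_const _)
  refine (i1.add i2).mono' ms.aestronglyMeasurable (ae_of_all _ fun z => ?_)
  rw [Real.norm_of_nonneg (Wk_nonneg z), Pi.add_apply]
  have n1 : 0 ≤ (2:ℝ) ^ e * (1 + ‖z‖) ^ (-e) := by positivity
  have n2 : 0 ≤ (Metric.ball (0 : Spc m) 1).indicator (fun z => ‖z‖ ^ (-((m:ℝ) + 1) + (κ - τ) * p)) z := indicator_nonneg (fun _ _ => by positivity) z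
  by_cases hz : ‖z‖ < 1
  · refine le_trans ?_ (le_add_of_nonneg_right n1)
    rw [indicator_of_mem (by simpa using hz), Wk]
    rcases eq_or_ne z 0 with rfl | h0
    · rw [norm_zero, Real.zero_rpow (by linarith), zero_mul]; positivity
    have zp : 0 < ‖z‖ := norm_pos_iff.2 h0
    calc _ ≤ ‖z‖ ^ (-e) * (‖z‖ ^ κ) ^ p := by gcongr; exact min_le_right _ _
      _ = _ := by rw [← Real.rpow_mul zp.le, ← Real.rpow_add zp, he]; congr 1; ring
  · push Not at hz
    have zp : 0 < ‖z‖ := by linarith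
    refine le_trans ?_ (le_add_of_nonneg_left n2)
    calc Wk m p τ κ z ≤ ‖z‖ ^ (-e) * 1 := by
          unfold Wk; gcongr
          exact Real.rpow_le_one (by positivity) (min_le_left _ _) p0.le
      _ ≤ ((1 + ‖z‖) / 2) ^ (-e) := by
          rw [mul_one]
          exact Real.rpow_le_rpow_of_nonpos (by linarith) (by linarith) (by linarith)
      _ = _ := by
          rw [Real.div_rpow (by positivity) (by norm_num), Real.rpow_neg (by norm_num : (0:ℝ) ≤ 2), div_inv_eq_mul, mul_comm]

set_option maxHeartbeats 1000000 in
lemma gag_int (hp : 1 ≤ p) (t0 : 0 < τ) (tk : τ < κ) : ∃ C, 0 ≤ C ∧ ∀ (g : Spc m → F), Continuous g → ∀ b K : ℝ, 0 < b → 0 ≤ K →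
    (∀ z, LN p (fun x => g (x + z) - g x) ≤ ENNReal.ofReal K) → (∀ z, LN p (fun x => g (x + z) - g x) ≤ ENNReal.ofReal (K * (‖z‖ / b) ^ κ)) →
    gagl τ p g ≤ ENNReal.ofReal (C * (K * b ^ (-τ))) := by
  haveI := haarSpc (m := m)
  have p0 : 0 < p := by linarith
  have m0 : (0:ℝ) ≤ m := m.cast_nonneg
  set e := (m : ℝ) + 1 + τ * p with he
  have tp : 0 < τ * p := by positivity
  have e0 : 0 < e := by positivity
  set I := ∫⁻ z, ENNReal.ofReal (Wk m p τ κ z) with hI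
  have It : I ≠ ⊤ := by
    have := (Wk_int (m := m) hp t0 tk).lintegral_lt_top
    exact this.ne
  refine ⟨I.toReal ^ p⁻¹, by positivity, fun g hg b K hb hK h1 h2 => ?_⟩
  rw [gagl, one_div, ENNReal.rpow_inv_le_iff p0]
  have st1 : ∀ z : Spc m, ∫⁻ x, ENNReal.ofReal (‖g (x + z) - g x‖ ^ p / ‖z‖ ^ e) ∂μT m ≤ ENNReal.ofReal (K ^ p * b ^ (-e)) * ENNReal.ofReal (Wk m p τ κ (b⁻¹ • z)) := fun z => by
    have z0 : 0 ≤ ‖z‖ := norm_nonneg z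
    have a1 : ∀ x, ENNReal.ofReal (‖g (x + z) - g x‖ ^ p / ‖z‖ ^ e) = ENNReal.ofReal (‖z‖ ^ (-e)) * ‖g (x + z) - g x‖ₑ ^ p := fun x => by
      rw [← ofReal_norm, ENNReal.ofReal_rpow_of_nonneg (norm_nonneg _) p0.le, ← ENNReal.ofReal_mul (by positivity), Real.rpow_neg z0, div_eq_mul_inv, mul_comm]
    simp_rw [a1]
    rw [lintegral_const_mul' _ _ ENNReal.ofReal_ne_top, ← LN_pow p0]
    have a2 : LN p (fun x => g (x + z) - g x) ≤ ENNReal.ofReal (K * min 1 ((‖z‖ / b) ^ κ)) := by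
      rcases le_total 1 ((‖z‖ / b) ^ κ) with h | h
      · rw [min_eq_left h, mul_one]; exact h1 z
      · rw [min_eq_right h]; exact h2 z
    refine (mul_le_mul_right (ENNReal.rpow_le_rpow a2 p0.le) _).trans (le_of_eq ?_)
    rw [ENNReal.ofReal_rpow_of_nonneg (by positivity) p0.le, ← ENNReal.ofReal_mul (by positivity), ← ENNReal.ofReal_mul (by positivity)]
    congr 1
    rw [Wk, norm_smul, norm_inv, Real.norm_of_nonneg hb.le, inv_mul_eq_div, Real.mul_rpow hK (by positivity), ← he, show (‖z‖ / b) ^ (-e) = ‖z‖ ^ (-e) / b ^ (-e) from Real.div_rpow z0 hb.le _]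
    have : b ^ (-e) ≠ 0 := by positivity
    field_simp
  have st2 : ∫⁻ z : Spc m, ENNReal.ofReal (Wk m p τ κ (b⁻¹ • z)) = ENNReal.ofReal (b ^ (m + 1)) * I := by
    calc _ = ∫⁻ y, ENNReal.ofReal (Wk m p τ κ y) ∂(Measure.map (fun x : Spc m => b⁻¹ • x) volume) :=
          ((Homeomorph.smulOfNeZero (α := Spc m) b⁻¹ (by positivity)).measurableEmbedding.lintegral_map (μ := volume) (fun y => ENNReal.ofReal (Wk m p τ κ y))).symm
      _ = _ := by
        rw [Measure.map_addHaar_smul _ (by positivity), lintegral_smul_measure, finr, abs_of_pos (by positivity), inv_pow, inv_inv]; rfl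
  calc _ ≤ ∫⁻ x, (∫⁻ z, ENNReal.ofReal (‖g (x + z) - g x‖ ^ p / ‖z‖ ^ e)) ∂μT m := by
        refine lintegral_mono fun x => ?_
        refine (setLIntegral_le_lintegral _ _).trans (le_of_eq ?_)
        rw [← lintegral_add_left_eq_self _ x]
        refine lintegral_congr fun z => ?_
        rw [norm_sub_rev, show x - (x + z) = - z by abel, norm_neg]
    _ = ∫⁻ z, (∫⁻ x, ENNReal.ofReal (‖g (x + z) - g x‖ ^ p / ‖z‖ ^ e) ∂μT m) := by
        refine lintegral_lintegral_swap (f := fun x z => ENNReal.ofReal (‖g (x + z) - g x‖ ^ p / ‖z‖ ^ e)) (Measurable.aemeasurable ?_)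
        have h1 : Measurable fun q : Spc m × Spc m => ‖g (q.1 + q.2) - g q.1‖ := by
          refine Continuous.measurable ?_
          fun_prop
        simp only [Function.uncurry_def]
        fun_prop
    _ ≤ ∫⁻ z, ENNReal.ofReal (K ^ p * b ^ (-e)) * ENNReal.ofReal (Wk m p τ κ (b⁻¹ • z)) := lintegral_mono st1
    _ = ENNReal.ofReal (K ^ p * b ^ (-e)) * (ENNReal.ofReal (b ^ (m + 1)) * ENNReal.ofReal I.toReal) := by
        rw [lintegral_const_mul' _ _ ENNReal.ofReal_ne_top, st2, ENNReal.ofReal_toReal It]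
    _ = _ := by
        rw [ENNReal.ofReal_rpow_of_nonneg (by positivity) p0.le, ← ENNReal.ofReal_mul (by positivity), ← ENNReal.ofReal_mul (by positivity)]
        congr 1
        rw [Real.mul_rpow (by positivity) (by positivity), ← Real.rpow_mul (by positivity), inv_mul_cancel₀ p0.ne', Real.rpow_one, Real.mul_rpow hK (by positivity), ← Real.rpow_mul hb.le]
        have : b ^ (-τ * p) = b ^ (-e) * b ^ (m + 1) := by
          rw [← Real.rpow_natCast b (m + 1), ← Real.rpow_add hb, he]; push_cast; congr 1; ring
        rw [this]; ring

end gint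

section hol
variable {m : ℕ} {p τ σ : ℝ}

lemma pw {b B j k : ℝ} (hb : 0 ≤ b) (hB : b ≤ B) (hj : 0 ≤ j) (hk : j ≤ k) : b ^ k ≤ B ^ (k - j) * b ^ j := by
  have : b ^ k = b ^ (k - j) * b ^ j := by rw [← Real.rpow_add_of_nonneg hb (by linarith) hj]; congr 1; ring
  rw [this]; gcongr

lemma LN_d2 {F : Type*} [NormedAddCommGroup F] [NormedSpace ℝ F] (hp : 1 ≤ p) {g : Spc m → F} (hg : Continuous g) (hper : Per g) {A : ℝ} (hA : 0 ≤ A) (h : LN p g ≤ ENNReal.ofReal A) (z : Spc m) :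
    LN p (fun x => g (x + z) - g x) ≤ ENNReal.ofReal (2 * A) := by
  rw [two_mul]
  exact LN_sub hp (f := fun x => g (x + z)) (by fun_prop) hg hA hA ((LN_tr (by linarith) hper z).trans_le h) h

set_option maxHeartbeats 1000000 in
lemma Wb (hp : 1 ≤ p) (s1 : 1 < σ) (s2 : σ < 2) (t0 : 0 ≤ τ) (ht : τ < σ) {B : ℝ} (hB : 0 ≤ B) : ∃ C, 0 ≤ C ∧ ∀ (g : Spc m → ℝ) (d : Spc m → Spc m →L[ℝ] ℝ), (∀ x, HasFDerivAt g (d x) x) → Continuous d → Per d → Continuous g → Per g →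
    ∀ b K : ℝ, 0 < b → b ≤ B → 0 ≤ K → LN p g ≤ ENNReal.ofReal (K * b ^ σ) → LN p d ≤ ENNReal.ofReal (K * b ^ (σ - 1)) → (∀ z, LN p (fun x => d (x + z) - d x) ≤ ENNReal.ofReal (K * ‖z‖ ^ (σ - 1))) →
    WNorm τ p g ≤ ENNReal.ofReal (C * K * b ^ (σ - τ)) := by
  have add3 : ∀ {x y : ℝ≥0∞} {X Y : ℝ}, 0 ≤ X → 0 ≤ Y → x ≤ ENNReal.ofReal X → y ≤ ENNReal.ofReal Y → x + y ≤ ENNReal.ofReal (X + Y) := fun hX hY h1 h2 => by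
    rw [ENNReal.ofReal_add hX hY]; exact add_le_add h1 h2
  have p1 : ∀ {b : ℝ}, 0 < b → b ≤ B → b ^ σ ≤ B ^ τ * b ^ (σ - τ) := fun hb h => by
    have := pw hb.le h (j := σ - τ) (k := σ) (by linarith) (by linarith)
    rwa [show σ - (σ - τ) = τ by ring] at this
  have p2 : ∀ {b : ℝ}, 1 ≤ τ → 0 < b → b ≤ B → b ^ (σ - 1) ≤ B ^ (τ - 1) * b ^ (σ - τ) := fun h1 hb h => by
    have := pw hb.le h (j := σ - τ) (k := σ - 1) (by linarith) (by linarith)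
    rwa [show σ - 1 - (σ - τ) = τ - 1 by ring] at this
  rcases t0.eq_or_lt with h | h
  · refine ⟨1, zero_le_one, fun g d hd dc dp gc gp b K hb hbB hK h1 h2 h3 => ?_⟩
    rw [Wn0 h.symm.le, ← h, sub_zero, one_mul]; exact h1
  rcases lt_or_ge τ 1 with h' | h'
  · obtain ⟨C, hC, hI⟩ := gag_int (m := m) (F := ℝ) hp h h'
    refine ⟨B ^ τ + C * 2, by positivity, fun g d hd dc dp gc gp b K hb hbB hK h1 h2 h3 => ?_⟩
    rw [WNorm, if_neg (not_le.2 h), if_pos h']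
    have i := hI g gc b (2 * (K * b ^ σ)) hb (by positivity) (LN_d2 hp gc gp (by positivity) h1) (fun z => (diffN hp hd dc dp (by positivity) h2 z).trans (ENNReal.ofReal_le_ofReal ?_))
    · refine (add3 (by positivity) (by positivity) h1 i).trans (ENNReal.ofReal_le_ofReal ?_)
      have e : b ^ (σ - τ) = b ^ σ * b ^ (-τ) := by rw [← Real.rpow_add hb]; rfl
      have := mul_le_mul_of_nonneg_left (p1 hb hbB) hK
      calc _ ≤ K * (B ^ τ * b ^ (σ - τ)) + C * (2 * (K * b ^ σ) * b ^ (-τ)) := by gcongr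
        _ = _ := by rw [e]; ring
    · rw [Real.rpow_one, Real.rpow_sub_one hb.ne']
      have : 0 ≤ K * b ^ σ * (‖z‖ / b) := by positivity
      calc K * (b ^ σ / b) * ‖z‖ = K * b ^ σ * (‖z‖ / b) := by ring
        _ ≤ _ := by linarith
  have W : ∀ (g : Spc m → ℝ) (d : Spc m → Spc m →L[ℝ] ℝ), (∀ x, HasFDerivAt g (d x) x) → WNorm τ p g = LN p g + LN p d + (if τ = 1 then 0 else gagl (τ - 1) p d) := fun g d hd => by
    have e : grd g = d := funext fun x => (hd x).fderiv
    rw [WNorm, if_neg (not_le.2 h), if_neg (not_lt.2 h'), if_pos (by linarith), e]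
    congr 2
    exact eLpNorm_norm d
  rcases h'.eq_or_lt with h1' | h1'
  · refine ⟨B ^ τ + B ^ (τ - 1), by positivity, fun g d hd dc dp gc gp b K hb hbB hK h1 h2 h3 => ?_⟩
    rw [W g d hd, if_pos h1'.symm, add_zero]
    refine (add3 (by positivity) (by positivity) h1 h2).trans (ENNReal.ofReal_le_ofReal ?_)
    have q1 := mul_le_mul_of_nonneg_left (p1 hb hbB) hK
    have q2 := mul_le_mul_of_nonneg_left (p2 h' hb hbB) hK
    linarith
  · obtain ⟨C, hC, hI⟩ := gag_int (m := m) (F := Spc m →L[ℝ] ℝ) (τ := τ - 1) (κ := σ - 1) hp (by linarith) (by linarith)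
    refine ⟨B ^ τ + B ^ (τ - 1) + C * 2, by positivity, fun g d hd dc dp gc gp b K hb hbB hK h1 h2 h3 => ?_⟩
    rw [W g d hd, if_neg h1'.ne']
    have i := hI d dc b (2 * (K * b ^ (σ - 1))) hb (by positivity) (LN_d2 hp dc dp (by positivity) h2) (fun z => (h3 z).trans (ENNReal.ofReal_le_ofReal ?_))
    · refine (add3 (by positivity) (by positivity) (add3 (by positivity) (by positivity) h1 h2) i).trans (ENNReal.ofReal_le_ofReal ?_)
      have e : b ^ (σ - τ) = b ^ (σ - 1) * b ^ (-(τ - 1)) := by rw [← Real.rpow_add hb]; congr 1; ring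
      have q1 := mul_le_mul_of_nonneg_left (p1 hb hbB) hK
      have q2 := mul_le_mul_of_nonneg_left (p2 h' hb hbB) hK
      calc _ ≤ K * (B ^ τ * b ^ (σ - τ)) + K * (B ^ (τ - 1) * b ^ (σ - τ)) + C * (2 * (K * b ^ (σ - 1)) * b ^ (-(τ - 1))) := by gcongr
        _ = _ := by rw [e]; ring
    · rw [Real.div_rpow (norm_nonneg _) hb.le]
      have : 0 ≤ K * ‖z‖ ^ (σ - 1) := by positivity
      calc K * ‖z‖ ^ (σ - 1) ≤ 2 * (K * ‖z‖ ^ (σ - 1)) := by linarith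
        _ = _ := by field_simp

set_option maxHeartbeats 1000000 in
lemma hold {β T μ : ℝ} (hβ : 0 < β) (hT : 0 ≤ T) (hp : 1 ≤ p) (s1 : 1 < σ) (s2 : σ < 2) (t0 : 0 ≤ τ) (ht : τ < σ) (m0 : 0 ≤ μ) (m1 : μ ≤ (σ - τ) / 2) {ψ : ℝ → Spc m → ℝ} {d : ℝ → Spc m → Spc m →L[ℝ] ℝ}
    (hE : Est β T p (σ - 1) ψ d) (h : ∀ t, 0 ≤ t → t ≤ T → (∀ x, HasFDerivAt (ψ t) (d t x) x) ∧ Continuous (d t) ∧ Per (d t) ∧ Continuous (ψ t)) (hper : ∀ t, 0 ≤ t → t ≤ T → Per (ψ t)) :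
    HolderW μ τ p (Icc 0 T) ψ := by
  obtain ⟨K, hK, hE⟩ := hE
  obtain ⟨C, hC, hW⟩ := Wb (m := m) hp s1 s2 t0 ht (B := 1 + bb β T) (by have := bb_nonneg (β := β) T; linarith)
  have key : ∀ s t, 0 ≤ s → s ≤ t → t ≤ T → ∀ u v, (u = s ∧ v = t) ∨ (u = t ∧ v = s) → ∀ b k, 0 < b → b ≤ 1 + bb β T → 0 ≤ k →
      LN p (fun x => ψ t x - ψ s x) ≤ ENNReal.ofReal (k * b ^ σ) → LN p (fun x => d t x - d s x) ≤ ENNReal.ofReal (k * b ^ (σ - 1)) → (∀ z, LN p (fun x => (d v (x + z) - d u (x + z)) - (d v x - d u x)) ≤ ENNReal.ofReal (k * ‖z‖ ^ (σ - 1))) →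
      WNorm τ p (fun x => ψ v x - ψ u x) ≤ ENNReal.ofReal (C * k * b ^ (σ - τ)) := fun s t hs hst htT u v huv b k hb hbB hk h1 h2 h3 => by
    have r1 : LN p (fun x => ψ v x - ψ u x) = LN p (fun x => ψ t x - ψ s x) ∧ LN p (fun x => d v x - d u x) = LN p (fun x => d t x - d s x) ∧ (0 ≤ u ∧ u ≤ T) ∧ (0 ≤ v ∧ v ≤ T) := by
      rcases huv with ⟨rfl, rfl⟩ | ⟨rfl, rfl⟩
      · exact ⟨rfl, rfl, ⟨hs, hst.trans htT⟩, ⟨hs.trans hst, htT⟩⟩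
      · exact ⟨le_antisymm (LN_mono fun x => (norm_sub_rev _ _).le) (LN_mono fun x => (norm_sub_rev _ _).le), le_antisymm (LN_mono fun x => (norm_sub_rev _ _).le) (LN_mono fun x => (norm_sub_rev _ _).le), ⟨hs.trans hst, htT⟩, ⟨hs, hst.trans htT⟩⟩
    obtain ⟨e1', e2, ⟨u0, u1⟩, v0, v1⟩ := r1
    obtain ⟨a1, a2, a3, a4⟩ := h u u0 u1
    obtain ⟨b1, b2, b3, b4⟩ := h v v0 v1
    exact hW (fun x => ψ v x - ψ u x) (fun x => d v x - d u x) (fun x => (b1 x).sub (a1 x)) (b2.sub a2) (fun k j x => by simp only [b3 k j x, a3 k j x]) (b4.sub a4) (fun k j x => by simp only [hper v v0 v1 k j x, hper u u0 u1 k j x]) b k hb hbB hk (e1' ▸ h1) (e2 ▸ h2) h3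
  set D := C * (2 * K) * ((1 + bb β T) ^ (σ - τ - 2 * μ) * (2 / β) ^ μ) with hD
  have fin : ∀ s t, 0 ≤ s → s ≤ t → t ≤ T → ∀ u v, (u = s ∧ v = t) ∨ (u = t ∧ v = s) → WNorm τ p (fun x => ψ v x - ψ u x) ≤ ENNReal.ofReal (D * (t - s) ^ μ) := fun s t hs hst htT u v huv => by
    rcases hst.eq_or_lt with e | e
    · subst e
      have e' : u = v := by rcases huv with ⟨rfl, rfl⟩ | ⟨rfl, rfl⟩ <;> rfl
      have := key s s hs hst htT u v huv 1 0 one_pos (by have := bb_nonneg (β := β) T; linarith) le_rfl (by simp [LN]) (by simp [LN]) (fun z => by simp [LN, e'])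
      refine this.trans ?_
      simp
    · have ts : 0 ≤ t - s := by linarith
      have b0 : 0 < bb β (t - s) := bb_pos hβ (by linarith)
      have bB : bb β (t - s) ≤ 1 + bb β T := (bb_mono hβ (by linarith : t - s ≤ T)).trans (by linarith)
      obtain ⟨g1, g2, g3⟩ := hE s t hs hst htT
      obtain ⟨-, -, g4⟩ := hE s s hs le_rfl (hst.trans htT)
      obtain ⟨-, ct, -, -⟩ := h t (hs.trans hst) htT
      obtain ⟨-, cs, -, -⟩ := h s hs (hst.trans htT)
      refine (key s t hs hst htT u v huv _ (2 * K) b0 bB (by positivity) (g1.trans (ENNReal.ofReal_le_ofReal ?_)) (g2.trans (ENNReal.ofReal_le_ofReal ?_)) (fun z => ?_)).trans (ENNReal.ofReal_le_ofReal ?_)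
      · rw [add_sub_cancel]; gcongr; linarith
      · gcongr; linarith
      · have A : LN p (fun x => (d t (x + z) - d t x) - (d s (x + z) - d s x)) ≤ ENNReal.ofReal (K * ‖z‖ ^ (σ - 1) + K * ‖z‖ ^ (σ - 1)) :=
          LN_sub hp (f := fun x => d t (x + z) - d t x) (g := fun x => d s (x + z) - d s x) (by fun_prop) (by fun_prop) (by positivity) (by positivity) (g3 z) (g4 z)
        rw [mul_assoc, two_mul]
        refine le_trans (LN_mono fun x => le_of_eq ?_) A
        rcases huv with ⟨rfl, rfl⟩ | ⟨rfl, rfl⟩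
        · congr 1; abel
        · rw [← norm_neg]; congr 1; abel
      · have q := pw b0.le bB (j := 2 * μ) (k := σ - τ) (by linarith) (by linarith)
        rw [bb_rpow hβ ts (2 * μ), mul_div_cancel_left₀ _ two_ne_zero] at q
        calc _ ≤ C * (2 * K) * ((1 + bb β T) ^ (σ - τ - 2 * μ) * ((2 / β) ^ μ * (t - s) ^ μ)) := by gcongr
          _ = _ := by rw [hD]; ring
  refine ⟨D, fun t ht t' ht' => ?_⟩
  rcases le_total t t' with e | e
  · rw [abs_of_nonneg (by linarith)]; exact fin t t' ht.1 e ht'.2 t t' (Or.inl ⟨rfl, rfl⟩)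
  · rw [abs_sub_comm, abs_of_nonneg (by linarith)]; exact fin t' t ht'.1 e ht.2 t t' (Or.inr ⟨rfl, rfl⟩)

end hol

section asm
variable {m : ℕ} {V : Spc m → ℝ} {β : ℝ}

lemma NS.res (hβ : 0 < β) {T T' : ℝ} {ψ ψ' : ℝ → Spc m → ℝ} (h : NS V β T ψ) (h0 : 0 ≤ T') (h1 : T' ≤ T) (he : ∀ t, 0 ≤ t → t ≤ T' → ψ' t = ψ t) : NS V β T' ψ' := by
  obtain ⟨R, κ, w, hκ, S, hw⟩ := h
  refine ⟨R, κ, _, hκ, S.restrict hβ h0 h1, fun t t0 t1 => ?_⟩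
  simp only [ct_eq t0 t1, he t t0 t1]
  exact hw t t0 (t1.trans h1)

lemma NS.bd (hV : ContDiff ℝ 2 V) (hp : Per V) {T : ℝ} {ψ : ℝ → Spc m → ℝ} (h : NS V β T ψ) : ∃ M, ∀ t, 0 ≤ t → t ≤ T → ∀ x, |ψ t x| ≤ M := by
  obtain ⟨R, κ, w, hκ, S, hw⟩ := h
  obtain ⟨C, hC, hc⟩ := Per.bounded (wt_per (β := β) hp) (wt_cont hV)
  refine ⟨C * R, fun t t0 t1 x => ?_⟩
  rw [(hw t t0 t1).2.2, abs_mul]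
  exact mul_le_mul (hc x) ((norm_fst_le _).trans ((hw t t0 t1).1 x)) (abs_nonneg _) hC

lemma marg_min {ψ0 : Spc m → ℝ} (hc : Continuous ψ0) (hp : Per ψ0) (h : ∀ s, 0 < marg ψ0 s) : ∃ c, 0 < c ∧ ∀ s, c ≤ marg ψ0 s := by
  obtain ⟨s0, -, hs⟩ := isCompact_Icc.exists_isMinOn (nonempty_Icc.2 (zero_le_one' ℝ)) (mcont hc).continuousOn
  refine ⟨_, h s0, fun s => ?_⟩
  have : marg ψ0 s0 ≤ marg ψ0 (Int.fract s) := hs (a := Int.fract s) ⟨Int.fract_nonneg s, (Int.fract_lt_one s).le⟩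
  have e : Int.fract s = s + ((-⌊s⌋ : ℤ) : ℝ) := by rw [Int.fract]; push_cast; ring
  rwa [e, marg_per hp] at this

lemma Ico_top {t : ℝ} (h : 0 ≤ t) : t ∈ Ico0 ⊤ := ⟨h, ENNReal.ofReal_lt_top⟩

end asm

/-- **Local existence, uniqueness and regularity (Theorem `loc`).**
Assume `[H₁]` and `[H₂]`. The nonlocal Fokker–Planck initial value problem has a unique
maximal `L^p`-solution `ψ` with maximal interval of existence `(0, T_max)`, `T_max > 0`.
Moreover: (i) `ψ ∈ C((0,T_max), W^{2,p}) ∩ C^μ_loc([0,T_max), W^{τ,p})` for every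
`ε ∈ [0, 1 − σ/2)` and `τ ∈ [0, σ)`, with `μ := min(1 − σ/2 − ε, (σ−τ)/2)`;
(ii) `dψ/dt = β⁻¹Δψ + F(ψ) ∈ C^{ν−ε}_loc((0,T_max), L^p)` for every `ε ∈ (0,ν)`, with
`ν := min(1 − σ/2, σ/2 − 1/2 − n/(2p))` (here `n = m + 1`). -/
theorem fokkerPlanck_local_existence_uniqueness_regularity
    (m : ℕ) (V : Spc m → ℝ) (β σ p : ℝ) (ψ0 : Spc m → ℝ)
    (hV : ContDiff ℝ 2 V) (hVper : IsPeriodic V) (hβ : 0 < β)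
    (h1 : Hyp1 σ p ψ0) (h2 : Hyp2 m σ p) :
    ∃ (Tmax : ℝ≥0∞) (ψ : ℝ → Spc m → ℝ),
      0 < Tmax ∧ IsMaximalLpSolution V β σ p ψ0 Tmax ψ ∧
      (∀ (Tmax' : ℝ≥0∞) (ψ' : ℝ → Spc m → ℝ),
        IsMaximalLpSolution V β σ p ψ0 Tmax' ψ' →
          Tmax' = Tmax ∧ ∀ t ∈ Ico0 Tmax, ∀ᵐ x ∂(volume : Measure (Spc m)),
            ψ' t x = ψ t x) ∧
      ContW 2 p (Ioo0 Tmax) ψ ∧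
      (∀ ε τ : ℝ, 0 ≤ ε → ε < 1 - σ / 2 → 0 ≤ τ → τ < σ →
        ∀ T : ℝ, 0 ≤ T → ENNReal.ofReal T < Tmax →
          HolderW (min (1 - σ / 2 - ε) ((σ - τ) / 2)) τ p (Set.Icc 0 T) ψ) ∧
      (∀ ε : ℝ, 0 < ε →
          ε < min (1 - σ / 2) (σ / 2 - 1 / 2 - ((m : ℝ) + 1) / (2 * p)) →
        ∀ a b : ℝ, 0 < a → a ≤ b → ENNReal.ofReal b < Tmax →
          HolderW (min (1 - σ / 2) (σ / 2 - 1 / 2 - ((m : ℝ) + 1) / (2 * p)) - ε) 0 p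
            (Set.Icc a b) (fun t x => β⁻¹ * lap (ψ t) x + Fop V (ψ t) x)) := by
  obtain ⟨⟨⟨hper, hmeas, hdiff, -, hWn⟩, hpos⟩, hn, -⟩ := h1
  obtain ⟨hm, hpn, hσ, hσ2⟩ := h2
  have m1 : (1:ℝ) ≤ m := by exact_mod_cast hm
  have p2 : 2 ≤ p := by linarith
  have p1 : 1 ≤ p := by linarith
  have p0 : 0 < p := by linarith
  have mp : 0 < ((m:ℝ) + 1) / p := by positivity
  have s1 : 1 < σ := by linarith
  have pV : Per V := per_iff.1 hVper
  have pψ : Per ψ0 := per_iff.1 hper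
  have hd : ∀ x, HasFDerivAt ψ0 (grd ψ0 x) x := fun x => (hdiff s1.le x).hasFDerivAt
  have ha : (m:ℝ) + 1 < (σ - 1) * p := by rw [← div_lt_iff₀ p0]; linarith
  rw [WNorm, if_neg (by linarith), if_neg (by linarith), if_pos hσ2, if_neg s1.ne', ENNReal.add_lt_top, ENNReal.add_lt_top] at hWn
  obtain ⟨⟨-, w1⟩, w2⟩ := hWn
  have hi : ∀ i, Integrable (fun x => grd ψ0 x (vv i)) (μT m) := fun i => by
    have l : MemLp (fun x => ‖grd ψ0 x‖) (ENNReal.ofReal p) (μT m) := ⟨(measurable_fderiv ℝ ψ0).norm.aestronglyMeasurable, w1⟩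
    refine (l.integrable (by simpa using p1)).mono' (pd_meas (vv i) ψ0).aestronglyMeasurable (ae_of_all _ fun x => ?_)
    exact (ContinuousLinearMap.le_opNorm _ _).trans (mul_le_of_le_one_right (norm_nonneg _) (vv_norm i))
  obtain ⟨dc, C0, hC0, hN⟩ := rd_main p1 (by linarith) ha hd pψ hi w2
  have cψ : Continuous ψ0 := (hdiff s1.le).continuous
  obtain ⟨c, hc, hcm⟩ := marg_min cψ pψ hpos
  choose Ψ hΨ hΨ0 using fun N : ℕ => glob hV pV hβ hd dc pψ hn hc hcm (T := (N:ℝ) + 1) (by positivity)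
  have sΨ : ∀ N : ℕ, IsLpSolution V β σ p ψ0 (ENNReal.ofReal ((N:ℝ) + 1)) (Ψ N) := fun N => by
    have := (lp_of (Tm := ENNReal.ofReal ((N:ℝ) + 1)) (ψ := Ψ N) hV pV hβ p0 s1 hσ2 fun t t0 t1 => ⟨(N:ℝ) + 1, (ENNReal.ofReal_lt_ofReal_iff (by positivity)).1 t1, hΨ N⟩).1
    rwa [hΨ0] at this
  have inI : ∀ {N : ℕ} {t : ℝ}, 0 ≤ t → t < (N:ℝ) + 1 → t ∈ Ico0 (ENNReal.ofReal ((N:ℝ) + 1)) := fun t0 t1 => ⟨t0, (ENNReal.ofReal_lt_ofReal_iff (by positivity)).2 t1⟩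
  have U : ∀ (N : ℕ) (t : ℝ), 0 ≤ t → t < (N:ℝ) + 1 → ∀ T' ψ', IsLpSolution V β σ p ψ0 T' ψ' → t ∈ Ico0 T' → ψ' t = Ψ N t := fun N t t0 t1 T' ψ' hs ht => by
    obtain ⟨M, hM⟩ := (hΨ N).bd hV pV
    exact uniq hV pV hβ p2 (sΨ N) hs cψ pψ hn hc hcm (inI t0 t1) ht (fun s s0 s1 x => hM s s0 (by linarith) x)
  set ψ : ℝ → Spc m → ℝ := fun t => Ψ ⌊t⌋₊ t with hψ
  have ag : ∀ (N : ℕ) (t : ℝ), 0 ≤ t → t < (N:ℝ) + 1 → ψ t = Ψ N t := fun N t t0 t1 =>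
    U N t t0 t1 _ (Ψ ⌊t⌋₊) (sΨ ⌊t⌋₊) (inI t0 (Nat.lt_floor_add_one t))
  have e0 : ψ 0 = ψ0 := by rw [ag 0 0 le_rfl (by simp)]; exact hΨ0 0
  have nsT : ∀ T, 0 ≤ T → NS V β T ψ := fun T hT =>
    (hΨ ⌊T⌋₊).res hβ hT (Nat.lt_floor_add_one T).le fun t t0 t1 => ag _ t t0 (t1.trans_lt (Nat.lt_floor_add_one T))
  obtain ⟨r1, r2, r3⟩ := lp_of (Tm := ⊤) (σ := σ) (p := p) hV pV hβ p0 s1 hσ2 fun t t0 _ => ⟨t + 1, lt_add_one t, nsT (t + 1) (by linarith)⟩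
  rw [e0] at r1
  have UU' : ∀ T' ψ', IsLpSolution V β σ p ψ0 T' ψ' → ∀ t ∈ Ico0 T', ψ' t = ψ t := fun T' ψ' hs t ht => by
    rw [ag _ t ht.1 (Nat.lt_floor_add_one t)]
    exact U _ t ht.1 (Nat.lt_floor_add_one t) T' ψ' hs ht
  refine ⟨⊤, ψ, ENNReal.zero_lt_top, ⟨r1, ENNReal.zero_lt_top, fun _ _ _ _ => le_top⟩, fun T' ψ' h => ?_, r2, fun ε τ ε0 ε1 τ0 τ1 T hT _ => ?_, fun ε ε0 ε1 a b a0 ab hb => ?_⟩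
  · have hT : T' = ⊤ := top_le_iff.1 (h.2.2 ⊤ ψ r1 fun t ht => (UU' T' ψ' h.1 t ht).symm)
    refine ⟨hT, fun t ht => ae_of_all _ fun x => ?_⟩
    rw [UU' T' ψ' h.1 t (hT ▸ ht)]
  · have hns := nsT T hT
    obtain ⟨d, hE, hr⟩ := ns_est hV pV hβ hT hns (d0 := grd ψ0) (by rw [e0]; exact hd) dc (a := σ - 1) (by linarith) (by linarith) p1 hC0 hN
    exact hold hβ hT p1 s1 hσ2 τ0 τ1 (le_min (by linarith) (by linarith)) (min_le_right _ _) hE hr fun t t0 t1 => hns.per pV t0 t1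
  · refine r3 a b a0 ab hb _ (by linarith) ?_
    have l1 := min_le_left (1 - σ / 2) (σ / 2 - 1 / 2 - ((m : ℝ) + 1) / (2 * p))
    have l2 := min_le_right (1 - σ / 2) (σ / 2 - 1 / 2 - ((m : ℝ) + 1) / (2 * p))
    have : 0 ≤ ((m : ℝ) + 1) / (2 * p) := by positivity
    linarith
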